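/- For every graph H containing at least one edge, there exist a constant C = C(H) and an integer n₀ = n₀(H) such that the following holds: if G is a graph on n ≥ n₀ vertices and d(x) + d(y) ≥ 2(1 − 1/χ_cr(H))·n for every pair of distinct nonadjacent vertices x, y ∈ V(G), then G contains an H-tiling covering all but at most C vertices of G. -/

import Mathlib

/-- `𝒯` is an `H`-tiling in `G`: a collection of pairwise vertex-disjoint
subgraphs of `G`, each isomorphic to `H`; each copy is recorded as an injective
adjacency-preserving map from the vertices of `H` into `G`. -/
def IsTiling {W V : Type*} (H : SimpleGraph W) (G : SimpleGraph V)
    (𝒯 : Finset (W → V)) : Prop :=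
  (∀ f ∈ 𝒯, Function.Injective f ∧ ∀ a b : W, H.Adj a b → G.Adj (f a) (f b)) ∧
  ((𝒯 : Set (W → V)).Pairwise fun f g => Disjoint (Set.range f) (Set.range g))

/-- The set of vertices of `G` not covered by the tiling `𝒯`. -/
def untiled {W V : Type*} (𝒯 : Finset (W → V)) : Set V :=
  {v : V | ∀ f ∈ 𝒯, v ∉ Set.range f}

/-- `σ` is the minimum possible size of a colour class in a proper colouring
of `H` with `k` colours. -/
def IsMinColorClassSize {W : Type*} [Fintype W] (H : SimpleGraph W) (k σ : ℕ) : Prop :=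
  (∃ (c : H.Coloring (Fin k)) (i : Fin k),
      (Finset.univ.filter fun v => c v = i).card = σ) ∧
  ∀ (c : H.Coloring (Fin k)) (i : Fin k),
      σ ≤ (Finset.univ.filter fun v => c v = i).card

namespace OreT
section ModA
open Finset
open scoped Classical

variable {V : Type} {G : SimpleGraph V}

/-- complete multipartite family of vertex sets -/
def CMP (G : SimpleGraph V) {k : ℕ} (D : Fin k → Finset V) : Prop :=
  ∀ i j, i ≠ j → ∀ x ∈ D i, ∀ y ∈ D j, G.Adj x y

/-- complete `k`-partite vertex set with one part of size `s`, the others of size `w` -/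
def IsBottle (G : SimpleGraph V) (k s w : ℕ) (X : Finset V) : Prop :=
  ∃ (D : Fin k → Finset V) (i0 : Fin k), CMP G D ∧ (D i0).card = s ∧
    (∀ i, i ≠ i0 → (D i).card = w) ∧ X = univ.biUnion D

inductive Til (G : SimpleGraph V) (k s w : ℕ) : Finset V → Prop
  | empty : Til G k s w ∅
  | add (X Y : Finset V) (hX : Til G k s w X) (hY : IsBottle G k s w Y)
      (h : Disjoint X Y) : Til G k s w (X ∪ Y)

lemma CMP.disj {k : ℕ} {D : Fin k → Finset V} (h : CMP G D) {i j : Fin k} (hij : i ≠ j) :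
    Disjoint (D i) (D j) := by
  rw [Finset.disjoint_left]
  intro x hx hy
  exact G.loopless.irrefl x (h i j hij x hx x hy)

lemma CMP.mono {k : ℕ} {D D' : Fin k → Finset V} (h : CMP G D) (h' : ∀ i, D' i ⊆ D i) :
    CMP G D' := fun i j hij x hx y hy => h i j hij x (h' i hx) y (h' j hy)

lemma CMP.card {k : ℕ} {D : Fin k → Finset V} (h : CMP G D) :
    (univ.biUnion D).card = ∑ i, (D i).card :=
  card_biUnion fun i _ j _ hij => h.disj hij

lemma IsBottle.card {k s w : ℕ} {X : Finset V} (h : IsBottle G (k+1) s w X) :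
    X.card = s + k * w := by
  obtain ⟨D, i0, hD, h0, h1, rfl⟩ := h
  rw [hD.card, ← Finset.add_sum_erase _ _ (mem_univ i0), h0,
    Finset.sum_congr rfl (fun i hi => h1 i (ne_of_mem_erase hi))]
  simp

lemma Til.single {k s w : ℕ} {Y : Finset V} (h : IsBottle G k s w Y) : Til G k s w Y := by
  have := Til.add _ _ Til.empty h (disjoint_empty_left _)
  simpa using this

lemma Til.union {k s w : ℕ} {X Y : Finset V} (hX : Til G k s w X) (hY : Til G k s w Y)
    (h : Disjoint X Y) : Til G k s w (X ∪ Y) := by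
  induction hY with
  | empty => simpa using hX
  | add A B hA hB hd ih =>
    rw [← union_assoc]
    rw [disjoint_union_right] at h
    refine Til.add _ _ (ih h.1) hB ?_
    rw [disjoint_union_left]
    exact ⟨h.2, hd⟩

lemma IsBottle.cons {k s w : ℕ} {X D : Finset V} (h : IsBottle G k s w X)
    (hD : D.card = w) (hc : ∀ x ∈ X, ∀ y ∈ D, G.Adj x y) : IsBottle G (k+1) s w (X ∪ D) := by
  obtain ⟨E, i0, hE, h0, h1, rfl⟩ := h
  refine ⟨Fin.cons D E, i0.succ, ?_, by simpa using h0, ?_, ?_⟩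
  · intro i j hij x hx y hy
    refine Fin.cases ?_ (fun i => ?_) i hij hx <;> refine Fin.cases ?_ (fun j => ?_) j hy
    · intro _ h _; exact absurd rfl h
    · intro hy _ hx
      exact (hc y (mem_biUnion.2 ⟨j, mem_univ _, by simpa using hy⟩) x (by simpa using hx)).symm
    · intro hy _ hx
      exact hc x (mem_biUnion.2 ⟨i, mem_univ _, by simpa using hx⟩) y (by simpa using hy)
    · intro hy hij hx
      exact hE i j (fun h => hij (by rw [h])) x (by simpa using hx) y (by simpa using hy)
  · intro i
    refine Fin.cases ?_ (fun i => ?_) i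
    · intro _; simpa using hD
    · intro h; simpa using h1 i (fun h' => h (by rw [h']))
  · ext x
    simp [Fin.exists_fin_succ, or_comm]

lemma IsBottle.consNeck {k s w : ℕ} {X D : Finset V} (h : IsBottle G k w w X)
    (hD : D.card = s) (hc : ∀ x ∈ X, ∀ y ∈ D, G.Adj x y) : IsBottle G (k+1) s w (X ∪ D) := by
  obtain ⟨E, i0, hE, h0, h1, rfl⟩ := h
  refine ⟨Fin.cons D E, 0, ?_, by simpa using hD, ?_, ?_⟩
  · intro i j hij x hx y hy
    refine Fin.cases ?_ (fun i => ?_) i hij hx <;> refine Fin.cases ?_ (fun j => ?_) j hy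
    · intro _ h _; exact absurd rfl h
    · intro hy _ hx
      exact (hc y (mem_biUnion.2 ⟨j, mem_univ _, by simpa using hy⟩) x (by simpa using hx)).symm
    · intro hy _ hx
      exact hc x (mem_biUnion.2 ⟨i, mem_univ _, by simpa using hx⟩) y (by simpa using hy)
    · intro hy hij hx
      exact hE i j (fun h => hij (by rw [h])) x (by simpa using hx) y (by simpa using hy)
  · intro i
    refine Fin.cases ?_ (fun i => ?_) i
    · intro h; exact absurd rfl h
    · intro _
      by_cases h : i = i0
      · subst h; simpa using h0
      · simpa using h1 i h
  · ext x
    simp [Fin.exists_fin_succ, or_comm]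

lemma til_of_sizes (k s w : ℕ) : ∀ (A : ℕ) (a : Fin k → ℕ) (D : Fin k → Finset V),
    CMP G D → ∑ i, a i = A → (∀ i, (D i).card + w * a i = w * A + s * a i) →
    Til G k s w (univ.biUnion D) := by
  intro A
  induction A with
  | zero =>
    intro a D _ ha hD
    have : univ.biUnion D = ∅ := by
      rw [← Finset.card_eq_zero]
      have h0 : ∀ i, a i = 0 := fun i => by
        have := Finset.single_le_sum (f := a) (fun _ _ => Nat.zero_le _) (mem_univ i)
        omega
      have : ∀ i, D i = ∅ := fun i => by
        have := hD i
        rw [h0 i] at this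
        rw [← Finset.card_eq_zero]; omega
      rw [Finset.card_eq_zero]; ext x; simp [this]
    rw [this]; exact Til.empty
  | succ A ih =>
    intro a D hD ha hc
    obtain ⟨i0, hi0⟩ : ∃ i, 0 < a i := by
      by_contra h
      push Not at h
      have : ∑ i, a i = 0 := Finset.sum_eq_zero fun i _ => by have := h i; omega
      omega
    have hale : ∀ i, a i ≤ A + 1 := fun i => ha ▸ Finset.single_le_sum (f := a)
      (fun _ _ => Nat.zero_le _) (mem_univ i)
    have hale' : ∀ i, i ≠ i0 → a i ≤ A := fun i hi => by
      have h1 := Finset.add_sum_erase univ a (mem_univ i0)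
      have := Finset.single_le_sum (f := a) (s := univ.erase i0) (fun _ _ => Nat.zero_le _)
        (mem_erase.2 ⟨hi, mem_univ i⟩)
      omega
    have key : ∀ i, ∃ E ⊆ D i, E.card = if i = i0 then s else w := by
      intro i
      apply Finset.exists_subset_card_eq
      have h := hc i
      split_ifs with hi
      · have h2 : w * a i ≤ w * (A+1) := Nat.mul_le_mul_left _ (hale i)
        have h3 : s * 1 ≤ s * a i := Nat.mul_le_mul_left _ (hi ▸ hi0)
        omega
      · have h2 : w * a i ≤ w * A := Nat.mul_le_mul_left _ (hale' i hi)
        rw [Nat.mul_add] at h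
        omega
    choose E hE hEc using key
    have hs : univ.biUnion D = univ.biUnion (fun i => D i \ E i) ∪ univ.biUnion E := by
      ext x
      simp only [mem_biUnion, mem_union, mem_univ, true_and, mem_sdiff]
      constructor
      · rintro ⟨i, hi⟩
        by_cases h : x ∈ E i
        · exact Or.inr ⟨i, h⟩
        · exact Or.inl ⟨i, hi, h⟩
      · rintro (⟨i, hi, _⟩ | ⟨i, hi⟩)
        · exact ⟨i, hi⟩
        · exact ⟨i, hE i hi⟩
    rw [hs]
    refine Til.add _ _ (ih (fun i => if i = i0 then a i - 1 else a i) _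
      (hD.mono fun i => sdiff_subset) ?_ ?_) ⟨E, i0, hD.mono hE, by simp [hEc], ?_, rfl⟩ ?_
    · have h1 := Finset.add_sum_erase univ a (mem_univ i0)
      rw [← Finset.add_sum_erase univ _ (mem_univ i0)]
      have h2 : ∑ x ∈ univ.erase i0, (if x = i0 then a x - 1 else a x) =
          ∑ x ∈ univ.erase i0, a x :=
        Finset.sum_congr rfl fun i hi => by rw [if_neg (ne_of_mem_erase hi)]
      rw [h2, if_pos rfl]
      omega
    · intro i
      rw [card_sdiff_of_subset (hE i), hEc]
      have h := hc i
      have h3 := card_le_card (hE i)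
      rw [hEc] at h3
      rw [Nat.mul_add] at h
      split_ifs with hi
      · rw [if_pos hi] at h3
        obtain ⟨q, hq⟩ : ∃ q, a i = q + 1 := ⟨a i - 1, by have := hi ▸ hi0; omega⟩
        rw [hq] at h ⊢
        rw [Nat.mul_add, Nat.mul_add] at h
        simp only [Nat.add_sub_cancel]
        omega
      · rw [if_neg hi] at h3
        omega
    · intro i hi; simp [hEc, hi]
    · rw [Finset.disjoint_left]
      intro x hx hy
      simp only [mem_biUnion, mem_univ, true_and, mem_sdiff] at hx hy
      obtain ⟨i, h1, h2⟩ := hx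
      obtain ⟨j, h3⟩ := hy
      by_cases hij : i = j
      · subst hij; exact h2 h3
      · exact Finset.disjoint_left.1 (hD.disj hij) h1 (hE j h3)

end ModA
section ModA2
open Finset
open scoped Classical
variable {V : Type} {G : SimpleGraph V}

/-- `X` is exactly tiled by copies of `H` -/
def HT {W : Type} (H : SimpleGraph W) (G : SimpleGraph V) (X : Finset V) : Prop :=
  ∃ 𝒯 : Finset (W → V), IsTiling H G 𝒯 ∧ ∀ v, (∃ f ∈ 𝒯, v ∈ Set.range f) ↔ v ∈ X

lemma HT.union {W : Type} {H : SimpleGraph W} {X Y : Finset V} (hX : HT H G X)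
    (hY : HT H G Y) (h : Disjoint X Y) : HT H G (X ∪ Y) := by
  obtain ⟨S, ⟨hS1, hS2⟩, hS⟩ := hX
  obtain ⟨T, ⟨hT1, hT2⟩, hT⟩ := hY
  have cross : ∀ f ∈ S, ∀ g ∈ T, Disjoint (Set.range f) (Set.range g) := by
    intro f hf g hg
    rw [Set.disjoint_left]
    intro v h1 h2
    exact Finset.disjoint_left.1 h ((hS v).1 ⟨f, hf, h1⟩) ((hT v).1 ⟨g, hg, h2⟩)
  refine ⟨S ∪ T, ⟨?_, ?_⟩, ?_⟩
  · intro f hf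
    rcases mem_union.1 hf with hf | hf
    · exact hS1 f hf
    · exact hT1 f hf
  · intro f hf g hg hfg
    rw [Finset.mem_coe, mem_union] at hf hg
    rcases hf with hf | hf <;> rcases hg with hg | hg
    · exact hS2 hf hg hfg
    · exact cross f hf g hg
    · exact (cross g hg f hf).symm
    · exact hT2 hf hg hfg
  · intro v
    rw [mem_union, ← hS, ← hT]
    constructor
    · rintro ⟨f, hf, hv⟩
      rcases mem_union.1 hf with hf | hf
      · exact Or.inl ⟨f, hf, hv⟩
      · exact Or.inr ⟨f, hf, hv⟩
    · rintro (⟨f, hf, hv⟩ | ⟨f, hf, hv⟩)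
      · exact ⟨f, mem_union_left _ hf, hv⟩
      · exact ⟨f, mem_union_right _ hf, hv⟩

lemma Til.ht {W : Type} {H : SimpleGraph W} {k s w : ℕ}
    (hb : ∀ Y : Finset V, IsBottle G k s w Y → HT H G Y) {X : Finset V} (hX : Til G k s w X) :
    HT H G X := by
  induction hX with
  | empty => exact ⟨∅, ⟨by simp, by simp⟩, by simp⟩
  | add A B _ hB hd ih => exact ih.union (hb _ hB) hd

lemma bottle_ht {W : Type} [Fintype W] [Nonempty W] {H : SimpleGraph W} {m σ : ℕ}
    (c : H.Coloring (Fin (m+1)))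
    (hm : 0 < m) (i0 : Fin (m+1)) (hσ : (univ.filter fun v => c v = i0).card = σ)
    {X : Finset V} (hX : IsBottle G (m+1) (m * σ) (Fintype.card W - σ) X) : HT H G X := by
  obtain ⟨D, i1, hD, h0, h1, rfl⟩ := hX
  haveI : NeZero m := ⟨hm.ne'⟩
  have e1 : ∀ j : Fin m, Nonempty ({v // c v ≠ i0} ≃ D (i1.succAbove j)) := by
    intro j
    apply Fintype.card_eq.1
    rw [Fintype.card_coe, h1 _ (Fin.succAbove_ne i1 j), ← hσ, Fintype.card_subtype_compl,
      Fintype.card_subtype]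
  have e2 : Nonempty (Fin m × {v // c v = i0} ≃ D i1) := by
    apply Fintype.card_eq.1
    rw [Fintype.card_coe, h0, Fintype.card_prod, Fintype.card_fin, ← hσ, Fintype.card_subtype]
  have e := fun j => Classical.choice (e1 j)
  have e' := Classical.choice e2
  have hidx : ∀ v : {v // c v ≠ i0}, ∃ j : Fin m, i0.succAbove j = c v.1 := fun v =>
    Fin.exists_succAbove_eq v.2
  choose idx hidx using hidx
  let part : Fin m → W → Fin (m+1) := fun l v =>
    if h : c v = i0 then i1 else i1.succAbove (idx ⟨v, h⟩ + l)
  let f : Fin m → W → V := fun l v =>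
    if h : c v = i0 then (e' (l, ⟨v, h⟩)).1 else (e (idx ⟨v, h⟩ + l) ⟨v, h⟩).1
  have hf : ∀ l v, f l v ∈ D (part l v) := by
    intro l v
    by_cases h : c v = i0
    · simp only [f, part, dif_pos h]; exact (e' _).2
    · simp only [f, part, dif_neg h]; exact (e _ _).2
  have hpart : ∀ l v v', c v ≠ c v' → part l v ≠ part l v' := by
    intro l v v' hv
    by_cases h : c v = i0 <;> by_cases h' : c v' = i0
    · exact absurd (h.trans h'.symm) hv
    · simp only [part, dif_pos h, dif_neg h']; exact (Fin.succAbove_ne _ _).symm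
    · simp only [part, dif_pos h', dif_neg h]; exact (Fin.succAbove_ne _ _)
    · simp only [part, dif_neg h', dif_neg h]
      intro h2
      have h3 := add_right_cancel (Fin.succAbove_right_injective h2)
      apply hv
      rw [← hidx ⟨v, h⟩, ← hidx ⟨v', h'⟩, h3]
  have hinj : ∀ l l' v v', f l v = f l' v' → l = l' ∧ v = v' := by
    intro l l' v v' hv
    have hp : part l v = part l' v' := by
      by_contra hne
      exact Finset.disjoint_left.1 (hD.disj hne) (hf l v) (hv ▸ hf l' v')
    by_cases h : c v = i0 <;> by_cases h' : c v' = i0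
    · simp only [f, dif_pos h, dif_pos h'] at hv
      have := e'.injective (Subtype.ext hv)
      simp only [Prod.mk.injEq, Subtype.mk.injEq] at this
      exact this
    · simp only [part, dif_pos h, dif_neg h'] at hp
      exact absurd hp.symm (Fin.succAbove_ne _ _)
    · simp only [part, dif_pos h', dif_neg h] at hp
      exact absurd hp (Fin.succAbove_ne _ _)
    · simp only [part, dif_neg h', dif_neg h] at hp
      have h3 := Fin.succAbove_right_injective hp
      simp only [f, dif_neg h, dif_neg h'] at hv
      rw [h3] at hv
      have h4 := (e _).injective (Subtype.ext hv)
      have h5 : v = v' := by simpa using h4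
      subst h5
      exact ⟨add_left_cancel h3, rfl⟩
  have hsurj : ∀ x ∈ univ.biUnion D, ∃ l v, f l v = x := by
    intro x hx
    obtain ⟨j, -, hj⟩ := mem_biUnion.1 hx
    by_cases hj1 : j = i1
    · subst hj1
      obtain ⟨⟨l, v⟩, hlv⟩ := e'.surjective ⟨x, hj⟩
      refine ⟨l, v.1, ?_⟩
      simp only [f, dif_pos v.2, Subtype.coe_eta, hlv]
    · obtain ⟨j', rfl⟩ := Fin.exists_succAbove_eq hj1
      obtain ⟨v, hv⟩ := (e j').surjective ⟨x, hj⟩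
      refine ⟨j' - idx v, v.1, ?_⟩
      simp only [f, dif_neg v.2, Subtype.coe_eta]
      have : idx v + (j' - idx v) = j' := by abel
      rw [this, hv]
  refine ⟨univ.image f, ⟨?_, ?_⟩, ?_⟩
  · intro g hg
    obtain ⟨l, -, rfl⟩ := mem_image.1 hg
    refine ⟨fun v v' h => (hinj l l v v' h).2, fun a b hab => ?_⟩
    exact hD _ _ (hpart l a b (c.valid hab)) _ (hf l a) _ (hf l b)
  · intro g hg g' hg' hne
    obtain ⟨l, -, rfl⟩ := mem_image.1 (Finset.mem_coe.1 hg)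
    obtain ⟨l', -, rfl⟩ := mem_image.1 (Finset.mem_coe.1 hg')
    rw [Set.disjoint_left]
    rintro x ⟨v, rfl⟩ ⟨v', hv'⟩
    exact hne (by rw [(hinj l' l v' v hv').1])
  · intro x
    constructor
    · rintro ⟨g, hg, v, rfl⟩
      obtain ⟨l, -, rfl⟩ := mem_image.1 hg
      exact mem_biUnion.2 ⟨_, mem_univ _, hf l v⟩
    · intro hx
      obtain ⟨l, v, rfl⟩ := hsurj x hx
      exact ⟨f l, mem_image.2 ⟨l, mem_univ _, rfl⟩, v, rfl⟩
end ModA2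
end OreT

namespace OreT
section ModB
open Finset
open scoped Classical BigOperators

variable {V : Type}

/-- `k`-tuples of elements of `S` -/
def tup {α : Type} (S : Finset α) (k : ℕ) : Finset (Fin k → α) := Fintype.piFinset fun _ => S

lemma mem_tup {α : Type} {S : Finset α} {k : ℕ} {x : Fin k → α} :
    x ∈ tup S k ↔ ∀ i, x i ∈ S := by simp [tup]

lemma card_tup {α : Type} (S : Finset α) (k : ℕ) : (tup S k).card = S.card ^ k := by
  simp [tup]

lemma tup_nonempty {α : Type} {S : Finset α} (h : S.Nonempty) (k : ℕ) : (tup S k).Nonempty := by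
  obtain ⟨a, ha⟩ := h
  exact ⟨fun _ => a, mem_tup.2 fun _ => ha⟩

lemma expect_tup_succ {α : Type} (S : Finset α) (k : ℕ) (f : (Fin (k+1) → α) → ℝ) :
    𝔼 x ∈ tup S (k+1), f x = 𝔼 a ∈ S, 𝔼 x ∈ tup S k, f (Fin.cons a x) := by
  rw [← Finset.expect_product' S (tup S k) (fun a x => f (Fin.cons a x))]
  refine Finset.expect_nbij' (fun x => (x 0, Fin.tail x)) (fun p => Fin.cons p.1 p.2) ?_ ?_ ?_ ?_ ?_
  · intro x hx
    rw [mem_tup] at hx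
    simp only [mem_product, mem_tup]
    exact ⟨hx 0, fun i => hx _⟩
  · rintro ⟨a, x⟩ hx
    simp only [mem_product, mem_tup] at hx
    rw [mem_tup]
    intro i
    refine Fin.cases ?_ (fun i => ?_) i
    · exact hx.1
    · exact hx.2 i
  · intro x _; simp
  · rintro ⟨a, x⟩ _; simp
  · intro x _; simp

lemma expect_jensen {α : Type} {S : Finset α} (hS : S.Nonempty) (f : α → ℝ) (n : ℕ)
    (hf : ∀ i ∈ S, 0 ≤ f i) : (𝔼 i ∈ S, f i) ^ n ≤ 𝔼 i ∈ S, f i ^ n := by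
  cases n with
  | zero => simp [hS]
  | succ n =>
    rw [Finset.expect_eq_sum_div_card, Finset.expect_eq_sum_div_card, div_pow, pow_succ (_ : ℝ) n]
    have h0 : (0:ℝ) < S.card := by exact_mod_cast hS.card_pos
    have := pow_sum_div_card_le_sum_pow hf n
    rw [pow_succ (S.card : ℝ), ← div_div, ← pow_succ]
    gcongr

lemma blow_expect (T : ℕ) {S : Finset V} (hS : S.Nonempty) : ∀ (k : ℕ)
    (f : (Fin k → V) → ℝ), (∀ x, 0 ≤ f x) →
    (𝔼 x ∈ tup S k, f x) ^ (T ^ k) ≤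
      𝔼 D ∈ tup (tup S T) k, ∏ φ : Fin k → Fin T, f (fun i => D i (φ i)) := by
  intro k
  induction k with
  | zero =>
    intro f hf
    have h1 : tup S 0 = {Fin.elim0} := by
      ext x; simp [mem_tup, eq_iff_true_of_subsingleton]
    have h2 : tup (tup S T) 0 = {Fin.elim0} := by
      ext x; simp [mem_tup, eq_iff_true_of_subsingleton]
    rw [h1, h2]
    simp only [pow_zero, pow_one, expect_singleton, univ_unique, prod_singleton]
    apply le_of_eq
    congr 1
    exact Subsingleton.elim _ _
  | succ k ih =>
    intro f hf
    have h1 : 𝔼 x ∈ tup S (k+1), f x = 𝔼 x ∈ tup S k, 𝔼 a ∈ S, f (Fin.cons a x) := by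
      rw [expect_tup_succ, Finset.expect_comm]
    have h2 : (𝔼 x ∈ tup S (k+1), f x) ^ T ≤
        𝔼 d ∈ tup S T, 𝔼 x ∈ tup S k, ∏ t, f (Fin.cons (d t) x) := by
      rw [h1]
      refine (expect_jensen (tup_nonempty hS k) _ T
        (fun i _ => Finset.expect_nonneg fun _ _ => hf _)).trans ?_
      rw [Finset.expect_comm]
      apply le_of_eq
      refine Finset.expect_congr rfl fun x _ => ?_
      rw [Finset.expect_pow]
      rfl
    have h0 : 0 ≤ 𝔼 x ∈ tup S (k+1), f x := Finset.expect_nonneg fun _ _ => hf _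
    calc (𝔼 x ∈ tup S (k+1), f x) ^ (T ^ (k+1))
        = ((𝔼 x ∈ tup S (k+1), f x) ^ T) ^ (T ^ k) := by rw [← pow_mul, pow_succ, mul_comm]
      _ ≤ (𝔼 d ∈ tup S T, 𝔼 x ∈ tup S k, ∏ t, f (Fin.cons (d t) x)) ^ (T^k) :=
          pow_le_pow_left₀ (pow_nonneg h0 _) h2 _
      _ ≤ 𝔼 d ∈ tup S T, (𝔼 x ∈ tup S k, ∏ t, f (Fin.cons (d t) x)) ^ (T^k) :=
          expect_jensen (tup_nonempty hS T) _ _ fun i _ => Finset.expect_nonneg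
            fun _ _ => Finset.prod_nonneg fun _ _ => hf _
      _ ≤ 𝔼 d ∈ tup S T, 𝔼 D ∈ tup (tup S T) k, ∏ φ : Fin k → Fin T,
            ∏ t, f (Fin.cons (d t) (fun i => D i (φ i))) :=
          Finset.expect_le_expect fun d _ => ih _ fun _ => Finset.prod_nonneg fun _ _ => hf _
      _ = _ := by
          rw [expect_tup_succ]
          refine Finset.expect_congr rfl fun d _ => Finset.expect_congr rfl fun D _ => ?_
          rw [Finset.prod_comm, ← Finset.prod_product']
          refine Finset.prod_nbij' (fun p => Fin.cons p.1 p.2) (fun φ => (φ 0, Fin.tail φ))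
            ?_ ?_ ?_ ?_ ?_
          · simp
          · simp
          · simp
          · simp
          · rintro ⟨t, φ⟩ _
            simp only
            congr 1
            ext i
            refine Fin.cases ?_ (fun i => ?_) i <;> simp

lemma noninj_card (k T : ℕ) {S : Finset V} (i : Fin k) (t t' : Fin T) (h : t ≠ t') :
    ((tup (tup S T) k).filter fun D => D i t = D i t').card * S.card ≤ S.card ^ (k * T) := by
  have h2 : S.card ^ (k * T) = (tup (tup S T) k).card := by
    rw [card_tup, card_tup, ← pow_mul, mul_comm]
  rw [h2, ← card_product]
  refine Finset.card_le_card_of_injOn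
    (fun p => Function.update p.1 i (Function.update (p.1 i) t' p.2)) ?_ ?_
  · rintro ⟨D, u⟩ hp
    simp only [coe_product, Set.mem_prod, mem_coe, mem_filter, mem_tup] at hp
    rw [mem_coe, mem_tup]
    intro j
    rw [mem_tup]
    intro l
    by_cases hj : j = i
    · subst hj
      simp only [Function.update_self]
      by_cases hl : l = t'
      · subst hl; simpa using hp.2
      · rw [Function.update_of_ne hl]; exact hp.1.1 _ _
    · simp only [Function.update_of_ne hj]; exact hp.1.1 _ _
  · rintro ⟨D, u⟩ hp ⟨D', u'⟩ hp' heq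
    simp only [coe_product, Set.mem_prod, mem_coe, mem_filter, mem_tup] at hp hp'
    simp only at heq
    have e1 : ∀ j l, (Function.update D i (Function.update (D i) t' u)) j l =
      (Function.update D' i (Function.update (D' i) t' u')) j l := fun j l => by rw [heq]
    have hu : u = u' := by simpa using e1 i t'
    have e2 : ∀ j l, ¬ (j = i ∧ l = t') → D j l = D' j l := by
      intro j l hjl
      have := e1 j l
      by_cases hj : j = i
      · subst hj
        have hl : l ≠ t' := fun hl => hjl ⟨rfl, hl⟩
        simpa [Function.update_of_ne hl] using this
      · simpa [Function.update_of_ne hj] using this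
    have hD : D = D' := by
      ext j l
      by_cases hjl : j = i ∧ l = t'
      · obtain ⟨rfl, rfl⟩ := hjl
        rw [← hp.1.2, ← hp'.1.2]
        exact e2 _ _ (fun h' => h h'.2)
      · exact e2 j l hjl
    rw [hu, hD]

/-- Good blow-ups: all transversals satisfy `E`, and each part is injective. -/
def GoodB {k T : ℕ} (E : (Fin k → V) → Prop) (D : Fin k → Fin T → V) : Prop :=
  (∀ i, Function.Injective (D i)) ∧ ∀ φ : Fin k → Fin T, E (fun i => D i (φ i))

lemma blow_count (k T : ℕ) (c : ℝ) (hc : 0 < c) : ∃ c' > 0, ∃ n0 : ℕ, ∀ (V : Type) (S : Finset V)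
    (E : (Fin k → V) → Prop), n0 ≤ S.card →
    c * (S.card:ℝ) ^ k ≤ ((tup S k).filter E).card →
    c' * (S.card:ℝ) ^ (k * T) ≤ ((tup (tup S T) k).filter (GoodB E)).card := by
  have hcp : 0 < c ^ (T^k) := pow_pos hc _
  refine ⟨c ^ (T^k) / 2, by positivity, ⌈2 * (k * T * T) / c ^ (T^k)⌉₊ + 1, ?_⟩
  intro V S E hn hE
  have hSpos : 0 < S.card := by omega
  have hS : S.Nonempty := card_pos.1 hSpos
  have hSR : (0:ℝ) < S.card := by exact_mod_cast hSpos
  have h1 := blow_expect T hS k (fun x => if E x then 1 else 0) (fun x => by split_ifs <;> norm_num)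
  have h2 : c ≤ 𝔼 x ∈ tup S k, (if E x then (1:ℝ) else 0) := by
    rw [Finset.expect_eq_sum_div_card, card_tup, Finset.sum_boole, le_div_iff₀ (by positivity)]
    push_cast
    exact hE
  have h3 : c ^ (T^k) ≤ 𝔼 D ∈ tup (tup S T) k, ∏ φ : Fin k → Fin T,
      (if E (fun i => D i (φ i)) then (1:ℝ) else 0) :=
    (pow_le_pow_left₀ hc.le h2 _).trans h1
  have hcard : ((tup (tup S T) k).card : ℝ) = (S.card:ℝ) ^ (k*T) := by
    rw [card_tup, card_tup, ← pow_mul, mul_comm]; push_cast; rfl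
  rw [Finset.expect_eq_sum_div_card, hcard, le_div_iff₀ (by positivity)] at h3
  have h4 : ∀ D : Fin k → Fin T → V, (∏ φ : Fin k → Fin T,
      (if E (fun i => D i (φ i)) then (1:ℝ) else 0)) =
      if ∀ φ : Fin k → Fin T, E (fun i => D i (φ i)) then 1 else 0 := by
    intro D
    rw [Finset.prod_ite_zero]
    simp
  simp_rw [h4] at h3
  rw [Finset.sum_boole] at h3
  let Bad : Finset (Fin k → Fin T → V) := univ.biUnion fun p : Fin k × Fin T × Fin T =>
    if p.2.1 = p.2.2 then ∅ else (tup (tup S T) k).filter fun D => D p.1 p.2.1 = D p.1 p.2.2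
  have hBad : (Bad.card : ℝ) * S.card ≤ (k * T * T) * (S.card:ℝ) ^ (k*T) := by
    have : Bad.card * S.card ≤ (k * T * T) * S.card ^ (k*T) := by
      calc Bad.card * S.card ≤ (∑ p : Fin k × Fin T × Fin T, (if p.2.1 = p.2.2 then ∅ else
            (tup (tup S T) k).filter fun D => D p.1 p.2.1 = D p.1 p.2.2).card) * S.card :=
            Nat.mul_le_mul_right _ card_biUnion_le
        _ = ∑ p : Fin k × Fin T × Fin T, (if p.2.1 = p.2.2 then ∅ else
            (tup (tup S T) k).filter fun D => D p.1 p.2.1 = D p.1 p.2.2).card * S.card := by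
            rw [Finset.sum_mul]
        _ ≤ ∑ p : Fin k × Fin T × Fin T, S.card ^ (k*T) := by
            refine Finset.sum_le_sum fun p _ => ?_
            split_ifs with h
            · simp
            · exact noninj_card k T p.1 p.2.1 p.2.2 h
        _ = _ := by
            simp only [sum_const, card_univ, Fintype.card_prod, Fintype.card_fin, smul_eq_mul]
            ring
    exact_mod_cast this
  have hsub : (tup (tup S T) k).filter (fun D => ∀ φ : Fin k → Fin T, E (fun i => D i (φ i))) ⊆
      (tup (tup S T) k).filter (GoodB E) ∪ Bad := by
    intro D hD
    rw [mem_filter] at hD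
    by_cases hi : ∀ i, Function.Injective (D i)
    · exact mem_union_left _ (mem_filter.2 ⟨hD.1, hi, hD.2⟩)
    · push Not at hi
      obtain ⟨i, hi⟩ := hi
      rw [Function.Injective] at hi
      push Not at hi
      obtain ⟨t, t', h, hne⟩ := hi
      refine mem_union_right _ (mem_biUnion.2 ⟨(i, t, t'), mem_univ _, ?_⟩)
      rw [if_neg hne, mem_filter]
      exact ⟨hD.1, h⟩
  have h5 := (card_le_card hsub).trans (card_union_le _ _)
  have h5' : (((tup (tup S T) k).filter (fun D => ∀ φ : Fin k → Fin T,
    E (fun i => D i (φ i)))).card : ℝ) ≤ ((tup (tup S T) k).filter (GoodB E)).card + Bad.card := by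
    exact_mod_cast h5
  have h6 : (Bad.card : ℝ) ≤ c ^ (T^k) / 2 * (S.card:ℝ) ^ (k * T) := by
    have hn' : 2 * (k * T * T) / c ^ (T^k) ≤ (S.card : ℝ) := by
      refine (Nat.le_ceil _).trans ?_
      exact_mod_cast (by omega : ⌈2 * ((k:ℝ) * T * T) / c ^ (T^k)⌉₊ ≤ S.card)
    rw [div_le_iff₀ hcp] at hn'
    have hp : (0:ℝ) < (S.card:ℝ) ^ (k*T) := by positivity
    have : (Bad.card : ℝ) * S.card ≤ (c ^ (T^k) / 2 * (S.card:ℝ) ^ (k * T)) * S.card := by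
      refine hBad.trans ?_
      nlinarith
    exact le_of_mul_le_mul_right this hSR
  linarith

lemma blow_exists (k T : ℕ) (c : ℝ) (hc : 0 < c) : ∃ n0 : ℕ, ∀ (V : Type) (S : Finset V)
    (E : (Fin k → V) → Prop), n0 ≤ S.card →
    c * (S.card:ℝ) ^ k ≤ ((tup S k).filter E).card →
    ∃ D : Fin k → Fin T → V, (∀ i t, D i t ∈ S) ∧ GoodB E D := by
  obtain ⟨c', hc', n0, h⟩ := blow_count k T c hc
  refine ⟨n0 + 1, fun V S E hn hE => ?_⟩
  have h1 := h V S E (by omega) hE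
  have hS : (0:ℝ) < S.card := by exact_mod_cast (by omega : 0 < S.card)
  have h2 : (0:ℝ) < ((tup (tup S T) k).filter (GoodB E)).card :=
    lt_of_lt_of_le (by positivity) h1
  have h3 : 0 < ((tup (tup S T) k).filter (GoodB E)).card := by exact_mod_cast h2
  obtain ⟨D, hD⟩ := card_pos.1 h3
  rw [mem_filter, mem_tup] at hD
  exact ⟨D, fun i t => mem_tup.1 (hD.1 i) t, hD.2⟩

end ModB
end OreT

namespace OreT
section ModC
open Finset
open scoped Classical BigOperators

variable {V : Type} {G : SimpleGraph V}

/-- number of non-neighbours in `S` -/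
noncomputable def nn (G : SimpleGraph V) (S : Finset V) (v : V) : ℕ :=
  (S.filter fun u => ¬ G.Adj v u).card

/-- number of ordered adjacent pairs -/
noncomputable def ee (G : SimpleGraph V) (P : Finset V) : ℕ :=
  ((P ×ˢ P).filter fun p => G.Adj p.1 p.2).card

/-- at least `(δ|S|)^m` many lists, in the nested sense -/
noncomputable def ManyL (S : Finset V) (δ : ℝ) : ℕ → (List V → Prop) → Prop
  | 0, P => P []
  | m+1, P => δ * S.card ≤ ((S.filter fun v => ManyL S δ m (fun l => P (v::l))).card : ℝ)

lemma ManyL.mono {S : Finset V} {δ : ℝ} : ∀ {m : ℕ} {P Q : List V → Prop},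
    (∀ l, l.length = m → (∀ v ∈ l, v ∈ S) → P l → Q l) → ManyL S δ m P → ManyL S δ m Q := by
  intro m
  induction m with
  | zero => intro P Q h hP; exact h [] rfl (by simp) hP
  | succ m ih =>
    intro P Q h hP
    unfold ManyL at hP ⊢
    refine hP.trans ?_
    gcongr with v hv
    intro hm
    refine ih (fun l hl hlS hPl => h _ (by simp [hl]) ?_ hPl) hm
    intro u hu
    rcases List.mem_cons.1 hu with rfl | hu
    · assumption
    · exact hlS u hu

lemma ManyL.exists {S : Finset V} {δ : ℝ} (hδ : 0 < δ * S.card) : ∀ {m : ℕ} {P : List V → Prop},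
    ManyL S δ m P → ∃ l, l.length = m ∧ (∀ v ∈ l, v ∈ S) ∧ P l := by
  intro m
  induction m with
  | zero => intro P h; exact ⟨[], rfl, by simp, h⟩
  | succ m ih =>
    intro P h
    unfold ManyL at h
    have h1 : (0:ℝ) < ((S.filter fun v => ManyL S δ m (fun l => P (v::l))).card : ℝ) :=
      lt_of_lt_of_le hδ h
    have h2 : 0 < (S.filter fun v => ManyL S δ m (fun l => P (v::l))).card := by exact_mod_cast h1
    obtain ⟨v, hv⟩ := card_pos.1 h2
    rw [mem_filter] at hv
    obtain ⟨l, h3, h4, h5⟩ := ih hv.2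
    refine ⟨v :: l, by simp [h3], ?_, h5⟩
    intro u hu
    rcases List.mem_cons.1 hu with rfl | hu
    · exact hv.1
    · exact h4 u hu

/-- one step, from a subset of candidates -/
lemma ManyL.step {S Z : Finset V} {δ : ℝ} {m : ℕ} {P : List V → Prop} (hZ : Z ⊆ S)
    (hc : δ * S.card ≤ Z.card) (h : ∀ v ∈ Z, ManyL S δ m (fun l => P (v::l))) :
    ManyL S δ (m+1) P := by
  unfold ManyL
  refine hc.trans ?_
  exact_mod_cast card_le_card fun v hv => mem_filter.2 ⟨hZ hv, h v hv⟩

lemma ManyL.count {S : Finset V} {δ : ℝ} (hδ : 0 ≤ δ) : ∀ {m : ℕ} {P : List V → Prop},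
    ManyL S δ m P →
    δ ^ m * (S.card:ℝ) ^ m ≤ ((tup S m).filter fun x => P (List.ofFn x)).card := by
  intro m
  induction m with
  | zero =>
    intro P h
    have : Fin.elim0 ∈ (tup S 0).filter fun x => P (List.ofFn x) := by
      rw [mem_filter, mem_tup]
      exact ⟨fun i => i.elim0, h⟩
    have := card_pos.2 ⟨_, this⟩
    simp only [pow_zero, mul_one]
    exact_mod_cast this
  | succ m ih =>
    intro P h
    unfold ManyL at h
    set Z := S.filter fun v => ManyL S δ m (fun l => P (v::l)) with hZ
    have h1 : ∑ v ∈ Z, (((tup S m).filter fun x => P (v :: List.ofFn x)).card : ℝ) ≤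
        (((tup S (m+1)).filter fun x => P (List.ofFn x)).card : ℝ) := by
      rw [← Nat.cast_sum, ← card_sigma]
      refine Nat.cast_le.2 (Finset.card_le_card_of_injOn
        (fun p : (_ : V) × (Fin m → V) => Fin.cons p.1 p.2) ?_ ?_)
      · rintro ⟨v, x⟩ hp
        rw [mem_coe, mem_sigma] at hp
        obtain ⟨hp1, hp2⟩ := hp
        simp only [mem_filter, mem_tup] at hp2
        rw [mem_coe, mem_filter, mem_tup]
        refine ⟨fun i => ?_, ?_⟩
        · refine Fin.cases ?_ (fun i => ?_) i
          · exact (mem_filter.1 hp1).1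
          · exact hp2.1 i
        · simpa using hp2.2
      · rintro ⟨v, x⟩ _ ⟨v', x'⟩ _ heq
        obtain ⟨h1, h2⟩ := Fin.cons_injective2 heq
        subst h1; subst h2; rfl
    refine le_trans ?_ h1
    calc δ ^ (m+1) * (S.card:ℝ) ^ (m+1) = (δ * S.card) * (δ ^ m * (S.card:ℝ)^m) := by ring
      _ ≤ Z.card * (δ ^ m * (S.card:ℝ)^m) := by gcongr
      _ = ∑ v ∈ Z, (δ ^ m * (S.card:ℝ)^m) := by simp
      _ ≤ _ := Finset.sum_le_sum fun v hv => ih (mem_filter.1 hv).2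

lemma manyL_clique {S L : Finset V} (hL : (L : Set V).Pairwise G.Adj) {δ : ℝ}
    (h1 : 1 ≤ δ * S.card) : ∀ (m : ℕ) (B : Finset V), B ⊆ S → B ⊆ L → m * (δ * S.card) ≤ B.card →
    ManyL S δ m (fun K => K.Pairwise G.Adj ∧ ∀ v ∈ K, v ∈ B) := by
  intro m
  induction m with
  | zero => intro B _ _ _; simp [ManyL]
  | succ m ih =>
    intro B hBS hBL hc
    push_cast at hc
    refine ManyL.step hBS (by nlinarith [mul_nonneg (Nat.cast_nonneg (α := ℝ) m) (by linarith : (0:ℝ) ≤ δ * S.card)]) fun v hv => ?_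
    have h2 : (B.card : ℝ) ≤ (B.erase v).card + 1 := by
      exact_mod_cast (card_erase_add_one hv).ge
    refine (ih (B.erase v) ((erase_subset _ _).trans hBS) ((erase_subset _ _).trans hBL)
      (by linarith)).mono fun K _ _ hK => ⟨?_, ?_⟩
    · rw [List.pairwise_cons]
      refine ⟨fun u hu => ?_, hK.1⟩
      have := hK.2 u hu
      rw [mem_erase] at this
      exact hL (hBL hv) (hBL this.2) this.1.symm
    · intro u hu
      rcases List.mem_cons.1 hu with rfl | hu
      · exact hv
      · exact mem_of_mem_erase (hK.2 u hu)

lemma card_filter_adj_ge {S N : Finset V} (hN : N ⊆ S) (v : V) :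
    N.card ≤ (N.filter fun u => G.Adj v u).card + nn G S v := by
  rw [← card_filter_add_card_filter_not (s := N) (fun u => G.Adj v u)]
  gcongr
  exact card_le_card (filter_subset_filter _ hN)

lemma chain {S L : Finset V} (hL : (L : Set V).Pairwise G.Adj) {τ δ : ℝ}
    (hτ : ∀ v ∈ S, v ∉ L → (nn G S v : ℝ) ≤ τ) (h1 : 1 ≤ δ * S.card) (hτ0 : 0 ≤ τ)
    (y : V → ℕ) (κ : ℕ) : ∀ (m : ℕ), m ≤ κ → ∀ N : Finset V, N ⊆ S →
    (m = 0 ∨ ((m:ℝ) - 1) * τ + (κ + 1) * (δ * S.card) ≤ N.card) →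
    ManyL S δ m (fun K => K.Pairwise G.Adj ∧ (∀ v ∈ K, v ∈ N) ∧
      ∀ c, m ≤ K.countP (fun v => y v ≤ c) ∨
        ∃ j ≤ m, (∀ v ∈ K.take j, v ∉ L ∧ y v ≤ c) ∧
          ((N.filter fun v => y v ≤ c).card : ℝ) ≤ j * τ + (κ + 1) * (δ * S.card)) := by
  intro m
  induction m with
  | zero => intro _ N _ _; simp [ManyL]
  | succ m ih =>
    intro hm N hN hcard
    set d := δ * S.card with hd
    have hcard' : (m:ℝ) * τ + (κ+1) * d ≤ N.card := by
      rcases hcard with h | h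
      · omega
      · push_cast at h; linarith
    have hex : ∃ c, d ≤ (((N.filter fun v => y v ≤ c) \ L).card : ℝ) ∨
        κ * d ≤ (((N.filter fun v => y v ≤ c) ∩ L).card : ℝ) := by
      refine ⟨N.sup y, ?_⟩
      rw [filter_true_of_mem]
      · by_contra hcon
        push Not at hcon
        have : ((N \ L).card : ℝ) + (N ∩ L).card = N.card := by
          exact_mod_cast card_sdiff_add_card_inter N L
        nlinarith [mul_nonneg (Nat.cast_nonneg (α := ℝ) m) hτ0]
      · intro v hv; exact Finset.le_sup (f := y) hv
    set c0 := Nat.find hex with hc0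
    have hlow : ∀ c < c0, ((N.filter fun v => y v ≤ c).card : ℝ) ≤ (κ+1) * d := by
      intro c hc
      have := Nat.find_min hex hc
      push Not at this
      have e : (((N.filter fun v => y v ≤ c) \ L).card : ℝ) +
          (((N.filter fun v => y v ≤ c) ∩ L).card : ℝ) = (N.filter fun v => y v ≤ c).card := by
        exact_mod_cast card_sdiff_add_card_inter _ L
      nlinarith
    rcases Nat.find_spec hex with hcase | hcase
    · refine ManyL.step (Z := (N.filter fun v => y v ≤ c0) \ L)
        ((sdiff_subset.trans (filter_subset _ _)).trans hN) hcase fun v hv => ?_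
      rw [mem_sdiff, mem_filter] at hv
      obtain ⟨⟨hvN, hvc⟩, hvL⟩ := hv
      have hnv := hτ v (hN hvN) hvL
      have hsz : (N.card : ℝ) ≤ (N.filter fun u => G.Adj v u).card + τ := by
        have : (N.card : ℝ) ≤ (N.filter fun u => G.Adj v u).card + nn G S v := by
          exact_mod_cast card_filter_adj_ge hN v
        linarith
      refine (ih (by omega) (N.filter fun u => G.Adj v u) ((filter_subset _ _).trans hN)
        ?_).mono ?_
      · right
        linarith
      · rintro K - - ⟨hK1, hK2, hK3⟩
        refine ⟨?_, ?_, ?_⟩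
        · rw [List.pairwise_cons]
          exact ⟨fun u hu => (mem_filter.1 (hK2 u hu)).2, hK1⟩
        · intro u hu
          rcases List.mem_cons.1 hu with rfl | hu
          · exact hvN
          · exact (mem_filter.1 (hK2 u hu)).1
        · intro c
          by_cases hc : c < c0
          · right
            refine ⟨0, by omega, by simp, ?_⟩
            have := hlow c hc
            simpa using this
          · have hyc : y v ≤ c := hvc.trans (not_lt.1 hc)
            rcases hK3 c with h | ⟨j, hj, hj1, hj2⟩
            · left
              rw [List.countP_cons_of_pos (by simpa using hyc)]
              omega
            · right
              refine ⟨j+1, by omega, ?_, ?_⟩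
              · intro u hu
                rw [List.take_succ_cons] at hu
                rcases List.mem_cons.1 hu with rfl | hu
                · exact ⟨hvL, hyc⟩
                · exact hj1 u hu
              · have h3 : ((N.filter fun v => y v ≤ c).card : ℝ) ≤
                    (((N.filter fun v => y v ≤ c).filter fun u => G.Adj v u).card : ℝ) +
                      nn G S v := by
                  exact_mod_cast card_filter_adj_ge ((filter_subset _ _).trans hN) v
                rw [filter_filter] at h3 hj2
                have h4 : (N.filter fun a => y a ≤ c ∧ G.Adj v a) =
                    (N.filter fun a => G.Adj v a ∧ y a ≤ c) :=
                  filter_congr fun a _ => and_comm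
                rw [h4] at h3
                push_cast
                linarith
    · have hsub : (N.filter fun v => y v ≤ c0) ∩ L ⊆ N :=
        inter_subset_left.trans (filter_subset _ _)
      refine (manyL_clique hL h1 (m+1) ((N.filter fun v => y v ≤ c0) ∩ L)
        (hsub.trans hN) inter_subset_right ?_).mono ?_
      · refine le_trans ?_ hcase
        gcongr
      · rintro K hlen - ⟨hK1, hK2⟩
        refine ⟨hK1, fun v hv => hsub (hK2 v hv), fun c => ?_⟩
        by_cases hc : c < c0
        · right
          refine ⟨0, by omega, by simp, ?_⟩
          have := hlow c hc
          simpa using this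
        · left
          rw [List.countP_eq_length.2, hlen]
          intro v hv
          have := hK2 v hv
          rw [mem_inter, mem_filter] at this
          simpa using this.1.2.trans (not_lt.1 hc)

end ModC
end OreT

namespace OreT
section ModC2
open Finset
open scoped Classical BigOperators

variable {V : Type} {G : SimpleGraph V}

structure Hyp (G : SimpleGraph V) (S L : Finset V) (θ μ γ α : ℝ) : Prop where
  cl : (L : Set V).Pairwise G.Adj
  deg : ∀ v ∈ S, v ∉ L → (nn G S v : ℝ) ≤ (θ + μ) * S.card
  ne : ∀ P ⊆ S, (θ - γ) * S.card ≤ P.card → α * (S.card : ℝ)^2 ≤ ee G P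

/-- fraction of vertices with `y ≤ c` -/
noncomputable def Fr (S : Finset V) (y : V → ℕ) (c : ℕ) : ℝ :=
  ((S.filter fun v => y v ≤ c).card : ℝ) / S.card

noncomputable def Tm (S : Finset V) (y : V → ℕ) (κ : ℕ) (θ : ℝ) (K : List V) (c : ℕ) : ℝ :=
  (1 - Fr S y c) - (if κ ≤ K.countP (fun v => y v ≤ c) then 0 else
    1 - θ * (K.countP (fun v => y v ≤ c)))

lemma Fr_nonneg (S : Finset V) (y : V → ℕ) (c : ℕ) : 0 ≤ Fr S y c := by unfold Fr; positivity
lemma Fr_le_one (S : Finset V) (y : V → ℕ) (c : ℕ) : Fr S y c ≤ 1 := by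
  unfold Fr
  apply div_le_one_of_le₀ _ (by positivity)
  exact_mod_cast card_filter_le _ _

lemma Tm_ge_neg_Fr (S : Finset V) (y : V → ℕ) (κ : ℕ) {θ : ℝ} (hθ : 0 ≤ θ) (K : List V) (c : ℕ) :
    - Fr S y c ≤ Tm S y κ θ K c := by
  unfold Tm
  split_ifs
  · linarith
  · have : 0 ≤ θ * (K.countP (fun v => y v ≤ c) : ℝ) := by positivity
    linarith

lemma Tm_full {S : Finset V} {y : V → ℕ} {κ : ℕ} {θ : ℝ} {K : List V} {c : ℕ}
    (h : κ ≤ K.countP (fun v => y v ≤ c)) : Tm S y κ θ K c = 1 - Fr S y c := by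
  unfold Tm; rw [if_pos h]; ring

lemma Tm_ge {S : Finset V} {y : V → ℕ} {κ : ℕ} {θ : ℝ} (hθ : 0 ≤ θ) {K : List V} {c : ℕ} {j : ℕ}
    (h : K.countP (fun v => y v ≤ c) < κ) (hj : j ≤ K.countP (fun v => y v ≤ c)) :
    θ * j - Fr S y c ≤ Tm S y κ θ K c := by
  unfold Tm; rw [if_neg (not_le.2 h)]
  have : θ * (j:ℝ) ≤ θ * (K.countP (fun v => y v ≤ c) : ℝ) := by gcongr
  linarith

lemma list_nbrs {S L : Finset V} {τ : ℝ}
    (hτ : ∀ v ∈ S, v ∉ L → (nn G S v : ℝ) ≤ τ) {N : Finset V} (hN : N ⊆ S) : ∀ E : List V,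
    (∀ v ∈ E, v ∈ S ∧ v ∉ L) →
    (N.card : ℝ) ≤ (N.filter fun u => ∀ v ∈ E, G.Adj v u).card + E.length * τ := by
  intro E
  induction E with
  | nil => intro _; simp
  | cons a E ih =>
    intro h
    have h1 := ih fun v hv => h v (List.mem_cons_of_mem _ hv)
    have h2 : ((N.filter fun u => ∀ v ∈ E, G.Adj v u).card : ℝ) ≤
        ((N.filter fun u => ∀ v ∈ E, G.Adj v u).filter fun u => G.Adj a u).card + nn G S a := by
      exact_mod_cast card_filter_adj_ge ((filter_subset _ _).trans hN) a
    have h3 := hτ a (h a (List.mem_cons_self)).1 (h a (List.mem_cons_self)).2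
    have h4 : ((N.filter fun u => ∀ v ∈ E, G.Adj v u).filter fun u => G.Adj a u) =
        N.filter fun u => ∀ v ∈ a :: E, G.Adj v u := by
      rw [filter_filter]
      refine filter_congr fun u _ => ?_
      simp [and_comm]
    rw [h4] at h2
    push_cast [List.length_cons]
    linarith

lemma manyL_prefix {S : Finset V} {δ : ℝ} {Good : List V → Prop} (hδ : 0 < δ * S.card) :
    ∀ (m : ℕ) (pre : List V),
    ManyL S δ m (fun r => Good (pre ++ r) ∨
      ∃ q < m, ManyL S δ (m - q) (fun r' => Good (pre ++ r.take q ++ r'))) →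
    ManyL S δ m (fun r => Good (pre ++ r)) := by
  intro m
  induction m with
  | zero =>
    intro pre h
    simpa [ManyL] using h
  | succ m ih =>
    intro pre h
    by_cases hA : ManyL S δ (m+1) (fun r => Good (pre ++ r))
    · exact hA
    · have h2 : ∀ v, (ManyL S δ m fun r => Good (pre ++ v :: r) ∨
          ∃ q < m+1, ManyL S δ (m+1 - q) (fun r' => Good (pre ++ (v::r).take q ++ r'))) →
          ManyL S δ m fun r => Good (pre ++ v :: r) := by
        intro v hv
        have := ih (pre ++ [v]) (hv.mono ?_)
        · simpa using this
        · rintro r - - (h3 | ⟨q, hq, h3⟩)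
          · left; simpa using h3
          · right
            rcases q with _ | q
            · exfalso; apply hA; simpa using h3
            · refine ⟨q, by omega, ?_⟩
              have : m + 1 - (q+1) = m - q := by omega
              rw [this] at h3
              simpa using h3
      unfold ManyL at h ⊢
      refine h.trans ?_
      gcongr with v hv
      exact h2 v

lemma many_edges {S P : Finset V} (hP : P ⊆ S) {γ δ : ℝ} (hδ : 2 * δ ≤ γ)
    (hS : 0 < S.card)
    (hee : γ * (S.card:ℝ)^2 ≤ ee G P) :
    δ * S.card ≤ ((P.filter fun u => δ * S.card ≤ ((P.filter fun v => G.Adj u v).card:ℝ)).card:ℝ) := by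
  set Z := P.filter fun u => δ * S.card ≤ ((P.filter fun v => G.Adj u v).card:ℝ) with hZ
  have hn : (0:ℝ) < S.card := by exact_mod_cast hS
  have h1 : (ee G P : ℝ) = ∑ u ∈ P, ((P.filter fun v => G.Adj u v).card : ℝ) := by
    unfold ee
    rw [card_filter, sum_product, Nat.cast_sum]
    refine sum_congr rfl fun u _ => ?_
    rw [card_filter]
  have hPc : (P.card : ℝ) ≤ S.card := by exact_mod_cast card_le_card hP
  by_cases hδ0 : δ < 0
  · have : δ * S.card < 0 := mul_neg_of_neg_of_pos hδ0 hn
    exact this.le.trans (by positivity)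
  push Not at hδ0
  have h2 : ∑ u ∈ P, ((P.filter fun v => G.Adj u v).card : ℝ) ≤
      ∑ u ∈ P, ((if u ∈ Z then (S.card:ℝ) else 0) + δ * S.card) := by
    refine sum_le_sum fun u hu => ?_
    split_ifs with h
    · have : ((P.filter fun v => G.Adj u v).card : ℝ) ≤ P.card := by
        exact_mod_cast card_filter_le _ _
      have : 0 ≤ δ * S.card := by positivity
      linarith
    · rw [hZ, mem_filter] at h
      push Not at h
      linarith [h hu]
  rw [sum_add_distrib, ← sum_filter, sum_const, sum_const, nsmul_eq_mul, nsmul_eq_mul] at h2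
  have h3 : (P.filter fun u => u ∈ Z) = Z := by
    ext u; simp [hZ]
  rw [h3] at h2
  have h4 : (P.card:ℝ) * (δ * S.card) ≤ S.card * (δ * S.card) := by gcongr
  have h5 : γ * (S.card:ℝ)^2 ≤ Z.card * S.card + S.card * (δ * S.card) := by linarith
  have h6 : (2 * δ) * (S.card:ℝ)^2 ≤ γ * (S.card:ℝ)^2 := by gcongr
  have h7 : (δ * S.card) * S.card ≤ Z.card * S.card := by nlinarith
  exact le_of_mul_le_mul_right h7 hn

/-- construction of the alternative cliques -/
lemma alt_clique {S L : Finset V} {θ μ γ α δ γ' : ℝ} {κ i : ℕ} (hyp : Hyp G S L θ μ γ α)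
    (hθ : 0 ≤ θ) (hμ : 0 ≤ μ) (hδ0 : 0 < δ)
    (h1 : 1 ≤ δ * S.card) (hA : (κ - 1) * (θ + μ) + (κ + 1) * δ ≤ 1)
    (hγ : γ' + κ * μ + κ * δ ≤ γ) (hδγ : 2 * δ ≤ α)
    (y : V → ℕ) (hi1 : 1 ≤ i) (hi2 : i + 1 ≤ κ) (E : List V) (hE : E.length = i - 1)
    (hEp : E.Pairwise G.Adj) (c0 : ℕ) (hEc : ∀ v ∈ E, v ∈ S ∧ v ∉ L ∧ y v ≤ c0)
    (hF : i * θ - γ' ≤ Fr S y c0) :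
    ManyL S δ (κ - (i-1)) (fun r => (E ++ r).Pairwise G.Adj ∧ ∀ c, c0 ≤ c →
      κ ≤ (E ++ r).countP (fun v => y v ≤ c) ∨
      (i + 1 ≤ (E ++ r).countP (fun v => y v ≤ c) ∧
        Fr S y c ≤ (E ++ r).countP (fun v => y v ≤ c) * (θ + μ) + (κ + 1) * δ)) := by
  set n : ℝ := (S.card : ℝ) with hn
  have hnpos : 0 < n := by
    by_contra h
    have : δ * n ≤ 0 := mul_nonpos_of_nonneg_of_nonpos hδ0.le (not_lt.1 h)
    linarith
  have hSpos : 0 < S.card := by rw [hn] at hnpos; exact_mod_cast hnpos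
  set τ : ℝ := (θ + μ) * n with hτd
  have hτ0 : 0 ≤ τ := by positivity
  have hτ := hyp.deg
  have hEcount : ∀ c, c0 ≤ c → E.countP (fun v => y v ≤ c) = i - 1 := by
    intro c hc
    rw [List.countP_eq_length.2, hE]
    intro v hv
    simpa using (hEc v hv).2.2.trans hc
  set N1 := S.filter fun u => ∀ v ∈ E, G.Adj v u with hN1
  have hN1S : N1 ⊆ S := filter_subset _ _
  set W := N1.filter fun v => y v ≤ c0 with hW
  have hWS : W ⊆ S := (filter_subset _ _).trans hN1S
  have hiR : ((i - 1 : ℕ) : ℝ) = (i:ℝ) - 1 := by push_cast [hi1]; ring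
  have hUW : Fr S y c0 * n ≤ W.card + (i - 1) * τ := by
    have := list_nbrs (N := S.filter fun v => y v ≤ c0) hτ (filter_subset _ _) E
      (fun v hv => ⟨(hEc v hv).1, (hEc v hv).2.1⟩)
    rw [hE, filter_filter, hiR] at this
    have h2 : W = S.filter fun a => y a ≤ c0 ∧ ∀ v ∈ E, G.Adj v a := by
      rw [hW, hN1, filter_filter]
      exact filter_congr fun a _ => and_comm
    rw [h2]
    unfold Fr
    rw [div_mul_cancel₀ _ hnpos.ne']
    exact this
  have hpair : ∀ r : List V, (∀ v ∈ r, v ∈ N1) → r.Pairwise G.Adj → (E ++ r).Pairwise G.Adj := by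
    intro r hr hp
    rw [List.pairwise_append]
    exact ⟨hEp, hp, fun a ha b hb => (mem_filter.1 (hr b hb)).2 a ha⟩
  have hiκ : (i:ℝ) + 1 ≤ κ := by exact_mod_cast hi2
  by_cases hcase : κ * (δ * n) ≤ ((W ∩ L).card : ℝ)
  · refine (manyL_clique hyp.cl h1 (κ - (i-1)) (W ∩ L) (inter_subset_left.trans hWS)
      inter_subset_right ?_).mono ?_
    · refine le_trans ?_ hcase
      gcongr
      omega
    · rintro r hlen - ⟨hr1, hr2⟩
      refine ⟨hpair r (fun v hv => (mem_filter.1 (mem_inter.1 (hr2 v hv)).1).1) hr1, ?_⟩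
      intro c hc
      left
      rw [List.countP_append, hEcount c hc, List.countP_eq_length.2, hlen]
      · omega
      · intro v hv
        simpa using (mem_filter.1 (mem_inter.1 (hr2 v hv)).1).2.trans hc
  · push Not at hcase
    have hWL : (θ - γ) * n ≤ ((W \ L).card : ℝ) := by
      have e : ((W \ L).card : ℝ) + (W ∩ L).card = W.card := by
        exact_mod_cast card_sdiff_add_card_inter W L
      have h2 : (i * θ - γ') * n ≤ Fr S y c0 * n := by gcongr
      have h3 : ((i:ℝ) - 1) * μ * n ≤ κ * μ * n := by gcongr; linarith
      have h4 : (γ' + κ * μ + κ * δ) * n ≤ γ * n := by gcongr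
      have h5 : W.card ≥ (i * θ - γ') * n - (i-1) * ((θ + μ) * n) := by rw [← hτd]; linarith
      nlinarith
    have hee := hyp.ne (W \ L) (sdiff_subset.trans hWS) hWL
    have hWLS : W \ L ⊆ S := sdiff_subset.trans hWS
    have hm := many_edges (δ := δ) hWLS hδγ hSpos hee
    obtain ⟨m, hm'⟩ : ∃ m, κ - (i - 1) = m + 1 + 1 := ⟨κ - i - 1, by omega⟩
    rw [hm']
    refine ManyL.step ((filter_subset _ _).trans hWLS) hm fun u hu => ?_
    rw [mem_filter] at hu
    refine ManyL.step ((filter_subset _ _).trans hWLS) hu.2 fun u' hu' => ?_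
    rw [mem_filter, mem_sdiff] at hu'
    obtain ⟨hu1, hu2⟩ := hu
    rw [mem_sdiff] at hu1
    set E' : List V := u' :: u :: E with hE'
    set N2 := S.filter fun a => ∀ v ∈ E', G.Adj v a with hN2
    have hE'p : ∀ v ∈ E', v ∈ S ∧ v ∉ L := by
      intro v hv
      rcases List.mem_cons.1 hv with rfl | hv
      · exact ⟨hWS hu'.1.1, hu'.1.2⟩
      rcases List.mem_cons.1 hv with rfl | hv
      · exact ⟨hWS hu1.1, hu1.2⟩
      · exact ⟨(hEc v hv).1, (hEc v hv).2.1⟩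
    have hE'len : (E'.length : ℝ) = i + 1 := by
      have : E'.length = i + 1 := by rw [hE']; simp [hE]; omega
      rw [this]; push_cast; ring
    have hN2c : n ≤ N2.card + (i + 1) * τ := by
      have := list_nbrs (N := S) hτ (subset_refl _) E' hE'p
      rw [hE'len] at this
      exact this
    have hmR : (m:ℝ) = κ - i - 1 := by
      have : κ = m + i + 1 := by omega
      rw [this]; push_cast; ring
    have hchain := chain hyp.cl hτ h1 hτ0 y κ m (by omega) N2 (filter_subset _ _) (by
      right
      have : ((κ - 1) * (θ + μ) + (κ + 1) * δ) * n ≤ 1 * n := by gcongr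
      rw [hmR]
      have e2 : ((κ:ℝ) - 1) * ((θ + μ) * n) = (κ - i - 1 - 1) * τ + (i+1) * τ := by rw [hτd]; ring
      nlinarith)
    refine hchain.mono ?_
    rintro r hlen - ⟨hr1, hr2, hr3⟩
    have hrN : ∀ v ∈ r, G.Adj u v ∧ G.Adj u' v ∧ v ∈ N1 := by
      intro v hv
      have := hr2 v hv
      rw [hN2, mem_filter] at this
      refine ⟨this.2 u (by simp [hE']), this.2 u' (by simp [hE']), ?_⟩
      rw [hN1, mem_filter]
      exact ⟨this.1, fun a ha => this.2 a (by simp [hE', ha])⟩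
    refine ⟨?_, ?_⟩
    · apply hpair
      · intro v hv
        rcases List.mem_cons.1 hv with rfl | hv
        · exact (mem_filter.1 hu1.1).1
        rcases List.mem_cons.1 hv with rfl | hv
        · exact (mem_filter.1 hu'.1.1).1
        · exact (hrN v hv).2.2
      · rw [List.pairwise_cons, List.pairwise_cons]
        refine ⟨?_, fun v hv => (hrN v hv).2.1, hr1⟩
        intro v hv
        rcases List.mem_cons.1 hv with rfl | hv
        · exact hu'.2
        · exact (hrN v hv).1
    · intro c hc
      have hyu : y u ≤ c := (mem_filter.1 hu1.1).2.trans hc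
      have hyu' : y u' ≤ c := (mem_filter.1 hu'.1.1).2.trans hc
      have hcnt : (E ++ u :: u' :: r).countP (fun v => y v ≤ c) =
          i + 1 + r.countP (fun v => y v ≤ c) := by
        rw [List.countP_append, hEcount c hc, List.countP_cons_of_pos (by simpa using hyu),
          List.countP_cons_of_pos (by simpa using hyu')]
        omega
      rw [hcnt]
      rcases hr3 c with h | ⟨j, hj, hj1, hj2⟩
      · left; omega
      · right
        refine ⟨by omega, ?_⟩
        have hjc : j ≤ r.countP (fun v => y v ≤ c) := by
          have h5 : (r.take j).countP (fun v => y v ≤ c) = j := by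
            rw [List.countP_eq_length.2, List.length_take, hlen]
            · omega
            · intro v hv; simpa using (hj1 v hv).2
          rw [← h5]
          exact (List.take_sublist j r).countP_le
        have hU : ((S.filter fun v => y v ≤ c).card : ℝ) ≤
            (N2.filter fun v => y v ≤ c).card + (i+1) * τ := by
          have := list_nbrs (N := S.filter fun v => y v ≤ c) hτ (filter_subset _ _) E' hE'p
          rw [hE'len, filter_filter] at this
          rw [hN2, filter_filter]
          have e3 : (S.filter fun a => (∀ v ∈ E', G.Adj v a) ∧ y a ≤ c) =
              S.filter fun a => y a ≤ c ∧ (∀ v ∈ E', G.Adj v a) :=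
            filter_congr fun a _ => and_comm
          rw [e3]
          exact this
        unfold Fr
        rw [div_le_iff₀ hnpos]
        push_cast
        have h6 : (j:ℝ) * τ ≤ (r.countP (fun v => y v ≤ c) : ℝ) * τ := by gcongr
        have h7 : (((i:ℝ) + 1 + (r.countP (fun v => y v ≤ c) : ℝ)) * (θ + μ) + (κ + 1) * δ) * n =
            (i + 1) * τ + (r.countP (fun v => y v ≤ c) : ℝ) * τ + (κ + 1) * (δ * n) := by
          rw [hτd]; ring
        rw [h7]
        linarith

end ModC2
end OreT

namespace OreT
section ModC3
open Finset
open scoped Classical BigOperators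

variable {V : Type} {G : SimpleGraph V}

/-- longest initial segment avoiding `L` below level `c` -/
noncomputable def JJ (L : Finset V) (y : V → ℕ) (κ : ℕ) (K : List V) (c : ℕ) : ℕ :=
  Nat.findGreatest (fun j => ∀ v ∈ K.take j, v ∉ L ∧ y v ≤ c) κ

lemma JJ_spec (L : Finset V) (y : V → ℕ) (κ : ℕ) (K : List V) (c : ℕ) :
    ∀ v ∈ K.take (JJ L y κ K c), v ∉ L ∧ y v ≤ c := by
  have := Nat.findGreatest_spec (P := fun j => ∀ v ∈ K.take j, v ∉ L ∧ y v ≤ c) (m := 0) (n := κ)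
    (Nat.zero_le _) (by simp)
  exact this

lemma le_JJ {L : Finset V} {y : V → ℕ} {κ : ℕ} {K : List V} {c j : ℕ} (hj : j ≤ κ)
    (h : ∀ v ∈ K.take j, v ∉ L ∧ y v ≤ c) : j ≤ JJ L y κ K c :=
  Nat.le_findGreatest (P := fun j => ∀ v ∈ K.take j, v ∉ L ∧ y v ≤ c) hj h

lemma JJ_le (L : Finset V) (y : V → ℕ) (κ : ℕ) (K : List V) (c : ℕ) : JJ L y κ K c ≤ κ :=
  Nat.findGreatest_le _

lemma JJ_mono {L : Finset V} {y : V → ℕ} {κ : ℕ} {K : List V} {c c' : ℕ} (h : c ≤ c') :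
    JJ L y κ K c ≤ JJ L y κ K c' :=
  le_JJ (JJ_le _ _ _ _ _) fun v hv => ⟨(JJ_spec L y κ K c v hv).1, (JJ_spec L y κ K c v hv).2.trans h⟩

lemma countP_take_all {y : V → ℕ} {K : List V} {c j : ℕ} (hj : j ≤ K.length)
    (h : ∀ v ∈ K.take j, y v ≤ c) : (K.take j).countP (fun v => y v ≤ c) = j := by
  rw [List.countP_eq_length.2, List.length_take]
  · omega
  · intro v hv; simpa using h v hv

lemma JJ_le_count {L : Finset V} {y : V → ℕ} {κ : ℕ} {K : List V} {c : ℕ} (hK : K.length = κ) :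
    JJ L y κ K c ≤ K.countP (fun v => y v ≤ c) := by
  have h := countP_take_all (y := y) (K := K) (c := c) (j := JJ L y κ K c)
    (hK ▸ JJ_le _ _ _ _ _) fun v hv => (JJ_spec L y κ K c v hv).2
  have h2 := (List.take_sublist (JJ L y κ K c) K).countP_le (p := fun v => decide (y v ≤ c))
  omega

lemma countP_mono_c {y : V → ℕ} {K : List V} {c c' : ℕ} (h : c ≤ c') :
    K.countP (fun v => y v ≤ c) ≤ K.countP (fun v => y v ≤ c') := by
  apply List.countP_mono_left
  intro v _ hv
  simp only [decide_eq_true_eq] at hv ⊢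
  exact hv.trans h

def TypeC (S L : Finset V) (y : V → ℕ) (κ : ℕ) (θ γ' : ℝ) (K : List V) (i c : ℕ) : Prop :=
  K.countP (fun v => y v ≤ c) < κ ∧ JJ L y κ K c = i ∧ i * θ - γ' ≤ Fr S y c

lemma Tm_ge_of {S : Finset V} {y : V → ℕ} {κ : ℕ} {θ μ e : ℝ} (hθ : 0 ≤ θ) (hμ : 0 ≤ μ)
    (he : 0 ≤ e) {K : List V} {c j : ℕ}
    (hj : j ≤ K.countP (fun v => y v ≤ c)) (hjκ : j ≤ κ) (hF : Fr S y c ≤ j * (θ + μ) + e) :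
    -(κ * μ + e) ≤ Tm S y κ θ K c := by
  have h2 : (j:ℝ) * μ ≤ κ * μ := by gcongr
  by_cases h : κ ≤ K.countP (fun v => y v ≤ c)
  · rw [Tm_full h]
    have := Fr_le_one S y c
    have : 0 ≤ κ * μ := by positivity
    linarith
  · have := Tm_ge (S := S) hθ (not_le.1 h) hj
    nlinarith

lemma alt_exists {S L : Finset V} {θ μ γ α δ γ' ε c1 : ℝ} {κ i : ℕ} (hyp : Hyp G S L θ μ γ α)
    (hθ : 0 ≤ θ) (hμ : 0 ≤ μ) (hδ0 : 0 < δ)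
    (h1 : 1 ≤ δ * S.card) (hA : (κ - 1) * (θ + μ) + (κ + 1) * δ ≤ 1)
    (hγ : γ' + κ * μ + κ * δ ≤ γ) (hδγ : 2 * δ ≤ α) (hc1 : c1 = 1 - (κ - 1) * θ) (hc1θ : c1 ≤ θ)
    (y : V → ℕ) (M : ℕ) (hi1 : 1 ≤ i) (hi2 : i + 1 ≤ κ)
    (K : List V) (hK : K.length = κ) (hKS : ∀ v ∈ K, v ∈ S) (hKp : K.Pairwise G.Adj)
    (hKF : ∀ c, K.countP (fun v => y v ≤ c) < κ →
      Fr S y c ≤ JJ L y κ K c * (θ + μ) + (κ + 1) * δ)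
    (hbad : ¬ (K.Pairwise G.Adj ∧ -(ε * M) ≤ ∑ c ∈ range M, Tm S y κ θ K c))
    (hbad2 : ∀ q < κ, ¬ ManyL S δ (κ - q) (fun r => (K.take q ++ r).Pairwise G.Adj ∧
      -(ε * M) ≤ ∑ c ∈ range M, Tm S y κ θ (K.take q ++ r) c)) :
    ∃ Ki : List V, (∑ c ∈ range M, Tm S y κ θ Ki c < -(ε * M)) ∧
      (∀ c, K.countP (fun v => y v ≤ c) < κ → JJ L y κ K c ≠ i →
        -(κ * μ + (κ + 1) * δ) ≤ Tm S y κ θ Ki c) ∧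
      (∀ c, TypeC S L y κ θ γ' K i c → c1 - (κ * μ + (κ + 1) * δ) ≤ Tm S y κ θ Ki c) ∧
      (∀ c, κ ≤ K.countP (fun v => y v ≤ c) → κ ≤ Ki.countP (fun v => y v ≤ c) ∨
        (-(κ * μ + (κ + 1) * δ) ≤ Tm S y κ θ Ki c ∧
          c1 - (κ * μ + (κ + 1) * δ) ≤ 1 - Fr S y c)) := by
  have he : 0 ≤ ((κ:ℝ) + 1) * δ := by positivity
  have hiκ : (i:ℝ) ≤ κ - 1 := by
    have : (i:ℝ) + 1 ≤ κ := by exact_mod_cast hi2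
    linarith
  by_cases hex : ∃ c, TypeC S L y κ θ γ' K i c
  swap
  · push Not at hex
    refine ⟨K, ?_, ?_, ?_, ?_⟩
    · by_contra h; exact hbad ⟨hKp, not_lt.1 h⟩
    · intro c hc _
      exact Tm_ge_of hθ hμ he (JJ_le_count hK) (JJ_le _ _ _ _ _) (hKF c hc)
    · intro c hc; exact absurd hc (hex c)
    · intro c hc; exact Or.inl hc
  set c0 := Nat.find hex with hc0
  have hc0s : TypeC S L y κ θ γ' K i c0 := Nat.find_spec hex
  have hc0m : ∀ c, TypeC S L y κ θ γ' K i c → c0 ≤ c := fun c hc => Nat.find_min' hex hc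
  have hJ0 := JJ_spec L y κ K c0
  rw [hc0s.2.1] at hJ0
  have hsub : ∀ j ≤ i, ∀ v ∈ K.take j, v ∈ K.take i := by
    intro j hj v hv
    exact (List.take_sublist_take_left hj).subset hv
  have halt := alt_clique hyp hθ hμ hδ0 h1 hA hγ hδγ y hi1 hi2 (K.take (i-1)) (by
      rw [List.length_take, hK]; omega) (hKp.sublist (List.take_sublist _ _)) c0 (by
      intro v hv
      have := hJ0 v (hsub _ (by omega) v hv)
      exact ⟨hKS v (List.mem_of_mem_take hv), this⟩) hc0s.2.2
  have hb := hbad2 (i-1) (by omega)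
  obtain ⟨r, hr⟩ : ∃ r : List V, ((K.take (i-1) ++ r).Pairwise G.Adj ∧ ∀ c, c0 ≤ c →
      κ ≤ (K.take (i-1) ++ r).countP (fun v => y v ≤ c) ∨
      (i + 1 ≤ (K.take (i-1) ++ r).countP (fun v => y v ≤ c) ∧
        Fr S y c ≤ (K.take (i-1) ++ r).countP (fun v => y v ≤ c) * (θ + μ) + (κ + 1) * δ)) ∧
      ¬ ((K.take (i-1) ++ r).Pairwise G.Adj ∧
      -(ε * M) ≤ ∑ c ∈ range M, Tm S y κ θ (K.take (i-1) ++ r) c) := by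
    by_contra hcon
    push Not at hcon
    apply hb
    refine halt.mono ?_
    intro r _ _ hr
    exact hcon r ⟨hr.1, hr.2⟩
  obtain ⟨⟨hr1, hr2⟩, hr3⟩ := hr
  have hge : ∀ c, c0 ≤ c → κ ≤ (K.take (i-1) ++ r).countP (fun v => y v ≤ c) ∨
      ((K.take (i-1) ++ r).countP (fun v => y v ≤ c) < κ ∧
      i + 1 ≤ (K.take (i-1) ++ r).countP (fun v => y v ≤ c) ∧
        Fr S y c ≤ (K.take (i-1) ++ r).countP (fun v => y v ≤ c) * (θ + μ) + (κ + 1) * δ) := by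
    intro c hc
    by_cases h : κ ≤ (K.take (i-1) ++ r).countP (fun v => y v ≤ c)
    · exact Or.inl h
    · rcases hr2 c hc with h2 | h2
      · exact absurd h2 h
      · exact Or.inr ⟨not_le.1 h, h2⟩
  have hfull : ∀ c, κ ≤ (K.take (i-1) ++ r).countP (fun v => y v ≤ c) →
      -(κ * μ + (κ + 1) * δ) ≤ Tm S y κ θ (K.take (i-1) ++ r) c := by
    intro c hc
    rw [Tm_full hc]
    have := Fr_le_one S y c
    have : 0 ≤ κ * μ := by positivity
    linarith
  refine ⟨K.take (i-1) ++ r, ?_, ?_, ?_, ?_⟩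
  · by_contra h; exact hr3 ⟨hr1, not_lt.1 h⟩
  · intro c hc hJ
    by_cases hcc : c0 ≤ c
    · rcases hge c hcc with h | ⟨h, h', h''⟩
      · exact hfull c h
      · exact Tm_ge_of hθ hμ he le_rfl h.le h''
    · have hJi : JJ L y κ K c ≤ i - 1 := by
        have := JJ_mono (L := L) (y := y) (κ := κ) (K := K) (not_le.1 hcc).le
        rw [hc0s.2.1] at this
        omega
      refine Tm_ge_of hθ hμ he ?_ (JJ_le _ _ _ _ _) (hKF c hc)
      rw [List.countP_append]
      have h5 := countP_take_all (y := y) (K := K) (c := c) (j := JJ L y κ K c)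
        (hK ▸ JJ_le _ _ _ _ _) fun v hv => (JJ_spec L y κ K c v hv).2
      have h6 := (List.take_sublist_take_left (l := K) hJi).countP_le (p := fun v => decide (y v ≤ c))
      omega
  · intro c hc
    have hcc := hc0m c hc
    have hF := hKF c hc.1
    rw [hc.2.1] at hF
    have hiμ : (i:ℝ) * μ ≤ κ * μ := by gcongr; linarith
    rcases hge c hcc with h | ⟨h, h', h''⟩
    · rw [Tm_full h]
      have : (i:ℝ) * θ ≤ (κ - 1) * θ := by gcongr
      rw [hc1]; linarith
    · have := Tm_ge (S := S) hθ h h'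
      push_cast at this
      linarith
  · intro c hc
    have hcc : c0 ≤ c := by
      by_contra h
      have := countP_mono_c (y := y) (K := K) (not_le.1 h).le
      have := hc0s.1
      omega
    rcases hge c hcc with h | ⟨h, h', h''⟩
    · exact Or.inl h
    · right
      refine ⟨Tm_ge_of hθ hμ he le_rfl h.le h'', ?_⟩
      have hh : (((K.take (i-1) ++ r).countP (fun v => y v ≤ c) : ℕ) : ℝ) ≤ κ - 1 := by
        have : (((K.take (i-1) ++ r).countP (fun v => y v ≤ c) : ℕ) : ℝ) + 1 ≤ κ := by exact_mod_cast h
        linarith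
      have h3 : (((K.take (i-1) ++ r).countP (fun v => y v ≤ c) : ℕ) : ℝ) * (θ + μ) ≤ (κ - 1) * (θ + μ) := by
        gcongr
      rw [hc1]
      linarith

lemma lp_core {S L : Finset V} {θ μ γ α δ γ' ε c1 p : ℝ} {κ : ℕ} (hyp : Hyp G S L θ μ γ α)
    (hκ : 1 ≤ κ)
    (hθ : 0 ≤ θ) (hμ : 0 ≤ μ) (hδ0 : 0 < δ) 
    (h1 : 1 ≤ δ * S.card) (hA : (κ - 1) * (θ + μ) + (κ + 1) * δ ≤ 1)
    (hγ : γ' + κ * μ + κ * δ ≤ γ) (hδγ : 2 * δ ≤ α) (hc1 : c1 = 1 - (κ - 1) * θ) (hc1θ : c1 ≤ θ)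
    (hp0 : 0 ≤ p) (hp : p * c1 = κ * μ) (hp1 : (κ - 1) * p ≤ 1)
    (hp2 : (κ - 1) * p ≤ (1 - (κ - 1) * p) * γ')
    (hp3 : κ * μ + (κ + 1) * δ ≤ (1 - (κ - 1) * p) * c1) (hε : (κ + 1) * δ ≤ ε)
    (y : V → ℕ) (M : ℕ) :
    ManyL S δ κ (fun K => K.Pairwise G.Adj ∧ -(ε * M) ≤ ∑ c ∈ range M, Tm S y κ θ K c) := by
  have hnpos : (0:ℝ) < S.card := by
    by_contra h
    have : δ * S.card ≤ 0 := mul_nonpos_of_nonneg_of_nonpos hδ0.le (not_lt.1 h)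
    linarith
  set e : ℝ := (κ + 1) * δ with he
  have he0 : 0 ≤ e := by positivity
  have hκR : (1:ℝ) ≤ κ := by exact_mod_cast hκ
  have hchain := chain hyp.cl hyp.deg h1 (by positivity) y κ κ le_rfl S (subset_refl _) (by
    right
    have : ((κ - 1) * (θ + μ) + e) * S.card ≤ 1 * S.card := by gcongr
    rw [he] at this
    linarith)
  have := manyL_prefix (S := S) (δ := δ) (Good := fun K => K.Pairwise G.Adj ∧
    -(ε * M) ≤ ∑ c ∈ range M, Tm S y κ θ K c) (by positivity) κ [] ?_
  · simpa using this
  refine hchain.mono ?_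
  rintro K hK hKS ⟨hKp, -, hKc⟩
  by_contra hcon
  push Not at hcon
  obtain ⟨hbad', hbad2'⟩ := hcon
  simp only [List.nil_append] at hbad' hbad2'
  have hbad := hbad' hKp
  have hKF : ∀ c, K.countP (fun v => y v ≤ c) < κ →
      Fr S y c ≤ JJ L y κ K c * (θ + μ) + (κ + 1) * δ := by
    intro c hc
    rcases hKc c with h | ⟨j, hj, hj1, hj2⟩
    · omega
    · have hjJ : (j:ℝ) ≤ JJ L y κ K c := by exact_mod_cast le_JJ hj hj1
      unfold Fr
      rw [div_le_iff₀ hnpos]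
      have : (j:ℝ) * ((θ + μ) * S.card) ≤ JJ L y κ K c * ((θ + μ) * S.card) := by gcongr
      linarith
  have hQ : ∀ i ∈ Icc 1 (κ - 1), _ := fun i hi => alt_exists (i := i) (ε := ε) hyp hθ hμ hδ0 h1 hA hγ hδγ
    hc1 hc1θ y M (mem_Icc.1 hi).1 (by have := mem_Icc.1 hi; omega) K hK hKS hKp hKF
    (by push Not; exact fun _ => hbad) (fun q hq => hbad2' q hq)
  choose! Ks hs hb hc hd using hQ
  set I := Icc 1 (κ - 1) with hI
  have hIc : (I.card : ℝ) = κ - 1 := by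
    rw [hI, Nat.card_Icc]; push_cast [hκ]; ring
  have hone : 0 ≤ 1 - (κ - 1) * p := by linarith
  have sumge : ∀ (c : ℕ) (a : ℝ), (∀ i ∈ I, a ≤ Tm S y κ θ (Ks i) c) →
      (κ - 1) * a ≤ ∑ i ∈ I, Tm S y κ θ (Ks i) c := by
    intro c a h
    have := card_nsmul_le_sum I _ a h
    rwa [nsmul_eq_mul, hIc] at this
  have hlam : 0 ≤ κ * μ + e := by positivity
  have hpt : ∀ c, -e ≤ (1 - (κ - 1) * p) * Tm S y κ θ K c + p * ∑ i ∈ I, Tm S y κ θ (Ks i) c := by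
    intro c
    have hF1 := Fr_le_one S y c
    have hF0 := Fr_nonneg S y c
    by_cases hfull : κ ≤ K.countP (fun v => y v ≤ c)
    · rw [Tm_full hfull]
      by_cases hx : c1 - (κ * μ + e) ≤ 1 - Fr S y c
      · have h2 := sumge c (-(κ * μ + e)) (fun i hi => by
          rcases hd i hi c hfull with h | h
          · rw [Tm_full h]; linarith
          · exact h.1)
        have h3 := mul_le_mul_of_nonneg_left hx hone
        have h4 := mul_le_mul_of_nonneg_left h2 hp0
        nlinarith
      · have h2 := sumge c 0 (fun i hi => by
          rcases hd i hi c hfull with h | h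
          · rw [Tm_full h]; linarith
          · exact absurd h.2 hx)
        have h4 := mul_le_mul_of_nonneg_left h2 hp0
        have h3 := mul_nonneg hone (sub_nonneg.2 hF1)
        linarith
    · push Not at hfull
      have hFJ := hKF c hfull
      have hJc := JJ_le_count (L := L) (y := y) (c := c) hK
      have hTK : -(κ * μ + e) ≤ Tm S y κ θ K c := Tm_ge_of hθ hμ he0 hJc (JJ_le _ _ _ _ _) hFJ
      rcases Nat.eq_zero_or_pos (JJ L y κ K c) with hJ0 | hJ0
      · rw [hJ0] at hFJ
        have hFe : Fr S y c ≤ e := by simpa using hFJ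
        have h2 := sumge c (-e) (fun i hi => by
          have := Tm_ge_neg_Fr S y κ hθ (Ks i) c; linarith)
        have h3 : -e ≤ Tm S y κ θ K c := by
          have := Tm_ge_neg_Fr S y κ hθ K c; linarith
        have h4 := mul_le_mul_of_nonneg_left h2 hp0
        have h5 := mul_le_mul_of_nonneg_left h3 hone
        nlinarith
      · by_cases hC : TypeC S L y κ θ γ' K (JJ L y κ K c) c
        · have hiI : JJ L y κ K c ∈ I := by rw [hI, mem_Icc]; omega
          have h2 := hc _ hiI c hC
          rw [← add_sum_erase I _ hiI]
          have h3 : (κ - 1 - 1 : ℝ) * (-(κ * μ + e)) ≤ ∑ i ∈ I.erase (JJ L y κ K c), Tm S y κ θ (Ks i) c := by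
            have := card_nsmul_le_sum (I.erase (JJ L y κ K c)) (fun i => Tm S y κ θ (Ks i) c)
              (-(κ * μ + e)) (fun i hi => by
                rw [mem_erase] at hi
                exact hb i hi.2 c hfull (Ne.symm hi.1))
            rw [nsmul_eq_mul] at this
            have hce : ((I.erase (JJ L y κ K c)).card : ℝ) = κ - 1 - 1 := by
              have := card_erase_add_one hiI
              have : ((I.erase (JJ L y κ K c)).card : ℝ) + 1 = I.card := by exact_mod_cast this
              linarith
            rwa [hce] at this
          have h4 := mul_le_mul_of_nonneg_left (add_le_add h2 h3) hp0
          have h5 := mul_le_mul_of_nonneg_left hTK hone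
          nlinarith
        · have h3 : γ' ≤ Tm S y κ θ K c := by
            have := Tm_ge (S := S) hθ hfull hJc
            unfold TypeC at hC
            push Not at hC
            have := hC hfull rfl
            linarith
          have h2 := sumge c (-1) (fun i hi => by
            have := Tm_ge_neg_Fr S y κ hθ (Ks i) c; linarith)
          have h4 := mul_le_mul_of_nonneg_left h2 hp0
          have h5 := mul_le_mul_of_nonneg_left h3 hone
          nlinarith
  have hsum : ∑ c ∈ range M, -e ≤ ∑ c ∈ range M, ((1 - (κ - 1) * p) * Tm S y κ θ K c +
      p * ∑ i ∈ I, Tm S y κ θ (Ks i) c) := sum_le_sum fun c _ => hpt c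
  rw [sum_add_distrib, ← mul_sum, ← mul_sum, sum_comm, sum_const, card_range, nsmul_eq_mul] at hsum
  have hs2 : ∑ i ∈ I, ∑ c ∈ range M, Tm S y κ θ (Ks i) c ≤ (κ - 1) * (-(ε * M)) := by
    have := sum_le_card_nsmul I (fun i => ∑ c ∈ range M, Tm S y κ θ (Ks i) c) _ fun i hi => (hs i hi).le
    rwa [nsmul_eq_mul, hIc] at this
  have h4 := mul_le_mul_of_nonneg_left hs2 hp0
  have hMe : (M:ℝ) * e ≤ ε * M := by rw [mul_comm]; gcongr
  rcases eq_or_lt_of_le hone with h0 | h0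
  · have : (1 - (κ - 1) * p) * γ' = 0 := by rw [← h0, zero_mul]
    have : (κ - 1) * p = 1 := by linarith
    linarith
  · have h5 := mul_lt_mul_of_pos_left hbad h0
    have h6 : (1 - (κ - 1) * p) * (-(ε * M)) + p * ((κ - 1) * (-(ε * M))) = -(ε * M) := by ring
    linarith

end ModC3
end OreT

namespace OreT
section ModC4
open Finset
open scoped Classical BigOperators

variable {V : Type} {G : SimpleGraph V}

lemma bottle_cost (κ s w : ℕ) (hκ : 1 ≤ κ) (hw : 0 < w) (hsw : s ≤ w) (c : ℝ) (hc : 0 < c) :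
    ∃ n0 : ℕ, ∀ (V : Type) (G : SimpleGraph V) (S : Finset V) (y : V → ℝ) (T : ℝ), (∀ v, 0 ≤ y v) →
    n0 ≤ S.card →
    c * (S.card:ℝ)^κ ≤ ((tup S κ).filter fun x => (∀ i j, i ≠ j → G.Adj (x i) (x j)) ∧
      ∃ i0, ∑ i, (if i = i0 then (s:ℝ) else w) * y (x i) ≤ T).card →
    ∃ X ⊆ S, IsBottle G κ s w X ∧ ∑ x ∈ X, y x ≤ T := by
  obtain ⟨n0, h⟩ := blow_exists κ w (c / κ) (by positivity)
  refine ⟨n0, ?_⟩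
  intro V G S y T hy hn hcard
  set E : Fin κ → (Fin κ → V) → Prop := fun i0 x => (∀ i j, i ≠ j → G.Adj (x i) (x j)) ∧
    ∑ i, (if i = i0 then (s:ℝ) else w) * y (x i) ≤ T with hE
  obtain ⟨i0, hi0⟩ : ∃ i0, c / κ * (S.card:ℝ)^κ ≤ ((tup S κ).filter (E i0)).card := by
    by_contra hcon
    push Not at hcon
    have h1 : ((tup S κ).filter fun x => (∀ i j, i ≠ j → G.Adj (x i) (x j)) ∧
      ∃ i0, ∑ i, (if i = i0 then (s:ℝ) else w) * y (x i) ≤ T) ⊆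
      univ.biUnion fun i0 => (tup S κ).filter (E i0) := by
      intro x hx
      rw [mem_filter] at hx
      obtain ⟨hx1, hx2, i0, hx3⟩ := hx
      rw [mem_biUnion]
      exact ⟨i0, mem_univ _, mem_filter.2 ⟨hx1, hx2, hx3⟩⟩
    have h2 : (((tup S κ).filter fun x => (∀ i j, i ≠ j → G.Adj (x i) (x j)) ∧
      ∃ i0, ∑ i, (if i = i0 then (s:ℝ) else w) * y (x i) ≤ T).card : ℝ) ≤
      ∑ i0 : Fin κ, (((tup S κ).filter (E i0)).card : ℝ) := by
      exact_mod_cast (card_le_card h1).trans card_biUnion_le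
    have h3 : ∑ i0 : Fin κ, (((tup S κ).filter (E i0)).card : ℝ) <
        ∑ i0 : Fin κ, c / κ * (S.card:ℝ)^κ := by
      apply sum_lt_sum_of_nonempty
      · exact ⟨⟨0, by omega⟩, mem_univ _⟩
      · intro i _; exact hcon i
    rw [sum_const, card_univ, Fintype.card_fin, nsmul_eq_mul] at h3
    have h4 : (κ:ℝ) * (c / κ * (S.card:ℝ)^κ) = c * (S.card:ℝ)^κ := by
      have : (κ:ℝ) ≠ 0 := by positivity
      field_simp
    linarith
  obtain ⟨D, hDS, hDi, hDE⟩ := h V S (E i0) hn (by convert hi0)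
  set P : Fin κ → Finset V := fun i => if i = i0 then
    (univ.filter fun t : Fin w => t.val < s).image (D i) else univ.image (D i) with hP
  have hPs : ∀ i, ∀ x ∈ P i, ∃ t, D i t = x := by
    intro i x hx
    simp only [hP] at hx
    split_ifs at hx
    · obtain ⟨t, -, ht⟩ := mem_image.1 hx; exact ⟨t, ht⟩
    · obtain ⟨t, -, ht⟩ := mem_image.1 hx; exact ⟨t, ht⟩
  have hcmp : CMP G P := by
    intro i j hij x hx z hz
    obtain ⟨t, rfl⟩ := hPs i x hx
    obtain ⟨t', rfl⟩ := hPs j z hz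
    have := (hDE (fun a => if a = i then t else t')).1 i j hij
    simpa [hij.symm] using this
  have hcs : (P i0).card = s := by
    simp only [hP, if_true]
    rw [card_image_of_injective _ (hDi i0), Fin.card_filter_val_lt]
    omega
  have hcw : ∀ i, i ≠ i0 → (P i).card = w := by
    intro i hi
    simp only [hP, if_neg hi]
    rw [card_image_of_injective _ (hDi i)]; simp
  refine ⟨univ.biUnion P, ?_, ⟨P, i0, hcmp, hcs, hcw, rfl⟩, ?_⟩
  · intro x hx
    obtain ⟨i, -, hi⟩ := mem_biUnion.1 hx
    obtain ⟨t, rfl⟩ := hPs i x hi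
    exact hDS i t
  · rw [sum_biUnion (fun i _ j _ hij => hcmp.disj hij)]
    have : Nonempty (Fin w) := ⟨⟨0, hw⟩⟩
    choose φ hφ using fun i => Finite.exists_max (fun t => y (D i t))
    refine le_trans (sum_le_sum fun i _ => ?_) (hDE φ).2
    have : ∑ x ∈ P i, y x ≤ (P i).card • y (D i (φ i)) := by
      apply sum_le_card_nsmul
      intro x hx
      obtain ⟨t, rfl⟩ := hPs i x hx
      exact hφ i t
    rw [nsmul_eq_mul] at this
    split_ifs with hi
    · subst hi; rwa [hcs] at this
    · rwa [hcw i hi] at this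

lemma layer (y M : ℕ) (hy : y ≤ M) : (y : ℝ) = ∑ c ∈ range M, (if y ≤ c then (0:ℝ) else 1) := by
  have : ∑ c ∈ range M, (if y ≤ c then (0:ℝ) else 1) = ∑ c ∈ range M, (if c < y then (1:ℝ) else 0) := by
    refine sum_congr rfl fun c _ => ?_
    by_cases h : y ≤ c
    · simp [h]
    · rw [if_neg h, if_pos (not_le.1 h)]
  rw [this, ← sum_filter]
  have : (range M).filter (fun c => c < y) = range y := by
    ext c; simp; omega
  rw [this]; simp

lemma cost_eq {S : Finset V} (hS : S.Nonempty) {y : V → ℕ} {M κ s w : ℕ} (hy : ∀ v, y v ≤ M)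
    (hκ : 1 ≤ κ) (hw : 0 < w)
    {θ b : ℝ} (hb : b = s + (κ - 1) * w) (hb0 : b ≠ 0) (hθ : θ = w / b)
    (x : Fin κ → V) : ∃ i0, ∑ i, (if i = i0 then (s:ℝ) else w) * y (x i) =
      b * ((∑ v ∈ S, (y v : ℝ)) / S.card - ∑ c ∈ range M, Tm S y κ θ (List.ofFn x) c) := by
  have : Nonempty (Fin κ) := ⟨⟨0, hκ⟩⟩
  obtain ⟨i0, hi0⟩ := Finite.exists_max (fun i => y (x i))
  refine ⟨i0, ?_⟩
  have hSR : (0:ℝ) < S.card := by exact_mod_cast hS.card_pos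
  have h1 : (∑ v ∈ S, (y v : ℝ)) / S.card = ∑ c ∈ range M, (1 - Fr S y c) := by
    rw [div_eq_iff hSR.ne', sum_mul]
    rw [sum_congr rfl (fun v _ => layer (y v) M (hy v)), sum_comm]
    refine sum_congr rfl fun c _ => ?_
    unfold Fr
    rw [sub_mul, div_mul_cancel₀ _ hSR.ne', one_mul]
    have : (S.card : ℝ) = (S.filter fun v => y v ≤ c).card + (S.filter fun v => ¬ y v ≤ c).card := by
      exact_mod_cast (card_filter_add_card_filter_not (s := S) (fun v => y v ≤ c)).symm
    rw [this, add_sub_cancel_left, card_filter]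
    push_cast
    refine sum_congr rfl fun v _ => ?_
    by_cases h : y v ≤ c <;> simp [h]
  rw [h1, ← sum_sub_distrib]
  have h2 : ∀ i, (if i = i0 then (s:ℝ) else w) * y (x i) = ∑ c ∈ range M,
      (if i = i0 then (s:ℝ) else w) * (if y (x i) ≤ c then (0:ℝ) else 1) := by
    intro i
    rw [← mul_sum, ← layer _ _ (hy _)]
  rw [sum_congr rfl (fun i _ => h2 i), sum_comm, mul_sum]
  refine sum_congr rfl fun c _ => ?_
  unfold Tm
  have hcnt : (List.ofFn x).countP (fun v => decide (y v ≤ c)) = (univ.filter fun i => y (x i) ≤ c).card := by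
    rw [List.ofFn_eq_map, List.countP_map, Finset.card_def, Finset.filter_val,
      ← Multiset.countP_eq_card_filter, Fin.univ_def]
    rw [Multiset.coe_countP]
    rfl
  rw [hcnt]
  have h3 : ∑ i, (if i = i0 then (s:ℝ) else w) * (if y (x i) ≤ c then (0:ℝ) else 1) =
      w * (κ - (univ.filter fun i => y (x i) ≤ c).card) - (w - s) * (if y (x i0) ≤ c then 0 else 1) := by
    have e1 : ∀ i, (if i = i0 then (s:ℝ) else w) * (if y (x i) ≤ c then (0:ℝ) else 1) =
        w * (1 - if y (x i) ≤ c then (1:ℝ) else 0) - (if i = i0 then ((w:ℝ) - s) *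
          (if y (x i0) ≤ c then 0 else 1) else 0) := by
      intro i
      by_cases h : i = i0
      · subst h; simp only [if_true]; split_ifs <;> ring
      · simp only [if_neg h]; split_ifs <;> ring
    rw [sum_congr rfl (fun i _ => e1 i), sum_sub_distrib, sum_ite_eq' univ i0]
    simp only [mem_univ, if_true]
    rw [← mul_sum, sum_sub_distrib, card_filter]
    simp
  rw [h3]
  have h4 : (κ ≤ (univ.filter fun i => y (x i) ≤ c).card) ↔ y (x i0) ≤ c := by
    constructor
    · intro h
      have : (univ.filter fun i => y (x i) ≤ c) = univ := by
        apply eq_univ_of_card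
        apply le_antisymm (card_le_univ _)
        simpa using h
      have := this ▸ mem_univ i0
      exact (mem_filter.1 this).2
    · intro h
      have : (univ.filter fun i => y (x i) ≤ c) = univ := by
        ext i; simp; exact (hi0 i).trans h
      rw [this]; simp
  have hθb : b * θ = w := by rw [hθ]; field_simp
  by_cases h5 : y (x i0) ≤ c
  · rw [if_pos h5, if_pos (h4.2 h5)]
    have : (univ.filter fun i => y (x i) ≤ c).card = κ := by
      apply le_antisymm _ (h4.2 h5)
      simpa using card_le_univ (univ.filter fun i => y (x i) ≤ c)
    rw [this]; ring
  · rw [if_neg h5, if_neg (fun h => h5 (h4.1 h))]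
    have : b * (1 - Fr S y c - (1 - Fr S y c - (1 - θ * ((univ.filter fun i => y (x i) ≤ c).card:ℝ))))
      = b - (b * θ) * ((univ.filter fun i => y (x i) ≤ c).card:ℝ) := by ring
    rw [this, hθb, hb]; ring

end ModC4
end OreT

namespace OreT
section ModC5
open Finset
open scoped Classical BigOperators

variable {V : Type} {G : SimpleGraph V}

set_option maxHeartbeats 1000000 in
lemma lp_bottle (κ s w : ℕ) (hκ : 1 ≤ κ) (hs : 0 < s) (hsw : s ≤ w) (b : ℝ)
    (hb : b = s + (κ - 1) * w) (γ : ℝ) (hγ : 0 < γ) :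
    ∃ μ0 > 0, ∀ α > 0, ∀ ε > 0, ∃ n0 : ℕ, ∀ (V : Type) (G : SimpleGraph V) (S L : Finset V) (ζ : V → ℝ)
      (μ : ℝ), 0 ≤ μ → μ ≤ μ0 →
      (∀ v, 0 ≤ ζ v ∧ ζ v ≤ 1) → n0 ≤ S.card → Hyp G S L (w / b) μ γ α →
      ∃ X ⊆ S, IsBottle G κ s w X ∧ b * ((∑ v ∈ S, ζ v) / S.card) - ε ≤ ∑ x ∈ X, ζ x := by
  have hκR : (1:ℝ) ≤ κ := by exact_mod_cast hκ
  have hsR : (0:ℝ) < s := by exact_mod_cast hs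
  have hwR : (0:ℝ) < w := by exact_mod_cast (by omega : 0 < w)
  have hswR : (s:ℝ) ≤ w := by exact_mod_cast hsw
  have hκ1 : 0 ≤ ((κ:ℝ) - 1) * w := mul_nonneg (by linarith) hwR.le
  have hb0 : 0 < b := by rw [hb]; linarith
  set θ : ℝ := w / b with hθ
  have hθ0 : 0 ≤ θ := by positivity
  set c1 : ℝ := s / b with hc1
  have hc1p : 0 < c1 := by positivity
  have hc11 : c1 ≤ 1 := by rw [hc1, div_le_one hb0, hb]; linarith
  have hc1e : c1 = 1 - (κ - 1) * θ := by
    rw [hc1, hθ]; field_simp; rw [hb]; ring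
  have hc1θ : c1 ≤ θ := by rw [hc1, hθ]; gcongr
  set g := min 1 γ with hg
  have hg0 : 0 < g := by rw [hg]; positivity
  have hg1 : g ≤ 1 := min_le_left _ _
  have hgγ : g ≤ γ := min_le_right _ _
  refine ⟨c1 * g / (4 * κ^2), by positivity, fun α hα ε hε => ?_⟩
  set ε1 := ε / (4 * b) with hε1
  have hε10 : 0 < ε1 := by positivity
  set δ : ℝ := min (g * c1) (min α ε1) / (4 * (κ + 1)) with hδ
  have hδ0 : 0 < δ := by rw [hδ]; positivity
  have hδ4 : (κ + 1) * δ = min (g * c1) (min α ε1) / 4 := by rw [hδ]; field_simp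
  have hδa : (κ + 1) * δ ≤ g * c1 / 4 := by rw [hδ4]; gcongr; exact min_le_left _ _
  have hδb : (κ + 1) * δ ≤ ε1 / 4 := by rw [hδ4]; gcongr; exact (min_le_right _ _).trans (min_le_right _ _)
  have hδc : (κ + 1) * δ ≤ α / 4 := by rw [hδ4]; gcongr; exact (min_le_right _ _).trans (min_le_left _ _)
  have hgc : g * c1 ≤ g := mul_le_of_le_one_right hg0.le hc11
  have hgc' : g * c1 ≤ c1 := mul_le_of_le_one_left hc1p.le hg1
  obtain ⟨n1, hn1⟩ := bottle_cost κ s w hκ (by omega) hsw (δ ^ κ) (by positivity)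
  set M : ℕ := ⌈1 / ε1⌉₊ + 1 with hM
  have hM0 : (0:ℝ) < M := by rw [hM]; positivity
  have hM1 : 1 / (M:ℝ) ≤ ε1 := by
    rw [div_le_comm₀ hM0 hε10, hM]
    push_cast
    linarith [Nat.le_ceil (1 / ε1)]
  refine ⟨n1 + ⌈1 / δ⌉₊ + 1, ?_⟩
  intro V G S L ζ μ hμ0 hμ hζ hn hyp
  have hSpos : 0 < S.card := by omega
  have hSR : (0:ℝ) < S.card := by exact_mod_cast hSpos
  have h1 : 1 ≤ δ * S.card := by
    rw [← div_le_iff₀' hδ0]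
    refine (Nat.le_ceil _).trans ?_
    exact_mod_cast (by omega : ⌈1 / δ⌉₊ ≤ S.card)
  have hκμ : κ^2 * μ ≤ c1 * g / 4 := by
    have : (κ:ℝ)^2 * μ ≤ κ^2 * (c1 * g / (4 * κ^2)) := by gcongr
    refine this.trans (le_of_eq ?_)
    field_simp
  have hκκ : (κ:ℝ) * μ ≤ κ^2 * μ := by
    rw [pow_two, mul_assoc]
    exact le_mul_of_one_le_left (by positivity) hκR
  set p : ℝ := κ * μ / c1 with hp
  have hp0 : 0 ≤ p := by positivity
  have hpc : p * c1 = κ * μ := by rw [hp]; field_simp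
  have hκp : κ * p ≤ g / 4 := by
    have : κ * p = (κ^2 * μ) / c1 := by rw [hp]; ring
    rw [this, div_le_iff₀ hc1p]; linarith
  have hκp1 : (κ - 1) * p ≤ g / 4 := by linarith
  have h34 : 3/4 ≤ 1 - (κ - 1) * p := by linarith
  set y : V → ℕ := fun v => ⌊M * (1 - ζ v)⌋₊ with hy
  have hyM : ∀ v, y v ≤ M := by
    intro v
    have : M * (1 - ζ v) ≤ M := mul_le_of_le_one_right hM0.le (by linarith [(hζ v).1])
    exact Nat.floor_le_of_le this
  have hkey := lp_core (γ' := γ / 2) (ε := ε1) (p := p) (c1 := c1) hyp hκ hθ0 hμ0 hδ0 h1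
    (by
      have : (κ - 1 : ℝ) * θ = 1 - c1 := by linarith
      have e2 : (κ - 1 : ℝ) * μ ≤ κ * μ := by gcongr; linarith
      have e3 : (κ - 1 : ℝ) * (θ + μ) = (κ - 1) * θ + (κ - 1) * μ := by ring
      linarith)
    (by linarith) (by nlinarith) hc1e hc1θ hp0 hpc (by linarith)
    (by
      have : 3/4 * (γ / 2) ≤ (1 - (κ - 1) * p) * (γ/2) := by gcongr
      linarith)
    (by
      have : 3/4 * c1 ≤ (1 - (κ - 1) * p) * c1 := by gcongr
      linarith) (by linarith) y M
  have hcount := hkey.count hδ0.le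
  set avg := (∑ v ∈ S, (y v : ℝ)) / S.card with havg
  obtain ⟨X, hXS, hXb, hXc⟩ := hn1 V G S (fun v => (y v : ℝ)) (b * (avg + ε1 * M)) (fun v => by positivity)
    (by omega) (by
      refine hcount.trans (Nat.cast_le.2 (card_le_card ?_))
      intro x hx
      obtain ⟨hx1, hx2, hx3⟩ := (@mem_filter _ _ (_) _ _).1 hx
      refine mem_filter.2 ⟨hx1, ?_, ?_⟩
      · intro i j hij
        rw [List.pairwise_ofFn] at hx2
        rcases lt_or_gt_of_ne hij with h | h
        · exact hx2 h
        · exact (hx2 h).symm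
      · obtain ⟨i0, hi0⟩ := cost_eq (S := S) (card_pos.1 hSpos) hyM hκ (by omega : 0 < w) hb hb0.ne' hθ x
        refine ⟨i0, ?_⟩
        rw [hi0]
        gcongr
        linarith)
  refine ⟨X, hXS, hXb, ?_⟩
  have hXcard : (X.card : ℝ) = b := by
    obtain ⟨k', rfl⟩ : ∃ k', κ = k' + 1 := ⟨κ - 1, by omega⟩
    rw [hXb.card, hb]; push_cast; ring
  have hlo : ∀ v, M * (1 - ζ v) - 1 ≤ y v := fun v => by
    have := Nat.lt_floor_add_one (M * (1 - ζ v)); simp only [hy]; linarith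
  have hhi : ∀ v, (y v:ℝ) ≤ M * (1 - ζ v) := fun v =>
    Nat.floor_le (mul_nonneg hM0.le (by linarith [(hζ v).2]))
  have s1 : ∑ x ∈ X, (M * (1 - ζ x) - 1) ≤ ∑ x ∈ X, (y x:ℝ) := sum_le_sum fun x _ => hlo x
  have s2 : avg ≤ (∑ v ∈ S, M * (1 - ζ v)) / S.card := by
    rw [havg]; gcongr with v; exact hhi v
  have s3 : (∑ v ∈ S, M * (1 - ζ v)) / S.card = M * (1 - (∑ v ∈ S, ζ v) / S.card) := by
    rw [← mul_sum, sum_sub_distrib]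
    simp only [sum_const, nsmul_eq_mul, mul_one]
    field_simp
  have s4 : ∑ x ∈ X, (M * (1 - ζ x) - 1) = M * (b - ∑ x ∈ X, ζ x) - b := by
    rw [sum_sub_distrib, ← mul_sum, sum_sub_distrib]
    simp only [sum_const, nsmul_eq_mul, mul_one]
    rw [hXcard]
  rw [s4] at s1
  rw [s3] at s2
  have s5 : M * (b - ∑ x ∈ X, ζ x) - b ≤ b * (M * (1 - (∑ v ∈ S, ζ v) / S.card) + ε1 * M) := by
    have : b * (avg + ε1 * M) ≤ b * (M * (1 - (∑ v ∈ S, ζ v) / S.card) + ε1 * M) := by gcongr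
    linarith
  have s6 : (b - ∑ x ∈ X, ζ x) ≤ b * (1 - (∑ v ∈ S, ζ v) / S.card) + b * ε1 + b * (1 / M) := by
    have e : b * (1 - (∑ v ∈ S, ζ v) / S.card) + b * ε1 + b * (1 / M) =
      (b * (M * (1 - (∑ v ∈ S, ζ v) / S.card) + ε1 * M) + b) / M := by field_simp
    rw [e, le_div_iff₀ hM0]
    linarith
  have s7 : b * (1 / M) ≤ b * ε1 := by gcongr
  have s8 : b * ε1 = ε / 4 := by rw [hε1]; field_simp
  linarith

end ModC5
end OreT

namespace OreT
section ModC6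
open Finset
open scoped Classical BigOperators

variable {V : Type} {G : SimpleGraph V}

lemma ee_eq_sum (P : Finset V) :
    (ee G P : ℝ) = ∑ u ∈ P, ((P.filter fun v => G.Adj u v).card : ℝ) := by
  unfold ee
  rw [card_filter, sum_product, Nat.cast_sum]
  refine sum_congr rfl fun u _ => ?_
  rw [card_filter]

lemma few_high {P : Finset V} {t : ℝ} :
    ((P.filter fun u => t < ((P.filter fun v => G.Adj u v).card:ℝ)).card : ℝ) * t ≤ ee G P := by
  rw [ee_eq_sum]
  calc _ = ∑ u ∈ P.filter fun u => t < ((P.filter fun v => G.Adj u v).card:ℝ), t := by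
        rw [sum_const, nsmul_eq_mul]
    _ ≤ ∑ u ∈ P.filter fun u => t < ((P.filter fun v => G.Adj u v).card:ℝ),
        ((P.filter fun v => G.Adj u v).card : ℝ) :=
        sum_le_sum fun u hu => (mem_filter.1 hu).2.le
    _ ≤ _ := sum_le_sum_of_subset_of_nonneg (filter_subset _ _) fun _ _ _ => by positivity

/-- vertices of `S` with no neighbour in `F` -/
noncomputable def HF (G : SimpleGraph V) (S F : Finset V) : Finset V :=
  S.filter fun u => ∀ v ∈ F, ¬ G.Adj v u

/-- container -/
noncomputable def CF (G : SimpleGraph V) (S : Finset V) (β : ℝ) (F : Finset V) : Finset V :=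
  (HF G S F).filter fun v => (((HF G S F).filter fun u => G.Adj v u).card : ℝ) < β * S.card

lemma CF_subset (S : Finset V) (β : ℝ) (F : Finset V) : CF G S β F ⊆ S :=
  (filter_subset _ _).trans (filter_subset _ _)

lemma CF_ee {S : Finset V} {β : ℝ} (hβ : 0 ≤ β) (F : Finset V) : (ee G (CF G S β F) : ℝ) ≤ β * (S.card:ℝ)^2 := by
  rw [ee_eq_sum]
  calc _ ≤ ∑ u ∈ CF G S β F, β * S.card := by
        refine sum_le_sum fun u hu => ?_
        refine le_trans ?_ (mem_filter.1 hu).2.le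
        exact_mod_cast card_le_card (filter_subset_filter _ (filter_subset _ _))
    _ = (CF G S β F).card * (β * S.card) := by rw [sum_const, nsmul_eq_mul]
    _ ≤ S.card * (β * S.card) := by
        gcongr
        exact CF_subset _ _ _
    _ = _ := by ring

lemma container {S P : Finset V} (hP : P ⊆ S) {β α' ξ : ℝ} (hβ : 0 < β) (hξ : 0 < ξ)
    (q : ℕ) (hq : 1 < q * β) (hS : 0 < S.card) (hee : (ee G P : ℝ) ≤ α' * (S.card:ℝ)^2) :
    ∃ F ⊆ S, F.card ≤ q ∧ (((P \ CF G S β F).card : ℕ) : ℝ) ≤ (α' / ξ + q * ξ) * S.card := by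
  have hn : (0:ℝ) < S.card := by exact_mod_cast hS
  set P0 := P.filter fun u => ¬ (ξ * S.card < ((P.filter fun v => G.Adj u v).card:ℝ)) with hP0
  have hbad : (((P.filter fun u => ξ * S.card < ((P.filter fun v => G.Adj u v).card:ℝ)).card : ℕ) : ℝ) ≤
      α' / ξ * S.card := by
    have := few_high (G := G) (P := P) (t := ξ * S.card)
    have h2 := this.trans hee
    have h3 : α' / ξ * S.card = α' * (S.card:ℝ)^2 / (ξ * S.card) := by field_simp
    rw [h3, le_div_iff₀ (by positivity)]
    exact h2
  have hstep : ∀ t : ℕ, ∃ F ⊆ P0, F.card ≤ t ∧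
      ((∀ v ∈ P0, v ∈ HF G S F → v ∈ CF G S β F) ∨ ((HF G S F).card : ℝ) + t * (β * S.card) ≤ S.card) := by
    intro t
    induction t with
    | zero =>
      refine ⟨∅, by simp, by simp, Or.inr ?_⟩
      simp [HF]
    | succ t ih =>
      obtain ⟨F, hF, hFc, h | h⟩ := ih
      · exact ⟨F, hF, by omega, Or.inl h⟩
      · by_cases hst : ∀ v ∈ P0, v ∈ HF G S F → v ∈ CF G S β F
        · exact ⟨F, hF, by omega, Or.inl hst⟩
        · push Not at hst
          obtain ⟨v, hv0, hvH, hvC⟩ := hst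
          have hdeg : β * S.card ≤ (((HF G S F).filter fun u => G.Adj v u).card : ℝ) := by
            by_contra hcon
            exact hvC (mem_filter.2 ⟨hvH, not_le.1 hcon⟩)
          refine ⟨insert v F, ?_, ?_, Or.inr ?_⟩
          · intro u hu
            rcases mem_insert.1 hu with rfl | hu
            · exact hv0
            · exact hF hu
          · exact (card_insert_le _ _).trans (by omega)
          · have e : HF G S (insert v F) = (HF G S F).filter fun u => ¬ G.Adj v u := by
              ext u; simp [HF]; tauto
            have e2 : (((HF G S F).filter fun u => G.Adj v u).card : ℝ) +
                ((HF G S F).filter fun u => ¬ G.Adj v u).card = (HF G S F).card := by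
              exact_mod_cast card_filter_add_card_filter_not (s := HF G S F) (fun u => G.Adj v u)
            rw [e]; push_cast; linarith
  obtain ⟨F, hF, hFc, h | h⟩ := hstep q
  swap
  · exfalso
    have : (q:ℝ) * (β * S.card) = q * β * S.card := by ring
    have h2 : 1 * (S.card:ℝ) < q * β * S.card := by gcongr
    have : (0:ℝ) ≤ (HF G S F).card := by positivity
    linarith
  refine ⟨F, hF.trans ((filter_subset _ _).trans hP), hFc, ?_⟩
  have hsub : P \ CF G S β F ⊆ (P.filter fun u => ξ * S.card < ((P.filter fun v => G.Adj u v).card:ℝ)) ∪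
      F.biUnion fun v => P.filter fun u => G.Adj v u := by
    intro u hu
    rw [mem_sdiff] at hu
    rw [mem_union, mem_filter, mem_biUnion]
    by_cases h1 : ξ * S.card < ((P.filter fun v => G.Adj u v).card:ℝ)
    · exact Or.inl ⟨hu.1, h1⟩
    · right
      by_contra hcon
      push Not at hcon
      apply hu.2
      apply h u (mem_filter.2 ⟨hu.1, h1⟩)
      refine mem_filter.2 ⟨hP hu.1, fun v hv hadj => ?_⟩
      exact hcon v hv (mem_filter.2 ⟨hu.1, hadj⟩)
  have h1 : (((F.biUnion fun v => P.filter fun u => G.Adj v u).card : ℕ) : ℝ) ≤ q * (ξ * S.card) := by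
    have a1 : (((F.biUnion fun v => P.filter fun u => G.Adj v u).card : ℕ) : ℝ) ≤
        ∑ v ∈ F, ((P.filter fun u => G.Adj v u).card : ℝ) := by exact_mod_cast card_biUnion_le
    have a2 : ∑ v ∈ F, ((P.filter fun u => G.Adj v u).card : ℝ) ≤ F.card • (ξ * S.card) := by
      apply sum_le_card_nsmul
      intro v hv
      exact not_lt.1 (mem_filter.1 (hF hv)).2
    rw [nsmul_eq_mul] at a2
    have a3 : (F.card:ℝ) * (ξ * S.card) ≤ q * (ξ * S.card) := by gcongr
    linarith
  have h2 : (((P \ CF G S β F).card : ℕ) : ℝ) ≤ ((P.filter fun u => ξ * S.card < ((P.filter fun v => G.Adj u v).card:ℝ)).card : ℝ) +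
      ((F.biUnion fun v => P.filter fun u => G.Adj v u).card : ℝ) := by
    exact_mod_cast (card_le_card hsub).trans (card_union_le _ _)
  linarith

lemma card_small_subsets (S : Finset V) : ∀ q : ℕ,
    (S.powerset.filter fun F => F.card ≤ q).card ≤ (S.card + 1)^q := by
  intro q
  induction q with
  | zero =>
    have : (S.powerset.filter fun F => F.card ≤ 0) ⊆ {∅} := by
      intro F hF
      simpa using (mem_filter.1 hF).2
    simpa using card_le_card this
  | succ q ih =>
    have hsub : (S.powerset.filter fun F => F.card ≤ q+1) ⊆
        insert ∅ ((S ×ˢ (S.powerset.filter fun F => F.card ≤ q)).image fun p => insert p.1 p.2) := by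
      intro F hF
      rw [mem_filter, mem_powerset] at hF
      rcases F.eq_empty_or_nonempty with rfl | ⟨a, ha⟩
      · simp
      · rw [mem_insert, mem_image]
        right
        refine ⟨(a, F.erase a), ?_, insert_erase ha⟩
        rw [mem_product, mem_filter, mem_powerset]
        refine ⟨hF.1 ha, (erase_subset _ _).trans hF.1, ?_⟩
        rw [card_erase_of_mem ha]; omega
    refine (card_le_card hsub).trans ((card_insert_le _ _).trans ?_)
    have : ((S ×ˢ (S.powerset.filter fun F => F.card ≤ q)).image fun p : V × Finset V => insert p.1 p.2).card ≤
        S.card * (S.card+1)^q := by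
      refine card_image_le.trans ?_
      rw [card_product]
      gcongr
    have h1 : 1 ≤ (S.card+1)^q := Nat.one_le_pow _ _ (by omega)
    rw [pow_succ]
    nlinarith

/-- the family of test sets -/
noncomputable def Fam (G : SimpleGraph V) (S L : Finset V) (β : ℝ) (q : ℕ) : Finset (Finset V) :=
  ((S \ L).image fun v => S.filter fun u => ¬ G.Adj v u) ∪
    (S.powerset.filter fun F => F.card ≤ q).image (CF G S β)

lemma card_Fam (S L : Finset V) (β : ℝ) (q : ℕ) :
    (Fam G S L β q).card ≤ 2 * (S.card + 1)^(q+1) := by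
  unfold Fam
  refine (card_union_le _ _).trans ?_
  have h1 : ((S \ L).image fun v => S.filter fun u => ¬ G.Adj v u).card ≤ S.card :=
    card_image_le.trans (card_le_card sdiff_subset)
  have h2 := (card_image_le (f := CF G S β)).trans (card_small_subsets S q)
  have h3 : 1 ≤ (S.card+1)^q := Nat.one_le_pow _ _ (by omega)
  rw [pow_succ]
  nlinarith

lemma Fam_sub {S L : Finset V} {β : ℝ} {q : ℕ} {F : Finset V} (hF : F ∈ Fam G S L β q) : F ⊆ S := by
  unfold Fam at hF
  rcases mem_union.1 hF with h | h
  · obtain ⟨v, -, rfl⟩ := mem_image.1 h; exact filter_subset _ _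
  · obtain ⟨v, -, rfl⟩ := mem_image.1 h; exact CF_subset _ _ _

/-- heredity of the hypotheses under balanced restriction -/
lemma hyp_hered {S L R : Finset V} {θ μ γ α ε η : ℝ} {q : ℕ} (hyp : Hyp G S L θ μ γ α)
    (hα : 0 < α) (hγ : 0 < γ) (hη : 0 < η) (hq : 1 < q * (α / 2)) (hS : 0 < S.card)
    (hε : ε ≤ γ / 8) (hRS : R ⊆ S) (hR : η * S.card ≤ R.card)
    (hbal : ∀ F ∈ Fam G S L (α/2) q, ((F ∩ R).card : ℝ) ≤ ((F.card : ℝ) / S.card + ε) * R.card) :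
    Hyp G R L θ (μ + ε) (γ / 2) ((η * γ / 8) * ((η * γ / 16) / (q + 1)) / 2) := by
  have hn : (0:ℝ) < S.card := by exact_mod_cast hS
  have hr : (0:ℝ) < R.card := lt_of_lt_of_le (by positivity) hR
  have hRSc : (R.card : ℝ) ≤ S.card := by exact_mod_cast card_le_card hRS
  refine ⟨hyp.cl, ?_, ?_⟩
  · intro v hv hvL
    have hF := hbal (S.filter fun u => ¬ G.Adj v u) (mem_union_left _ (mem_image.2
      ⟨v, mem_sdiff.2 ⟨hRS hv, hvL⟩, rfl⟩))
    have e : (S.filter fun u => ¬ G.Adj v u) ∩ R = R.filter fun u => ¬ G.Adj v u := by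
      ext u; simp only [mem_inter, mem_filter]; constructor
      · tauto
      · intro h; exact ⟨⟨hRS h.1, h.2⟩, h.1⟩
    rw [e] at hF
    have hd := hyp.deg v (hRS hv) hvL
    unfold nn at hd ⊢
    refine hF.trans ?_
    refine mul_le_mul_of_nonneg_right ?_ hr.le
    have : ((S.filter fun u => ¬ G.Adj v u).card : ℝ) / S.card ≤ θ + μ := by
      rw [div_le_iff₀ hn]; exact hd
    linarith
  · intro P hP hPc
    by_contra hcon
    push Not at hcon
    set ξ : ℝ := (η * γ / 16) / (q + 1) with hξ
    have hξ0 : 0 < ξ := by positivity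
    set α1 : ℝ := (η * γ / 8) * ξ / 2 with hα1
    have hα10 : 0 < α1 := by positivity
    have hee : (ee G P : ℝ) ≤ α1 * (S.card:ℝ)^2 := by
      refine hcon.le.trans ?_
      gcongr
    obtain ⟨F, hFS, hFq, hF⟩ := container (hP.trans hRS) (by positivity : 0 < α / 2) hξ0 q hq hS hee
    have hc : α1 / ξ + q * ξ ≤ η * γ / 8 := by
      have e1 : α1 / ξ = η * γ / 16 := by rw [hα1]; field_simp; ring
      have e2 : (q:ℝ) * ξ ≤ (q + 1) * ξ := by gcongr; linarith
      have e3 : (q + 1) * ξ = η * γ / 16 := by rw [hξ]; field_simp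
      linarith
    have hb := hbal (CF G S (α/2) F) (mem_union_right _ (mem_image.2 ⟨F, mem_filter.2
      ⟨mem_powerset.2 hFS, hFq⟩, rfl⟩))
    have hCF : ((CF G S (α/2) F).card : ℝ) < (θ - γ) * S.card := by
      by_contra h
      have h2 := hyp.ne _ (CF_subset _ _ _) (not_lt.1 h)
      have h3 := CF_ee (G := G) (S := S) (by positivity : 0 ≤ α / 2) F
      have : 0 < α * (S.card:ℝ)^2 := by positivity
      linarith
    have h4 : ((CF G S (α/2) F).card : ℝ) / S.card ≤ θ - γ := by
      rw [div_le_iff₀ hn]; exact hCF.le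
    have h5 : (P.card : ℝ) ≤ (CF G S (α/2) F ∩ R).card + (P \ CF G S (α/2) F).card := by
      have : P ⊆ (CF G S (α/2) F ∩ R) ∪ (P \ CF G S (α/2) F) := by
        intro u hu
        rw [mem_union, mem_inter, mem_sdiff]
        by_cases h : u ∈ CF G S (α/2) F
        · exact Or.inl ⟨h, hP hu⟩
        · exact Or.inr ⟨hu, h⟩
      exact_mod_cast (card_le_card this).trans (card_union_le _ _)
    have h6 : (α1 / ξ + q * ξ) * S.card ≤ γ / 8 * R.card := by
      calc (α1 / ξ + q * ξ) * S.card ≤ (η * γ / 8) * S.card := by gcongr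
        _ = γ / 8 * (η * S.card) := by ring
        _ ≤ _ := by gcongr
    have h7 : (((CF G S (α/2) F).card : ℝ) / S.card + ε) * R.card ≤ (θ - γ + γ / 8) * R.card := by
      gcongr
    have h8 : 0 < γ * R.card := by positivity
    linarith

end ModC6
end OreT

namespace OreT
section ModC7
open Finset
open scoped Classical BigOperators

variable {V : Type} {G : SimpleGraph V}

/-- density of `F` in `R` -/
noncomputable def zz (F R : Finset V) : ℝ := ((F ∩ R).card : ℝ) / R.card

noncomputable def Ph (𝓕 : Finset (Finset V)) (l : ℝ) (z0 : Finset V → ℝ) (R : Finset V) : ℝ :=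
  ∑ F ∈ 𝓕, Real.exp (l * (zz F R - z0 F))

lemma exp_le_quad {a : ℝ} (h : |a| ≤ 1) : Real.exp a ≤ 1 + a + a^2 := by
  have := Real.abs_exp_sub_one_sub_id_le h
  have := (abs_le.1 this).2
  linarith

lemma mwu_step (𝓕 : Finset (Finset V)) (h𝓕 : 𝓕.Nonempty) (l : ℝ) (hl : 0 ≤ l) (z0 : Finset V → ℝ)
    {R X : Finset V} (hX : X ⊆ R) {b ε : ℝ} (hb : (X.card : ℝ) = b) (hbr : b < R.card)
    (hlb : l * b ≤ R.card - b)
    (hcov : b * ((∑ v ∈ R, ∑ F ∈ 𝓕, if v ∈ F then Real.exp (l * (zz F R - z0 F)) / Ph 𝓕 l z0 R else 0) / R.card) - ε ≤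
      ∑ v ∈ X, ∑ F ∈ 𝓕, if v ∈ F then Real.exp (l * (zz F R - z0 F)) / Ph 𝓕 l z0 R else 0) :
    Ph 𝓕 l z0 (R \ X) ≤ Ph 𝓕 l z0 R * Real.exp (l * ε / (R.card - b) + l^2 * b^2 / (R.card - b)^2) := by
  set r : ℝ := (R.card : ℝ) with hr
  set W : Finset V → ℝ := fun F => Real.exp (l * (zz F R - z0 F)) with hW
  have hΦ : Ph 𝓕 l z0 R = ∑ F ∈ 𝓕, W F := rfl
  have hW0 : ∀ F, 0 < W F := fun F => Real.exp_pos _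
  have hΦ0 : 0 < Ph 𝓕 l z0 R := by rw [hΦ]; exact sum_pos (fun F _ => hW0 F) h𝓕
  have hb0 : 0 ≤ b := by rw [← hb]; positivity
  have hr0 : 0 < r := by linarith
  have hrb : 0 < r - b := by linarith
  have hsum : ∀ Y : Finset V, (∑ v ∈ Y, ∑ F ∈ 𝓕, if v ∈ F then W F / Ph 𝓕 l z0 R else 0) =
      (∑ F ∈ 𝓕, W F * (F ∩ Y).card) / Ph 𝓕 l z0 R := by
    intro Y
    rw [sum_comm, sum_div]
    refine sum_congr rfl fun F _ => ?_
    rw [← sum_filter, sum_const, nsmul_eq_mul]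
    have : Y.filter (fun v => v ∈ F) = F ∩ Y := by ext v; simp [and_comm]
    rw [this]; ring
  rw [hsum, hsum] at hcov
  have hRX : ((R \ X).card : ℝ) = r - b := by
    rw [cast_card_sdiff hX, hb]
  have hIntr : ∀ F : Finset V, ((F ∩ (R \ X)).card : ℝ) = (F ∩ R).card - (F ∩ X).card := by
    intro F
    have h1 : F ∩ (R \ X) = (F ∩ R) \ (F ∩ X) := by ext v; simp; tauto
    rw [h1, cast_card_sdiff (inter_subset_inter_left hX)]
  set a : Finset V → ℝ := fun F => l * (b * zz F R - (F ∩ X).card) / (r - b) with ha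
  have hz : ∀ F, zz F (R \ X) - z0 F = (zz F R - z0 F) + (b * zz F R - (F ∩ X).card) / (r - b) := by
    intro F
    unfold zz
    rw [hIntr, hRX, ← hr]
    field_simp
    ring
  have habs : ∀ F, |b * zz F R - (F ∩ X).card| ≤ b := by
    intro F
    have h1 : 0 ≤ zz F R := by unfold zz; positivity
    have h2 : zz F R ≤ 1 := by
      unfold zz; apply div_le_one_of_le₀ _ (by positivity)
      exact_mod_cast card_le_card inter_subset_right
    have h3 : ((F ∩ X).card : ℝ) ≤ b := by rw [← hb]; exact_mod_cast card_le_card inter_subset_right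
    have h4 : b * zz F R ≤ b := mul_le_of_le_one_right hb0 h2
    have h5 : 0 ≤ b * zz F R := by positivity
    have h6 : (0:ℝ) ≤ ((F ∩ X).card : ℝ) := by positivity
    rw [abs_le]; constructor <;> linarith
  have haabs : ∀ F, |a F| ≤ l * b / (r - b) := by
    intro F
    simp only [ha]
    rw [abs_div, abs_mul, abs_of_nonneg hl, abs_of_pos hrb]
    gcongr
    exact habs F
  have ha1 : ∀ F, |a F| ≤ 1 := fun F => (haabs F).trans (by rw [div_le_one hrb]; exact hlb)
  have hterm : ∀ F ∈ 𝓕, Real.exp (l * (zz F (R \ X) - z0 F)) ≤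
      W F + W F * a F + W F * (l * b / (r - b))^2 := by
    intro F _
    have e : l * (zz F (R \ X) - z0 F) = l * (zz F R - z0 F) + a F := by
      rw [hz]; simp only [ha]; ring
    rw [e, Real.exp_add]
    have h1 := exp_le_quad (ha1 F)
    have h2 : a F ^ 2 ≤ (l * b / (r - b))^2 := by
      rw [← sq_abs]; gcongr; exact haabs F
    have : W F * Real.exp (a F) ≤ W F * (1 + a F + (l * b / (r - b))^2) := by
      gcongr
      linarith
    calc _ = W F * Real.exp (a F) := rfl
      _ ≤ _ := this
      _ = _ := by ring
  have hmain : Ph 𝓕 l z0 (R \ X) ≤ Ph 𝓕 l z0 R * (1 + (l * ε / (r - b) + l^2 * b^2 / (r - b)^2)) := by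
    have h1 : Ph 𝓕 l z0 (R \ X) ≤ ∑ F ∈ 𝓕, (W F + W F * a F + W F * (l * b / (r - b))^2) :=
      sum_le_sum hterm
    rw [sum_add_distrib, sum_add_distrib, ← sum_mul, ← hΦ] at h1
    have h2 : ∑ F ∈ 𝓕, W F * a F = l / (r - b) * (b * ((∑ F ∈ 𝓕, W F * (F ∩ R).card) / r) -
        ∑ F ∈ 𝓕, W F * (F ∩ X).card) := by
      rw [sum_div, mul_sum, ← sum_sub_distrib, mul_sum]
      refine sum_congr rfl fun F _ => ?_
      simp only [ha, zz]
      rw [← hr]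
      ring
    have h3 : b * ((∑ F ∈ 𝓕, W F * (F ∩ R).card) / r) - ∑ F ∈ 𝓕, W F * (F ∩ X).card ≤
        ε * Ph 𝓕 l z0 R := by
      have e1 : b * ((∑ F ∈ 𝓕, W F * (F ∩ R).card) / Ph 𝓕 l z0 R / r) =
        b * ((∑ F ∈ 𝓕, W F * (F ∩ R).card) / r) / Ph 𝓕 l z0 R := by field_simp
      rw [e1] at hcov
      have := mul_le_mul_of_nonneg_right hcov hΦ0.le
      rw [sub_mul, div_mul_cancel₀ _ hΦ0.ne', div_mul_cancel₀ _ hΦ0.ne'] at this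
      linarith
    have h4 : ∑ F ∈ 𝓕, W F * a F ≤ l / (r - b) * (ε * Ph 𝓕 l z0 R) := by
      rw [h2]; gcongr
    have e5 : Ph 𝓕 l z0 R * (1 + (l * ε / (r - b) + l^2 * b^2 / (r - b)^2)) =
      Ph 𝓕 l z0 R + l / (r - b) * (ε * Ph 𝓕 l z0 R) + Ph 𝓕 l z0 R * (l * b / (r - b))^2 := by
      rw [div_pow, mul_pow]; ring
    rw [e5]
    linarith
  refine hmain.trans ?_
  gcongr
  linarith [Real.add_one_le_exp (l * ε / (r - b) + l^2 * b^2 / (r - b)^2)]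

lemma poly_le_exp (q : ℕ) (c : ℝ) (hc : 0 < c) : ∃ n0 : ℕ, ∀ n : ℕ, n0 ≤ n →
    2 * ((n:ℝ) + 1)^(q+1) ≤ Real.exp (c * n) := by
  have h1 : Filter.Tendsto (fun x : ℝ => x^(q+1) * Real.exp (-x)) Filter.atTop (nhds 0) :=
    Real.tendsto_pow_mul_exp_neg_atTop_nhds_zero (q+1)
  have h2 : Filter.Tendsto (fun n : ℕ => c * ((n:ℝ) + 1)) Filter.atTop Filter.atTop := by
    apply Filter.Tendsto.const_mul_atTop hc
    exact Filter.tendsto_atTop_add_const_right _ _ tendsto_natCast_atTop_atTop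
  have h3 := h1.comp h2
  have h4 : (0:ℝ) < c^(q+1) / (2 * Real.exp c) := by positivity
  have h5 := (h3.eventually (gt_mem_nhds h4))
  obtain ⟨n0, hn0⟩ := Filter.eventually_atTop.1 h5
  refine ⟨n0, fun n hn => ?_⟩
  have := hn0 n hn
  simp only [Function.comp] at this
  rw [Real.exp_neg, mul_pow, ← div_eq_mul_inv, div_lt_div_iff₀ (Real.exp_pos _) (by positivity)] at this
  have e : Real.exp (c * ((n:ℝ) + 1)) = Real.exp (c * n) * Real.exp c := by
    rw [← Real.exp_add]; ring_nf
  rw [e] at this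
  have hce : 0 < c^(q+1) * Real.exp c := by positivity
  have h6 : (c^(q+1) * Real.exp c) * (2 * ((n:ℝ)+1)^(q+1)) < (c^(q+1) * Real.exp c) * Real.exp (c * n) := by
    linarith
  exact (lt_of_mul_lt_mul_left h6 hce.le).le

end ModC7
end OreT

namespace OreT
section ModC8
open Finset
open scoped Classical BigOperators

variable {V : Type} {G : SimpleGraph V}

set_option maxHeartbeats 1000000 in
lemma near_cover (κ s w : ℕ) (hκ : 1 ≤ κ) (hs : 0 < s) (hsw : s ≤ w) (b : ℝ)
    (hb : b = s + (κ - 1) * w) (γ : ℝ) (hγ : 0 < γ) :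
    ∃ μ0 > 0, ∀ α > 0, ∀ η > 0, ∃ n0 : ℕ, ∀ (V : Type) (G : SimpleGraph V) (S L : Finset V)
      (μ : ℝ), 0 ≤ μ → μ ≤ μ0 → n0 ≤ S.card → Hyp G S L (w / b) μ γ α →
      ∃ X ⊆ S, Til G κ s w X ∧ (((S \ X).card : ℕ) : ℝ) ≤ η * S.card := by
  obtain ⟨μ1, hμ1, hlp⟩ := lp_bottle κ s w hκ hs hsw b hb (γ/2) (by positivity)
  refine ⟨μ1 / 2, by positivity, fun α hα η hη => ?_⟩
  have hsR : (1:ℝ) ≤ s := by exact_mod_cast hs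
  have hκR : (1:ℝ) ≤ κ := by exact_mod_cast hκ
  have hb1 : 1 ≤ b := by
    rw [hb]
    have : 0 ≤ ((κ:ℝ) - 1) * w := mul_nonneg (by linarith) (by positivity)
    linarith
  have hb0 : 0 < b := by linarith
  set q : ℕ := ⌈2 / α⌉₊ + 1 with hq
  have hq1 : 1 < q * (α / 2) := by
    have : 2 / α < q := by
      rw [hq]; push_cast; linarith [Nat.le_ceil (2 / α)]
    rw [div_lt_iff₀ hα] at this
    linarith
  set ε' : ℝ := min (γ / 8) (μ1 / 2) with hε'
  have hε'0 : 0 < ε' := by positivity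
  set α1 : ℝ := (η * γ / 8) * ((η * γ / 16) / (q + 1)) / 2 with hα1
  set ε : ℝ := η * ε' / 8 with hε
  have hε0 : 0 < ε := by positivity
  obtain ⟨n1, hn1⟩ := hlp α1 (by positivity) ε hε0
  set c : ℝ := min (ε' * η^2 / (16 * b^2)) (η / (2 * b)) with hc
  have hc0 : 0 < c := by positivity
  have hca : c * (16 * b^2) ≤ ε' * η^2 := by
    rw [← le_div_iff₀ (by positivity)]; exact min_le_left _ _
  have hcb : c * (2 * b) ≤ η := by
    rw [← le_div_iff₀ (by positivity)]; exact min_le_right _ _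
  obtain ⟨n2, hn2⟩ := poly_le_exp q (c * ε' / 4) (by positivity)
  refine ⟨n2 + ⌈2 * b / η⌉₊ + ⌈n1 / η⌉₊ + 1, ?_⟩
  intro V G S L μ hμ0 hμ hn hyp
  have hS : 0 < S.card := by omega
  have hnpos : (0:ℝ) < S.card := by exact_mod_cast hS
  set n : ℝ := (S.card : ℝ) with hnd
  have hnb : 2 * b ≤ η * n := by
    rw [← div_le_iff₀' hη]
    refine (Nat.le_ceil _).trans ?_
    rw [hnd]; exact_mod_cast (by omega : ⌈2 * b / η⌉₊ ≤ S.card)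
  have hnn1 : (n1:ℝ) ≤ η * n := by
    rw [← div_le_iff₀' hη]
    refine (Nat.le_ceil _).trans ?_
    rw [hnd]; exact_mod_cast (by omega : ⌈(n1:ℝ) / η⌉₊ ≤ S.card)
  set 𝓕 := Fam G S L (α/2) q with h𝓕
  have h𝓕ne : 𝓕.Nonempty := ⟨CF G S (α/2) ∅, mem_union_right _ (mem_image.2 ⟨∅, by simp, rfl⟩)⟩
  set l : ℝ := c * n with hl
  have hl0 : 0 < l := by positivity
  set z0 : Finset V → ℝ := fun F => (F.card : ℝ) / n with hz0
  have hN : (𝓕.card : ℝ) ≤ Real.exp (l * ε' / 4) := by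
    have h1 : (𝓕.card : ℝ) ≤ 2 * ((S.card : ℝ) + 1)^(q+1) := by exact_mod_cast card_Fam S L (α/2) q
    refine h1.trans ((hn2 S.card (by omega)).trans (le_of_eq ?_))
    congr 1; rw [hl, hnd]; ring
  set st : ℝ := 2 * l * ε / (η * n) + 4 * l^2 * b^2 / (η * n)^2 with hst
  have hst0 : 0 ≤ st := by positivity
  have hnst : n * st ≤ l * ε' / 2 := by
    have e1 : n * st = 2 * l * ε / η + l * (4 * (c * b^2) / η^2) := by
      rw [hst, hl]; field_simp
    have e2 : 2 * l * ε / η = l * ε' / 4 := by rw [hε]; field_simp; ring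
    have e3 : 4 * (c * b^2) / η^2 ≤ ε' / 4 := by
      rw [div_le_iff₀ (by positivity)]; linarith
    have e4 : l * (4 * (c * b^2) / η^2) ≤ l * (ε' / 4) := by gcongr
    rw [e1, e2]; linarith
  have hmain : ∀ t : ℕ, ∃ X ⊆ S, Til G κ s w X ∧ ((((S \ X).card : ℕ) : ℝ) ≤ η * n ∨
      (t + (S \ X).card ≤ S.card ∧ Ph 𝓕 l z0 (S \ X) ≤ 𝓕.card * Real.exp (t * st))) := by
    intro t
    induction t with
    | zero =>
      refine ⟨∅, by simp, Til.empty, Or.inr ⟨by simp, ?_⟩⟩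
      unfold Ph
      rw [sdiff_empty]
      have : ∀ F ∈ 𝓕, Real.exp (l * (zz F S - z0 F)) ≤ 1 := by
        intro F hF
        have : zz F S = z0 F := by
          simp only [zz, hz0]; rw [inter_eq_left.2 (Fam_sub hF)]
        rw [this]; simp
      have := sum_le_card_nsmul _ _ _ this
      simpa using this
    | succ t ih =>
      obtain ⟨X, hXS, hXT, h | ⟨h1, h2⟩⟩ := ih
      · exact ⟨X, hXS, hXT, Or.inl h⟩
      by_cases hbig : (((S \ X).card : ℕ) : ℝ) ≤ η * n
      · exact ⟨X, hXS, hXT, Or.inl hbig⟩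
      push Not at hbig
      set R := S \ X with hR
      have hRS : R ⊆ S := sdiff_subset
      have htn : (t:ℝ) ≤ n := by rw [hnd]; exact_mod_cast (by omega : t ≤ S.card)
      have hr0 : (0:ℝ) < R.card := lt_trans (by positivity) hbig
      have hPh : Ph 𝓕 l z0 R ≤ Real.exp (l * ε') := by
        refine h2.trans ?_
        have : (t:ℝ) * st ≤ n * st := by gcongr
        calc (𝓕.card : ℝ) * Real.exp (t * st) ≤ Real.exp (l * ε' / 4) * Real.exp (l * ε' / 2) := by
              gcongr; linarith
          _ = Real.exp (l * ε' / 4 + l * ε' / 2) := (Real.exp_add _ _).symm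
          _ ≤ _ := by
            apply Real.exp_le_exp.2
            have : 0 < l * ε' := by positivity
            linarith
      have hbal : ∀ F ∈ 𝓕, ((F ∩ R).card : ℝ) ≤ ((F.card : ℝ) / S.card + ε') * R.card := by
        intro F hF
        have h3 : Real.exp (l * (zz F R - z0 F)) ≤ Ph 𝓕 l z0 R :=
          single_le_sum (f := fun F => Real.exp (l * (zz F R - z0 F))) (fun _ _ => (Real.exp_pos _).le) hF
        have h4 := Real.exp_le_exp.1 (h3.trans hPh)
        have h5 : zz F R - z0 F ≤ ε' := le_of_mul_le_mul_left h4 hl0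
        rw [← div_le_iff₀ hr0]
        have : ((F ∩ R).card : ℝ) / R.card = zz F R := rfl
        rw [this]
        have : (F.card : ℝ) / S.card = z0 F := rfl
        linarith
      have hypR := hyp_hered hyp hα hγ hη hq1 hS (min_le_left _ _) hRS hbig.le hbal
      set Φ := Ph 𝓕 l z0 R with hΦ
      have hΦe : Φ = ∑ F ∈ 𝓕, Real.exp (l * (zz F R - z0 F)) := rfl
      have hΦ0 : 0 < Φ := sum_pos (fun _ _ => Real.exp_pos _) h𝓕ne
      obtain ⟨Y, hYR, hYb, hYc⟩ := hn1 V G R L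
        (fun v => ∑ F ∈ 𝓕, if v ∈ F then Real.exp (l * (zz F R - z0 F)) / Φ else 0) (μ + ε')
        (by positivity) (by
          have : ε' ≤ μ1 / 2 := min_le_right _ _
          linarith) (by
          intro v
          constructor
          · refine sum_nonneg fun F _ => ?_
            split_ifs
            · positivity
            · exact le_rfl
          · calc _ ≤ ∑ F ∈ 𝓕, Real.exp (l * (zz F R - z0 F)) / Φ := by
                  refine sum_le_sum fun F _ => ?_
                  split_ifs
                  · exact le_rfl
                  · positivity
              _ = 1 := by rw [← sum_div, ← hΦe, div_self hΦ0.ne'])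
        (by
          have : (n1:ℝ) ≤ R.card := by linarith
          exact_mod_cast this) hypR
      have hYcard : (Y.card : ℝ) = b := by
        obtain ⟨k', rfl⟩ : ∃ k', κ = k' + 1 := ⟨κ - 1, by omega⟩
        rw [hYb.card, hb]; push_cast; ring
      have hdiff : S \ (X ∪ Y) = R \ Y := by rw [hR]; ext v; simp; tauto
      have hrb : η * n / 2 ≤ R.card - b := by linarith
      have hηn : 0 < η * n := by positivity
      have hrb0 : 0 < R.card - b := by linarith
      have hstep := mwu_step 𝓕 h𝓕ne l hl0.le z0 hYR hYcard (by linarith) (by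
        have : l * b ≤ η * n / 2 := by
          have : l * b = (c * (2 * b)) * n / 2 := by rw [hl]; ring
          rw [this]; gcongr
        linarith) hYc
      refine ⟨X ∪ Y, union_subset hXS (hYR.trans hRS), Til.add _ _ hXT hYb ?_, Or.inr ⟨?_, ?_⟩⟩
      · exact disjoint_sdiff.mono_right hYR
      · rw [hdiff]
        have h6 : (R \ Y).card + Y.card = R.card := card_sdiff_add_card_eq_card hYR
        have h7 : 1 ≤ Y.card := by
          have : (1:ℝ) ≤ Y.card := by rw [hYcard]; exact hb1
          exact_mod_cast this
        omega
      · rw [hdiff]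
        refine hstep.trans ?_
        have hexp : l * ε / (R.card - b) + l^2 * b^2 / (R.card - b)^2 ≤ st := by
          have a1 : l * ε / (R.card - b) ≤ l * ε / (η * n / 2) := by gcongr
          have a2 : l^2 * b^2 / (R.card - b)^2 ≤ l^2 * b^2 / (η * n / 2)^2 := by gcongr
          have a3 : l * ε / (η * n / 2) = 2 * l * ε / (η * n) := by field_simp
          have a4 : l^2 * b^2 / (η * n / 2)^2 = 4 * l^2 * b^2 / (η * n)^2 := by field_simp; ring
          rw [hst, ← a3, ← a4]; linarith
        calc Φ * Real.exp (l * ε / (R.card - b) + l^2 * b^2 / (R.card - b)^2)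
            ≤ (𝓕.card * Real.exp (t * st)) * Real.exp st := by gcongr
          _ = 𝓕.card * Real.exp (((t + 1 : ℕ) : ℝ) * st) := by
              rw [mul_assoc, ← Real.exp_add]; congr 2; push_cast; ring
  obtain ⟨X, hXS, hXT, h | ⟨h, -⟩⟩ := hmain S.card
  · exact ⟨X, hXS, hXT, h⟩
  · refine ⟨X, hXS, hXT, ?_⟩
    have : (S \ X).card = 0 := by omega
    rw [this]; simp; positivity

end ModC8
end OreT

namespace OreT
section ModD1
open Finset
open scoped Classical BigOperators

variable {V : Type} {G : SimpleGraph V}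

lemma ManyL.append {S : Finset V} {δ : ℝ} : ∀ {m p : ℕ} {P : List V → Prop},
    ManyL S δ m (fun r => ManyL S δ p (fun r' => P (r ++ r'))) → ManyL S δ (p + m) P := by
  intro m
  induction m with
  | zero => intro p P h; simpa [ManyL] using h
  | succ m ih =>
    intro p P h
    rw [← Nat.add_assoc]
    unfold ManyL at h ⊢
    refine h.trans ?_
    gcongr with v hv
    intro hm
    exact ih (P := fun l => P (v :: l)) (by simpa using hm)

/-- many cliques inside large sets avoiding `L` -/
lemma many_cliques {S L : Finset V} {θ μ γ α δ : ℝ} (hyp : Hyp G S L θ μ γ α)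
    (hμ : 0 ≤ μ) (hS : 0 < S.card) (hδα : 2 * δ ≤ α) (hδθ : γ + δ ≤ θ) (hδ : 0 < δ) (hγ : 0 ≤ γ) :
    ∀ (m : ℕ) (N : Finset V), N ⊆ S → (∀ v ∈ N, v ∉ L) →
    (m = 1 → δ * S.card ≤ N.card) → (2 ≤ m → ((m - 1) * θ - γ + (m - 2) * μ) * S.card ≤ N.card) →
    ManyL S δ m (fun K => K.Pairwise G.Adj ∧ ∀ v ∈ K, v ∈ N) := by
  have hn : (0:ℝ) < S.card := by exact_mod_cast hS
  intro m
  induction m with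
  | zero => intro N _ _ _ _; simp [ManyL]
  | succ m ih =>
    intro N hN hNL h1 h2
    rcases Nat.lt_trichotomy m 1 with hm | hm | hm
    · obtain rfl : m = 0 := by omega
      refine ManyL.step hN (h1 rfl) fun v hv => ?_
      simp [ManyL, hv]
    · subst hm
      have h3 := h2 le_rfl
      norm_num at h3
      have h4 := many_edges hN hδα hS (hyp.ne N hN h3)
      refine ManyL.step ((filter_subset _ _).trans hN) h4 fun u hu => ?_
      rw [mem_filter] at hu
      refine ManyL.step ((filter_subset _ _).trans hN) hu.2 fun v hv => ?_
      rw [mem_filter] at hv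
      simp [ManyL, hu.1, hv]
    · have h3 := h2 (by omega)
      push_cast at h3
      have hm' : (2:ℝ) ≤ m := by exact_mod_cast hm
      have hθ : 0 ≤ θ := by linarith
      have h5 : δ ≤ ((m + 1 - 1) * θ - γ + (m + 1 - 2) * μ) := by nlinarith
      refine ManyL.step hN (le_trans (by gcongr) h3) fun v hv => ?_
      have h6 : (N.card:ℝ) ≤ (N.filter fun u => G.Adj v u).card + nn G S v := by
        exact_mod_cast card_filter_adj_ge hN v
      have h7 := hyp.deg v (hN hv) (hNL v hv)
      refine (ih (N.filter fun u => G.Adj v u) ((filter_subset _ _).trans hN)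
        (fun u hu => hNL u (mem_filter.1 hu).1) (by omega) (fun _ => ?_)).mono ?_
      · have : ((m - 1) * θ - γ + (m - 2) * μ) * (S.card:ℝ) =
          ((m + 1 - 1) * θ - γ + (m + 1 - 2) * μ) * S.card - (θ + μ) * S.card := by ring
        linarith
      · rintro K - - ⟨hK1, hK2⟩
        refine ⟨List.pairwise_cons.2 ⟨fun u hu => (mem_filter.1 (hK2 u hu)).2, hK1⟩, ?_⟩
        intro u hu
        rcases List.mem_cons.1 hu with rfl | hu
        · exact hv
        · exact (mem_filter.1 (hK2 u hu)).1

/-- list version of the link structure -/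
def GoodLk (G : SimpleGraph V) (m s : ℕ) (v : V) (l : List V) : Prop :=
  (l.take m).Pairwise G.Adj ∧ (∀ u ∈ l.take m, G.Adj v u) ∧
    (0 < s → ∀ u ∈ l.take m, ∀ d ∈ l.drop m, G.Adj u d)

lemma link_many {S L : Finset V} {θ μ γ α δ : ℝ} {m s : ℕ} (hm : 1 ≤ m) (hms : 2 ≤ m ∨ 0 < s)
    (hyp : Hyp G S L θ μ γ α)
    (hμ : 0 ≤ μ) (hδS : 1 ≤ δ * S.card) (hδα : 2 * δ ≤ α) (hδθ : γ + δ ≤ θ) (hδ : 0 < δ) (hγ : 0 ≤ γ)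
    (hθm : m * θ ≤ 1) (hneck : 0 < s → m * (θ + μ) + (m + 2) * δ ≤ 1)
    (hμγ : (m - 1) * μ + (m + 1) * δ ≤ γ) (hδ1 : δ ≤ 1)
    (v : V) (hv : v ∈ S) (hvL : v ∉ L ∨ (m + 2) * (δ * S.card) ≤ ((L ∩ S).card : ℝ)) :
    ManyL S δ (m+1) (GoodLk G m s v) := by
  have hS : 0 < S.card := by
    rcases Nat.eq_zero_or_pos S.card with h | h
    · rw [h] at hδS; norm_num at hδS
    · exact h
  have hn : (0:ℝ) < S.card := by exact_mod_cast hS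
  set d := δ * S.card with hd
  have hm' : (1:ℝ) ≤ m := by exact_mod_cast hm
  have hτ : 0 ≤ θ + μ := by linarith
  by_cases hB : (m + 1) * d ≤ (((L ∩ S).filter fun u => G.Adj v u).card : ℝ)
  · refine (manyL_clique hyp.cl hδS (m+1) ((L ∩ S).filter fun u => G.Adj v u)
      ((filter_subset _ _).trans inter_subset_right)
      ((filter_subset _ _).trans inter_subset_left) (by push_cast; exact hB)).mono ?_
    rintro K - - ⟨hK1, hK2⟩
    refine ⟨hK1.sublist (List.take_sublist _ _), fun u hu => (mem_filter.1 (hK2 u (List.mem_of_mem_take hu))).2, ?_⟩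
    intro _ u hu e he
    have h3 : (K.take m ++ K.drop m).Pairwise G.Adj := by rwa [List.take_append_drop]
    exact (List.pairwise_append.1 h3).2.2 u hu e he
  · push Not at hB
    have hvL' : v ∉ L := by
      rcases hvL with h | h
      · exact h
      · intro hL
        have h1 : (L ∩ S).erase v ⊆ (L ∩ S).filter fun u => G.Adj v u := by
          intro u hu
          rw [mem_erase] at hu
          refine mem_filter.2 ⟨hu.2, hyp.cl hL (mem_inter.1 hu.2).1 hu.1.symm⟩
        have h2 := card_le_card h1
        have h3 : (L ∩ S).card ≤ ((L ∩ S).erase v).card + 1 := by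
          have := pred_card_le_card_erase (s := L ∩ S) (a := v)
          omega
        have h4 : ((L ∩ S).card : ℝ) ≤ ((L ∩ S).filter fun u => G.Adj v u).card + 1 := by
          exact_mod_cast h3.trans (by omega)
        linarith
    set N := (S.filter fun u => G.Adj v u) \ L with hN
    have hNS : N ⊆ S := sdiff_subset.trans (filter_subset _ _)
    have hNL : ∀ u ∈ N, u ∉ L := fun u hu => (mem_sdiff.1 hu).2
    have hNc : (S.card : ℝ) - (θ + μ) * S.card - (m+1) * d ≤ N.card := by
      have h1 := hyp.deg v hv hvL'
      have h2 : (S.card:ℝ) ≤ (S.filter fun u => G.Adj v u).card + nn G S v := by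
        exact_mod_cast card_filter_adj_ge (Subset.refl S) v
      have h3 : ((S.filter fun u => G.Adj v u).card : ℝ) ≤ N.card + ((L ∩ S).filter fun u => G.Adj v u).card := by
        have : (S.filter fun u => G.Adj v u) ⊆ N ∪ ((L ∩ S).filter fun u => G.Adj v u) := by
          intro u hu
          rw [mem_filter] at hu
          by_cases huL : u ∈ L
          · exact mem_union_right _ (mem_filter.2 ⟨mem_inter.2 ⟨huL, hu.1⟩, hu.2⟩)
          · exact mem_union_left _ (mem_sdiff.2 ⟨mem_filter.2 hu, huL⟩)
        exact_mod_cast (card_le_card this).trans (card_union_le _ _)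
      linarith
    have hmain := many_cliques hyp hμ hS hδα hδθ hδ hγ m N hNS hNL (by
        intro hm1
        have hs : 0 < s := by omega
        have := hneck hs
        have hm1' : (m:ℝ) = 1 := by exact_mod_cast hm1
        rw [hm1'] at this hNc
        have h5 : (1 * (θ + μ) + (1 + 2) * δ) * S.card ≤ 1 * S.card := by gcongr
        linarith) (by
        intro _
        refine le_trans ?_ hNc
        have h5 : ((m - 1) * μ + (m + 1) * δ) * S.card ≤ γ * S.card := by gcongr
        have h6 : (m * θ) * S.card ≤ 1 * S.card := by gcongr
        linarith)
    have : m + 1 = 1 + m := by omega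
    rw [this]
    refine ManyL.append (hmain.mono ?_)
    rintro r hr hrS ⟨hr1, hr2⟩
    have hZ : ∃ Z ⊆ S, d ≤ (Z.card : ℝ) ∧ ∀ e ∈ Z, 0 < s → ∀ u ∈ r, G.Adj u e := by
      by_cases hs : 0 < s
      · refine ⟨S.filter fun u => ∀ x ∈ r, G.Adj x u, filter_subset _ _, ?_, fun e he _ => (mem_filter.1 he).2⟩
        have h1 := list_nbrs (G := G) (S := S) (L := L) (τ := (θ + μ) * S.card) hyp.deg (Subset.refl S) r
          (fun x hx => ⟨hrS x hx, hNL x (hr2 x hx)⟩)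
        rw [hr] at h1
        have h5 : (m * (θ + μ) + (m + 2) * δ) * S.card ≤ 1 * S.card := by
          have := hneck hs
          gcongr
        have h6 : 0 ≤ (m + 1) * (δ * S.card) := by positivity
        linarith
      · exact ⟨S, Subset.refl _, by rw [hd]; nlinarith, fun e _ h => absurd h hs⟩
    obtain ⟨Z, hZS, hZd, hZ⟩ := hZ
    refine ManyL.step hZS hZd fun e he => ?_
    simp only [ManyL]
    unfold GoodLk
    rw [List.take_left' hr, List.drop_left' hr]
    refine ⟨hr1, fun u hu => ?_, fun hs u hu f hf => ?_⟩
    · have := hr2 u hu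
      exact (mem_filter.1 (mem_sdiff.1 this).1).2
    · obtain rfl := List.mem_singleton.1 hf
      exact hZ f he hs u hu

end ModD1
end OreT

namespace OreT
section ModD2
open Finset
open scoped Classical BigOperators

variable {V : Type} {G : SimpleGraph V}

/-- tuple version of the link structure: the last vertex is the neck -/
def Lk (G : SimpleGraph V) {m : ℕ} (s : ℕ) (v : V) (x : Fin (m+1) → V) : Prop :=
  (∀ i : Fin (m+1), i.val < m → G.Adj v (x i)) ∧
  (∀ i l : Fin (m+1), i ≠ l → i.val < m → l.val < m → G.Adj (x i) (x l)) ∧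
  (0 < s → ∀ i : Fin (m+1), i.val < m → G.Adj (x i) (x (Fin.last m)))

lemma GoodLk.lk {m s : ℕ} {v : V} {x : Fin (m+1) → V} (h : GoodLk G m s v (List.ofFn x)) :
    Lk G s v x := by
  obtain ⟨h1, h2, h3⟩ := h
  have hmem : ∀ i : Fin (m+1), i.val < m → x i ∈ (List.ofFn x).take m := by
    intro i hi
    rw [List.mem_take_iff_getElem]
    exact ⟨i.val, by simp; omega, by simp [-List.ofFn_succ]⟩
  have hd : x (Fin.last m) ∈ (List.ofFn x).drop m := by
    rw [List.mem_drop_iff_getElem]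
    refine ⟨0, by simp, ?_⟩
    simp [-List.ofFn_succ]; rfl
  refine ⟨fun i hi => h2 _ (hmem i hi), ?_, fun hs i hi => h3 hs _ (hmem i hi) _ hd⟩
  have key : ∀ i l : Fin (m+1), i < l → i.val < m → l.val < m → G.Adj (x i) (x l) := by
    intro i l hil hi hl
    rw [List.pairwise_iff_getElem] at h1
    have := h1 i.val l.val (by simp; omega) (by simp; omega) hil
    simpa [-List.ofFn_succ] using this
  intro i l hil hi hl
  rcases lt_or_gt_of_ne hil with h | h
  · exact key i l h hi hl
  · exact (key l i h hl hi).symm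

/-- the used parts of a blow-up -/
noncomputable def pt {m T : ℕ} (e : ℕ) (D : Fin (m+1) → Fin T → V) (i : Fin (m+1)) : Finset V :=
  if i.val < m then univ.image (D i) else (univ.filter fun t : Fin T => t.val < e).image (D i)

lemma pt_sub {m T : ℕ} {e : ℕ} {D : Fin (m+1) → Fin T → V} {i : Fin (m+1)} {u : V}
    (h : u ∈ pt e D i) : ∃ t, D i t = u := by
  unfold pt at h
  split_ifs at h
  · obtain ⟨t, -, ht⟩ := mem_image.1 h; exact ⟨t, ht⟩
  · obtain ⟨t, -, ht⟩ := mem_image.1 h; exact ⟨t, ht⟩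

lemma pt_card {m T e : ℕ} (he : e ≤ T) {D : Fin (m+1) → Fin T → V} (hD : ∀ i, Function.Injective (D i))
    (i : Fin (m+1)) : (pt e D i).card = if i.val < m then T else e := by
  unfold pt
  split_ifs
  · rw [card_image_of_injective _ (hD i)]; simp
  · rw [card_image_of_injective _ (hD i), Fin.card_filter_val_lt]; omega

noncomputable def om {m T : ℕ} (e : ℕ) (D : Fin (m+1) → Fin T → V) : Finset V := univ.biUnion (pt e D)

lemma om_card {m T e : ℕ} (D : Fin (m+1) → Fin T → V) : (om e D).card ≤ (m+1) * T := by
  refine card_biUnion_le.trans ?_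
  refine (sum_le_card_nsmul univ _ T fun i _ => ?_).trans (by simp)
  unfold pt
  split_ifs
  · exact card_image_le.trans (by simp)
  · exact card_image_le.trans ((card_filter_le _ _).trans (by simp))

lemma absorber {m s w b : ℕ} (hw : 0 < w) (hsw : s ≤ w) (hb : b = s + m * w) (hb0 : 0 < b)
    {Q : Finset V} (hQ : Q.card + s * b = w * b) (hQn : Q.Nonempty) {D : Fin (m+1) → Fin (w*b) → V}
    (hD : GoodB (fun x => ∀ v ∈ Q, Lk G s v x) D) :
    Til G (m+1) s w (om (s*b) D) ∧
      (Disjoint Q (om (s*b) D) → Til G (m+1) s w (om (s*b) D ∪ Q)) := by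
  obtain ⟨hinj, hE⟩ := hD
  have hT : 0 < w * b := Nat.mul_pos hw hb0
  have heT : s * b ≤ w * b := Nat.mul_le_mul_right _ hsw
  have t0 : Fin (w*b) := ⟨0, hT⟩
  obtain ⟨q0, hq0⟩ := hQn
  have hQD : ∀ q ∈ Q, ∀ i : Fin (m+1), i.val < m → ∀ t, G.Adj q (D i t) := by
    intro q hq i hi t
    exact (hE (fun _ => t) q hq).1 i hi
  have hDD : ∀ i l : Fin (m+1), i ≠ l → i.val < m → l.val < m → ∀ t t', G.Adj (D i t) (D l t') := by
    intro i l hil hi hl t t'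
    have := (hE (fun j => if j = i then t else t') q0 hq0).2.1 i l hil hi hl
    simpa [hil.symm] using this
  have hDN : 0 < s → ∀ i : Fin (m+1), i.val < m → ∀ t t', G.Adj (D i t) (D (Fin.last m) t') := by
    intro hs i hi t t'
    have := (hE (fun j => if j = i then t else t') q0 hq0).2.2 hs i hi
    have hne : Fin.last m ≠ i := fun h => by rw [← h] at hi; simp at hi
    simpa [hne] using this
  have hlast : ∀ i : Fin (m+1), ¬ i.val < m → i = Fin.last m := by
    intro i hi; ext; simp; omega
  have hpl : ∀ u ∈ pt (s*b) D (Fin.last m), 0 < s := by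
    intro u hu
    by_contra h
    have : s = 0 := by omega
    subst this
    simp [pt] at hu
  have hcm : CMP G (pt (s*b) D) := by
    intro i l hil x hx y hy
    obtain ⟨t, rfl⟩ := pt_sub hx
    obtain ⟨t', rfl⟩ := pt_sub hy
    by_cases hi : i.val < m <;> by_cases hl : l.val < m
    · exact hDD i l hil hi hl t t'
    · rw [hlast l hl] at hy ⊢
      exact hDN (hpl _ hy) i hi t t'
    · rw [hlast i hi] at hx ⊢
      exact (hDN (hpl _ hx) l hl t' t).symm
    · exact absurd ((hlast i hi).trans (hlast l hl).symm) hil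
  have hcard := pt_card heT hinj
  refine ⟨?_, fun hdis => ?_⟩
  · refine til_of_sizes (m+1) s w b (fun i => if i = Fin.last m then b else 0) _ hcm (by simp) ?_
    intro i
    rw [hcard]
    by_cases hi : i.val < m
    · have hne : i ≠ Fin.last m := fun h => by rw [h] at hi; simp at hi
      simp [hi, hne]
    · rw [hlast i hi]; simp; ring
  · have h1 : om (s*b) D ∪ Q =
        univ.biUnion (fun i : Fin (m+1) => if i.val < m then pt (s*b) D i else pt (s*b) D i ∪ Q) := by
      ext u
      simp only [om, mem_union, mem_biUnion, mem_univ, true_and]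
      constructor
      · rintro (⟨i, hi⟩ | h)
        · refine ⟨i, ?_⟩
          split_ifs
          · exact hi
          · exact mem_union_left _ hi
        · exact ⟨Fin.last m, by simp [h]⟩
      · rintro ⟨i, hi⟩
        split_ifs at hi
        · exact Or.inl ⟨i, hi⟩
        · rcases mem_union.1 hi with h | h
          · exact Or.inl ⟨i, h⟩
          · exact Or.inr h
    rw [h1]
    refine til_of_sizes (m+1) s w ((m+1)*w) (fun _ => w) _ ?_ (by simp) ?_
    · intro i l hil x hx y hy
      beta_reduce at hx hy
      by_cases hi : i.val < m <;> by_cases hl : l.val < m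
      · rw [if_pos hi] at hx; rw [if_pos hl] at hy; exact hcm i l hil x hx y hy
      · rw [if_pos hi] at hx; rw [if_neg hl] at hy
        rcases mem_union.1 hy with h | h
        · exact hcm i l hil x hx y h
        · obtain ⟨t, rfl⟩ := pt_sub hx
          exact (hQD y h i hi t).symm
      · rw [if_neg hi] at hx; rw [if_pos hl] at hy
        rcases mem_union.1 hx with h | h
        · exact hcm i l hil x h y hy
        · obtain ⟨t, rfl⟩ := pt_sub hy
          exact (hQD x h l hl t)
      · exact absurd ((hlast i hi).trans (hlast l hl).symm) hil
    · intro i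
      have hfin : w * b + w * w = w * ((m+1) * w) + s * w := by rw [hb]; ring
      by_cases hi : i.val < m
      · rw [if_pos hi, hcard, if_pos hi]; exact hfin
      · rw [if_neg hi, card_union_of_disjoint, hcard, if_neg hi]
        · linarith
        · refine Disjoint.symm (hdis.mono_right ?_)
          exact subset_biUnion_of_mem _ (mem_univ i)

/-- rich sets exist among many vertices -/
lemma rich_exists {k : ℕ} {S : Finset V} (hS : S.Nonempty) {E : V → (Fin k → V) → Prop} {c : ℝ} (hc : 0 < c)
    {f : ℕ} {Z : Finset V} (hZ0 : 0 < Z.card) (hZ : 2 * f ≤ c * Z.card)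
    (hE : ∀ v ∈ Z, c * (S.card:ℝ)^k ≤ ((tup S k).filter (E v)).card) :
    ∃ Q ⊆ Z, Q.card = f ∧ c / 2 / 2 ^ Z.card * (S.card:ℝ)^k ≤
      ((tup S k).filter (fun x => ∀ v ∈ Q, E v x)).card := by
  set M := (S.card:ℝ)^k with hM
  have hSc : (0:ℝ) < S.card := by exact_mod_cast hS.card_pos
  have hMpos : 0 < M := by positivity
  have hZpos : (0:ℝ) < Z.card := by exact_mod_cast hZ0
  set g : (Fin k → V) → ℕ := fun x => (Z.filter fun v => E v x).card with hg
  have h1 : ∑ v ∈ Z, (((tup S k).filter (E v)).card : ℝ) = ∑ x ∈ tup S k, (g x : ℝ) := by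
    simp only [hg, card_filter, Nat.cast_sum]
    rw [sum_comm]
  set B := (tup S k).filter fun x => f ≤ g x with hB
  have h2 : ∑ x ∈ tup S k, (g x : ℝ) ≤ ∑ x ∈ tup S k, ((if x ∈ B then (Z.card:ℝ) else 0) + f) := by
    refine sum_le_sum fun x hx => ?_
    split_ifs with h
    · have : (g x : ℝ) ≤ Z.card := by exact_mod_cast card_filter_le _ _
      have : (0:ℝ) ≤ f := by positivity
      linarith
    · have : ¬ f ≤ g x := fun h' => h (mem_filter.2 ⟨hx, h'⟩)
      have : (g x:ℝ) ≤ f := by exact_mod_cast (by omega)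
      linarith
  rw [sum_add_distrib, ← sum_filter, sum_const, sum_const, nsmul_eq_mul, nsmul_eq_mul, card_tup] at h2
  have h3 : ((tup S k).filter fun x => x ∈ B) = B := by ext x; simp [hB]
  rw [h3] at h2
  push_cast at h2
  have h4 : Z.card * (c * M) ≤ ∑ v ∈ Z, (((tup S k).filter (E v)).card : ℝ) := by
    have := card_nsmul_le_sum Z (fun v => (((tup S k).filter (E v)).card : ℝ)) (c * M) hE
    simpa using this
  have h5 : c / 2 * M * Z.card ≤ B.card * Z.card := by
    have : M * (2 * f) ≤ M * (c * Z.card) := by gcongr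
    nlinarith
  by_contra hcon
  push Not at hcon
  have h6 : B ⊆ (Z.powersetCard f).biUnion fun Q => (tup S k).filter (fun x => ∀ v ∈ Q, E v x) := by
    intro x hx
    rw [hB, mem_filter] at hx
    obtain ⟨Q, hQ1, hQ2⟩ := exists_subset_card_eq hx.2
    refine mem_biUnion.2 ⟨Q, mem_powersetCard.2 ⟨hQ1.trans (filter_subset _ _), hQ2⟩, mem_filter.2 ⟨hx.1, ?_⟩⟩
    exact fun v hv => (mem_filter.1 (hQ1 hv)).2
  have h7 : (B.card : ℝ) ≤ ∑ Q ∈ Z.powersetCard f, (((tup S k).filter (fun x => ∀ v ∈ Q, E v x)).card : ℝ) := by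
    exact_mod_cast (card_le_card h6).trans card_biUnion_le
  have h8 : c / 2 * M ≤ B.card := le_of_mul_le_mul_right h5 hZpos
  have hfle : f ≤ Z.card := by
    by_contra h
    have : B = ∅ := by
      rw [hB, filter_eq_empty_iff]
      intro x _ hx
      have := card_filter_le Z fun v => E v x
      change f ≤ (Z.filter fun v => E v x).card at hx
      omega
    rw [this] at h8; simp at h8
    have : 0 < c / 2 * M := by positivity
    linarith
  have hne : (Z.powersetCard f).Nonempty := powersetCard_nonempty.2 hfle
  have h9 : ∑ Q ∈ Z.powersetCard f, (((tup S k).filter (fun x => ∀ v ∈ Q, E v x)).card : ℝ) <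
      ∑ Q ∈ Z.powersetCard f, (c / 2 / 2 ^ Z.card * M) := by
    refine sum_lt_sum_of_nonempty hne fun Q hQ => ?_
    rw [mem_powersetCard] at hQ
    exact hcon Q hQ.1 hQ.2
  rw [sum_const, nsmul_eq_mul] at h9
  have h10 : ((Z.powersetCard f).card : ℝ) ≤ 2 ^ Z.card := by
    have : (Z.powersetCard f).card ≤ Z.powerset.card :=
      card_le_card (fun Q hQ => mem_powerset.2 (mem_powersetCard.1 hQ).1)
    rw [card_powerset] at this
    exact_mod_cast this
  have h11 : ((Z.powersetCard f).card : ℝ) * (c / 2 / 2 ^ Z.card * M) ≤ 2 ^ Z.card * (c / 2 / 2 ^ Z.card * M) := by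
    gcongr
  have h12 : (2:ℝ) ^ Z.card * (c / 2 / 2 ^ Z.card * M) = c / 2 * M := by field_simp
  linarith

end ModD2
end OreT

namespace OreT
section ModD3
open Finset
open scoped Classical BigOperators

variable {V : Type} {G : SimpleGraph V}

lemma select {α β : Type} (𝒬 : Finset α) (h𝒬 : 𝒬.Nonempty) (𝒟 : Finset β) (h𝒟 : 𝒟.Nonempty)
    (hit : α → β → Prop) (vs : β → Finset V)
    (p : ℝ) (hp : 0 < p) (K N : ℕ) (hvs : ∀ D, (vs D).card ≤ K)
    (hav : ∀ U : Finset V, U.card ≤ K * N → ∀ q ∈ 𝒬,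
      p * 𝒟.card ≤ ((𝒟.filter fun D => Disjoint U (vs D)).filter fun D => hit q D).card) :
    ∀ t ≤ N, ∃ F : ℕ → β, (∀ i < t, F i ∈ 𝒟 ∧ ∃ q ∈ 𝒬, hit q (F i)) ∧
      (∀ i < t, ∀ j < t, i ≠ j → Disjoint (vs (F i)) (vs (F j))) ∧
      ∑ q ∈ 𝒬, (1/2 : ℝ) ^ ((range t).filter fun i => hit q (F i)).card ≤ 𝒬.card * (1 - p/2)^t := by
  have hDc : (0:ℝ) < 𝒟.card := by exact_mod_cast h𝒟.card_pos
  have hp1 : p ≤ 1 := by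
    obtain ⟨q, hq⟩ := h𝒬
    have h1 := hav ∅ (by simp) q hq
    have h2 : (((𝒟.filter fun D => Disjoint ∅ (vs D)).filter fun D => hit q D).card : ℝ) ≤ 𝒟.card := by
      exact_mod_cast (card_filter_le _ _).trans (card_filter_le _ _)
    have : p * 𝒟.card ≤ 1 * 𝒟.card := by linarith
    exact le_of_mul_le_mul_right this hDc
  intro t
  induction t with
  | zero =>
    intro _
    obtain ⟨D, _⟩ := h𝒟
    exact ⟨fun _ => D, by simp, by simp, by simp⟩
  | succ t ih =>
    intro ht
    obtain ⟨F, hF1, hF2, hF3⟩ := ih (by omega)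
    set wt : α → ℝ := fun q => (1/2 : ℝ) ^ ((range t).filter fun i => hit q (F i)).card with hwt
    have hwt0 : ∀ q, 0 < wt q := fun q => by positivity
    set U := (range t).biUnion fun i => vs (F i) with hU
    have hUc : U.card ≤ K * N := by
      refine card_biUnion_le.trans ((sum_le_card_nsmul _ _ K fun i _ => hvs _).trans ?_)
      simp only [card_range, smul_eq_mul]
      rw [mul_comm]; gcongr; omega
    set 𝒜 := 𝒟.filter fun D => Disjoint U (vs D) with h𝒜
    have hsum : p * 𝒟.card * ∑ q ∈ 𝒬, wt q ≤ ∑ D ∈ 𝒜, ∑ q ∈ 𝒬.filter (fun q => hit q D), wt q := by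
      simp_rw [sum_filter]
      rw [sum_comm, mul_sum]
      refine sum_le_sum fun q hq => ?_
      rw [← sum_filter, sum_const, nsmul_eq_mul]
      have := hav U hUc q hq
      have := (hwt0 q).le
      gcongr
      
    have hex : ∃ D ∈ 𝒜, p * ∑ q ∈ 𝒬, wt q ≤ ∑ q ∈ 𝒬.filter (fun q => hit q D), wt q := by
      by_contra hcon
      push Not at hcon
      have hwpos : 0 < ∑ q ∈ 𝒬, wt q := sum_pos (fun q _ => hwt0 q) h𝒬
      have hA : 𝒜.Nonempty := by
        rw [nonempty_iff_ne_empty]; intro h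
        rw [h] at hsum; simp at hsum
        have : 0 < p * 𝒟.card * ∑ q ∈ 𝒬, wt q := by positivity
        linarith
      have h1 := sum_lt_sum_of_nonempty hA hcon
      rw [sum_const, nsmul_eq_mul] at h1
      have h2 : (𝒜.card : ℝ) ≤ 𝒟.card := by exact_mod_cast card_filter_le _ _
      have h3 : (𝒜.card : ℝ) * (p * ∑ q ∈ 𝒬, wt q) ≤ 𝒟.card * (p * ∑ q ∈ 𝒬, wt q) := by gcongr
      linarith
    obtain ⟨D, hDA, hD⟩ := hex
    rw [h𝒜, mem_filter] at hDA
    have hFi : ∀ i < t, Function.update F t D i = F i := fun i hi => Function.update_of_ne (by omega) _ _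
    have hFt : Function.update F t D t = D := by simp
    refine ⟨Function.update F t D, ?_, ?_, ?_⟩
    · intro i hi
      rcases Nat.lt_succ_iff_lt_or_eq.1 hi with h | h
      · rw [hFi i h]; exact hF1 i h
      · subst h; rw [hFt]
        refine ⟨hDA.1, ?_⟩
        by_contra hno
        have : 𝒬.filter (fun q => hit q D) = ∅ := by
          rw [filter_eq_empty_iff]; intro q hq hh; exact hno ⟨q, hq, hh⟩
        rw [this] at hD; simp at hD
        have hwpos : 0 < ∑ q ∈ 𝒬, wt q := sum_pos (fun q _ => hwt0 q) h𝒬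
        have : 0 < p * ∑ q ∈ 𝒬, wt q := by positivity
        linarith
    · have hdU : ∀ i < t, Disjoint (vs (F i)) (vs D) := by
        intro i hi
        exact hDA.2.mono_left (subset_biUnion_of_mem (fun i => vs (F i)) (mem_range.2 hi))
      intro i hi j hj hij
      rcases Nat.lt_succ_iff_lt_or_eq.1 hi with h | h <;> rcases Nat.lt_succ_iff_lt_or_eq.1 hj with h' | h'
      · rw [hFi i h, hFi j h']; exact hF2 i h j h' hij
      · subst h'; rw [hFi i h, hFt]; exact hdU i h
      · subst h; rw [hFi j h', hFt]; exact (hdU j h').symm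
      · omega
    · have hnew : ∀ q, (1/2 : ℝ) ^ ((range (t+1)).filter fun i => hit q (Function.update F t D i)).card =
          wt q - (1/2) * (if hit q D then wt q else 0) := by
        intro q
        rw [range_add_one, filter_insert, hFt]
        have hcong : ((range t).filter fun i => hit q (Function.update F t D i)) =
            (range t).filter fun i => hit q (F i) := by
          refine filter_congr fun i hi => ?_
          rw [hFi i (mem_range.1 hi)]
        rw [hcong]
        split_ifs with h
        · rw [card_insert_of_notMem (by simp), pow_succ]
          simp only [hwt]; ring
        · simp [hwt]
      rw [sum_congr rfl fun q _ => hnew q, sum_sub_distrib, ← mul_sum, ← sum_filter]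
      have h1 : (1 - p/2) * ∑ q ∈ 𝒬, wt q ≤ (1 - p/2) * (𝒬.card * (1 - p/2)^t) := by
        gcongr
        linarith
      rw [pow_succ]
      linarith

lemma conflict {k T : ℕ} {S U : Finset V} (i : Fin k) (t : Fin T) :
    ((tup (tup S T) k).filter fun D => D i t ∈ U).card * S.card ≤ U.card * S.card ^ (k * T) := by
  have h1 : (tup (tup S T) k).card = S.card ^ (k * T) := by
    rw [card_tup, card_tup, ← pow_mul, mul_comm]
  rw [← h1, ← card_product, ← card_product]
  refine card_le_card_of_injOn
    (fun p => (p.1 i t, Function.update p.1 i (Function.update (p.1 i) t p.2))) ?_ ?_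
  · rintro ⟨D, v⟩ h
    rw [mem_coe, mem_product] at h
    obtain ⟨h1, h2⟩ := h
    have h1' := mem_filter.1 h1
    refine mem_coe.2 (mem_product.2 ⟨h1'.2, mem_tup.2 fun i' => mem_tup.2 fun t' => ?_⟩)
    have h3 := mem_tup.1 (mem_tup.1 h1'.1 i') t'
    by_cases hi : i' = i
    · subst hi
      by_cases ht : t' = t
      · subst ht; simpa using h2
      · simpa [ht] using h3
    · simpa [hi] using h3
  · rintro ⟨D, v⟩ _ ⟨D', v'⟩ _ h
    simp only [Prod.mk.injEq] at h
    obtain ⟨ha, hb⟩ := h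
    have hv : v = v' := by
      have := congrFun (congrFun hb i) t
      simpa using this
    subst hv
    have : D = D' := by
      funext i' t'
      by_cases hi : i' = i
      · subst hi
        by_cases ht : t' = t
        · subst ht; exact ha
        · have := congrFun (congrFun hb i') t'
          simpa [ht] using this
      · have := congrFun (congrFun hb i') t'
        simpa [hi] using this
    subst this; rfl

end ModD3
end OreT

namespace OreT
section ModD4
open Finset
open scoped Classical BigOperators

variable {V : Type} {G : SimpleGraph V}

lemma til_biUnion {k s w : ℕ} {β : Type} {F : β → Finset V} : ∀ (I : Finset β),
    (∀ i ∈ I, Til G k s w (F i)) → (∀ i ∈ I, ∀ j ∈ I, i ≠ j → Disjoint (F i) (F j)) →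
    Til G k s w (I.biUnion F) := by
  intro I
  induction I using Finset.induction_on with
  | empty => intro _ _; simpa using Til.empty
  | insert a I ha ih =>
    intro h1 h2
    rw [biUnion_insert]
    refine Til.union (h1 a (mem_insert_self _ _)) (ih (fun i hi => h1 i (mem_insert_of_mem hi))
      (fun i hi j hj => h2 i (mem_insert_of_mem hi) j (mem_insert_of_mem hj))) ?_
    rw [disjoint_biUnion_right]
    intro i hi
    exact h2 a (mem_insert_self _ _) i (mem_insert_of_mem hi) (fun h => ha (h ▸ hi))

lemma absorb_phase {k s w : ℕ} {β : Type} {S : Finset V} (𝒬 : Finset (Finset V)) (F : ℕ → β) (N M Dn : ℕ)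
    (hit : Finset V → β → Prop) (vs : β → Finset V)
    (hne : ∀ Q ∈ 𝒬, Q.Nonempty)
    (h1 : ∀ Z ⊆ S, Z.card = Dn → ∃ Q ⊆ Z, Q ∈ 𝒬)
    (h2 : ∀ Q ∈ 𝒬, M < ((range N).filter fun i => hit Q (F i)).card)
    (h3 : ∀ i < N, Til G k s w (vs (F i)))
    (h4 : ∀ Q ∈ 𝒬, ∀ i < N, hit Q (F i) → Disjoint Q (vs (F i)) → Til G k s w (vs (F i) ∪ Q))
    (h5 : ∀ i < N, ∀ j < N, i ≠ j → Disjoint (vs (F i)) (vs (F j))) :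
    ∀ (z : ℕ) (Z : Finset V), Z.card ≤ z → Z ⊆ S → (∀ i < N, Disjoint Z (vs (F i))) →
      ∀ I ⊆ range N, N + Z.card ≤ I.card + M →
      ∃ Z' ⊆ Z, Z'.card ≤ Dn ∧ Til G k s w (I.biUnion (fun i => vs (F i)) ∪ (Z \ Z')) := by
  intro z
  induction z with
  | zero =>
    intro Z hZ _ _ I hI _
    have : Z = ∅ := card_eq_zero.1 (by omega)
    subst this
    refine ⟨∅, by simp, by simp, ?_⟩
    simp only [sdiff_self, bot_eq_empty, union_empty]
    exact til_biUnion I (fun i hi => h3 i (mem_range.1 (hI hi)))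
      (fun i hi j hj => h5 i (mem_range.1 (hI hi)) j (mem_range.1 (hI hj)))
  | succ z ih =>
    intro Z hZ hZS hZd I hI hIc
    by_cases hD : Z.card ≤ Dn
    · refine ⟨Z, Subset.refl _, hD, ?_⟩
      simp only [sdiff_self, bot_eq_empty, union_empty]
      exact til_biUnion I (fun i hi => h3 i (mem_range.1 (hI hi)))
        (fun i hi j hj => h5 i (mem_range.1 (hI hi)) j (mem_range.1 (hI hj)))
    · obtain ⟨Z0, hZ0, hZ0c⟩ := exists_subset_card_eq (show Dn ≤ Z.card by omega)
      obtain ⟨Q, hQ, hQ𝒬⟩ := h1 Z0 (hZ0.trans hZS) hZ0c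
      have hQZ := hQ.trans hZ0
      have hQpos := (hne Q hQ𝒬).card_pos
      have hex : ∃ i ∈ I, hit Q (F i) := by
        by_contra hcon
        push Not at hcon
        have : ((range N).filter fun i => hit Q (F i)) ⊆ range N \ I := by
          intro i hi
          rw [mem_filter] at hi
          exact mem_sdiff.2 ⟨hi.1, fun h => hcon i h hi.2⟩
        have h6 := card_le_card this
        rw [card_sdiff_of_subset hI, card_range] at h6
        have h7 := h2 Q hQ𝒬
        have h8 := card_le_card hI
        rw [card_range] at h8
        omega
      obtain ⟨i, hiI, hi⟩ := hex
      have hiN := mem_range.1 (hI hiI)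
      have hIe := card_erase_of_mem hiI
      have hIpos : 0 < I.card := card_pos.2 ⟨i, hiI⟩
      have hZQ : (Z \ Q).card + Q.card = Z.card := card_sdiff_add_card_eq_card hQZ
      obtain ⟨Z', hZ'1, hZ'2, hZ'3⟩ := ih (Z \ Q) (by omega) (sdiff_subset.trans hZS)
        (fun j hj => (hZd j hj).mono_left sdiff_subset) (I.erase i) ((erase_subset _ _).trans hI)
        (by omega)
      refine ⟨Z', hZ'1.trans sdiff_subset, hZ'2, ?_⟩
      have h6 := h4 Q hQ𝒬 i hiN hi ((hZd i hiN).mono_left hQZ)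
      have h7 := Til.union hZ'3 h6 ?_
      · convert h7 using 1
        have hZ'Q : Disjoint Z' Q := disjoint_of_subset_left hZ'1 sdiff_disjoint
        ext u
        simp only [mem_union, mem_biUnion, mem_sdiff, mem_erase]
        constructor
        · rintro (⟨j, hj, hu⟩ | ⟨hu1, hu2⟩)
          · by_cases hji : j = i
            · subst hji; exact Or.inr (Or.inl hu)
            · exact Or.inl (Or.inl ⟨j, ⟨hji, hj⟩, hu⟩)
          · by_cases huQ : u ∈ Q
            · exact Or.inr (Or.inr huQ)
            · exact Or.inl (Or.inr ⟨⟨hu1, huQ⟩, hu2⟩)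
        · rintro ((⟨j, ⟨_, hj⟩, hu⟩ | ⟨⟨hu1, huQ⟩, hu2⟩) | (hu | hu))
          · exact Or.inl ⟨j, hj, hu⟩
          · exact Or.inr ⟨hu1, hu2⟩
          · exact Or.inl ⟨i, hiI, hu⟩
          · exact Or.inr ⟨hQZ hu, fun h => disjoint_left.1 hZ'Q h hu⟩
      · rw [disjoint_union_left, disjoint_biUnion_left]
        constructor
        · intro j hj
          have hj' := mem_erase.1 hj
          have hjN := mem_range.1 (hI hj'.2)
          rw [disjoint_union_right]
          exact ⟨h5 j hjN i hiN hj'.1, ((hZd j hjN).mono_left hQZ).symm⟩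
        · rw [disjoint_union_right]
          refine ⟨(hZd i hiN).mono_left (sdiff_subset.trans sdiff_subset), ?_⟩
          exact disjoint_of_subset_left sdiff_subset sdiff_disjoint

set_option maxHeartbeats 1000000 in
lemma absorbing (m s w b : ℕ) (hsw : s < w) (hb : b = s + m * w) (hb0 : 0 < b)
    (c : ℝ) (hc : 0 < c) (ε : ℝ) (hε : 0 < ε) : ∃ η > 0, ∃ Dn n0 : ℕ, ∀ (V : Type) (G : SimpleGraph V)
    (S : Finset V), n0 ≤ S.card →
    (∀ v ∈ S, c * (S.card:ℝ)^(m+1) ≤ ((tup S (m+1)).filter (Lk G s v)).card) →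
    ∃ A ⊆ S, (A.card : ℝ) ≤ ε * S.card ∧ ∀ Z ⊆ S \ A, (Z.card : ℝ) ≤ η * S.card →
      ∃ Z' ⊆ Z, Z'.card ≤ Dn ∧ Til G (m+1) s w (A ∪ (Z \ Z')) := by
  set f := (w - s) * b with hf
  have hf0 : 0 < f := Nat.mul_pos (by omega) hb0
  have hfs : f + s * b = w * b := by rw [hf, ← add_mul]; congr 1; omega
  set Dn := ⌈2 * f / c⌉₊ + 1 with hDn
  set c2 := c / 2 / 2 ^ Dn with hc2
  have hc2p : 0 < c2 := by positivity
  set T := w * b with hT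
  have hT0 : 0 < T := Nat.mul_pos (by omega) hb0
  obtain ⟨β, hβ, n1, hblow⟩ := blow_count (m+1) T c2 hc2p
  set K := (m+1) * T with hK
  have hK0 : 0 < K := Nat.mul_pos (by omega) hT0
  have hKR : (0:ℝ) < K := by exact_mod_cast hK0
  obtain ⟨ρ, hρ, hρ1, hρ2⟩ : ∃ ρ : ℝ, 0 < ρ ∧ K * K * ρ ≤ β / 2 ∧ K * ρ ≤ ε := by
    refine ⟨min (β / 2 / (K*K)) (ε / K), by positivity, ?_, ?_⟩
    · calc K * K * min (β / 2 / (K*K)) (ε / K) ≤ K * K * (β / 2 / (K*K)) := by gcongr; exact min_le_left _ _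
        _ = β / 2 := by field_simp
    · calc K * min (β / 2 / (K*K)) (ε / K) ≤ K * (ε / K) := by gcongr; exact min_le_right _ _
        _ = ε := by field_simp
  set p := β / 2 with hp
  have hp0 : 0 < p := by positivity
  obtain ⟨n2, hn2⟩ := poly_le_exp f (p * ρ / 8) (by positivity)
  refine ⟨p * ρ / 16, by positivity, Dn, n1 + n2 + ⌈2 / ρ⌉₊ + ⌈16 / (p * ρ)⌉₊ + 1, ?_⟩
  intro V G S hn hlink
  have hSpos : 0 < S.card := by omega
  have hS : S.Nonempty := card_pos.1 hSpos
  set n : ℝ := (S.card : ℝ) with hnn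
  have hn0 : 0 < n := by rw [hnn]; exact_mod_cast hSpos
  have hnρ : 2 ≤ ρ * n := by
    have h1 : 2 / ρ ≤ n := (Nat.le_ceil _).trans (by rw [hnn]; exact_mod_cast (by omega))
    rw [div_le_iff₀ hρ] at h1; linarith
  have hnp : 16 ≤ p * ρ * n := by
    have h1 : 16 / (p * ρ) ≤ n := (Nat.le_ceil _).trans (by rw [hnn]; exact_mod_cast (by omega))
    rw [div_le_iff₀ (by positivity)] at h1; linarith
  set N := ⌊ρ * n⌋₊ with hN
  have hN1 : (N:ℝ) ≤ ρ * n := Nat.floor_le (by positivity)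
  have hN2 : ρ * n / 2 ≤ N := by
    have := Nat.lt_floor_add_one (ρ * n)
    linarith
  set 𝒬 := (S.powersetCard f).filter fun Q =>
    c2 * n^(m+1) ≤ (((tup S (m+1)).filter fun x => ∀ v ∈ Q, Lk G s v x).card : ℝ) with h𝒬
  have hrich : ∀ Z ⊆ S, Z.card = Dn → ∃ Q ⊆ Z, Q ∈ 𝒬 := by
    intro Z hZ hZc
    obtain ⟨Q, hQ1, hQ2, hQ3⟩ := rich_exists hS (E := fun v => Lk G s v) hc (f := f) (Z := Z) (by omega) (by
      have h1 := Nat.le_ceil (2 * (f:ℝ) / c)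
      rw [hZc, hDn]
      push_cast
      rw [div_le_iff₀ hc] at h1
      linarith) (fun v hv => hlink v (hZ hv))
    refine ⟨Q, hQ1, mem_filter.2 ⟨mem_powersetCard.2 ⟨hQ1.trans hZ, hQ2⟩, ?_⟩⟩
    rw [hZc] at hQ3
    exact hQ3
  by_cases hQe : 𝒬.Nonempty
  swap
  · rw [not_nonempty_iff_eq_empty] at hQe
    refine ⟨∅, by simp, by simp; positivity, ?_⟩
    intro Z hZ _
    refine ⟨Z, Subset.refl _, ?_, by simpa using Til.empty⟩
    by_contra hcon
    obtain ⟨Z0, hZ0, hZ0c⟩ := exists_subset_card_eq (show Dn ≤ Z.card by omega)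
    obtain ⟨Q, -, hQ⟩ := hrich Z0 (hZ0.trans (hZ.trans sdiff_subset)) hZ0c
    rw [hQe] at hQ; simp at hQ
  set 𝒟 := tup (tup S T) (m+1) with h𝒟
  have h𝒟c : (𝒟.card : ℝ) = n ^ K := by
    rw [h𝒟, card_tup, card_tup, ← pow_mul, mul_comm T]; push_cast; rfl
  have h𝒟ne : 𝒟.Nonempty := tup_nonempty (tup_nonempty hS _) _
  set hit : Finset V → (Fin (m+1) → Fin T → V) → Prop := fun Q D => GoodB (fun x => ∀ v ∈ Q, Lk G s v x) D with hhit
  have hconf : ∀ U : Finset V, U.card ≤ K * N →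
      ((𝒟.filter fun D => ¬ Disjoint U (om (s*b) D)).card : ℝ) ≤ p * n^K := by
    intro U hU
    have h1 : (𝒟.filter fun D => ¬ Disjoint U (om (s*b) D)) ⊆
        (univ : Finset (Fin (m+1) × Fin T)).biUnion fun it => 𝒟.filter fun D => D it.1 it.2 ∈ U := by
      intro D hD
      rw [mem_filter, not_disjoint_iff] at hD
      obtain ⟨hD, u, hu, hu2⟩ := hD
      obtain ⟨i, -, hi⟩ := mem_biUnion.1 hu2
      obtain ⟨t, rfl⟩ := pt_sub hi
      exact mem_biUnion.2 ⟨(i, t), mem_univ _, mem_filter.2 ⟨hD, hu⟩⟩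
    have h2 : (𝒟.filter fun D => ¬ Disjoint U (om (s*b) D)).card * S.card ≤ K * (U.card * S.card ^ K) := by
      calc _ ≤ (∑ it : Fin (m+1) × Fin T, (𝒟.filter fun D => D it.1 it.2 ∈ U).card) * S.card :=
            Nat.mul_le_mul_right _ ((card_le_card h1).trans card_biUnion_le)
        _ = ∑ it : Fin (m+1) × Fin T, (𝒟.filter fun D => D it.1 it.2 ∈ U).card * S.card := sum_mul _ _ _
        _ ≤ ∑ it : Fin (m+1) × Fin T, (U.card * S.card ^ K) := sum_le_sum fun it _ => conflict it.1 it.2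
        _ = K * (U.card * S.card ^ K) := by simp [hK]
    have h3 : ((𝒟.filter fun D => ¬ Disjoint U (om (s*b) D)).card : ℝ) * n ≤ K * (U.card * n ^ K) := by
      rw [hnn]; exact_mod_cast h2
    have h4 : (U.card : ℝ) ≤ K * (ρ * n) := by
      have : (U.card : ℝ) ≤ K * N := by exact_mod_cast hU
      refine this.trans (by gcongr)
    have h5 : (K:ℝ) * (U.card * n ^ K) ≤ K * ((K * (ρ * n)) * n^K) := by gcongr
    have h6 : (K * K * ρ) * (n^K * n) ≤ p * (n^K * n) := by gcongr
    have h7 : ((𝒟.filter fun D => ¬ Disjoint U (om (s*b) D)).card : ℝ) * n ≤ (p * n^K) * n := by linarith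
    exact le_of_mul_le_mul_right h7 hn0
  obtain ⟨F, hF1, hF2, hF3⟩ := select 𝒬 hQe 𝒟 h𝒟ne hit (om (s*b)) p hp0 K N (fun D => om_card D) (by
    intro U hU Q hQ
    have h1 := hconf U hU
    have h2 := hblow V S (fun x => ∀ v ∈ Q, Lk G s v x) (by omega) (by convert (mem_filter.1 hQ).2)
    have h3 : 𝒟.filter (GoodB (fun x => ∀ v ∈ Q, Lk G s v x)) ⊆
        ((𝒟.filter fun D => Disjoint U (om (s*b) D)).filter fun D => hit Q D) ∪
        (𝒟.filter fun D => ¬ Disjoint U (om (s*b) D)) := by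
      intro D hD
      rw [mem_filter] at hD
      by_cases h : Disjoint U (om (s*b) D)
      · exact mem_union_left _ (mem_filter.2 ⟨mem_filter.2 ⟨hD.1, h⟩, hD.2⟩)
      · exact mem_union_right _ (mem_filter.2 ⟨hD.1, h⟩)
    have h4 : ((𝒟.filter (GoodB (fun x => ∀ v ∈ Q, Lk G s v x))).card : ℝ) ≤
        (((𝒟.filter fun D => Disjoint U (om (s*b) D)).filter fun D => hit Q D).card : ℝ) +
        ((𝒟.filter fun D => ¬ Disjoint U (om (s*b) D)).card : ℝ) := by
      exact_mod_cast (card_le_card h3).trans (card_union_le _ _)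
    rw [h𝒟c]
    have h5 : β * n ^ K = p * n^K + p * n^K := by rw [hp]; ring
    have h2' : β * n ^ K ≤ ((𝒟.filter (GoodB (fun x => ∀ v ∈ Q, Lk G s v x))).card : ℝ) := h2
    linarith) N le_rfl
  have hQpos : ∀ Q ∈ 𝒬, Q.card = f := fun Q hQ => (mem_powersetCard.1 (mem_filter.1 hQ).1).2
  have hQne : ∀ Q ∈ 𝒬, Q.Nonempty := fun Q hQ => card_pos.1 (by rw [hQpos Q hQ]; exact hf0)
  have hcardQ : (𝒬.card : ℝ) < Real.exp (p * ρ / 8 * n) := by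
    have h1 : 𝒬.card ≤ S.card ^ f := by
      refine (card_filter_le _ _).trans ?_
      rw [card_powersetCard]
      exact Nat.choose_le_pow _ _
    have h2 : (𝒬.card : ℝ) ≤ n ^ f := by rw [hnn]; exact_mod_cast h1
    have h3 := hn2 S.card (by omega)
    have h4 : n ^ f ≤ (n + 1)^(f+1) := by
      calc n ^ f ≤ (n+1)^f := by gcongr; linarith
        _ ≤ (n+1)^(f+1) := pow_le_pow_right₀ (by linarith) (by omega)
    have h5 : 0 < (n+1)^(f+1) := by positivity
    have h3' : 2 * (n + 1)^(f+1) ≤ Real.exp (p * ρ / 8 * n) := h3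
    linarith
  have hhits : ∀ Q ∈ 𝒬, p * N / 4 < ((range N).filter fun i => hit Q (F i)).card := by
    intro Q hQ
    set h := ((range N).filter fun i => hit Q (F i)).card with hh
    by_contra hcon
    push Not at hcon
    have h1 : (1/2:ℝ)^h ≤ 𝒬.card * (1 - p/2)^N :=
      (single_le_sum (f := fun q => (1/2:ℝ)^((range N).filter fun i => hit q (F i)).card)
        (fun _ _ => by positivity) hQ).trans hF3
    have hpl : p / 2 ≤ 1 := by
      have h3 := hblow V S (fun x => ∀ v ∈ Q, Lk G s v x) (by omega) (by convert (mem_filter.1 hQ).2)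
      have h4 : ((𝒟.filter (GoodB (fun x => ∀ v ∈ Q, Lk G s v x))).card : ℝ) ≤ 𝒟.card := by
        exact_mod_cast card_filter_le _ _
      have h3' : β * n ^ K ≤ ((𝒟.filter (GoodB (fun x => ∀ v ∈ Q, Lk G s v x))).card : ℝ) := h3
      rw [h𝒟c] at h4
      have h5 : β * n^K ≤ 1 * n^K := by linarith
      have := le_of_mul_le_mul_right h5 (by positivity)
      rw [hp]; linarith
    have h3 : (1 - p/2)^N ≤ Real.exp (-(p/2) * N) := by
      rw [mul_comm, Real.exp_nat_mul]
      exact pow_le_pow_left₀ (by linarith) (by linarith [Real.add_one_le_exp (-(p/2))]) N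
    have h4 : Real.exp (-(h:ℝ)) ≤ (1/2:ℝ)^h := by
      rw [show -(h:ℝ) = h * (-1) by ring, Real.exp_nat_mul]
      gcongr
      rw [Real.exp_neg]
      have : 2 ≤ Real.exp 1 := by linarith [Real.add_one_le_exp 1]
      rw [one_div]
      gcongr
    have h5 : Real.exp (-(h:ℝ)) < Real.exp (p * ρ / 8 * n) * Real.exp (-(p/2) * N) := by
      calc Real.exp (-(h:ℝ)) ≤ 𝒬.card * (1 - p/2)^N := h4.trans h1
        _ ≤ 𝒬.card * Real.exp (-(p/2) * N) := by gcongr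
        _ < _ := by gcongr
    rw [← Real.exp_add, Real.exp_lt_exp] at h5
    have h6 : p * (ρ * n / 2) ≤ p * N := by gcongr
    linarith
  set A := (range N).biUnion fun i => om (s*b) (F i) with hA
  have hAS : A ⊆ S := by
    intro u hu
    obtain ⟨i, hi, hu⟩ := mem_biUnion.1 hu
    obtain ⟨j, -, hu⟩ := mem_biUnion.1 hu
    obtain ⟨t, rfl⟩ := pt_sub hu
    exact mem_tup.1 (mem_tup.1 (hF1 i (mem_range.1 hi)).1 j) t
  refine ⟨A, hAS, ?_, ?_⟩
  · have h1 : A.card ≤ N * K := by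
      refine card_biUnion_le.trans ((sum_le_card_nsmul _ _ K fun i _ => om_card _).trans ?_)
      simp
    have h2 : (A.card : ℝ) ≤ N * K := by exact_mod_cast h1
    calc (A.card : ℝ) ≤ N * K := h2
      _ ≤ (ρ * n) * K := by gcongr
      _ = (K * ρ) * n := by ring
      _ ≤ ε * n := by gcongr
  · intro Z hZ hZc
    have habs := absorb_phase (G := G) (k := m+1) (s := s) (w := w) (S := S) 𝒬 F N ⌊p * N / 4⌋₊ Dn hit (om (s*b))
      hQne hrich (fun Q hQ => by
        rw [Nat.floor_lt (by positivity)]; exact hhits Q hQ)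
      (fun i hi => by
        obtain ⟨-, Q, hQ, hh⟩ := hF1 i hi
        exact (absorber (by omega) hsw.le hb hb0 (by rw [hQpos Q hQ]; exact hfs) (hQne Q hQ) hh).1)
      (fun Q hQ i hi hh hd => (absorber (by omega) hsw.le hb hb0 (by rw [hQpos Q hQ]; exact hfs) (hQne Q hQ) hh).2 hd)
      hF2 Z.card Z le_rfl (hZ.trans sdiff_subset)
      (fun i hi => disjoint_of_subset_left hZ (disjoint_of_subset_right
        (subset_biUnion_of_mem (fun i => om (s*b) (F i)) (mem_range.2 hi)) sdiff_disjoint))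
      (range N) (Subset.refl _) (by
        rw [card_range]
        have : Z.card ≤ ⌊p * N / 4⌋₊ := by
          apply Nat.le_floor
          have h6 : p * (ρ * n / 2) ≤ p * N := by gcongr
          have h7 : (Z.card:ℝ) ≤ p * ρ / 16 * n := hZc
          have h8 : 0 < p * ρ * n := by positivity
          linarith
        omega)
    exact habs

end ModD4
end OreT

namespace OreT
section ModD5
open Finset
open scoped Classical BigOperators

variable {V : Type} {G : SimpleGraph V}

lemma Hyp.weaken {S L : Finset V} {θ μ γ α μ' γ' : ℝ} (h : Hyp G S L θ μ γ α) (hμ : μ ≤ μ') (hγ : γ' ≤ γ) :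
    Hyp G S L θ μ' γ' α :=
  ⟨h.cl, fun v hv hL => (h.deg v hv hL).trans (by gcongr), fun P hP hc => h.ne P hP (le_trans (by gcongr) hc)⟩

lemma hyp_del (θ μ' γ : ℝ) (hθ : 0 < θ) (hμ' : 0 < μ') (hγ : 0 < γ) : ∃ ξ > 0, ξ ≤ 1/2 ∧
    ∀ (V : Type) (G : SimpleGraph V) (S S' L : Finset V) (μ α : ℝ), μ ≤ μ'/2 → 0 ≤ α →
    S' ⊆ S → (1 - ξ) * S.card ≤ (S'.card : ℝ) → Hyp G S L θ μ γ α → Hyp G S' L θ μ' (γ/2) α := by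
  refine ⟨min (1/2) (min (μ' / (2 * (θ + μ'))) (γ / (2 * θ))), by positivity, min_le_left _ _, ?_⟩
  intro V G S S' L μ α hμ hα hS' hc hyp
  set ξ := min (1/2) (min (μ' / (2 * (θ + μ'))) (γ / (2 * θ))) with hξ
  have h1 : ξ * (θ + μ') ≤ μ' / 2 := by
    have : ξ ≤ μ' / (2 * (θ + μ')) := (min_le_right _ _).trans (min_le_left _ _)
    calc ξ * (θ + μ') ≤ μ' / (2 * (θ + μ')) * (θ + μ') := by gcongr
      _ = μ' / 2 := by field_simp
  have h2 : ξ * θ ≤ γ / 2 := by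
    have : ξ ≤ γ / (2 * θ) := (min_le_right _ _).trans (min_le_right _ _)
    calc ξ * θ ≤ γ / (2 * θ) * θ := by gcongr
      _ = γ / 2 := by field_simp
  have hξ0 : 0 < ξ := by positivity
  have hle : (S'.card : ℝ) ≤ S.card := by exact_mod_cast card_le_card hS'
  have hn : (0:ℝ) ≤ S.card := by positivity
  refine ⟨hyp.cl, ?_, ?_⟩
  · intro v hv hL
    have h3 := hyp.deg v (hS' hv) hL
    have h4 : (nn G S' v : ℝ) ≤ nn G S v := by
      exact_mod_cast card_le_card (filter_subset_filter _ hS')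
    have h5 : (θ + μ') * ((1 - ξ) * S.card) ≤ (θ + μ') * S'.card := by gcongr
    have h6 : (θ + μ) * S.card ≤ ((θ + μ') * (1 - ξ)) * S.card := by
      gcongr; linarith
    linarith
  · intro P hP hPc
    have h3 : (θ - γ) * S.card ≤ P.card := by
      refine le_trans ?_ hPc
      by_cases h : 0 ≤ θ - γ/2
      · have h5 : (θ - γ/2) * ((1 - ξ) * S.card) ≤ (θ - γ/2) * S'.card := by gcongr
        have h6 : (θ - γ) * S.card ≤ ((θ - γ/2) * (1 - ξ)) * S.card := by
          gcongr
          have : 0 < ξ * γ := by positivity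
          linarith
        linarith
      · push Not at h
        have h5 : (θ - γ/2) * S.card ≤ (θ - γ/2) * S'.card := mul_le_mul_of_nonpos_left hle h.le
        have h6 : (θ - γ) * S.card ≤ (θ - γ/2) * S.card := by gcongr; linarith
        linarith
    have h4 := hyp.ne P (hP.trans hS') h3
    refine le_trans ?_ h4
    gcongr

lemma til_any {k s w b : ℕ} (hb : 0 < b) : ∀ (q : ℕ) (Q : Finset V), Q.card ≤ q →
    (∀ Y ⊆ Q, Y.card = b → IsBottle G k s w Y) → ∃ X ⊆ Q, Til G k s w X ∧ (Q \ X).card ≤ b := by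
  intro q
  induction q with
  | zero =>
    intro Q hQ _
    exact ⟨∅, by simp, Til.empty, by simp; omega⟩
  | succ q ih =>
    intro Q hQ h
    by_cases hc : Q.card ≤ b
    · exact ⟨∅, by simp, Til.empty, by simpa using hc⟩
    · obtain ⟨Y, hY, hYc⟩ := exists_subset_card_eq (show b ≤ Q.card by omega)
      have h1 : (Q \ Y).card + Y.card = Q.card := card_sdiff_add_card_eq_card hY
      obtain ⟨X, hX1, hX2, hX3⟩ := ih (Q \ Y) (by omega) (fun Z hZ => h Z (hZ.trans sdiff_subset))
      refine ⟨X ∪ Y, union_subset (hX1.trans sdiff_subset) hY, hX2.add _ _ (h Y hY hYc)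
        (disjoint_of_subset_left hX1 sdiff_disjoint), ?_⟩
      have h2 : Q \ (X ∪ Y) = (Q \ Y) \ X := by ext u; simp; tauto
      rw [h2]; exact hX3

lemma til_zero {m w : ℕ} {X : Finset V} (h : Til G m w w X) : Til G (m+1) 0 w X := by
  induction h with
  | empty => exact Til.empty
  | add X Y _ hY hd ih =>
    refine Til.add X Y ih ?_ hd
    have := hY.consNeck (D := ∅) (s := 0) (by simp) (by simp)
    simpa using this

/-- `near_cover` in the uniform parametrisation -/
lemma near_cover' (m s w b : ℕ) (hsw : s < w) (hb : b = s + m * w) (hcase : 0 < s ∨ 1 ≤ m)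
    (γ : ℝ) (hγ : 0 < γ) : ∃ μ0 > 0, ∀ α > 0, ∀ η > 0, ∃ n0 : ℕ, ∀ (V : Type) (G : SimpleGraph V)
    (S L : Finset V) (μ : ℝ), 0 ≤ μ → μ ≤ μ0 → n0 ≤ S.card → Hyp G S L ((w:ℝ)/b) μ γ α →
    ∃ X ⊆ S, Til G (m+1) s w X ∧ ((S \ X).card : ℝ) ≤ η * S.card := by
  rcases Nat.eq_zero_or_pos s with hs | hs
  · subst hs
    have hm : 1 ≤ m := by omega
    obtain ⟨μ0, h0, h⟩ := near_cover m w w hm (by omega) le_rfl b (by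
      rw [hb]; push_cast [Nat.cast_sub hm]; ring) γ hγ
    refine ⟨μ0, h0, fun α hα η hη => ?_⟩
    obtain ⟨n0, h1⟩ := h α hα η hη
    refine ⟨n0, fun V G S L μ a1 a2 a3 a4 => ?_⟩
    obtain ⟨X, b1, b2, b3⟩ := h1 V G S L μ a1 a2 a3 a4
    exact ⟨X, b1, til_zero b2, b3⟩
  · obtain ⟨μ0, h0, h⟩ := near_cover (m+1) s w (by omega) hs hsw.le b (by
      rw [hb]; push_cast; ring) γ hγ
    exact ⟨μ0, h0, h⟩

lemma bottle_of_clique {m s w b : ℕ} (hb : b = s + m * w) {Y : Finset V}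
    (hY : (Y : Set V).Pairwise G.Adj) (hYc : Y.card = b) : IsBottle G (m+1) s w Y := by
  induction m generalizing b Y with
  | zero =>
    refine ⟨fun _ => Y, 0, ?_, by simp; omega, ?_, by ext; simp⟩
    · intro i j hij; exact absurd (Fin.ext (by omega)) hij
    · intro i hi; exact absurd (Fin.ext (by simp)) hi
  | succ m ih =>
    obtain ⟨D, hD, hDc⟩ := exists_subset_card_eq (show w ≤ Y.card by rw [hYc, hb]; nlinarith)
    have h1 : (Y \ D).card + D.card = Y.card := card_sdiff_add_card_eq_card hD
    have h2 := ih (b := s + m * w) rfl (Y := Y \ D)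
      (hY.mono (by intro x hx; exact (mem_sdiff.1 (mem_coe.1 hx)).1)) (by
        rw [hDc, hYc, hb] at h1; nlinarith)
    have h3 := h2.cons hDc (by
      intro x hx y hy
      have hx' := mem_sdiff.1 hx
      exact hY hx'.1 (hD hy) (fun h => hx'.2 (h ▸ hy)))
    rwa [sdiff_union_of_subset hD] at h3

lemma bottle_one {s w : ℕ} {Y : Finset V} (hY : Y.card = s) : IsBottle G (0+1) s w Y := by
  refine ⟨fun _ => Y, 0, ?_, hY, ?_, by ext; simp⟩
  · intro i j hij; exact absurd (Fin.ext (by omega)) hij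
  · intro i hi; exact absurd (Fin.ext (by simp)) hi

lemma bottle_two {w : ℕ} {Y : Finset V} (hY : Y.card = w) : IsBottle G (1+1) 0 w Y := by
  have h := (bottle_one (G := G) (w := w) hY).consNeck (D := ∅) (s := 0) card_empty
    (fun _ _ y hy => absurd hy (notMem_empty y))
  rw [union_empty] at h
  exact h

/-- bottle from a family -/
lemma gad {S L : Finset V} {θ μ γ α δ : ℝ} {m : ℕ} (hm : 1 ≤ m) (hyp : Hyp G S L θ μ γ α)
    (hμ : 0 ≤ μ) (hδS : 1 ≤ δ * S.card) (hδα : 2 * δ ≤ α) (hδθ : γ + δ ≤ θ) (hδ : 0 < δ) (hγ : 0 ≤ γ)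
    (hθm : m * θ ≤ 1) (hμγ : (m - 1) * μ + (m + 1) * δ ≤ γ) :
    δ^(m+1) * (S.card:ℝ)^(m+1) ≤
      ((tup S (m+1)).filter fun x => (List.ofFn x).Pairwise G.Adj).card := by
  have hS : 0 < S.card := by
    rcases Nat.eq_zero_or_pos S.card with h | h
    · rw [h] at hδS; norm_num at hδS
    · exact h
  have hn : (0:ℝ) < S.card := by exact_mod_cast hS
  suffices key : ManyL S δ (m+1) (fun l => l.Pairwise G.Adj) by
    have h := key.count hδ.le
    refine h.trans (le_of_eq ?_)
    congr 2
    ext x; simp only [mem_filter]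
  by_cases hB : (m + 1) * (δ * S.card) ≤ ((L ∩ S).card : ℝ)
  · exact (manyL_clique hyp.cl hδS (m+1) (L ∩ S) inter_subset_right inter_subset_left
      (by push_cast; exact hB)).mono fun K _ _ hK => hK.1
  · push Not at hB
    refine (many_cliques hyp hμ hS hδα hδθ hδ hγ (m+1) (S \ L) sdiff_subset
      (fun v hv => (mem_sdiff.1 hv).2) (by omega) fun _ => ?_).mono fun K _ _ hK => hK.1
    have h1 : (S.card : ℝ) = (S \ L).card + (L ∩ S).card := by
      rw [inter_comm]; exact_mod_cast (card_sdiff_add_card_inter S L).symm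
    have h5 : ((m - 1) * μ + (m + 1) * δ) * S.card ≤ γ * S.card := by gcongr
    have h6 : (m * θ) * S.card ≤ 1 * S.card := by gcongr
    push_cast
    linarith

lemma bottle_of_blow {m w : ℕ} {S : Finset V} {D : Fin (m+1) → Fin w → V}
    (hS : ∀ i t, D i t ∈ S)
    (h : GoodB (fun x => (List.ofFn x).Pairwise G.Adj) D) : ∃ X ⊆ S, IsBottle G (m+1) w w X := by
  refine ⟨univ.biUnion fun i => univ.image (D i), ?_, fun i => univ.image (D i), 0, ?_, ?_, ?_, rfl⟩
  · intro u hu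
    obtain ⟨i, -, hu⟩ := mem_biUnion.1 hu
    obtain ⟨t, -, rfl⟩ := mem_image.1 hu
    exact hS i t
  · have key : ∀ i l : Fin (m+1), i < l → ∀ t t', G.Adj (D i t) (D l t') := by
      intro i l hil t t'
      have := h.2 (fun j => if j = i then t else t')
      beta_reduce at this
      rw [List.pairwise_iff_getElem] at this
      have := this i.val l.val (by rw [List.length_ofFn]; exact i.2) (by rw [List.length_ofFn]; exact l.2) hil
      simpa [-List.ofFn_succ, hil.ne'] using this
    intro i l hil x hx y hy
    obtain ⟨t, -, rfl⟩ := mem_image.1 hx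
    obtain ⟨t', -, rfl⟩ := mem_image.1 hy
    rcases lt_or_gt_of_ne hil with h | h
    · exact key i l h t t'
    · exact (key l i h t' t).symm
  · rw [card_image_of_injective _ (h.1 0)]; simp
  · intro i _; rw [card_image_of_injective _ (h.1 i)]; simp

lemma cov_of_blow {m s w : ℕ} (hsw : s < w) (hms : 2 ≤ m ∨ 0 < s) {S : Finset V} {v : V} (hv : v ∈ S)
    {D : Fin (m+1) → Fin w → V} (hS : ∀ i t, D i t ∈ S)
    (h : GoodB (Lk G s v) D) : ∃ X ⊆ S, v ∈ X ∧ IsBottle G (m+1) s w X := by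
  obtain ⟨hinj, hE⟩ := h
  have t0 : Fin w := ⟨0, by omega⟩
  have hQD : ∀ i : Fin (m+1), i.val < m → ∀ t, G.Adj v (D i t) := by
    intro i hi t
    exact (hE (fun _ => t)).1 i hi
  have hDD : ∀ i l : Fin (m+1), i ≠ l → i.val < m → l.val < m → ∀ t t', G.Adj (D i t) (D l t') := by
    intro i l hil hi hl t t'
    have := (hE (fun j => if j = i then t else t')).2.1 i l hil hi hl
    simpa [hil.symm] using this
  have hDN : 0 < s → ∀ i : Fin (m+1), i.val < m → ∀ t t', G.Adj (D i t) (D (Fin.last m) t') := by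
    intro hs i hi t t'
    have := (hE (fun j => if j = i then t else t')).2.2 hs i hi
    have hne : Fin.last m ≠ i := fun h => by rw [← h] at hi; simp at hi
    simpa [hne] using this
  have hcard : ∀ i, (univ.image (D i)).card = w := fun i => by
    rw [card_image_of_injective _ (hinj i)]; simp
  have hmemS : ∀ i, univ.image (D i) ⊆ S := by
    intro i u hu
    obtain ⟨t, -, rfl⟩ := mem_image.1 hu
    exact hS i t
  have hlast : ∀ i : Fin (m+1), ¬ i.val < m → i = Fin.last m := by
    intro i hi; ext; simp; omega
  rcases Nat.eq_zero_or_pos s with hs | hs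
  · subst hs
    have hm : 2 ≤ m := by omega
    set i1 : Fin (m+1) := ⟨m-1, by omega⟩ with hi1
    have hi1m : i1.val < m := by simp [hi1]; omega
    have hvn : v ∉ univ.image (D i1) := by
      intro h
      obtain ⟨t, -, ht⟩ := mem_image.1 h
      have := hQD i1 hi1m t
      rw [ht] at this; exact G.irrefl this
    obtain ⟨Y, hY, hYc⟩ := exists_subset_card_eq (show w - 1 ≤ (univ.image (D i1)).card by rw [hcard]; omega)
    set P : Fin (m+1) → Finset V := fun i => if i.val < m then (if i = i1 then insert v Y else univ.image (D i)) else ∅ with hP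
    have hPin : ∀ i x, x ∈ P i → i.val < m ∧ ((i = i1 ∧ x = v) ∨ ∃ t, D i t = x) := by
      intro i x hx
      simp only [hP] at hx
      split_ifs at hx with h1 h2
      · refine ⟨h1, ?_⟩
        rcases mem_insert.1 hx with h | h
        · exact Or.inl ⟨h2, h⟩
        · obtain ⟨t, -, ht⟩ := mem_image.1 (hY h)
          exact Or.inr ⟨t, by rw [h2]; exact ht⟩
      · obtain ⟨t, -, ht⟩ := mem_image.1 hx
        exact ⟨h1, Or.inr ⟨t, ht⟩⟩
      · simp at hx
    refine ⟨univ.biUnion P, ?_, ?_, P, Fin.last m, ?_, by simp [hP], ?_, rfl⟩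
    · intro u hu
      obtain ⟨i, -, hu⟩ := mem_biUnion.1 hu
      obtain ⟨-, ⟨-, rfl⟩ | ⟨t, rfl⟩⟩ := hPin i u hu
      · exact hv
      · exact hS i t
    · refine mem_biUnion.2 ⟨i1, mem_univ _, ?_⟩
      simp only [hP, if_pos hi1m, if_true]; exact mem_insert_self _ _
    · intro i l hil x hx y hy
      obtain ⟨hi, ⟨hi', rfl⟩ | ⟨t, rfl⟩⟩ := hPin i x hx <;> obtain ⟨hl, ⟨hl', rfl⟩ | ⟨t', rfl⟩⟩ := hPin l y hy
      · exact absurd (hi'.trans hl'.symm) hil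
      · exact hQD l hl t'
      · exact (hQD i hi t).symm
      · exact hDD i l hil hi hl t t'
    · intro i hi
      have him : i.val < m := by
        by_contra h; exact hi (hlast i h)
      simp only [hP, if_pos him]
      split_ifs
      · rw [card_insert_of_notMem (fun h => hvn (hY h)), hYc]; omega
      · exact hcard i
  · obtain ⟨Y, hY, hYc⟩ := exists_subset_card_eq (show s - 1 ≤ ((univ.image (D (Fin.last m))).erase v).card by
      have := pred_card_le_card_erase (s := univ.image (D (Fin.last m))) (a := v)
      rw [hcard] at this; omega)
    set P : Fin (m+1) → Finset V := fun i => if i.val < m then univ.image (D i) else insert v Y with hP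
    have hPin : ∀ i x, x ∈ P i → (i.val < m ∧ ∃ t, D i t = x) ∨ (i = Fin.last m ∧ (x = v ∨ ∃ t, D (Fin.last m) t = x)) := by
      intro i x hx
      simp only [hP] at hx
      split_ifs at hx with h1
      · obtain ⟨t, -, ht⟩ := mem_image.1 hx
        exact Or.inl ⟨h1, t, ht⟩
      · refine Or.inr ⟨hlast i h1, ?_⟩
        rcases mem_insert.1 hx with h | h
        · exact Or.inl h
        · obtain ⟨t, -, ht⟩ := mem_image.1 (mem_of_mem_erase (hY h))
          exact Or.inr ⟨t, ht⟩
    refine ⟨univ.biUnion P, ?_, ?_, P, Fin.last m, ?_, ?_, ?_, rfl⟩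
    · intro u hu
      obtain ⟨i, -, hu⟩ := mem_biUnion.1 hu
      obtain ⟨-, t, rfl⟩ | ⟨-, rfl | ⟨t, rfl⟩⟩ := hPin i u hu
      · exact hS i t
      · exact hv
      · exact hS _ t
    · refine mem_biUnion.2 ⟨Fin.last m, mem_univ _, ?_⟩
      simp [hP]
    · intro i l hil x hx y hy
      obtain ⟨hi, t, rfl⟩ | ⟨hi, rfl | ⟨t, rfl⟩⟩ := hPin i x hx <;>
        obtain ⟨hl, t', rfl⟩ | ⟨hl, rfl | ⟨t', rfl⟩⟩ := hPin l y hy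
      · exact hDD i l hil hi hl t t'
      · exact (hQD i hi t).symm
      · exact hDN hs i hi t t'
      · exact hQD l hl t'
      · exact absurd (hi.trans hl.symm) hil
      · exact absurd (hi.trans hl.symm) hil
      · exact (hDN hs l hl t' t).symm
      · exact absurd (hi.trans hl.symm) hil
      · exact absurd (hi.trans hl.symm) hil
    · simp only [hP, Fin.val_last, lt_irrefl, if_false]
      rw [card_insert_of_notMem (fun h => notMem_erase _ _ (hY h)), hYc]; omega
    · intro i hi
      have him : i.val < m := by
        by_contra h; exact hi (hlast i h)
      simp only [hP, if_pos him]
      exact hcard i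

end ModD5
end OreT

namespace OreT
section ModD6
open Finset
open scoped Classical BigOperators

lemma params (m s w b : ℕ) (hm : 1 ≤ m) (hsw : s < w) (hb : b = s + m * w) (γ : ℝ) (hγ : 0 < γ)
    (hγθ : γ ≤ (w:ℝ)/b/2) : ∃ μ > 0, ∀ α > 0, ∃ δ > 0, 2 * δ ≤ α ∧ γ + δ ≤ (w:ℝ)/b ∧ m * ((w:ℝ)/b) ≤ 1 ∧
      (0 < s → m * ((w:ℝ)/b + μ) + (m + 2) * δ ≤ 1) ∧ (m - 1) * μ + (m + 1) * δ ≤ γ ∧ δ ≤ 1 := by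
  have hm' : (1:ℝ) ≤ m := by exact_mod_cast hm
  have hb0 : 0 < b := by rw [hb]; have := Nat.mul_pos (show 0 < m by omega) (show 0 < w by omega); omega
  have hbR : (0:ℝ) < b := by exact_mod_cast hb0
  have hwR : (0:ℝ) < w := by exact_mod_cast (show 0 < w by omega)
  have hbe : (b:ℝ) = s + m * w := by rw [hb]; push_cast; ring
  have hmθ : m * ((w:ℝ)/b) = 1 - s / b := by field_simp; linarith
  have hs0 : (0:ℝ) ≤ s / b := by positivity
  refine ⟨min (γ/(2*m)) (1/(2*b*m)), by positivity, fun α hα => ?_⟩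
  refine ⟨min (α/2) (min ((w:ℝ)/b/2) (min (1/(2*b*(m+2))) (min (γ/(2*(m+1))) 1))), by positivity, ?_⟩
  set μ := min (γ/(2*m)) (1/(2*b*m)) with hμ
  set δ := min (α/2) (min ((w:ℝ)/b/2) (min (1/(2*b*(m+2))) (min (γ/(2*(m+1))) 1))) with hδ
  have h1 : δ ≤ α/2 := min_le_left _ _
  have h1' := min_le_right (α/2) (min ((w:ℝ)/b/2) (min (1/(2*b*(m+2))) (min (γ/(2*(m+1))) 1)))
  have h2 : δ ≤ (w:ℝ)/b/2 := h1'.trans (min_le_left _ _)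
  have h2' := h1'.trans (min_le_right _ _)
  have h3 : δ ≤ 1/(2*b*(m+2)) := h2'.trans (min_le_left _ _)
  have h3' := h2'.trans (min_le_right _ _)
  have h4 : δ ≤ γ/(2*(m+1)) := h3'.trans (min_le_left _ _)
  have h5 : δ ≤ 1 := h3'.trans (min_le_right _ _)
  have h6 : μ ≤ γ/(2*m) := min_le_left _ _
  have h7 : μ ≤ 1/(2*b*m) := min_le_right _ _
  have hμ0 : 0 < μ := by positivity
  refine ⟨by linarith, by linarith, by linarith, ?_, ?_, h5⟩
  · intro hs
    have hs1 : (1:ℝ) ≤ s := by exact_mod_cast hs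
    have e1 : m * μ ≤ 1/(2*b) := by
      calc m * μ ≤ m * (1/(2*b*m)) := by gcongr
        _ = _ := by field_simp
    have e2 : (m+2) * δ ≤ 1/(2*b) := by
      calc (m+2) * δ ≤ (m+2) * (1/(2*b*(m+2))) := by gcongr
        _ = _ := by field_simp
    have e3 : 1/(2*b:ℝ) + 1/(2*b) = 1 / b := by field_simp; norm_num
    have e4 : (1:ℝ)/b ≤ s/b := by gcongr
    linarith
  · have e1 : m * μ ≤ γ/2 := by
      calc m * μ ≤ m * (γ/(2*m)) := by gcongr
        _ = _ := by field_simp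
    have e2 : (m+1) * δ ≤ γ/2 := by
      calc (m+1) * δ ≤ (m+1) * (γ/(2*(m+1))) := by gcongr
        _ = _ := by field_simp
    linarith

variable {V : Type} {G : SimpleGraph V}

lemma lk_count {m s : ℕ} {S : Finset V} {δ : ℝ} (hδ : 0 ≤ δ) {v : V}
    (h : ManyL S δ (m+1) (GoodLk G m s v)) :
    δ^(m+1) * (S.card:ℝ)^(m+1) ≤ ((tup S (m+1)).filter (Lk G s v)).card := by
  refine (h.count hδ).trans ?_
  have : ((tup S (m+1)).filter fun x => GoodLk G m s v (List.ofFn x)) ⊆ (tup S (m+1)).filter (Lk G s v) :=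
    monotone_filter_right _ fun x _ hx => GoodLk.lk hx
  exact_mod_cast card_le_card this

/-- conclusion of `res` -/
def ResC (G : SimpleGraph V) (m s w C : ℕ) (S L : Finset V) : Prop :=
  (∃ X ⊆ S, Til G (m+1) s w X ∧ (S \ X).card ≤ C) ∧
  (∀ v ∈ S, v ∉ L → ∃ X ⊆ S, v ∈ X ∧ IsBottle G (m+1) s w X) ∧
  (∃ X ⊆ S, IsBottle G (m+1) w w X)

lemma res_zero (s w : ℕ) (hs : 0 < s) (S L : Finset V) (h : s + w ≤ S.card) : ResC G 0 s w s S L := by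
  refine ⟨til_any hs _ S le_rfl fun Y _ hY => bottle_one hY, ?_, ?_⟩
  · intro v hv _
    obtain ⟨X, h1, h2, h3⟩ := exists_subsuperset_card_eq (s := {v}) (t := S) (n := s) (by simpa using hv) (by simp; omega) (by omega)
    exact ⟨X, h2, h1 (mem_singleton_self v), bottle_one h3⟩
  · obtain ⟨X, h1, h2⟩ := exists_subset_card_eq (show w ≤ S.card by omega)
    exact ⟨X, h1, bottle_one h2⟩

set_option maxHeartbeats 2000000 in
lemma res_main (m s w b : ℕ) (hsw : s < w) (hb : b = s + m * w) (hm : 1 ≤ m)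
    (γ : ℝ) (hγ : 0 < γ) : ∃ μ0 > 0, ∀ α > 0, ∃ C n0 : ℕ, ∀ (V : Type) (G : SimpleGraph V)
    (S L : Finset V) (μ : ℝ), 0 ≤ μ → μ ≤ μ0 → n0 ≤ S.card → Hyp G S L ((w:ℝ)/b) μ γ α →
    ResC G m s w C S L := by
  have hb0 : 0 < b := by rw [hb]; have := Nat.mul_pos (show 0 < m by omega) (show 0 < w by omega); omega
  have hbR : (0:ℝ) < b := by exact_mod_cast hb0
  have hwR : (0:ℝ) < w := by exact_mod_cast (show 0 < w by omega)
  have hθ : (0:ℝ) < (w:ℝ)/b := by positivity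
  set θ : ℝ := (w:ℝ)/b with hθd
  set γ0 := min γ (θ/2) with hγ0
  have hγ0p : 0 < γ0 := by positivity
  have hγ0γ : γ0 ≤ γ := min_le_left _ _
  have hγ0θ : γ0 ≤ θ/2 := min_le_right _ _
  obtain ⟨μnc, hμnc, hnc⟩ := near_cover' m s w b hsw hb (Or.inr hm) (γ0/2/2) (by positivity)
  obtain ⟨μp, hμp, hp⟩ := params m s w b hm hsw hb (γ0/2) (by positivity) (by rw [← hθd]; linarith)
  set μ1 := min μp (μnc/2) with hμ1
  have hμ1p : 0 < μ1 := by positivity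
  have hμ1a : μ1 ≤ μp := min_le_left _ _
  have hμ1b : μ1 ≤ μnc/2 := min_le_right _ _
  obtain ⟨ξ1, hξ1, hξ1h, hd1⟩ := hyp_del θ μ1 γ0 hθ hμ1p hγ0p
  obtain ⟨ξ2, hξ2, hξ2h, hd2⟩ := hyp_del θ μnc (γ0/2) hθ hμnc (by positivity)
  refine ⟨μ1/2, by positivity, fun α hα => ?_⟩
  obtain ⟨δ, hδ, q1, q2, q3, q4, q5, q6⟩ := hp (min α (ξ1/(m+2))) (by positivity)
  have q1a : 2 * δ ≤ α := q1.trans (min_le_left _ _)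
  have q1b : (m+2) * δ ≤ ξ1 := by
    have : 2 * δ ≤ ξ1/(m+2) := q1.trans (min_le_right _ _)
    rw [le_div_iff₀ (by positivity)] at this
    nlinarith [mul_nonneg hδ.le (show (0:ℝ) ≤ m + 2 by positivity)]
  obtain ⟨η, hη, Dn, na, habs⟩ := absorbing m s w b hsw hb hb0 (δ^(m+1)) (by positivity) ξ2 hξ2
  obtain ⟨nc, hnc⟩ := hnc α hα η hη
  obtain ⟨nb, hblow⟩ := blow_exists (m+1) w (δ^(m+1)) (by positivity)
  refine ⟨b + Dn, 2 * (⌈1/δ⌉₊ + na + 2 * nc + nb + w + b + 1), fun V G S L μ hμ0 hμμ hn0 hyp => ?_⟩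
  have hyp0 : Hyp G S L θ μ γ0 α := hyp.weaken le_rfl hγ0γ
  have hypS : Hyp G S L θ μp (γ0/2) α := hyp0.weaken (by linarith) (by linarith)
  have big : ∀ T : Finset V, S.card ≤ 2 * T.card → 1 ≤ δ * T.card := by
    intro T hT
    have h1 : ⌈1/δ⌉₊ ≤ T.card := by omega
    have h2 : 1/δ ≤ T.card := (Nat.le_ceil _).trans (by exact_mod_cast h1)
    rw [div_le_iff₀ hδ] at h2; linarith
  refine ⟨?_, ?_, ?_⟩
  ·
    by_cases htriv : 2 ≤ m ∨ 0 < s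
    swap
    · have hm1 : m = 1 := by omega
      have hs0 : s = 0 := by omega
      subst hm1; subst hs0
      obtain ⟨X, hX1, hX2, hX3⟩ := til_any (G := G) (show 0 < w by omega) _ S le_rfl fun Y _ hY => bottle_two hY
      exact ⟨X, hX1, hX2, by omega⟩
    obtain ⟨S1, hS1S, hS1c, hS1L, X1, hX1, hX1S, hX1d⟩ : ∃ S1 ⊆ S, (1 - ξ1) * S.card ≤ (S1.card:ℝ) ∧
        ((∀ v ∈ S1, v ∉ L) ∨ (m + 2) * (δ * S1.card) ≤ ((L ∩ S1).card : ℝ)) ∧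
        ∃ X1, Til G (m+1) s w X1 ∧ X1 ⊆ S \ S1 ∧ ((S \ S1) \ X1).card ≤ b := by
      by_cases hL : (m + 2) * (δ * S.card) ≤ ((L ∩ S).card : ℝ)
      · refine ⟨S, Subset.refl _, ?_, Or.inr hL, ∅, Til.empty, by simp, by simp⟩
        have : (0:ℝ) ≤ ξ1 * S.card := by positivity
        linarith
      · push Not at hL
        have e1 : (S.card : ℝ) = (S \ L).card + (L ∩ S).card := by
          rw [inter_comm]; exact_mod_cast (card_sdiff_add_card_inter S L).symm
        obtain ⟨X1, a1, a2, a3⟩ := til_any (G := G) (k := m+1) (s := s) (w := w) hb0 _ (L ∩ S) le_rfl (fun Y hY hYc =>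
          bottle_of_clique hb (hyp.cl.mono (fun x hx => mem_coe.2 (inter_subset_left (hY (mem_coe.1 hx))))) hYc)
        have e2 : S \ (S \ L) = L ∩ S := by ext u; simp; tauto
        refine ⟨S \ L, sdiff_subset, ?_, Or.inl fun v hv => (mem_sdiff.1 hv).2, X1, a2, by rw [e2]; exact a1, by rw [e2]; exact a3⟩
        have : ((m+2) * δ) * S.card ≤ ξ1 * S.card := by gcongr
        linarith
    have hS1half : S.card ≤ 2 * S1.card := by
      have : (S.card:ℝ) ≤ 2 * S1.card := by nlinarith [(by positivity : (0:ℝ) ≤ S.card)]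
      exact_mod_cast this
    have hyp1 := hd1 V G S S1 L μ α (by linarith) hα.le hS1S hS1c hyp0
    have hyp1p : Hyp G S1 L θ μp (γ0/2) α := hyp1.weaken hμ1a le_rfl
    obtain ⟨A, hA, hAc, hAabs⟩ := habs V G S1 (by omega) (fun v hv => lk_count hδ.le
      (link_many hm htriv hyp1p hμp.le (big S1 hS1half) q1a q2 hδ (by positivity) q3 q4 q5 q6 v hv
        (hS1L.imp (fun h => h v hv) id)))
    have hAS : ((S1 \ A).card : ℝ) = S1.card - A.card := by
      rw [card_sdiff_of_subset hA, Nat.cast_sub (card_le_card hA)]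
    have hyp2 := hd2 V G S1 (S1 \ A) L μ1 α hμ1b hα.le sdiff_subset (by rw [hAS]; linarith) hyp1
    have hc2 : nc ≤ (S1 \ A).card := by
      have : (nc : ℝ) ≤ (S1 \ A).card := by
        have h2 : (2 * nc : ℝ) ≤ S1.card := by
          have : 2 * nc ≤ S1.card := by omega
          exact_mod_cast this
        have h3 : ξ2 * S1.card ≤ 1/2 * S1.card := by gcongr
        rw [hAS]; linarith
      exact_mod_cast this
    obtain ⟨X2, b1, b2, b3⟩ := hnc V G (S1 \ A) L μnc hμnc.le le_rfl hc2 hyp2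
    obtain ⟨Z', c1, c2, c3⟩ := hAabs ((S1 \ A) \ X2) sdiff_subset (b3.trans (by
      gcongr; exact sdiff_subset))
    refine ⟨X1 ∪ (X2 ∪ (A ∪ ((S1 \ A) \ X2) \ Z')), ?_, ?_, ?_⟩
    · refine union_subset (hX1S.trans sdiff_subset) (Subset.trans ?_ hS1S)
      refine union_subset (b1.trans sdiff_subset) (union_subset hA ?_)
      exact sdiff_subset.trans (sdiff_subset.trans sdiff_subset)
    · refine hX1.union (b2.union c3 ?_) ?_
      · rw [Finset.disjoint_left]; intro u hu hu'
        have := b1 hu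
        simp only [mem_union, mem_sdiff] at hu' this
        tauto
      · rw [Finset.disjoint_left]; intro u hu hu'
        have h1 := hX1S hu
        have h2 := @b1 u
        have h3 := @hA u
        simp only [mem_union, mem_sdiff] at hu' h1 h2
        tauto
    · have : S \ (X1 ∪ (X2 ∪ (A ∪ ((S1 \ A) \ X2) \ Z'))) ⊆ ((S \ S1) \ X1) ∪ Z' := by
        intro u hu
        simp only [mem_union, mem_sdiff] at hu ⊢
        tauto
      exact (card_le_card this).trans ((card_union_le _ _).trans (by omega))
  · intro v hv hvL
    by_cases htriv : 2 ≤ m ∨ 0 < s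
    swap
    · have hm1 : m = 1 := by omega
      have hs0 : s = 0 := by omega
      subst hm1; subst hs0
      obtain ⟨X, h1, h2, h3⟩ := exists_subsuperset_card_eq (s := {v}) (t := S) (n := w) (by simpa using hv) (by simp; omega) (by omega)
      exact ⟨X, h2, h1 (mem_singleton_self v), bottle_two h3⟩
    obtain ⟨D, h1, h2⟩ := hblow V S (Lk G s v) (by omega) (lk_count hδ.le
      (link_many hm htriv hypS hμp.le (big S (by omega)) q1a q2 hδ (by positivity) q3 q4 q5 q6 v hv (Or.inl hvL)))
    exact cov_of_blow hsw htriv hv h1 h2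
  · obtain ⟨D, h1, h2⟩ := hblow V S (fun x => (List.ofFn x).Pairwise G.Adj) (by omega) (by
      refine (gad hm hypS hμp.le (big S (by omega)) q1a q2 hδ (by positivity) q3 q5).trans (le_of_eq ?_)
      congr 2; ext x; simp only [mem_filter])
    exact bottle_of_blow h1 h2

/-- the non-extremal case -/
theorem res (m s w b : ℕ) (hsw : s < w) (hb : b = s + m * w) (hcase : 0 < s ∨ 1 ≤ m)
    (γ : ℝ) (hγ : 0 < γ) : ∃ μ0 > 0, ∀ α > 0, ∃ C n0 : ℕ, ∀ (V : Type) (G : SimpleGraph V)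
    (S L : Finset V) (μ : ℝ), 0 ≤ μ → μ ≤ μ0 → n0 ≤ S.card → Hyp G S L ((w:ℝ)/b) μ γ α →
    ResC G m s w C S L := by
  rcases Nat.eq_zero_or_pos m with h | h
  · subst h
    refine ⟨1, one_pos, fun α _ => ⟨s, s + w, fun V G S L μ _ _ h _ => res_zero s w (by omega) S L h⟩⟩
  · exact res_main m s w b hsw hb h γ hγ

end ModD6
end OreT

namespace OreT
section ModE1
open Finset
open scoped Classical BigOperators

variable {V : Type} {G : SimpleGraph V}

lemma nn_mono {S T : Finset V} (h : S ⊆ T) (v : V) : nn G S v ≤ nn G T v :=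
  card_le_card (filter_subset_filter _ h)

/-- the common neighbourhood in `S` of a set `Y` -/
noncomputable def cn (G : SimpleGraph V) (S Y : Finset V) : Finset V := S.filter fun a => ∀ y ∈ Y, G.Adj y a

lemma cn_sub (S Y : Finset V) : cn G S Y ⊆ S := filter_subset _ _

lemma mem_cn {S Y : Finset V} {a : V} : a ∈ cn G S Y ↔ a ∈ S ∧ ∀ y ∈ Y, G.Adj y a := mem_filter

lemma card_cn (S Y : Finset V) : S.card ≤ (cn G S Y).card + ∑ y ∈ Y, nn G S y := by
  have h : S ⊆ cn G S Y ∪ Y.biUnion fun y => S.filter fun u => ¬ G.Adj y u := by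
    intro a ha
    rw [mem_union, mem_cn, mem_biUnion]
    by_cases h : ∀ y ∈ Y, G.Adj y a
    · exact Or.inl ⟨ha, h⟩
    · push Not at h
      obtain ⟨y, hy, hya⟩ := h
      exact Or.inr ⟨y, hy, mem_filter.2 ⟨ha, hya⟩⟩
  refine (card_le_card h).trans ((card_union_le _ _).trans ?_)
  gcongr
  exact card_biUnion_le

/-- extend a bottle by a family of parts -/
lemma extend {ι : Type} (s w d : ℕ) : ∀ (I : Finset ι) (κ : ℕ) (Y : Finset V) (Cd : ι → Finset V),
    IsBottle G κ s w Y → (∀ l ∈ I, ∀ y ∈ Y, ∀ a ∈ Cd l, G.Adj y a) →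
    (∀ l ∈ I, ∀ l' ∈ I, l ≠ l' → ∀ a ∈ Cd l, nn G (Cd l') a ≤ d) →
    (∀ l ∈ I, w + I.card * (w * d) ≤ (Cd l).card) →
    ∃ D : ι → Finset V, (∀ l ∈ I, D l ⊆ Cd l ∧ (D l).card = w) ∧
      IsBottle G (κ + I.card) s w (Y ∪ I.biUnion D) := by
  intro I
  induction I using Finset.induction_on with
  | empty =>
    intro κ Y Cd hY _ _ _
    exact ⟨fun _ => ∅, by simp, by simpa using hY⟩
  | insert l I hl ih =>
    intro κ Y Cd hY hadj hmiss hc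
    rw [card_insert_of_notMem hl] at hc
    obtain ⟨E, hE, hEc⟩ := exists_subset_card_eq (show w ≤ (Cd l).card from le_trans (Nat.le_add_right _ _) (hc l (mem_insert_self _ _)))
    have hY' := hY.cons hEc (fun y hy a ha => hadj l (mem_insert_self _ _) y hy a (hE ha))
    obtain ⟨D, hD, hDb⟩ := ih (κ+1) (Y ∪ E) (fun i => cn G (Cd i) E) hY' (by
      intro i hi y hy a ha
      rw [mem_cn] at ha
      rcases mem_union.1 hy with h | h
      · exact hadj i (mem_insert_of_mem hi) y h a ha.1
      · exact ha.2 y h) (by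
      intro i hi i' hi' hne a ha
      exact (nn_mono (cn_sub _ _) a).trans (hmiss i (mem_insert_of_mem hi) i' (mem_insert_of_mem hi') hne a (cn_sub _ _ ha))) (by
      intro i hi
      have h1 := card_cn (G := G) (Cd i) E
      have h2 : ∑ y ∈ E, nn G (Cd i) y ≤ ∑ y ∈ E, d := sum_le_sum fun y hy =>
        hmiss l (mem_insert_self _ _) i (mem_insert_of_mem hi) (fun h => hl (h ▸ hi)) y (hE hy)
      rw [sum_const, hEc, smul_eq_mul] at h2
      have h3 := hc i (mem_insert_of_mem hi)
      have h4 : (I.card + 1) * (w * d) = I.card * (w * d) + w * d := by ring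
      omega)
    refine ⟨fun i => if i = l then E else D i, ?_, ?_⟩
    · intro i hi
      by_cases h : i = l
      · subst h; simpa using ⟨hE, hEc⟩
      · have := hD i (mem_of_mem_insert_of_ne hi h)
        simpa [h] using ⟨this.1.trans (cn_sub _ _), this.2⟩
    · rw [card_insert_of_notMem hl, show κ + (I.card + 1) = κ + 1 + I.card by ring]
      convert hDb using 1
      rw [biUnion_insert, if_pos rfl, union_assoc]
      congr 2
      refine biUnion_congr rfl fun i hi => ?_
      rw [if_neg (fun h : i = l => hl (h ▸ hi))]

lemma til_family {k s w : ℕ} {X : Finset V} (h : Til G k s w X) :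
    ∃ (T : ℕ) (Y : Fin T → Finset V), (∀ t, IsBottle G k s w (Y t)) ∧
      (∀ t t', t ≠ t' → Disjoint (Y t) (Y t')) ∧ X = univ.biUnion Y := by
  induction h with
  | empty => exact ⟨0, fun _ => ∅, fun t => t.elim0, fun t => t.elim0, by simp⟩
  | add X Z _ hZ hd ih =>
    obtain ⟨T, Y, h1, h2, rfl⟩ := ih
    have hdt : ∀ t, Disjoint (Y t) Z := fun t => disjoint_of_subset_left (subset_biUnion_of_mem Y (mem_univ t)) hd
    refine ⟨T+1, Fin.cons Z Y, ?_, ?_, ?_⟩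
    · intro t; refine Fin.cases ?_ (fun t => ?_) t
      · simpa using hZ
      · simpa using h1 t
    · intro t t'
      refine Fin.cases ?_ (fun t => ?_) t <;> refine Fin.cases ?_ (fun t' => ?_) t'
      · intro h; exact absurd rfl h
      · intro _; simpa using (hdt t').symm
      · intro _; simpa using hdt t
      · intro h; simpa using h2 t t' (fun h' => h (by rw [h']))
    · ext x
      simp [Fin.exists_fin_succ, or_comm]

/-- Hall step: attach `w` vertices of `A` to every tile -/
lemma attach {κ s w T d d' : ℕ} (Y : Fin T → Finset V) (A : Finset V)
    (hY : ∀ t, IsBottle G κ s w (Y t))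
    (h1 : ∀ t, A.card ≤ (cn G A (Y t)).card + d)
    (h2 : ∀ a ∈ A, (univ.filter fun t => a ∉ cn G A (Y t)).card ≤ d')
    (hT : w * T ≤ A.card) (hA : w * d' + d ≤ A.card) :
    ∃ D : Fin T → Finset V, (∀ t, D t ⊆ A) ∧ (∀ t t', t ≠ t' → Disjoint (D t) (D t')) ∧
      ∀ t, (D t).card = w ∧ IsBottle G (κ+1) s w (Y t ∪ D t) := by
  have hall := (Finset.all_card_le_biUnion_card_iff_exists_injective
    (fun p : Fin T × Fin w => cn G A (Y p.1))).1 (by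
    intro S
    by_cases hS : S.card + d ≤ A.card
    · rcases S.eq_empty_or_nonempty with rfl | ⟨p, hp⟩
      · simp
      · have := h1 p.1
        have h3 := card_le_card (subset_biUnion_of_mem (fun p : Fin T × Fin w => cn G A (Y p.1)) hp)
        omega
    · have hsub : A ⊆ S.biUnion fun p : Fin T × Fin w => cn G A (Y p.1) := by
        intro a ha
        by_contra hn
        have h3 : S ⊆ (univ.filter fun t => a ∉ cn G A (Y t)) ×ˢ (univ : Finset (Fin w)) := by
          intro p hp
          rw [mem_product, mem_filter]
          exact ⟨⟨mem_univ _, fun h => hn (mem_biUnion.2 ⟨p, hp, h⟩)⟩, mem_univ _⟩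
        have h4 := card_le_card h3
        rw [card_product, card_univ, Fintype.card_fin] at h4
        have h5 := Nat.mul_le_mul_right w (h2 a ha)
        have h6 : d' * w = w * d' := mul_comm _ _
        omega
      have h4 : S.card ≤ w * T := by
        have := card_le_univ S
        simpa [mul_comm] using this
      exact h4.trans (hT.trans (card_le_card hsub)))
  obtain ⟨f, hf, hfm⟩ := hall
  refine ⟨fun t => univ.image fun c => f (t, c), ?_, ?_, ?_⟩
  · intro t u hu
    obtain ⟨c, -, rfl⟩ := mem_image.1 hu
    exact cn_sub _ _ (hfm (t, c))
  · intro t t' htt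
    rw [Finset.disjoint_left]
    intro u hu hu'
    obtain ⟨c, -, rfl⟩ := mem_image.1 hu
    obtain ⟨c', -, h⟩ := mem_image.1 hu'
    exact htt (congrArg Prod.fst (hf h)).symm
  · intro t
    have hc : (univ.image fun c => f (t, c)).card = w := by
      rw [card_image_of_injective _ (fun c c' h => congrArg Prod.snd (hf h))]; simp
    refine ⟨hc, (hY t).cons hc ?_⟩
    intro x hx y hy
    obtain ⟨c, -, rfl⟩ := mem_image.1 hy
    exact (mem_cn.1 (hfm (t, c))).2 x hx

/-- attach all the sets `A i` -/
lemma attach_all {j κ s w b T d : ℕ} (S : Finset V) (A : Fin j → Finset V)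
    (hAS : ∀ i, A i ⊆ S)
    (hdisj : ∀ i l, i ≠ l → Disjoint (A i) (A l))
    (hb : s + (κ + j) * w ≤ b)
    (h1 : ∀ i, ∀ v ∈ S, v ∉ A i → nn G (A i) v ≤ d)
    (h2 : ∀ i, ∀ a ∈ A i, nn G (S \ A i) a ≤ d)
    (hT : ∀ i, w * T ≤ (A i).card) (hd : ∀ i, w * d + b * d ≤ (A i).card)
    (Y : Fin T → Finset V) (hY : ∀ t, IsBottle G (κ+1) s w (Y t))
    (hYS : ∀ t, Y t ⊆ S \ univ.biUnion A)
    (hYd : ∀ t t', t ≠ t' → Disjoint (Y t) (Y t')) :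
    ∃ X ⊆ S, Til G (κ + j + 1) s w X ∧ X.card = T * (s + (κ + j) * w) := by
  have key : ∀ I : Finset (Fin j), ∃ Z : Fin T → Finset V, (∀ t, IsBottle G (κ + I.card + 1) s w (Z t)) ∧
      (∀ t, Z t ⊆ S) ∧ (∀ i, i ∉ I → ∀ t, Disjoint (Z t) (A i)) ∧ (∀ t t', t ≠ t' → Disjoint (Z t) (Z t')) := by
    intro I
    induction I using Finset.induction_on with
    | empty =>
      refine ⟨Y, by simpa using hY, fun t => (hYS t).trans sdiff_subset, ?_, hYd⟩
      intro i _ t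
      rw [Finset.disjoint_left]
      intro u hu hu'
      exact (mem_sdiff.1 (hYS t hu)).2 (mem_biUnion.2 ⟨i, mem_univ _, hu'⟩)
    | insert i I hi ih =>
      obtain ⟨Z, a1, a2, a3, a4⟩ := ih
      have hcI : I.card ≤ j := by simpa using card_le_univ I
      have hZn : ∀ t, ∀ y ∈ Z t, y ∉ A i := fun t y hy => Finset.disjoint_left.1 (a3 i hi t) hy
      have hZc : ∀ t, (Z t).card ≤ b := by
        intro t
        rw [(a1 t).card]
        have : (κ + I.card) * w ≤ (κ + j) * w := by gcongr
        omega
      obtain ⟨D, b1, b2, b3⟩ := attach (d := b * d) (d' := d) Z (A i) a1 (by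
        intro t
        refine (card_cn (G := G) (A i) (Z t)).trans ?_
        gcongr
        calc ∑ y ∈ Z t, nn G (A i) y ≤ ∑ y ∈ Z t, d := sum_le_sum fun y hy => h1 i y (a2 t hy) (hZn t y hy)
          _ = (Z t).card * d := by rw [sum_const, smul_eq_mul]
          _ ≤ b * d := by gcongr; exact hZc t) (by
        intro a ha
        refine le_trans ?_ (h2 i a ha)
        have hex : ∀ t ∈ univ.filter (fun t => a ∉ cn G (A i) (Z t)), ∃ y ∈ Z t, ¬ G.Adj a y := by
          intro t ht
          have := (mem_filter.1 ht).2
          rw [mem_cn] at this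
          push Not at this
          obtain ⟨y, hy, hya⟩ := this ha
          exact ⟨y, hy, fun h => hya h.symm⟩
        haveI : Nonempty V := ⟨a⟩
        choose! g hg1 hg2 using hex
        refine card_le_card_of_injOn g ?_ ?_
        · intro t ht
          have ht' := mem_coe.1 ht
          refine mem_coe.2 (mem_filter.2 ⟨mem_sdiff.2 ⟨a2 t (hg1 t ht'), hZn t _ (hg1 t ht')⟩, hg2 t ht'⟩)
        · intro t ht t' ht' h
          by_contra hne
          have e1 := hg1 t (mem_coe.1 ht)
          have e2 := hg1 t' (mem_coe.1 ht')
          rw [h] at e1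
          exact Finset.disjoint_left.1 (a4 t t' hne) e1 e2) (hT i) (hd i)
      refine ⟨fun t => Z t ∪ D t, ?_, ?_, ?_, ?_⟩
      · intro t
        rw [card_insert_of_notMem hi, show κ + (I.card + 1) + 1 = κ + I.card + 1 + 1 by ring]
        exact (b3 t).2
      · intro t; exact union_subset (a2 t) ((b1 t).trans (hAS i))
      · intro i' hi' t
        rw [mem_insert, not_or] at hi'
        rw [disjoint_union_left]
        exact ⟨a3 i' hi'.2 t, disjoint_of_subset_left (b1 t) (hdisj i i' (Ne.symm hi'.1))⟩
      · intro t t' h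
        rw [disjoint_union_left, disjoint_union_right, disjoint_union_right]
        exact ⟨⟨a4 t t' h, disjoint_of_subset_right (b1 t') (a3 i hi t)⟩,
          (disjoint_of_subset_right (b1 t) (a3 i hi t')).symm, b2 t t' h⟩
  obtain ⟨Z, a1, a2, -, a4⟩ := key univ
  rw [card_univ, Fintype.card_fin] at a1
  refine ⟨univ.biUnion Z, biUnion_subset.2 fun t _ => a2 t, ?_, ?_⟩
  · exact til_biUnion univ (fun t _ => Til.single (a1 t)) (fun t _ t' _ h => a4 t t' h)
  · rw [card_biUnion (fun t _ t' _ h => a4 t t' h), sum_congr rfl (fun t _ => (a1 t).card)]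
    simp

/-- final balanced step -/
lemma finish {j κ s w b T d C : ℕ} (S : Finset V) (A : Fin j → Finset V)
    (hAS : ∀ i, A i ⊆ S)
    (hdisj : ∀ i l, i ≠ l → Disjoint (A i) (A l)) (hw : 0 < w) (hb0 : 0 < b)
    (hb : b = s + (κ + j) * w)
    (h1 : ∀ i, ∀ v ∈ S, v ∉ A i → nn G (A i) v ≤ d)
    (h2 : ∀ i, ∀ a ∈ A i, nn G (S \ A i) a ≤ d)
    (hd : ∀ i, w * d + b * d ≤ (A i).card)
    (Y : Fin T → Finset V) (hY : ∀ t, IsBottle G (κ+1) s w (Y t))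
    (hYS : ∀ t, Y t ⊆ S \ univ.biUnion A)
    (hYd : ∀ t t', t ≠ t' → Disjoint (Y t) (Y t'))
    (hT : S.card ≤ b * T + C) (hA : ∀ i, w * S.card ≤ b * (A i).card + C) :
    ∃ X ⊆ S, Til G (κ + j + 1) s w X ∧ (S \ X).card ≤ b * C + b := by
  set T0 := S.card / b - C with hT0
  have hq : b * (S.card / b) ≤ S.card := Nat.mul_div_le _ _
  have hq2 : S.card < b * (S.card / b) + b := Nat.lt_mul_div_succ _ hb0
  rcases Nat.eq_zero_or_pos T0 with h0 | h0
  · refine ⟨∅, by simp, Til.empty, ?_⟩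
    have : S.card / b ≤ C := by omega
    have := Nat.mul_le_mul_left b this
    simp only [sdiff_empty]; omega
  have he : T0 + C = S.card / b := by omega
  rw [← he, mul_add] at hq hq2
  have hbC : C ≤ b * C := Nat.le_mul_of_pos_left _ hb0
  have hTT : T0 ≤ T := by
    have : b * T0 ≤ b * T := by omega
    exact Nat.le_of_mul_le_mul_left this hb0
  have hAT : ∀ i, w * T0 ≤ (A i).card := by
    intro i
    have e1 := Nat.mul_le_mul_left w hq
    have e2 := hA i
    have e3 : b * C ≤ w * (b * C) := Nat.le_mul_of_pos_left _ hw
    have : b * (w * T0) ≤ b * (A i).card := by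
      rw [mul_add] at e1
      have e4 : b * (w * T0) = w * (b * T0) := by ring
      omega
    exact Nat.le_of_mul_le_mul_left this hb0
  obtain ⟨X, a1, a2, a3⟩ := attach_all S A hAS hdisj hb.ge h1 h2 hAT hd (fun t : Fin T0 => Y (Fin.castLE hTT t))
    (fun t => hY _) (fun t => hYS _) (fun t t' h => hYd _ _ (fun h' => h (Fin.castLE_injective hTT h')))
  refine ⟨X, a1, a2, ?_⟩
  rw [card_sdiff_of_subset a1, a3, ← hb]
  have : T0 * b = b * T0 := mul_comm _ _
  omega

end ModE1
end OreT

namespace OreT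
section ModE2
open Finset
open scoped Classical BigOperators

variable {V : Type} {G : SimpleGraph V}

noncomputable def ad (G : SimpleGraph V) (S : Finset V) (v : V) : ℕ :=
  (S.filter fun u => G.Adj v u).card

lemma ad_nn (S : Finset V) (v : V) : (ad G S v : ℝ) + nn G S v = S.card := by
  have := card_filter_add_card_filter_not (s := S) (fun u => G.Adj v u)
  unfold ad nn
  exact_mod_cast this

lemma ad_mono {S T : Finset V} (h : S ⊆ T) (v : V) : ad G S v ≤ ad G T v :=
  card_le_card (filter_subset_filter _ h)

lemma nn_union_le (S T : Finset V) (v : V) : nn G (S ∪ T) v ≤ nn G S v + T.card := by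
  unfold nn
  rw [filter_union]
  exact (card_union_le _ _).trans (by gcongr; exact filter_subset _ _)

lemma ad_union_le (S T : Finset V) (v : V) : ad G (S ∪ T) v ≤ ad G S v + T.card := by
  unfold ad
  rw [filter_union]
  exact (card_union_le _ _).trans (by gcongr; exact filter_subset _ _)

lemma nn_split {S T : Finset V} (h : S ⊆ T) (v : V) : nn G T v = nn G S v + nn G (T \ S) v := by
  unfold nn
  rw [← card_union_of_disjoint (disjoint_of_subset_left (filter_subset _ _) (disjoint_of_subset_right (filter_subset _ _) disjoint_sdiff)),
    ← filter_union, union_sdiff_of_subset h]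

lemma nn_double (X Y : Finset V) : ∑ u ∈ X, nn G Y u = ∑ v ∈ Y, nn G X v := by
  unfold nn
  simp_rw [card_filter]
  rw [sum_comm]
  refine sum_congr rfl fun v _ => sum_congr rfl fun u _ => ?_
  rw [G.adj_comm]

def Ore (G : SimpleGraph V) [Fintype V] (θ : ℝ) : Prop :=
  ∀ x y : V, x ≠ y → ¬ G.Adj x y → (nn G univ x : ℝ) + nn G univ y ≤ 2 * θ * Fintype.card V

structure Near (G : SimpleGraph V) [Fintype V] (θ Γ : ℝ) (P : Finset V) : Prop where
  size : (θ - Γ) * Fintype.card V ≤ P.card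
  ee : (ee G P : ℝ) ≤ Γ * (Fintype.card V : ℝ)^2

noncomputable def Ath (G : SimpleGraph V) [Fintype V] (P : Finset V) (t : ℝ) : Finset V :=
  univ.filter fun v => (ad G P v : ℝ) ≤ t * Fintype.card V

section
variable [Fintype V] {θ e t : ℝ} {P : Finset V}

lemma cl1 (hn : (0:ℝ) < Fintype.card V) (he : 0 < e) (ht : e ≤ t) (hP : Near G θ (e*e) P) :
    ((P \ Ath G P t).card : ℝ) ≤ e * Fintype.card V := by
  set n : ℝ := (Fintype.card V : ℝ) with hnd
  have h1 : ((P \ Ath G P t).card : ℝ) * (e * n) ≤ ee G P := by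
    rw [ee_eq_sum]
    calc ((P \ Ath G P t).card : ℝ) * (e * n) = ∑ u ∈ P \ Ath G P t, e * n := by rw [sum_const, nsmul_eq_mul]
      _ ≤ ∑ u ∈ P \ Ath G P t, ((P.filter fun v => G.Adj u v).card : ℝ) := by
        refine sum_le_sum fun u hu => ?_
        have h2 := (mem_sdiff.1 hu).2
        have h3 : ¬ ((ad G P u : ℝ) ≤ t * n) := fun h => h2 (mem_filter.2 ⟨mem_univ _, h⟩)
        push Not at h3
        have h4 : e * n ≤ t * n := by gcongr
        have h5 : (ad G P u : ℝ) = ((P.filter fun v => G.Adj u v).card : ℝ) := rfl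
        linarith
      _ ≤ _ := sum_le_sum_of_subset_of_nonneg sdiff_subset (fun _ _ _ => by positivity)
  have h2 := h1.trans hP.ee
  have h3 : ((P \ Ath G P t).card : ℝ) * (e * n) ≤ (e * n) * (e * n) := by linarith [show e * e * n^2 = (e*n)*(e*n) by ring]
  exact le_of_mul_le_mul_right h3 (by positivity)

lemma near_size (hn : (0:ℝ) < Fintype.card V) (he : 0 < e) (he1 : e ≤ 1) (hP : Near G θ (e*e) P) : (θ - e) * Fintype.card V ≤ (P.card:ℝ) := by
  refine le_trans ?_ hP.size
  have : e * e ≤ e := by nlinarith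
  gcongr

lemma cl2 (hn : (0:ℝ) < Fintype.card V) (he : 0 < e) (he1 : e ≤ 1) (hP : Near G θ (e*e) P) {v : V} (hv : v ∈ Ath G P t) :
    (θ - e - t) * Fintype.card V ≤ (nn G P v : ℝ) := by
  have h1 := (mem_filter.1 hv).2
  have h2 := ad_nn (G := G) P v
  have h3 := near_size hn he he1 hP
  linarith

lemma cl3 (hO : Ore G θ) (hn : (0:ℝ) < Fintype.card V) (he : 0 < e) (he1 : e ≤ 1) (ht : e ≤ t) (hP : Near G θ (e*e) P)
    (hbig : 1 < (θ - 2 * e - t) * Fintype.card V) {v : V} (hv : v ∈ Ath G P t) :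
    (nn G univ v : ℝ) ≤ (θ + e + t) * Fintype.card V := by
  set n : ℝ := (Fintype.card V : ℝ) with hnd
  have h1 := (mem_filter.1 hv).2
  have h2 := cl2 hn he he1 hP hv
  have h3 := cl1 hn he ht hP
  have h4 : nn G P v ≤ nn G (P ∩ Ath G P t) v + (P \ Ath G P t).card := by
    have h : P ⊆ (P ∩ Ath G P t) ∪ (P \ Ath G P t) := by intro u hu; simp only [mem_union, mem_inter, mem_sdiff]; tauto
    exact (nn_mono h v).trans (nn_union_le _ _ v)
  have h4' : (nn G P v : ℝ) ≤ nn G (P ∩ Ath G P t) v + (P \ Ath G P t).card := by exact_mod_cast h4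
  have h5 : 1 < nn G (P ∩ Ath G P t) v := by
    have : (1:ℝ) < nn G (P ∩ Ath G P t) v := by linarith
    exact_mod_cast this
  obtain ⟨u, hu, hne⟩ := Finset.exists_mem_ne h5 v
  rw [mem_filter, mem_inter] at hu
  have h6 := hO v u hne.symm hu.2
  have h7 := cl2 hn he he1 hP hu.1.2
  have h8 : (nn G P u : ℝ) ≤ nn G univ u := by exact_mod_cast nn_mono (subset_univ P) u
  linarith

lemma cl4 (hO : Ore G θ) (hn : (0:ℝ) < Fintype.card V) (he : 0 < e) (he1 : e ≤ 1) (ht : e ≤ t) (hP : Near G θ (e*e) P)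
    (hbig : 1 < (θ - 2 * e - t) * Fintype.card V) {v : V} (hv : v ∈ Ath G P t) :
    (nn G (univ \ P) v : ℝ) ≤ 2 * (e + t) * Fintype.card V := by
  have h1 := cl3 hO hn he he1 ht hP hbig hv
  have h2 := cl2 hn he he1 hP hv
  have h3 : (nn G univ v : ℝ) = nn G P v + nn G (univ \ P) v := by exact_mod_cast nn_split (subset_univ P) v
  linarith

end

structure C1 (G : SimpleGraph V) [Fintype V] (θ β ρ ν : ℝ) (P A : Finset V) : Prop where
  lo : (θ - ρ) * Fintype.card V ≤ A.card
  hi : A.card ≤ (θ + ρ) * Fintype.card V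
  inner : ∀ v ∈ A, (ad G A v : ℝ) ≤ 2 * β * Fintype.card V
  miss : ∀ v ∈ A, (nn G (univ \ A) v : ℝ) ≤ 5 * β * Fintype.card V
  nnhi : ∀ v ∈ A, (nn G univ v : ℝ) ≤ (θ + 2 * β) * Fintype.card V
  nnlo : ∀ v ∈ A, (θ - 2 * β) * Fintype.card V ≤ (nn G P v : ℝ)
  rich : ∀ v, v ∉ A → β / 2 * Fintype.card V ≤ (ad G A v : ℝ)
  bad : ((univ.filter fun v => v ∉ A ∧ ρ * Fintype.card V < nn G A v).card : ℝ) ≤ ν * Fintype.card V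
  PA : ((P \ A).card : ℝ) ≤ ρ * Fintype.card V

set_option maxHeartbeats 1000000 in
lemma clean1 [Fintype V] {θ β ρ ν e : ℝ} {P : Finset V} (hO : Ore G θ) (he : 0 < e) (hρ : 0 < ρ) (hρβ : ρ ≤ β)
    (hβ : β ≤ θ / 10) (hθ : 0 < θ) (hθ1 : θ ≤ 1) (he1 : 20 * e ≤ ρ * θ) (he2 : 20 * e ≤ ν * ρ)
    (hn : 2 < θ * Fintype.card V) (hP : Near G θ (e*e) P) : C1 G θ β ρ ν P (Ath G P β) := by
  set n : ℝ := (Fintype.card V : ℝ) with hnd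
  have hn0 : 0 < n := by
    by_contra h; push Not at h
    have : θ * n ≤ 0 := mul_nonpos_of_nonneg_of_nonpos hθ.le h
    linarith
  have heρ : 20 * e ≤ ρ := he1.trans (by nlinarith)
  have heβ : e ≤ β := by linarith
  have hee : e ≤ 1 := by linarith
  have hbig : 1 < (θ - 2 * e - β) * n := by nlinarith
  have hbig' : 1 < (θ - 2 * e - e) * n := by nlinarith
  set A := Ath G P β with hA
  set Q := P ∩ Ath G P e with hQ
  have f1 := cl1 hn0 he heβ hP
  have f1' := cl1 hn0 he le_rfl hP
  rw [← hA] at f1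
  have hQA : Q ⊆ A := by
    intro u hu
    have := (mem_filter.1 (mem_inter.1 hu).2).2
    exact mem_filter.2 ⟨mem_univ _, this.trans (by gcongr)⟩
  have hPc := near_size hn0 he hee hP
  have hPQ : P \ Q = P \ Ath G P e := by ext u; simp [hQ]
  have hQc : (Q.card : ℝ) + (P \ Q).card = P.card := by
    have := card_sdiff_add_card_eq_card (show Q ⊆ P from inter_subset_left)
    exact_mod_cast (by omega : Q.card + (P \ Q).card = P.card)
  rw [hPQ] at hQc
  have f2 : ∑ u ∈ Q, (nn G (univ \ P) u : ℝ) ≤ n * (4 * e * n) := by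
    calc ∑ u ∈ Q, (nn G (univ \ P) u : ℝ) ≤ ∑ u ∈ Q, 4 * e * n := by
          refine sum_le_sum fun u hu => ?_
          have := cl4 hO hn0 he hee le_rfl hP hbig' (mem_inter.1 hu).2
          linarith
      _ = Q.card * (4 * e * n) := by rw [sum_const, nsmul_eq_mul]
      _ ≤ n * (4 * e * n) := by
          gcongr
          rw [hnd]; exact_mod_cast card_le_univ Q
  have f3 : ∑ v ∈ univ \ P, (nn G Q v : ℝ) ≤ n * (4 * e * n) := by
    refine le_trans (le_of_eq ?_) f2
    exact_mod_cast (nn_double (G := G) (univ \ P) Q)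
  have hPhi : (P.card : ℝ) ≤ (θ + 3 * e) * n := by
    have hQpos : 0 < Q.card := by
      have : (0:ℝ) < Q.card := by nlinarith
      exact_mod_cast this
    obtain ⟨u, hu⟩ := card_pos.1 hQpos
    have hu' := (mem_inter.1 hu).2
    have a1 := cl3 hO hn0 he hee le_rfl hP hbig' hu'
    have a2 := (mem_filter.1 hu').2
    have a3 := ad_nn (G := G) P u
    have a4 : (nn G P u : ℝ) ≤ nn G univ u := by exact_mod_cast nn_mono (subset_univ P) u
    linarith
  have hAP : ((A \ P).card : ℝ) * θ ≤ 8 * e * n := by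
    have h1 : ((A \ P).card : ℝ) * (θ/2 * n) ≤ n * (4 * e * n) := by
      refine le_trans ?_ f3
      calc ((A \ P).card : ℝ) * (θ/2 * n) = ∑ v ∈ A \ P, (θ/2*n) := by rw [sum_const, nsmul_eq_mul]
        _ ≤ ∑ v ∈ A \ P, (nn G Q v : ℝ) := by
          refine sum_le_sum fun v hv => ?_
          have a1 := cl2 hn0 he hee hP (mem_sdiff.1 hv).1
          have a2 : (nn G P v : ℝ) ≤ nn G Q v + (P \ Ath G P e).card := by
            have h : P ⊆ Q ∪ (P \ Ath G P e) := by
              intro u hu; simp only [hQ, mem_union, mem_inter, mem_sdiff]; tauto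
            exact_mod_cast (nn_mono h v).trans (nn_union_le _ _ v)
          have a3 : (θ/2 + e + e + β) * n ≤ θ * n := by gcongr; linarith
          linarith
        _ ≤ _ := sum_le_sum_of_subset_of_nonneg (sdiff_subset_sdiff (subset_univ _) (Subset.refl _)) (fun _ _ _ => by positivity)
    have h2 : ((A \ P).card * θ) * (n/2) ≤ (8 * e * n) * (n/2) := by linarith
    exact le_of_mul_le_mul_right h2 (by positivity)
  have hAP2 : ((A \ P).card : ℝ) ≤ 2/5 * ρ * n := by
    have : ((A \ P).card : ℝ) * θ ≤ (2/5 * ρ * n) * θ := by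
      have : (20 * e) * n ≤ (ρ * θ) * n := by gcongr
      linarith
    exact le_of_mul_le_mul_right this hθ
  have hsplit : (A.card : ℝ) = (A ∩ P).card + (A \ P).card := by
    have := card_sdiff_add_card_inter A P
    exact_mod_cast (by omega : A.card = (A ∩ P).card + (A \ P).card)
  have hsplit2 : (P.card : ℝ) = (A ∩ P).card + (P \ A).card := by
    have := card_sdiff_add_card_inter P A
    rw [inter_comm] at this
    exact_mod_cast (by omega : P.card = (A ∩ P).card + (P \ A).card)
  have hen : 20 * e * n ≤ ρ * n := by gcongr
  have hρn : 0 < ρ * n := by positivity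
  have hρβn : ρ * n ≤ β * n := by gcongr
  have hAsub : A ⊆ P ∪ (A \ P) := by intro u hu; simp; tauto
  refine ⟨?_, ?_, ?_, ?_, ?_, ?_, ?_, ?_, ?_⟩
  · have : (0:ℝ) ≤ (A \ P).card := by positivity
    linarith
  · have : (0:ℝ) ≤ (P \ A).card := by positivity
    linarith
  · intro v hv
    have a1 := (mem_filter.1 hv).2
    have a2 : (ad G A v : ℝ) ≤ ad G P v + (A \ P).card := by
      exact_mod_cast (ad_mono hAsub v).trans (ad_union_le _ _ v)
    linarith
  · intro v hv
    have a1 := cl4 hO hn0 he hee heβ hP hbig hv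
    have a2 : (nn G (univ \ A) v : ℝ) ≤ nn G (univ \ P) v + (P \ A).card := by
      have : univ \ A ⊆ (univ \ P) ∪ (P \ A) := by intro u hu; simp at hu ⊢; tauto
      exact_mod_cast (nn_mono this v).trans (nn_union_le _ _ v)
    linarith
  · intro v hv
    have a1 := cl3 hO hn0 he hee heβ hP hbig hv
    linarith
  · intro v hv
    have a1 := cl2 hn0 he hee hP hv
    linarith
  · intro v hv
    have a1 : β * n < ad G P v := by
      by_contra h; push Not at h
      exact hv (mem_filter.2 ⟨mem_univ _, h⟩)
    have a2 : (ad G P v : ℝ) ≤ ad G A v + (P \ A).card := by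
      have : P ⊆ A ∪ (P \ A) := by intro u hu; simp; tauto
      exact_mod_cast (ad_mono this v).trans (ad_union_le _ _ v)
    linarith
  · set Bd := univ.filter fun v => v ∉ A ∧ ρ * n < nn G A v with hBd
    have hB1 : Bd ⊆ (P \ A) ∪ (Bd \ P) := by
      intro v hv
      have := (mem_filter.1 hv).2.1
      simp only [mem_union, mem_sdiff]; tauto
    have hB2 : ((Bd \ P).card : ℝ) * (ρ/2 * n) ≤ n * (4 * e * n) := by
      refine le_trans ?_ f3
      calc ((Bd \ P).card : ℝ) * (ρ/2 * n) = ∑ v ∈ Bd \ P, (ρ/2*n) := by rw [sum_const, nsmul_eq_mul]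
        _ ≤ ∑ v ∈ Bd \ P, (nn G Q v : ℝ) := by
          refine sum_le_sum fun v hv => ?_
          have a1 := (mem_filter.1 (mem_sdiff.1 hv).1).2.2
          have a2 : (nn G A v : ℝ) ≤ nn G Q v + ((A \ P) ∪ (P \ Ath G P e)).card := by
            have : A ⊆ Q ∪ ((A \ P) ∪ (P \ Ath G P e)) := by
              intro u hu; simp only [hQ, mem_union, mem_inter, mem_sdiff]; tauto
            exact_mod_cast (nn_mono this v).trans (nn_union_le _ _ v)
          have a3 : (((A \ P) ∪ (P \ Ath G P e)).card : ℝ) ≤ (A \ P).card + (P \ Ath G P e).card := by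
            exact_mod_cast card_union_le _ _
          linarith
        _ ≤ _ := sum_le_sum_of_subset_of_nonneg (sdiff_subset_sdiff (subset_univ _) (Subset.refl _)) (fun _ _ _ => by positivity)
    have hB3 : ((Bd \ P).card : ℝ) ≤ 2/5 * ν * n := by
      have h1 : ((Bd \ P).card : ℝ) * (ρ/2 * n) ≤ (2/5 * ν * n) * (ρ/2*n) := by
        have : (20 * e) * (n * n) ≤ (ν * ρ) * (n * n) := by gcongr
        linarith
      exact le_of_mul_le_mul_right h1 (by positivity)
    have hB4 : (Bd.card : ℝ) ≤ (P \ A).card + (Bd \ P).card := by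
      exact_mod_cast (card_le_card hB1).trans (card_union_le _ _)
    have hν : 0 < ν := by
      by_contra h; push Not at h
      have : ν * ρ ≤ 0 := mul_nonpos_of_nonpos_of_nonneg h hρ.le
      linarith
    have : e * n ≤ ν * n / 20 := by
      have : (20 * e) * n ≤ ν * n := by
        gcongr
        refine he2.trans ?_
        have : ν * ρ ≤ ν * 1 := by gcongr; linarith
        linarith
      linarith
    linarith [mul_pos hν hn0]
  · linarith

end ModE2
end OreT

namespace OreT
section ModE3
open Finset
open scoped Classical BigOperators

variable {V : Type} {G : SimpleGraph V}

lemma ad_double (X Y : Finset V) : ∑ u ∈ X, ad G Y u = ∑ v ∈ Y, ad G X v := by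
  unfold ad
  simp_rw [card_filter]
  rw [sum_comm]
  refine sum_congr rfl fun v _ => sum_congr rfl fun u _ => ?_
  rw [G.adj_comm]

/-- disjoint stars in `A` with centres `Cn` and leaf sets `F` -/
structure Stars (G : SimpleGraph V) (w : ℕ) (A Cn : Finset V) (F : V → Finset V) : Prop where
  sub : Cn ⊆ A
  leaf : ∀ x ∈ Cn, F x ⊆ A \ Cn
  card : ∀ x ∈ Cn, (F x).card = w
  adj : ∀ x ∈ Cn, ∀ u ∈ F x, G.Adj x u
  disj : ∀ x ∈ Cn, ∀ y ∈ Cn, x ≠ y → Disjoint (F x) (F y)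

lemma Stars.step {w : ℕ} {A Cn : Finset V} {F : V → Finset V} (h : Stars G w A Cn F) {x : V}
    (hx : x ∈ A \ (Cn ∪ Cn.biUnion F)) (hd : w ≤ ad G (A \ (Cn ∪ Cn.biUnion F)) x) :
    ∃ F', Stars G w A (insert x Cn) F' := by
  obtain ⟨E, hE, hEc⟩ := exists_subset_card_eq hd
  have hE' : ∀ u ∈ E, u ∈ A ∧ u ∉ Cn ∧ u ∉ Cn.biUnion F ∧ G.Adj x u := by
    intro u hu
    have := mem_filter.1 (hE hu)
    simp only [mem_sdiff, mem_union, not_or] at this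
    exact ⟨this.1.1, this.1.2.1, this.1.2.2, this.2⟩
  simp only [mem_sdiff, mem_union, not_or] at hx
  have hxE : x ∉ E := fun h => G.irrefl (hE' x h).2.2.2
  have hne : ∀ y ∈ Cn, y ≠ x := fun y hy h => hx.2.1 (h ▸ hy)
  refine ⟨fun y => if y = x then E else F y, ?_, ?_, ?_, ?_, ?_⟩
  · exact insert_subset hx.1 h.sub
  · intro y hy
    rcases mem_insert.1 hy with rfl | hy
    · simp only [if_true]
      intro u hu
      rw [mem_sdiff, mem_insert, not_or]
      exact ⟨(hE' u hu).1, fun h => hxE (h ▸ hu), (hE' u hu).2.1⟩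
    · simp only [if_neg (hne y hy)]
      intro u hu
      have h1 := mem_sdiff.1 (h.leaf y hy hu)
      rw [mem_sdiff, mem_insert, not_or]
      exact ⟨h1.1, fun h => hx.2.2 (mem_biUnion.2 ⟨y, hy, h ▸ hu⟩), h1.2⟩
  · intro y hy
    rcases mem_insert.1 hy with rfl | hy
    · simpa using hEc
    · simpa [hne y hy] using h.card y hy
  · intro y hy u hu
    rcases mem_insert.1 hy with rfl | hy
    · simp only [if_true] at hu; exact (hE' u hu).2.2.2
    · simp only [if_neg (hne y hy)] at hu; exact h.adj y hy u hu
  · have key : ∀ y ∈ Cn, Disjoint E (F y) := by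
      intro y hy
      rw [Finset.disjoint_left]
      intro u hu hu'
      exact (hE' u hu).2.2.1 (mem_biUnion.2 ⟨y, hy, hu'⟩)
    intro y hy z hz hyz
    rcases mem_insert.1 hy with hy1 | hy1 <;> rcases mem_insert.1 hz with hz1 | hz1
    · exact absurd (hy1.trans hz1.symm) hyz
    · simpa [hy1, hne z hz1] using key z hz1
    · simpa [hz1, hne y hy1] using (key y hy1).symm
    · simpa [hne y hy1, hne z hz1] using h.disj y hy1 z hz1 hyz

lemma Stars.cardU {w : ℕ} {A Cn : Finset V} {F : V → Finset V} (h : Stars G w A Cn F) :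
    (Cn ∪ Cn.biUnion F).card ≤ Cn.card * (w + 1) := by
  refine (card_union_le _ _).trans ?_
  have : (Cn.biUnion F).card ≤ Cn.card * w := card_biUnion_le_card_mul _ _ _ (fun x hx => (h.card x hx).le)
  linarith

lemma stars_exist [Fintype V] {θ β ρ : ℝ} {w : ℕ} {A : Finset V} (hO : Ore G θ) (hw : 0 < w) (hθ : 0 < θ)
    (hβ : 0 < β) (hρβ : ρ ≤ β) (hwβ : 20 * (w + 1) * β ≤ θ) (hn : 1 ≤ β * Fintype.card V)
    (hlo : (θ - ρ) * Fintype.card V ≤ (A.card : ℝ)) (hhi : (A.card : ℝ) ≤ (θ + ρ) * Fintype.card V)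
    (hin : ∀ v ∈ A, (ad G A v : ℝ) ≤ 2 * β * Fintype.card V)
    (hq : 2 * (w:ℝ) < A.card - θ * Fintype.card V) : ∀ r : ℕ, (r:ℝ) < A.card - θ * Fintype.card V + 1 →
    ∃ Cn F, Stars G w A Cn F ∧ Cn.card = r := by
  set n : ℝ := (Fintype.card V : ℝ) with hnd
  have hn0 : 0 ≤ n := by positivity
  set q : ℝ := A.card - θ * n with hqd
  have hw1 : (1:ℝ) ≤ w := by exact_mod_cast hw
  intro r
  induction r with
  | zero =>
    intro _
    exact ⟨∅, fun _ => ∅, ⟨by simp, by simp, by simp, by simp, by simp⟩, rfl⟩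
  | succ r ih =>
    intro hr
    push_cast at hr
    obtain ⟨Cn, F, hS, hc⟩ := ih (by linarith)
    set U := Cn ∪ Cn.biUnion F with hU
    suffices hex : ∃ x ∈ A \ U, w ≤ ad G (A \ U) x by
      obtain ⟨x, hx, hd⟩ := hex
      obtain ⟨F', hF'⟩ := hS.step hx hd
      refine ⟨_, F', hF', ?_⟩
      rw [card_insert_of_notMem, hc]
      intro h; exact (mem_sdiff.1 hx).2 (mem_union_left _ h)
    by_contra hno
    push Not at hno
    set L0 := A.filter fun x => θ * n < nn G univ x with hL0
    have hL0c : (L0.card : ℝ) ≤ 2 * β * n + 1 := by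
      rcases L0.eq_empty_or_nonempty with h | ⟨x, hx⟩
      · rw [h, card_empty, Nat.cast_zero]; nlinarith
      · have h1 : L0.erase x ⊆ A.filter fun u => G.Adj x u := by
          intro y hy
          obtain ⟨hyx, hy⟩ := mem_erase.1 hy
          refine mem_filter.2 ⟨(mem_filter.1 hy).1, ?_⟩
          by_contra hxy
          have := hO x y hyx.symm hxy
          have a1 := (mem_filter.1 hx).2
          have a2 := (mem_filter.1 hy).2
          linarith
        have h2 := card_le_card h1
        have h3 := card_erase_add_one hx
        have h4 := hin x (mem_filter.1 hx).1
        have h5 : (L0.card : ℝ) ≤ ad G A x + 1 := by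
          have : L0.card ≤ ad G A x + 1 := by unfold ad; omega
          exact_mod_cast this
        linarith
    set X := A \ (U ∪ L0) with hX
    have hUA : U ⊆ A := by
      refine union_subset hS.sub (biUnion_subset.2 fun x hx => (hS.leaf x hx).trans sdiff_subset)
    have hdeg : ∀ x ∈ X, q / 2 ≤ ad G U x := by
      intro x hx
      rw [hX, mem_sdiff, mem_union, not_or] at hx
      have a1 : (ad G (A \ U) x : ℝ) ≤ w := by exact_mod_cast (hno x (mem_sdiff.2 ⟨hx.1, hx.2.1⟩)).le
      have a2 : (nn G univ x : ℝ) ≤ θ * n := by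
        by_contra h; push Not at h
        exact hx.2.2 (mem_filter.2 ⟨hx.1, h⟩)
      have a3 : (nn G A x : ℝ) ≤ nn G univ x := by exact_mod_cast nn_mono (subset_univ A) x
      have a4 := ad_nn (G := G) A x
      have a5 : (ad G A x : ℝ) ≤ ad G U x + ad G (A \ U) x := by
        have : ad G A x ≤ ad G U x + ad G (A \ U) x := by
          unfold ad
          rw [← union_sdiff_of_subset hUA, filter_union]
          refine (card_union_le _ _).trans (by rw [union_sdiff_of_subset hUA])
        exact_mod_cast this
      linarith
    have hcU : (U.card : ℝ) ≤ r * (w + 1) := by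
      have := hS.cardU
      rw [hc] at this
      exact_mod_cast this
    have hsum : (X.card : ℝ) * (q/2) ≤ r * (w+1) * (2 * β * n) := by
      calc (X.card : ℝ) * (q/2) = ∑ x ∈ X, q/2 := by rw [sum_const, nsmul_eq_mul]
        _ ≤ ∑ x ∈ X, (ad G U x : ℝ) := sum_le_sum hdeg
        _ = ∑ u ∈ U, (ad G X u : ℝ) := by exact_mod_cast ad_double (G := G) X U
        _ ≤ ∑ u ∈ U, 2 * β * n := by
          refine sum_le_sum fun u hu => ?_
          refine le_trans ?_ (hin u (hUA hu))
          exact_mod_cast ad_mono sdiff_subset u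
        _ = U.card * (2 * β * n) := by rw [sum_const, nsmul_eq_mul]
        _ ≤ _ := by gcongr
    have hq0 : 0 < q := by linarith
    have hrq : (r:ℝ) ≤ q := by linarith
    have hX1 : (X.card : ℝ) ≤ 4 * (w+1) * β * n := by
      have : (X.card : ℝ) * (q/2) ≤ (4 * (w+1) * β * n) * (q/2) := by
        calc (X.card : ℝ) * (q/2) ≤ r * (w+1) * (2 * β * n) := hsum
          _ ≤ q * (w+1) * (2 * β * n) := by gcongr
          _ = _ := by ring
      exact le_of_mul_le_mul_right this (by positivity)
    have hAc : (A.card : ℝ) ≤ X.card + (U.card + L0.card) := by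
      have : A ⊆ X ∪ (U ∪ L0) := by intro u hu; simp only [hX, mem_union, mem_sdiff]; tauto
      have := (card_le_card this).trans (card_union_le _ _)
      have h2 := card_union_le U L0
      exact_mod_cast this.trans (by omega)
    have hqρ : q ≤ ρ * n := by rw [hqd]; linarith
    have hρβn : ρ * n ≤ β * n := by gcongr
    have hU2 : (U.card : ℝ) ≤ (w+1) * (β * n) := by
      calc (U.card : ℝ) ≤ r * (w+1) := hcU
        _ ≤ (β * n) * (w+1) := by gcongr; linarith
        _ = _ := by ring
    have hwn : (20 * (w+1) * β) * n ≤ θ * n := by gcongr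
    have hwβn : 1 ≤ (w:ℝ) * (β * n) := by nlinarith
    linarith

/-- output of the star step: centres removed so that `A \ Cn` is not too large -/
lemma star_step [Fintype V] {θ β ρ : ℝ} {w : ℕ} {A : Finset V} (hO : Ore G θ) (hw : 0 < w) (hθ : 0 < θ)
    (hβ : 0 < β) (hρ0 : 0 ≤ ρ) (hρβ : ρ ≤ β) (hwβ : 20 * (w + 1) * β ≤ θ) (hn : 1 ≤ β * Fintype.card V)
    (hlo : (θ - ρ) * Fintype.card V ≤ (A.card : ℝ)) (hhi : (A.card : ℝ) ≤ (θ + ρ) * Fintype.card V)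
    (hin : ∀ v ∈ A, (ad G A v : ℝ) ≤ 2 * β * Fintype.card V) :
    ∃ Cn F, Stars G w A Cn F ∧ (Cn.card : ℝ) ≤ ρ * Fintype.card V + 1 ∧
      (θ - ρ) * Fintype.card V - 1 ≤ ((A \ Cn).card : ℝ) ∧ ((A \ Cn).card : ℝ) ≤ θ * Fintype.card V + 2 * w := by
  set n : ℝ := (Fintype.card V : ℝ) with hnd
  have hn0 : 0 ≤ n := by positivity
  have hρn : 0 ≤ ρ * n := by positivity
  by_cases hq : 2 * (w:ℝ) < A.card - θ * n
  · obtain ⟨Cn, F, hS, hc⟩ := stars_exist hO hw hθ hβ hρβ hwβ hn hlo hhi hin hq ⌈(A.card : ℝ) - θ * n⌉₊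
      (Nat.ceil_lt_add_one (by linarith [(by positivity : (0:ℝ) ≤ w)]))
    have h1 : (A.card : ℝ) - θ * n ≤ Cn.card := by rw [hc]; exact Nat.le_ceil _
    have h2 : (Cn.card : ℝ) < A.card - θ * n + 1 := by
      rw [hc]; exact Nat.ceil_lt_add_one (by linarith [(by positivity : (0:ℝ) ≤ w)])
    have h3 : ((A \ Cn).card : ℝ) = A.card - Cn.card := by
      rw [card_sdiff_of_subset hS.sub, Nat.cast_sub (card_le_card hS.sub)]
    refine ⟨Cn, F, hS, by linarith, by linarith, ?_⟩
    have : (0:ℝ) ≤ w := by positivity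
    linarith
  · push Not at hq
    refine ⟨∅, fun _ => ∅, ⟨by simp, by simp, by simp, by simp, by simp⟩, ?_, ?_, ?_⟩
    · simp; linarith
    · simp; linarith
    · simp; linarith

end ModE3
end OreT

namespace OreT
section ModE4
open Finset
open scoped Classical BigOperators

variable {V : Type} {G : SimpleGraph V}

/-- the part of the graph outside the sets `A i` -/
noncomputable def Rst [Fintype V] {j : ℕ} (A : Fin j → Finset V) : Finset V := univ \ univ.biUnion A

lemma mem_Rst [Fintype V] {j : ℕ} {A : Fin j → Finset V} {v : V} : v ∈ Rst A ↔ ∀ i, v ∉ A i := by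
  simp [Rst]

/-- the extremal structure -/
structure Ext [Fintype V] (G : SimpleGraph V) (j w b d D t Q : ℕ) (A : Fin j → Finset V) (B : Finset V)
    (F : V → Finset V) : Prop where
  disj : ∀ i l, i ≠ l → Disjoint (A i) (A l)
  good : ∀ i, ∀ v, v ∉ B → v ∉ A i → nn G (A i) v ≤ d
  miss : ∀ i, ∀ v ∈ A i, nn G (univ \ A i) v ≤ D
  Bc : B.card ≤ t
  hQ : 2 * w + j * (w * d) + b * d + 2 * t ≤ Q
  big : ∀ i, Q + w * D ≤ (A i).card
  sp : ∀ x ∈ B, x ∈ Rst A → (F x = ∅ ∧ ∀ l, Q ≤ ad G (A l) x) ∨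
    ∃ i, F x ⊆ A i ∧ (F x).card = w ∧ (∀ u ∈ F x, G.Adj x u) ∧ ∀ l, l ≠ i → Q + w * D ≤ ad G (A l) x
  fdisj : ∀ x ∈ B, x ∈ Rst A → ∀ y ∈ B, y ∈ Rst A → x ≠ y → Disjoint (F x) (F y)

lemma sumb {Y F : Finset V} {f : V → ℕ} {d D : ℕ} (h1 : ∀ y ∈ Y, y ∉ F → f y ≤ d) (h2 : ∀ y ∈ F, f y ≤ D) :
    ∑ y ∈ Y, f y ≤ F.card * D + Y.card * d := by
  have h3 : ∑ y ∈ Y, f y ≤ ∑ y ∈ Y, ((if y ∈ F then D else 0) + d) := by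
    refine sum_le_sum fun y hy => ?_
    by_cases h : y ∈ F
    · rw [if_pos h]; have := h2 y h; omega
    · rw [if_neg h]; have := h1 y hy h; omega
  rw [sum_add_distrib, sum_const, smul_eq_mul] at h3
  refine h3.trans ?_
  gcongr
  rw [← sum_filter, sum_const, smul_eq_mul]
  gcongr
  intro u hu; exact (mem_filter.1 hu).2

section
variable [Fintype V] {j s w b d D t Q : ℕ} {A : Fin j → Finset V} {B : Finset V} {F : V → Finset V}

lemma Ext.core (h : Ext G j w b d D t Q A B F) (I : Finset (Fin j)) (κ : ℕ) (Y : Finset V) (E : Fin j → Finset V)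
    (hY : IsBottle G κ s w Y) (hE : ∀ l ∈ I, E l ⊆ A l \ B) (M : ℕ)
    (hM : ∀ l ∈ I, ∑ y ∈ Y, nn G (E l) y ≤ M) (hc : ∀ l ∈ I, w + j * (w * d) + M ≤ (E l).card) :
    ∃ Dd : Fin j → Finset V, (∀ l ∈ I, Dd l ⊆ E l ∧ (Dd l).card = w) ∧
      IsBottle G (κ + I.card) s w (Y ∪ I.biUnion Dd) := by
  obtain ⟨Dd, h1, h2⟩ := extend s w d I κ Y (fun l => cn G (E l) Y) hY
    (fun l _ y hy a ha => (mem_cn.1 ha).2 y hy) (by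
      intro l hl l' hl' hne a ha
      have h3 := mem_sdiff.1 (hE l hl (cn_sub _ _ ha))
      refine le_trans (nn_mono ((cn_sub _ _).trans ((hE l' hl').trans sdiff_subset)) a) (h.good l' a h3.2 ?_)
      exact Finset.disjoint_left.1 (h.disj l l' hne) h3.1) (by
      intro l hl
      have h3 := card_cn (G := G) (E l) Y
      have h4 := hM l hl
      have h5 := hc l hl
      have h6 : I.card * (w * d) ≤ j * (w * d) := by
        gcongr
        exact (card_le_univ I).trans (by simp)
      show w + I.card * (w * d) ≤ (cn G (E l) Y).card
      omega)
  exact ⟨Dd, fun l hl => ⟨(h1 l hl).1.trans (cn_sub _ _), (h1 l hl).2⟩, h2⟩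

lemma Ext.inter1 (h : Ext G j w b d D t Q A B F) {I : Finset (Fin j)} {Y : Finset V} {Dd : Fin j → Finset V}
    (hD : ∀ l ∈ I, Dd l ⊆ A l) {i : Fin j} (hi : i ∈ I) (hY : Disjoint Y (A i)) :
    (Y ∪ I.biUnion Dd) ∩ A i = Dd i := by
  ext u
  simp only [mem_inter, mem_union, mem_biUnion]
  constructor
  · rintro ⟨h1 | ⟨l, hl, hu⟩, h2⟩
    · exact absurd h2 (Finset.disjoint_left.1 hY h1)
    · by_cases hil : l = i
      · exact hil ▸ hu
      · exact absurd h2 (Finset.disjoint_left.1 (h.disj l i hil) (hD l hl hu))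
  · intro hu
    exact ⟨Or.inr ⟨i, hi, hu⟩, hD i hi hu⟩

lemma Ext.inter2 (h : Ext G j w b d D t Q A B F) {I : Finset (Fin j)} {Y : Finset V} {Dd : Fin j → Finset V}
    (hD : ∀ l ∈ I, Dd l ⊆ A l) {i : Fin j} (hi : i ∉ I) :
    (Y ∪ I.biUnion Dd) ∩ A i = Y ∩ A i := by
  ext u
  simp only [mem_inter, mem_union, mem_biUnion]
  constructor
  · rintro ⟨h1 | ⟨l, hl, hu⟩, h2⟩
    · exact ⟨h1, h2⟩
    · have hil : l ≠ i := fun h => hi (h ▸ hl)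
      exact absurd h2 (Finset.disjoint_left.1 (h.disj l i hil) (hD l hl hu))
  · rintro ⟨h1, h2⟩
    exact ⟨Or.inl h1, h2⟩

lemma Ext.missl (h : Ext G j w b d D t Q A B F) {i l : Fin j} (hil : i ≠ l) {v : V} (hv : v ∈ A i) : nn G (A l) v ≤ D := by
  refine (nn_mono ?_ v).trans (h.miss i v hv)
  intro u hu
  rw [mem_sdiff]
  exact ⟨mem_univ _, fun h' => Finset.disjoint_left.1 (h.disj i l hil) h' hu⟩

lemma card_sdiff2 (S B Fb : Finset V) : S.card ≤ (S \ (B ∪ Fb)).card + B.card + Fb.card := by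
  have h1 := card_sdiff_add_card_inter S (B ∪ Fb)
  have h2 := card_le_card (inter_subset_right : S ∩ (B ∪ Fb) ⊆ _)
  have h3 := card_union_le B Fb
  omega

/-- cover one special vertex by a neutral bottle -/
lemma Ext.step (h : Ext G j w b d D t Q A B F) {m' C Z : ℕ} {L : Finset V} (hb : b = s + (m' + j) * w)
    (hBL : Disjoint B L)
    (hres : ∀ S ⊆ Rst A, (Rst A).card ≤ S.card + Z → ResC G m' s w C S L)
    (hZ : 2 * t + w * D ≤ Z) {x : V} (hx : x ∈ B) (hxR : x ∈ Rst A) {Fb : Finset V} (hFb : Fb.card ≤ t)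
    (hxF : x ∉ Fb) (hFF : Disjoint (F x) Fb) :
    ∃ X, IsBottle G (m' + j + 1) s w X ∧ x ∈ X ∧ Disjoint X Fb ∧ (∀ u ∈ X, u ∈ B → u ∈ Rst A → u = x) ∧
      ∀ i, (X ∩ A i).card = w := by
  have hBc := h.Bc
  have hQ := h.hQ
  have hxA : ∀ i, x ∉ A i := mem_Rst.1 hxR
  rcases h.sp x hx hxR with ⟨hF0, had⟩ | ⟨i, hFi, hFc, hFa, had⟩
  · set S := insert x (Rst A \ (B ∪ Fb)) with hS
    have hSR : S ⊆ Rst A := insert_subset hxR sdiff_subset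
    obtain ⟨-, hcov, -⟩ := hres S hSR (by
      have h1 := card_sdiff2 (Rst A) B Fb
      have h2 : (Rst A \ (B ∪ Fb)).card ≤ S.card := card_le_card (subset_insert _ _)
      omega)
    obtain ⟨X0, hX0, hxX, hbot⟩ := hcov x (mem_insert_self _ _) (Finset.disjoint_left.1 hBL hx)
    have hX0' : ∀ u ∈ X0, u ≠ x → u ∈ Rst A ∧ u ∉ B ∧ u ∉ Fb := by
      intro u hu hux
      have := hX0 hu
      simp only [hS, mem_insert, hux, false_or, mem_sdiff, mem_union, not_or] at this
      exact this
    have hXc := hbot.card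
    have hm'w : m' * w ≤ (m' + j) * w := by gcongr; omega
    obtain ⟨Dd, h1, h2⟩ := h.core univ (m'+1) X0 (fun l => (A l \ (B ∪ Fb)).filter fun u => G.Adj x u) hbot (by
      intro l _ u hu
      simp only [mem_filter, mem_sdiff, mem_union, not_or] at hu
      exact mem_sdiff.2 ⟨hu.1.1, hu.1.2.1⟩) (b * d) (by
      intro l _
      refine (sumb (F := ∅) (d := d) (D := 0) ?_ (by simp)).trans ?_
      · intro y hy _
        by_cases hyx : y = x
        · subst hyx
          unfold nn
          rw [filter_filter]
          rw [filter_eq_empty_iff.2]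
          · simp
          · intro u hu; tauto
        · obtain ⟨a1, a2, a3⟩ := hX0' y hy hyx
          exact (nn_mono ((filter_subset _ _).trans sdiff_subset) y).trans (h.good l y a2 (mem_Rst.1 a1 l))
      · rw [card_empty, zero_mul, zero_add]
        gcongr
        omega) (by
      intro l _
      have a1 := had l
      have a2 : ad G (A l) x ≤ ((A l \ (B ∪ Fb)).filter fun u => G.Adj x u).card + (B ∪ Fb).card := by
        refine (ad_mono (T := (A l \ (B ∪ Fb)) ∪ (B ∪ Fb)) ?_ x).trans (ad_union_le _ _ x)
        intro u hu; simp only [mem_union, mem_sdiff]; tauto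
      have a3 := card_union_le B Fb
      show w + j * (w * d) + b * d ≤ ((A l \ (B ∪ Fb)).filter fun u => G.Adj x u).card
      omega)
    have hDA : ∀ l ∈ (univ : Finset (Fin j)), Dd l ⊆ A l := fun l hl => (h1 l hl).1.trans ((filter_subset _ _).trans sdiff_subset)
    refine ⟨_, by simpa [add_assoc, add_comm, add_left_comm] using h2, mem_union_left _ hxX, ?_, ?_, ?_⟩
    · rw [Finset.disjoint_left]
      intro u hu huF
      rcases mem_union.1 hu with hu | hu
      · by_cases hux : u = x
        · exact hxF (hux ▸ huF)
        · exact (hX0' u hu hux).2.2 huF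
      · obtain ⟨l, hl, hu⟩ := mem_biUnion.1 hu
        have := (h1 l hl).1 hu
        simp only [mem_filter, mem_sdiff, mem_union, not_or] at this
        exact this.1.2.2 huF
    · intro u hu huB huR
      rcases mem_union.1 hu with hu | hu
      · by_contra hux
        exact (hX0' u hu hux).2.1 huB
      · obtain ⟨l, hl, hu⟩ := mem_biUnion.1 hu
        exact absurd (hDA l hl hu) (mem_Rst.1 huR l)
    · intro i
      rw [h.inter1 hDA (mem_univ i)]
      · exact (h1 i (mem_univ i)).2
      · rw [Finset.disjoint_left]
        intro u hu
        exact mem_Rst.1 (hSR (hX0 hu)) i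
  · set S := insert x (cn G (Rst A \ (B ∪ Fb)) (F x)) with hS
    have hSR : S ⊆ Rst A := insert_subset hxR ((cn_sub _ _).trans sdiff_subset)
    obtain ⟨-, hcov, -⟩ := hres S hSR (by
      have h1 := card_sdiff2 (Rst A) B Fb
      have h2 : (cn G (Rst A \ (B ∪ Fb)) (F x)).card ≤ S.card := card_le_card (subset_insert _ _)
      have h3 := card_cn (G := G) (Rst A \ (B ∪ Fb)) (F x)
      have h4 : ∑ y ∈ F x, nn G (Rst A \ (B ∪ Fb)) y ≤ ∑ y ∈ F x, D := by
        refine sum_le_sum fun y hy => (nn_mono ?_ y).trans (h.miss i y (hFi hy))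
        intro u hu
        exact mem_sdiff.2 ⟨mem_univ _, mem_Rst.1 (mem_sdiff.1 hu).1 i⟩
      rw [sum_const, hFc, smul_eq_mul] at h4
      omega)
    obtain ⟨X0, hX0, hxX, hbot⟩ := hcov x (mem_insert_self _ _) (Finset.disjoint_left.1 hBL hx)
    have hX0' : ∀ u ∈ X0, u ≠ x → (u ∈ Rst A ∧ u ∉ B ∧ u ∉ Fb) ∧ ∀ y ∈ F x, G.Adj y u := by
      intro u hu hux
      have := hX0 hu
      simp only [hS, mem_insert, hux, false_or, mem_cn, mem_sdiff, mem_union, not_or] at this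
      exact this
    have hbot2 := hbot.cons hFc (by
      intro u hu y hy
      by_cases hux : u = x
      · subst hux; exact hFa y hy
      · exact ((hX0' u hu hux).2 y hy).symm)
    have hXc := hbot2.card
    have hj : 1 ≤ j := Nat.succ_le_of_lt (lt_of_le_of_lt (Nat.zero_le _) i.2)
    have hm'w : (m'+1) * w ≤ (m' + j) * w := by gcongr
    have hne : ∀ l ∈ univ.erase i, l ≠ i := fun l hl => (mem_erase.1 hl).1
    obtain ⟨Dd, h1, h2⟩ := h.core (univ.erase i) (m'+1+1) (X0 ∪ F x) (fun l => (A l \ (B ∪ Fb)).filter fun u => G.Adj x u) hbot2 (by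
      intro l _ u hu
      simp only [mem_filter, mem_sdiff, mem_union, not_or] at hu
      exact mem_sdiff.2 ⟨hu.1.1, hu.1.2.1⟩) (w * D + b * d) (by
      intro l hl
      refine (sumb (F := F x) (d := d) (D := D) ?_ ?_).trans ?_
      · intro y hy hyF
        have hy := (mem_union.1 hy).resolve_right hyF
        by_cases hyx : y = x
        · subst hyx
          unfold nn
          rw [filter_filter]
          rw [filter_eq_empty_iff.2]
          · simp
          · intro u hu; tauto
        · obtain ⟨⟨a1, a2, a3⟩, -⟩ := hX0' y hy hyx
          exact (nn_mono ((filter_subset _ _).trans sdiff_subset) y).trans (h.good l y a2 (mem_Rst.1 a1 l))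
      · intro y hy
        exact (nn_mono ((filter_subset _ _).trans sdiff_subset) y).trans (h.missl (hne l hl).symm (hFi hy))
      · rw [hFc]
        gcongr
        omega) (by
      intro l hl
      have a1 := had l (hne l hl)
      have a2 : ad G (A l) x ≤ ((A l \ (B ∪ Fb)).filter fun u => G.Adj x u).card + (B ∪ Fb).card := by
        refine (ad_mono (T := (A l \ (B ∪ Fb)) ∪ (B ∪ Fb)) ?_ x).trans (ad_union_le _ _ x)
        intro u hu; simp only [mem_union, mem_sdiff]; tauto
      have a3 := card_union_le B Fb
      show w + j * (w * d) + (w * D + b * d) ≤ ((A l \ (B ∪ Fb)).filter fun u => G.Adj x u).card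
      omega)
    have hDA : ∀ l ∈ univ.erase i, Dd l ⊆ A l := fun l hl => (h1 l hl).1.trans ((filter_subset _ _).trans sdiff_subset)
    have hX0A : ∀ l, Disjoint X0 (A l) := by
      intro l
      rw [Finset.disjoint_left]
      intro u hu
      exact mem_Rst.1 (hSR (hX0 hu)) l
    refine ⟨X0 ∪ F x ∪ (univ.erase i).biUnion Dd, ?_, mem_union_left _ (mem_union_left _ hxX), ?_, ?_, ?_⟩
    · rw [card_erase_of_mem (mem_univ i), card_univ, Fintype.card_fin, show m' + 1 + 1 + (j - 1) = m' + j + 1 by omega] at h2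
      exact h2
    · rw [Finset.disjoint_left]
      intro u hu huF
      rcases mem_union.1 hu with hu | hu
      · rcases mem_union.1 hu with hu | hu
        · by_cases hux : u = x
          · exact hxF (hux ▸ huF)
          · exact (hX0' u hu hux).1.2.2 huF
        · exact Finset.disjoint_left.1 hFF hu huF
      · obtain ⟨l, hl, hu⟩ := mem_biUnion.1 hu
        have := (h1 l hl).1 hu
        simp only [mem_filter, mem_sdiff, mem_union, not_or] at this
        exact this.1.2.2 huF
    · intro u hu huB huR
      rcases mem_union.1 hu with hu | hu
      · rcases mem_union.1 hu with hu | hu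
        · by_contra hux
          exact (hX0' u hu hux).1.2.1 huB
        · exact absurd (hFi hu) (mem_Rst.1 huR i)
      · obtain ⟨l, hl, hu⟩ := mem_biUnion.1 hu
        exact absurd (hDA l hl hu) (mem_Rst.1 huR l)
    · intro l
      by_cases hl : l = i
      · subst hl
        rw [h.inter2 hDA (by simp), union_inter_distrib_right, (disjoint_iff_inter_eq_empty.1 (hX0A l)), empty_union,
          inter_eq_left.2 hFi, hFc]
      · rw [h.inter1 hDA (mem_erase.2 ⟨hl, mem_univ l⟩)]
        · exact (h1 l (mem_erase.2 ⟨hl, mem_univ l⟩)).2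
        · rw [disjoint_union_left]
          exact ⟨hX0A l, disjoint_of_subset_left hFi (h.disj i l (Ne.symm hl))⟩

/-- a gadget bottle using only `s` vertices of `A i` -/
lemma Ext.gadget (h : Ext G j w b d D t Q A B F) {m' C Z : ℕ} {L : Finset V} (hb : b = s + (m' + j) * w) (hsw : s < w)
    (hres : ∀ S ⊆ Rst A, (Rst A).card ≤ S.card + Z → ResC G m' s w C S L)
    (hZ : 2 * t + w * D ≤ Z) (i : Fin j) {Fb : Finset V} (hFb : Fb.card ≤ t) :
    ∃ X, IsBottle G (m' + j + 1) s w X ∧ Disjoint X Fb ∧ 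
      (X ∩ A i).card = s ∧ ∀ l, l ≠ i → (X ∩ A l).card = w := by
  have hBc := h.Bc
  have hQ := h.hQ
  obtain ⟨-, -, Y0, hY0, hbot⟩ := hres (Rst A \ (B ∪ Fb)) sdiff_subset (by
    have h1 := card_sdiff2 (Rst A) B Fb
    omega)
  have hY0' : ∀ u ∈ Y0, u ∈ Rst A ∧ u ∉ B ∧ u ∉ Fb := by
    intro u hu
    have := hY0 hu
    simp only [mem_sdiff, mem_union, not_or] at this
    exact this
  have hj : 1 ≤ j := Nat.succ_le_of_lt (lt_of_le_of_lt (Nat.zero_le _) i.2)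
  have hm'w : (m'+1) * w ≤ (m' + j) * w := by gcongr
  have hm'1 : (m'+1) * w = m' * w + w := by ring
  have hY0c := hbot.card
  have hcn : s ≤ (cn G (A i \ (B ∪ Fb)) Y0).card := by
    have h1 := card_sdiff2 (A i) B Fb
    have h3 := card_cn (G := G) (A i \ (B ∪ Fb)) Y0
    have h4 : ∑ y ∈ Y0, nn G (A i \ (B ∪ Fb)) y ≤ ∑ y ∈ Y0, d := sum_le_sum fun y hy => 
      (nn_mono sdiff_subset y).trans (h.good i y (hY0' y hy).2.1 (mem_Rst.1 (hY0' y hy).1 i))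
    rw [sum_const, smul_eq_mul] at h4
    have h5 := h.big i
    have h6 : Y0.card * d ≤ b * d := by gcongr; omega
    omega
  obtain ⟨E, hE, hEc⟩ := exists_subset_card_eq hcn
  have hE' : ∀ u ∈ E, (u ∈ A i ∧ u ∉ B ∧ u ∉ Fb) ∧ ∀ y ∈ Y0, G.Adj y u := by
    intro u hu
    have := hE hu
    simp only [mem_cn, mem_sdiff, mem_union, not_or] at this
    exact this
  have hbot2 := hbot.consNeck hEc (fun y hy u hu => (hE' u hu).2 y hy)
  have hXc := hbot2.card
  have hne : ∀ l ∈ univ.erase i, l ≠ i := fun l hl => (mem_erase.1 hl).1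
  obtain ⟨Dd, h1, h2⟩ := h.core (univ.erase i) (m'+1+1) (Y0 ∪ E) (fun l => A l \ (B ∪ Fb)) hbot2 (by
    intro l _ u hu
    simp only [mem_sdiff, mem_union, not_or] at hu
    exact mem_sdiff.2 ⟨hu.1, hu.2.1⟩) (b * d) (by
    intro l hl
    refine (sumb (F := ∅) (d := d) (D := 0) ?_ (by simp)).trans ?_
    · intro y hy _
      rcases mem_union.1 hy with hy | hy
      · exact (nn_mono sdiff_subset y).trans (h.good l y (hY0' y hy).2.1 (mem_Rst.1 (hY0' y hy).1 l))
      · exact (nn_mono sdiff_subset y).trans (h.good l y (hE' y hy).1.2.1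
          (Finset.disjoint_left.1 (h.disj i l (hne l hl).symm) (hE' y hy).1.1))
    · rw [card_empty, zero_mul, zero_add]
      gcongr
      omega) (by
    intro l hl
    have a1 := h.big l
    have a2 := card_sdiff2 (A l) B Fb
    show w + j * (w * d) + b * d ≤ (A l \ (B ∪ Fb)).card
    omega)
  have hDA : ∀ l ∈ univ.erase i, Dd l ⊆ A l := fun l hl => (h1 l hl).1.trans sdiff_subset
  have hY0A : ∀ l, Disjoint Y0 (A l) := by
    intro l
    rw [Finset.disjoint_left]
    intro u hu
    exact mem_Rst.1 (hY0' u hu).1 l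
  have hEi : E ⊆ A i := fun u hu => (hE' u hu).1.1
  refine ⟨Y0 ∪ E ∪ (univ.erase i).biUnion Dd, ?_, ?_, ?_, ?_⟩
  · rw [card_erase_of_mem (mem_univ i), card_univ, Fintype.card_fin, show m' + 1 + 1 + (j - 1) = m' + j + 1 by omega] at h2
    exact h2
  · rw [Finset.disjoint_left]
    intro u hu huF
    rcases mem_union.1 hu with hu | hu
    · rcases mem_union.1 hu with hu | hu
      · exact (hY0' u hu).2.2 huF
      · exact (hE' u hu).1.2.2 huF
    · obtain ⟨l, hl, hu⟩ := mem_biUnion.1 hu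
      have := (h1 l hl).1 hu
      simp only [mem_sdiff, mem_union, not_or] at this
      exact this.2.2 huF
  · rw [h.inter2 hDA (by simp), union_inter_distrib_right, (disjoint_iff_inter_eq_empty.1 (hY0A i)), empty_union,
      inter_eq_left.2 hEi, hEc]
  · intro l hl
    rw [h.inter1 hDA (mem_erase.2 ⟨hl, mem_univ l⟩)]
    · exact (h1 l (mem_erase.2 ⟨hl, mem_univ l⟩)).2
    · rw [disjoint_union_left]
      exact ⟨hY0A l, disjoint_of_subset_left hEi (h.disj i l (Ne.symm hl))⟩

end
end ModE4
end OreT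

namespace OreT
section ModE5
open Finset
open scoped Classical BigOperators

variable {V : Type} {G : SimpleGraph V}
variable [Fintype V] {j s w b d D t Q : ℕ} {A : Fin j → Finset V} {B : Finset V} {F : V → Finset V}

lemma adF {x : V} {S B Fb : Finset V} : ad G S x ≤ ((S \ (B ∪ Fb)).filter fun u => G.Adj x u).card + B.card + Fb.card := by
  have a2 : ad G S x ≤ ((S \ (B ∪ Fb)).filter fun u => G.Adj x u).card + (B ∪ Fb).card := by
    refine (ad_mono (T := (S \ (B ∪ Fb)) ∪ (B ∪ Fb)) ?_ x).trans (ad_union_le _ _ x)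
    intro u hu; simp only [mem_union, mem_sdiff]; tauto
  have a3 := card_union_le B Fb
  omega

lemma nnself {x : V} {S : Finset V} : nn G (S.filter fun u => G.Adj x u) x = 0 := by
  unfold nn
  rw [filter_filter, filter_eq_empty_iff.2]
  · simp
  · intro u hu; tauto

lemma Ext.step0 (h : Ext G j w b d D t Q A B F) (hw : 0 < w) (hb : b = j * w)
    {x : V} (hx : x ∈ B) (hxR : x ∈ Rst A) {Fb : Finset V} (hFb : Fb.card ≤ t)
    (hxF : x ∉ Fb) (hFF : Disjoint (F x) Fb) (l : Fin j) :
    ∃ X, IsBottle G (j + 1) 0 w X ∧ x ∈ X ∧ Disjoint X Fb ∧ (X ∩ A l).card + 1 = w ∧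
      ∀ i, i ≠ l → (X ∩ A i).card = w := by
  have hBc := h.Bc
  have hQ := h.hQ
  have hxA : ∀ i, x ∉ A i := mem_Rst.1 hxR
  have hj : 1 ≤ j := Nat.succ_le_of_lt (lt_of_le_of_lt (Nat.zero_le _) l.2)
  have hwb : w ≤ b := by rw [hb]; exact Nat.le_mul_of_pos_left _ hj
  have hcase : (∀ i, i ≠ l → Q ≤ ad G (A i) x) ∨ ∃ i, i ≠ l ∧ F x ⊆ A i ∧ (F x).card = w ∧ (∀ u ∈ F x, G.Adj x u) ∧
      ∀ l', l' ≠ i → Q + w * D ≤ ad G (A l') x := by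
    rcases h.sp x hx hxR with ⟨-, h1⟩ | ⟨i, h1, h2, h3, h4⟩
    · exact Or.inl fun i _ => h1 i
    · by_cases hil : i = l
      · subst hil
        exact Or.inl fun i' hi' => le_trans (Nat.le_add_right _ _) (h4 i' hi')
      · exact Or.inr ⟨i, hil, h1, h2, h3, h4⟩
  rcases hcase with had | ⟨i, hil, hFi, hFc, hFa, had⟩
  · have hEl : w - 1 ≤ (A l \ (B ∪ Fb)).card := by
      have := card_sdiff2 (A l) B Fb
      have := h.big l
      omega
    obtain ⟨E, hE, hEc⟩ := exists_subset_card_eq hEl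
    have hE' : ∀ u ∈ E, u ∈ A l ∧ u ∉ B ∧ u ∉ Fb := by
      intro u hu
      have := hE hu
      simp only [mem_sdiff, mem_union, not_or] at this
      exact this
    have hxE : x ∉ E := fun h' => hxA l (hE' x h').1
    have hYc : (insert x E).card = w := by rw [card_insert_of_notMem hxE]; omega
    have hbot := bottle_two (G := G) hYc
    have hne : ∀ l' ∈ univ.erase l, l' ≠ l := fun l' hl => (mem_erase.1 hl).1
    obtain ⟨Dd, h1, h2⟩ := h.core (univ.erase l) (1+1) (insert x E) (fun l => (A l \ (B ∪ Fb)).filter fun u => G.Adj x u) hbot (by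
      intro l _ u hu
      simp only [mem_filter, mem_sdiff, mem_union, not_or] at hu
      exact mem_sdiff.2 ⟨hu.1.1, hu.1.2.1⟩) (b * d) (by
      intro l' hl'
      refine (sumb (F := ∅) (d := d) (D := 0) ?_ (by simp)).trans ?_
      · intro y hy _
        rcases mem_insert.1 hy with rfl | hy
        · rw [nnself]; omega
        · exact (nn_mono ((filter_subset _ _).trans sdiff_subset) y).trans (h.good l' y (hE' y hy).2.1 
            (Finset.disjoint_left.1 (h.disj l l' (hne l' hl').symm) (hE' y hy).1))
      · rw [card_empty, zero_mul, zero_add]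
        gcongr
        omega) (by
      intro l' hl'
      have a1 := had l' (hne l' hl')
      have a2 := adF (G := G) (x := x) (S := A l') (B := B) (Fb := Fb)
      show w + j * (w * d) + b * d ≤ ((A l' \ (B ∪ Fb)).filter fun u => G.Adj x u).card
      omega)
    have hDA : ∀ l' ∈ univ.erase l, Dd l' ⊆ A l' := fun l' hl => (h1 l' hl).1.trans ((filter_subset _ _).trans sdiff_subset)
    refine ⟨insert x E ∪ (univ.erase l).biUnion Dd, ?_, mem_union_left _ (mem_insert_self _ _), ?_, ?_, ?_⟩
    · rw [card_erase_of_mem (mem_univ l), card_univ, Fintype.card_fin, show 1 + 1 + (j - 1) = j + 1 by omega] at h2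
      exact h2
    · rw [Finset.disjoint_left]
      intro u hu huF
      rcases mem_union.1 hu with hu | hu
      · rcases mem_insert.1 hu with rfl | hu
        · exact hxF huF
        · exact (hE' u hu).2.2 huF
      · obtain ⟨l', hl, hu⟩ := mem_biUnion.1 hu
        have := (h1 l' hl).1 hu
        simp only [mem_filter, mem_sdiff, mem_union, not_or] at this
        exact this.1.2.2 huF
    · rw [h.inter2 hDA (by simp)]
      have : insert x E ∩ A l = E := by
        ext u
        simp only [mem_inter, mem_insert]
        constructor
        · rintro ⟨rfl | h', h''⟩
          · exact absurd h'' (hxA l)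
          · exact h'
        · intro hu; exact ⟨Or.inr hu, (hE' u hu).1⟩
      rw [this]; omega
    · intro i hi
      rw [h.inter1 hDA (mem_erase.2 ⟨hi, mem_univ i⟩)]
      · exact (h1 i (mem_erase.2 ⟨hi, mem_univ i⟩)).2
      · rw [Finset.disjoint_left]
        intro u hu
        rcases mem_insert.1 hu with rfl | hu
        · exact hxA i
        · exact Finset.disjoint_left.1 (h.disj l i hi.symm) (hE' u hu).1
  · have hEl : w - 1 ≤ (cn G (A l \ (B ∪ Fb)) (F x)).card := by
      have h1 := card_sdiff2 (A l) B Fb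
      have h2 := h.big l
      have h3 := card_cn (G := G) (A l \ (B ∪ Fb)) (F x)
      have h4 : ∑ y ∈ F x, nn G (A l \ (B ∪ Fb)) y ≤ ∑ y ∈ F x, D := sum_le_sum fun y hy => 
        (nn_mono sdiff_subset y).trans (h.missl hil (hFi hy))
      rw [sum_const, hFc, smul_eq_mul] at h4
      omega
    obtain ⟨E, hE, hEc⟩ := exists_subset_card_eq hEl
    have hE' : ∀ u ∈ E, (u ∈ A l ∧ u ∉ B ∧ u ∉ Fb) ∧ ∀ y ∈ F x, G.Adj y u := by
      intro u hu
      have := hE hu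
      simp only [mem_cn, mem_sdiff, mem_union, not_or] at this
      exact this
    have hxE : x ∉ E := fun h' => hxA l (hE' x h').1.1
    have hYc : (insert x E).card = w := by rw [card_insert_of_notMem hxE]; omega
    have hbot0 := bottle_two (G := G) hYc
    have hbot := hbot0.cons hFc (by
      intro u hu y hy
      rcases mem_insert.1 hu with rfl | hu
      · exact hFa y hy
      · exact ((hE' u hu).2 y hy).symm)
    have hXc := hbot.card
    have hj2 : 2 ≤ j := by
      have h1 : ({i, l} : Finset (Fin j)).card = 2 := card_pair hil
      have h2 := card_le_univ ({i, l} : Finset (Fin j))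
      rw [h1, Fintype.card_fin] at h2
      exact h2
    have h2w : 2 * w ≤ j * w := by gcongr
    set I := (univ.erase l).erase i with hI
    have hIc : I.card = j - 2 := by
      rw [hI, card_erase_of_mem (mem_erase.2 ⟨hil, mem_univ i⟩), card_erase_of_mem (mem_univ l), card_univ, Fintype.card_fin]
      omega
    have hne : ∀ l' ∈ I, l' ≠ l := fun l' hl => (mem_erase.1 (mem_erase.1 hl).2).1
    have hnei : ∀ l' ∈ I, l' ≠ i := fun l' hl => (mem_erase.1 hl).1
    obtain ⟨Dd, h1, h2⟩ := h.core I (1+1+1) (insert x E ∪ F x) (fun l => (A l \ (B ∪ Fb)).filter fun u => G.Adj x u) hbot (by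
      intro l _ u hu
      simp only [mem_filter, mem_sdiff, mem_union, not_or] at hu
      exact mem_sdiff.2 ⟨hu.1.1, hu.1.2.1⟩) (w * D + b * d) (by
      intro l' hl'
      refine (sumb (F := F x) (d := d) (D := D) ?_ ?_).trans ?_
      · intro y hy hyF
        rcases mem_insert.1 ((mem_union.1 hy).resolve_right hyF) with rfl | hy
        · rw [nnself]; omega
        · exact (nn_mono ((filter_subset _ _).trans sdiff_subset) y).trans (h.good l' y (hE' y hy).1.2.1 
            (Finset.disjoint_left.1 (h.disj l l' (hne l' hl').symm) (hE' y hy).1.1))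
      · intro y hy
        exact (nn_mono ((filter_subset _ _).trans sdiff_subset) y).trans (h.missl (hnei l' hl').symm (hFi hy))
      · rw [hFc]
        gcongr
        omega) (by
      intro l' hl'
      have a1 := had l' (hnei l' hl')
      have a2 := adF (G := G) (x := x) (S := A l') (B := B) (Fb := Fb)
      show w + j * (w * d) + (w * D + b * d) ≤ ((A l' \ (B ∪ Fb)).filter fun u => G.Adj x u).card
      omega)
    have hDA : ∀ l' ∈ I, Dd l' ⊆ A l' := fun l' hl => (h1 l' hl).1.trans ((filter_subset _ _).trans sdiff_subset)
    have hIntr : ∀ l', l' ≠ l → Disjoint (insert x E) (A l') := by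
      intro l' hl'
      rw [Finset.disjoint_left]
      intro u hu
      rcases mem_insert.1 hu with rfl | hu
      · exact hxA l'
      · exact Finset.disjoint_left.1 (h.disj l l' hl'.symm) (hE' u hu).1.1
    refine ⟨insert x E ∪ F x ∪ I.biUnion Dd, ?_, mem_union_left _ (mem_union_left _ (mem_insert_self _ _)), ?_, ?_, ?_⟩
    · rw [hIc, show 1 + 1 + 1 + (j - 2) = j + 1 by omega] at h2
      exact h2
    · rw [Finset.disjoint_left]
      intro u hu huF
      rcases mem_union.1 hu with hu | hu
      · rcases mem_union.1 hu with hu | hu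
        · rcases mem_insert.1 hu with rfl | hu
          · exact hxF huF
          · exact (hE' u hu).1.2.2 huF
        · exact Finset.disjoint_left.1 hFF hu huF
      · obtain ⟨l', hl, hu⟩ := mem_biUnion.1 hu
        have := (h1 l' hl).1 hu
        simp only [mem_filter, mem_sdiff, mem_union, not_or] at this
        exact this.1.2.2 huF
    · rw [h.inter2 hDA (by simp [hI])]
      have : (insert x E ∪ F x) ∩ A l = E := by
        ext u
        simp only [mem_inter, mem_insert, mem_union]
        constructor
        · rintro ⟨(rfl | h') | h', h''⟩
          · exact absurd h'' (hxA l)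
          · exact h'
          · exact absurd h'' (Finset.disjoint_left.1 (h.disj i l hil) (hFi h'))
        · intro hu; exact ⟨Or.inl (Or.inr hu), (hE' u hu).1.1⟩
      rw [this]; omega
    · intro i' hi'
      by_cases hii : i' = i
      · subst hii
        rw [h.inter2 hDA (by simp [hI]), union_inter_distrib_right, disjoint_iff_inter_eq_empty.1 (hIntr _ hi'), empty_union,
          inter_eq_left.2 hFi, hFc]
      · have hm : i' ∈ I := mem_erase.2 ⟨hii, mem_erase.2 ⟨hi', mem_univ _⟩⟩
        rw [h.inter1 hDA hm]
        · exact (h1 i' hm).2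
        · rw [disjoint_union_left]
          exact ⟨hIntr _ hi', disjoint_of_subset_left hFi (h.disj i i' (Ne.symm hii))⟩

end ModE5
end OreT

namespace OreT
section ModE6
open Finset
open scoped Classical BigOperators

variable {V : Type} {G : SimpleGraph V}

/-- generic covering schedule -/
lemma sched {w b t : ℕ} {F : V → Finset V} (Pr : Finset V → Prop) (Sp : Finset V)
    (hF1 : ∀ x ∈ Sp, Disjoint (F x) Sp) (hF2 : ∀ x ∈ Sp, (F x).card ≤ w)
    (hF3 : ∀ x ∈ Sp, ∀ y ∈ Sp, x ≠ y → Disjoint (F x) (F y))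
    (ht : (b + 1 + w) * Sp.card ≤ t) (h0 : Pr ∅)
    (hstep : ∀ x ∈ Sp, ∀ U Fb : Finset V, Pr U → U ⊆ Fb → Fb.card ≤ t → x ∉ Fb → Disjoint (F x) Fb →
      ∃ X, X.card = b ∧ x ∈ X ∧ Disjoint X Fb ∧ Pr (U ∪ X)) :
    ∃ U, Pr U ∧ Sp ⊆ U ∧ U.card = b * Sp.card := by
  have key : ∀ S1 ⊆ Sp, ∃ U, Pr U ∧ S1 ⊆ U ∧ U.card = b * S1.card ∧
      ∀ y ∈ Sp, y ∉ S1 → y ∉ U ∧ Disjoint (F y) U := by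
    intro S1
    induction S1 using Finset.induction_on with
    | empty => intro _; exact ⟨∅, h0, by simp, by simp, by simp⟩
    | insert x S1 hx ih =>
      intro hS
      obtain ⟨U, hU, hSU, hUc, hUd⟩ := ih ((subset_insert _ _).trans hS)
      have hxS : x ∈ Sp := hS (mem_insert_self _ _)
      set R := Sp \ insert x S1 with hR
      have hRS : R ⊆ Sp := sdiff_subset
      have hxR : x ∉ R := by simp [hR]
      have hRn : ∀ y ∈ R, y ∈ Sp ∧ y ≠ x ∧ y ∉ S1 := by
        intro y hy
        rw [hR, mem_sdiff, mem_insert, not_or] at hy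
        exact ⟨hy.1, hy.2.1, hy.2.2⟩
      obtain ⟨X, hXc, hxX, hXd, hXP⟩ := hstep x hxS U (U ∪ (R ∪ R.biUnion F)) hU subset_union_left (by
        have h1 := card_union_le U (R ∪ R.biUnion F)
        have h2 := card_union_le R (R.biUnion F)
        have h3 : (R.biUnion F).card ≤ R.card * w := card_biUnion_le_card_mul _ _ _ (fun y hy => hF2 y (hRS hy))
        have h4 := card_le_card hRS
        have h5 : S1.card ≤ Sp.card := card_le_card ((subset_insert _ _).trans hS)
        have h6 : b * S1.card ≤ b * Sp.card := by gcongr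
        have h7 : R.card * w ≤ Sp.card * w := by gcongr
        have h8 : (b + 1 + w) * Sp.card = b * Sp.card + Sp.card + Sp.card * w := by ring
        omega) (by
        rw [mem_union, mem_union, mem_biUnion, not_or, not_or]
        refine ⟨(hUd x hxS hx).1, hxR, ?_⟩
        rintro ⟨y, hy, hxy⟩
        exact Finset.disjoint_left.1 (hF1 y (hRS hy)) hxy hxS) (by
        rw [disjoint_union_right, disjoint_union_right]
        refine ⟨(hUd x hxS hx).2, disjoint_of_subset_right hRS (hF1 x hxS), ?_⟩
        rw [disjoint_biUnion_right]
        intro y hy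
        exact hF3 x hxS y (hRS hy) (hRn y hy).2.1.symm)
      rw [disjoint_union_right, disjoint_union_right, disjoint_biUnion_right] at hXd
      refine ⟨U ∪ X, hXP, insert_subset (mem_union_right _ hxX) (hSU.trans subset_union_left), ?_, ?_⟩
      · rw [card_union_of_disjoint hXd.1.symm, hUc, hXc, card_insert_of_notMem hx]; ring
      · intro y hy hyS
        have hyR : y ∈ R := mem_sdiff.2 ⟨hy, hyS⟩
        have h1 := hUd y hy (hRn y hyR).2.2
        refine ⟨?_, ?_⟩
        · rw [mem_union, not_or]
          exact ⟨h1.1, fun h => Finset.disjoint_left.1 hXd.2.1 h hyR⟩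
        · rw [disjoint_union_right]
          exact ⟨h1.2, (hXd.2.2 y hyR).symm⟩
  obtain ⟨U, h1, h2, h3, -⟩ := key Sp (Subset.refl _)
  exact ⟨U, h1, h2, h3⟩

/-- imbalance of `A` with respect to the vertices not in `U` -/
noncomputable def Pot [Fintype V] (w b : ℕ) (A U : Finset V) : ℤ := w * ((univ \ U).card : ℤ) - b * ((A \ U).card : ℤ)

lemma pot_union [Fintype V] {w b : ℕ} {A U X : Finset V} (hd : Disjoint X U) (hX : X.card = b) :
    Pot w b A (U ∪ X) = Pot w b A U - w * b + b * ((X ∩ A).card : ℤ) := by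
  unfold Pot
  have h1 : (univ \ (U ∪ X)).card + b = (univ \ U).card := by
    rw [← hX, ← card_union_of_disjoint]
    · congr 1; ext u
      have := fun h : u ∈ X => Finset.disjoint_left.1 hd h
      simp only [mem_union, mem_sdiff, mem_univ]; tauto
    · rw [Finset.disjoint_left]; intro u hu; simp only [mem_union, mem_sdiff] at hu; tauto
  have h2 : (A \ (U ∪ X)).card + (X ∩ A).card = (A \ U).card := by
    rw [← card_union_of_disjoint]
    · congr 1; ext u
      have := fun h : u ∈ X => Finset.disjoint_left.1 hd h
      simp only [mem_union, mem_sdiff, mem_inter]; tauto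
    · rw [Finset.disjoint_left]; intro u hu; simp only [mem_union, mem_sdiff, mem_inter] at hu ⊢; tauto
  rw [← h1, ← h2]; push_cast; ring

section
variable [Fintype V] {j s w b d D t Q : ℕ} {A : Fin j → Finset V} {B : Finset V} {F : V → Finset V}

lemma part_card (hdisj : ∀ i l, i ≠ l → Disjoint (A i) (A l)) (U : Finset V) :
    (univ \ U).card = (Rst A \ U).card + ∑ i, (A i \ U).card := by
  rw [← card_biUnion, ← card_union_of_disjoint]
  · congr 1
    ext u
    simp only [mem_sdiff, mem_univ, true_and, mem_union, mem_biUnion, mem_Rst]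
    constructor
    · intro h
      by_cases h' : ∃ i, u ∈ A i
      · obtain ⟨i, hi⟩ := h'; exact Or.inr ⟨i, hi, h⟩
      · push Not at h'; exact Or.inl ⟨h', h⟩
    · rintro (h | ⟨i, h⟩)
      · exact h.2
      · exact h.2
  · rw [Finset.disjoint_left]
    intro u hu hu'
    obtain ⟨i, -, hi⟩ := mem_biUnion.1 hu'
    exact mem_Rst.1 (mem_sdiff.1 hu).1 i (mem_sdiff.1 hi).1
  · intro i _ l _ hil
    exact disjoint_of_subset_left sdiff_subset (disjoint_of_subset_right sdiff_subset (hdisj i l hil))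

lemma Ext.f1 (h : Ext G j w b d D t Q A B F) : ∀ x ∈ B ∩ Rst A, Disjoint (F x) (B ∩ Rst A) := by
  intro x hx
  obtain ⟨h1, h2⟩ := mem_inter.1 hx
  rcases h.sp x h1 h2 with ⟨h3, -⟩ | ⟨i, h3, -⟩
  · rw [h3]; exact disjoint_empty_left _
  · rw [Finset.disjoint_left]
    intro u hu hu'
    exact mem_Rst.1 (mem_inter.1 hu').2 i (h3 hu)

lemma Ext.f2 (h : Ext G j w b d D t Q A B F) : ∀ x ∈ B ∩ Rst A, (F x).card ≤ w := by
  intro x hx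
  obtain ⟨h1, h2⟩ := mem_inter.1 hx
  rcases h.sp x h1 h2 with ⟨h3, -⟩ | ⟨i, h3, h4, -⟩
  · rw [h3]; simp
  · exact h4.le

lemma Ext.f3 (h : Ext G j w b d D t Q A B F) : ∀ x ∈ B ∩ Rst A, ∀ y ∈ B ∩ Rst A, x ≠ y → Disjoint (F x) (F y) :=
  fun x hx y hy hxy => h.fdisj x (mem_inter.1 hx).1 (mem_inter.1 hx).2 y (mem_inter.1 hy).1 (mem_inter.1 hy).2 hxy

/-- gadgets until all imbalances are nonpositive -/
lemma Ext.balance (h : Ext G j w b d D t Q A B F) {m' C Z : ℕ} {L : Finset V} (hb : b = s + (m' + j) * w) (hsw : s < w)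
    (hb0 : 0 < b)
    (hres : ∀ S ⊆ Rst A, (Rst A).card ≤ S.card + Z → ResC G m' s w C S L)
    (hZ : 2 * t + w * D ≤ Z) {K : ℤ} (hK : (b:ℤ) * w ≤ K) : ∀ (N : ℕ) (U : Finset V), Til G (m' + j + 1) s w U →
    (∀ i, -K ≤ Pot w b (A i) U) → (∑ i, (Pot w b (A i) U).toNat = N) → U.card + b * N ≤ t →
    ∃ U', U ⊆ U' ∧ Til G (m' + j + 1) s w U' ∧ (∀ i, -K ≤ Pot w b (A i) U' ∧ Pot w b (A i) U' ≤ 0) ∧ U'.card ≤ t := by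
  intro N
  induction N using Nat.strong_induction_on with
  | _ N ih =>
    intro U hU hlow hN hcard
    by_cases hall : ∀ i, Pot w b (A i) U ≤ 0
    · exact ⟨U, Subset.refl _, hU, fun i => ⟨hlow i, hall i⟩, by omega⟩
    · push Not at hall
      obtain ⟨i, hi⟩ := hall
      obtain ⟨X, hX, hXd, hXs, hXw⟩ := h.gadget hb hsw hres hZ i (Fb := U) (by omega)
      have hXc : X.card = b := by rw [hX.card, hb]
      have hpi : Pot w b (A i) (U ∪ X) = Pot w b (A i) U - b * (w - s) := by
        rw [pot_union hXd hXc, hXs]; ring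
      have hpl : ∀ l, l ≠ i → Pot w b (A l) (U ∪ X) = Pot w b (A l) U := by
        intro l hl
        rw [pot_union hXd hXc, hXw l hl]; ring
      have hbs : (1:ℤ) ≤ b * ((w:ℤ) - s) := by
        have h1 : (1:ℤ) ≤ b := by exact_mod_cast hb0
        have h2 : (1:ℤ) ≤ (w:ℤ) - s := by omega
        nlinarith
      have hbs2 : (b:ℤ) * ((w:ℤ) - s) ≤ b * w := by
        have : (0:ℤ) ≤ b * s := by positivity
        linarith
      have hlt : ∑ l, (Pot w b (A l) (U ∪ X)).toNat < N := by
        rw [← hN]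
        refine sum_lt_sum ?_ ⟨i, mem_univ i, ?_⟩
        · intro l _
          by_cases hl : l = i
          · rw [hl, hpi]; omega
          · rw [hpl l hl]
        · rw [hpi]; omega
      obtain ⟨U', h1, h2, h3, h4⟩ := ih _ hlt (U ∪ X) (Til.add U X hU hX hXd.symm) (by
        intro l
        by_cases hl : l = i
        · rw [hl, hpi]; linarith
        · rw [hpl l hl]; exact hlow l) rfl (by
        rw [card_union_of_disjoint hXd.symm, hXc]
        have : b * (∑ l, (Pot w b (A l) (U ∪ X)).toNat + 1) ≤ b * N := by gcongr; omega
        rw [mul_add, mul_one] at this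
        omega)
      exact ⟨U', subset_union_left.trans h1, h2, h3, h4⟩

lemma sum_pot (hdisj : ∀ i l, i ≠ l → Disjoint (A i) (A l)) (U : Finset V) :
    ∑ i, Pot w b (A i) U = (j:ℤ) * w * (univ \ U).card - b * ((univ \ U).card - (Rst A \ U).card) := by
  unfold Pot
  rw [sum_sub_distrib, sum_const, ← mul_sum, card_univ, Fintype.card_fin, part_card hdisj U]
  push_cast
  simp only [nsmul_eq_mul]
  ring

lemma Ext.miss_all (h : Ext G j w b d D t Q A B F) (hdD : d ≤ D) {U : Finset V} (hU : B ∩ Rst A ⊆ U) {v : V}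
    (hv : v ∉ U) (i : Fin j) (hvi : v ∉ A i) : nn G (A i) v ≤ D := by
  by_cases hR : v ∈ Rst A
  · exact (h.good i v (fun hB => hv (hU (mem_inter.2 ⟨hB, hR⟩))) hvi).trans hdD
  · rw [mem_Rst] at hR
    push Not at hR
    obtain ⟨l, hl⟩ := hR
    exact h.missl (i := l) (l := i) (fun e => hvi (e ▸ hl)) hl

/-- final step -/
lemma Ext.final (h : Ext G j w b d D t Q A B F) {m' T C : ℕ} (hb : b = s + (m' + j) * w) (hw : 0 < w)
    (hb0 : 0 < b) (hdD : d ≤ D) (hbig : ∀ i, w * D + b * D + t ≤ (A i).card)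
    {U : Finset V} (hU : Til G (m' + j + 1) s w U) (hSp : B ∩ Rst A ⊆ U) (hUt : U.card ≤ t)
    (Y : Fin T → Finset V) (hY : ∀ t, IsBottle G (m'+1) s w (Y t))
    (hYS : ∀ t, Y t ⊆ Rst A \ U) (hYd : ∀ t t', t ≠ t' → Disjoint (Y t) (Y t'))
    (hP : ∀ i, Pot w b (A i) U ≤ C) (hT : (univ \ U).card ≤ b * T + C) :
    ∃ X, Til G (m' + j + 1) s w X ∧ (univ \ X).card ≤ b * C + b := by
  obtain ⟨X, h1, h2, h3⟩ := finish (G := G) (d := D) (C := C) (univ \ U) (fun i => A i \ U)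
    (fun i => sdiff_subset_sdiff (subset_univ _) (Subset.refl _))
    (fun i l hil => disjoint_of_subset_left sdiff_subset (disjoint_of_subset_right sdiff_subset (h.disj i l hil)))
    hw hb0 hb (by
      intro i v hv hvi
      have hvU := (mem_sdiff.1 hv).2
      refine (nn_mono sdiff_subset v).trans (h.miss_all hdD hSp hvU i ?_)
      intro hA; exact hvi (mem_sdiff.2 ⟨hA, hvU⟩)) (by
      intro i a ha
      refine (nn_mono ?_ a).trans (h.miss i a (mem_sdiff.1 ha).1)
      intro u hu
      simp only [mem_sdiff, mem_univ, true_and] at hu ⊢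
      tauto) (by
      intro i
      have h1 := card_sdiff_add_card_inter (A i) U
      have h2 := card_le_card (inter_subset_right : A i ∩ U ⊆ U)
      have := hbig i
      show w * D + b * D ≤ (A i \ U).card
      omega) Y hY (by
      intro t u hu
      have := mem_sdiff.1 (hYS t hu)
      rw [mem_Rst] at this
      simp only [mem_sdiff, mem_univ, true_and, mem_biUnion, not_exists, not_and]
      exact ⟨this.2, fun i hi => absurd hi (this.1 i)⟩) hYd hT (by
      intro i
      have := hP i
      unfold Pot at this
      show w * (univ \ U).card ≤ b * (A i \ U).card + C
      zify
      linarith)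
  refine ⟨U ∪ X, hU.union h2 ?_, ?_⟩
  · exact disjoint_of_subset_right h1 disjoint_sdiff
  · refine le_trans (card_le_card ?_) h3
    intro u hu
    simp only [mem_sdiff, mem_univ, mem_union, true_and] at hu ⊢
    tauto

/-- conclusion in the main regime -/
lemma Ext.conclude (h : Ext G j w b d D t Q A B F) {m' C Z p K P0 : ℕ} {L : Finset V} (hb : b = s + (m' + j) * w)
    (hsw : s < w) (hb1 : 0 < s + m' * w) (hBL : Disjoint B L)
    (hres : ∀ S ⊆ Rst A, (Rst A).card ≤ S.card + Z → ResC G m' s w C S L)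
    (hZ : 2 * t + w * D ≤ Z) (hdD : d ≤ D) (hbig : ∀ i, w * D + b * D + t ≤ (A i).card)
    (hK : b * w ≤ K) (hp : (B ∩ Rst A).card ≤ p) (ht : (b + 1 + w) * p + b * (j * P0) ≤ t)
    (hlow : ∀ i, -(K:ℤ) ≤ Pot w b (A i) ∅) (hhigh : ∀ i, Pot w b (A i) ∅ ≤ P0) :
    ∃ X, Til G (m' + j + 1) s w X ∧ (univ \ X).card ≤ b * (b * C + j * K) + b := by
  have hw : 0 < w := by omega
  have hb0 : 0 < b := by
    have : (m' + j) * w = m' * w + j * w := by ring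
    omega
  have hpt : (b + 1 + w) * (B ∩ Rst A).card ≤ (b + 1 + w) * p := by gcongr
  obtain ⟨U1, ⟨hU1, hU1p⟩, hSp, hU1c⟩ := sched (w := w) (b := b) (t := t) (F := F)
    (fun U => Til G (m' + j + 1) s w U ∧ ∀ i, Pot w b (A i) U = Pot w b (A i) ∅) (B ∩ Rst A) h.f1 h.f2 h.f3
    (by omega) ⟨Til.empty, fun _ => rfl⟩ (by
      rintro x hx U Fb ⟨hU, hUp⟩ hUF hFb hxF hFF
      obtain ⟨X, h1, h2, h3, -, h5⟩ := h.step hb hBL hres hZ (mem_inter.1 hx).1 (mem_inter.1 hx).2 hFb hxF hFF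
      have hXc : X.card = b := by rw [h1.card, hb]
      have hd : Disjoint X U := disjoint_of_subset_right hUF h3
      refine ⟨X, hXc, h2, h3, Til.add U X hU h1 hd.symm, fun i => ?_⟩
      rw [pot_union hd hXc, h5 i, hUp i]; ring)
  have hsumP : ∑ i, (Pot w b (A i) U1).toNat ≤ j * P0 := by
    calc ∑ i, (Pot w b (A i) U1).toNat ≤ ∑ i : Fin j, P0 := by
          refine sum_le_sum fun i _ => ?_
          rw [hU1p i]
          have := hhigh i
          omega
      _ = j * P0 := by simp
  have hbN : b * ∑ i, (Pot w b (A i) U1).toNat ≤ b * (j * P0) := by gcongr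
  have hbp : b * (B ∩ Rst A).card ≤ (b + 1 + w) * (B ∩ Rst A).card := by gcongr; omega
  obtain ⟨U, hU1U, hU, hUp, hUt⟩ := h.balance hb hsw hb0 hres hZ (K := K) (by exact_mod_cast hK) _ U1 hU1
    (fun i => by rw [hU1p i]; exact hlow i) rfl (by omega)
  obtain ⟨⟨X0, hX0, hX0t, hX0c⟩, -, -⟩ := hres (Rst A \ U) sdiff_subset (by
    have h1 := card_sdiff_add_card_inter (Rst A) U
    have h2 := card_le_card (inter_subset_right : Rst A ∩ U ⊆ U)
    omega)
  obtain ⟨T, Y, hY, hYd, rfl⟩ := til_family hX0t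
  have hYS : ∀ t, Y t ⊆ Rst A \ U := fun t => (subset_biUnion_of_mem Y (mem_univ t)).trans hX0
  have hXc : (univ.biUnion Y).card = T * (s + m' * w) := by
    rw [card_biUnion (fun t _ t' _ h => hYd t t' h), sum_congr rfl (fun t _ => (hY t).card)]
    simp
  have hRc : (Rst A \ U).card ≤ T * (s + m' * w) + C := by
    have := card_sdiff_of_subset hX0
    have := card_le_card hX0
    omega
  refine h.final hb hw hb0 hdD hbig hU (hSp.trans hU1U) hUt Y hY hYS hYd (C := b * C + j * K) ?_ ?_
  · intro i
    have := (hUp i).2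
    push_cast
    have : (0:ℤ) ≤ b * C + j * K := by positivity
    linarith
  · have h1 := sum_pot (w := w) (b := b) h.disj U
    have h2 : -((j:ℤ) * K) ≤ ∑ i, Pot w b (A i) U := by
      calc -((j:ℤ) * K) = ∑ i : Fin j, -(K:ℤ) := by simp
        _ ≤ _ := sum_le_sum fun i _ => (hUp i).1
    rw [h1] at h2
    set N : ℤ := ((univ \ U).card : ℤ) with hN
    have hRz : ((Rst A \ U).card : ℤ) ≤ T * (s + m' * w) + C := by exact_mod_cast hRc
    have hbz : (b:ℤ) = s + (m' + j) * w := by exact_mod_cast hb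
    set b' : ℤ := (s:ℤ) + m' * w with hb'
    have hb'1 : 1 ≤ b' := by
      have : 1 ≤ s + m' * w := hb1
      rw [hb']; exact_mod_cast this
    have h3 : (b:ℤ) * (Rst A \ U).card ≤ b * (T * b' + C) := by gcongr
    have h4 : b' * (N - b * T) ≤ b * C + j * K := by
      have : (b:ℤ) = b' + j * w := by rw [hbz, hb']; ring
      have e : (j:ℤ) * w * N - b * (N - (Rst A \ U).card) = -b' * N + b * (Rst A \ U).card := by
        rw [show (j:ℤ) * w = b - b' by rw [this]; ring]; ring
      rw [e] at h2
      linarith [show (b:ℤ) * (T * b' + C) = b' * (b * T) + b * C by ring, show b' * (N - b * T) = b' * N - b' * (b * T) by ring]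
    have h5 : N ≤ b * T + (b * C + j * K) := by
      by_contra hlt
      push Not at hlt
      have h6 : 1 * (N - b * T) ≤ b' * (N - b * T) := by
        have : (0:ℤ) ≤ b * C + j * K := by positivity
        gcongr
        linarith
      linarith
    have : ((univ \ U).card : ℤ) ≤ ((b * T + (b * C + j * K) : ℕ) : ℤ) := by push_cast; exact h5
    exact_mod_cast this

/-- conclusion in the degenerate regime `s = 0`, `j = m` -/
lemma Ext.conclude0 (h : Ext G j w b d D t Q A B F) {p K : ℕ} (hw : 0 < w) (hj : 0 < j) (hb : b = j * w)
    (hdD : d ≤ D) (hbig : ∀ i, w * D + b * D + t ≤ (A i).card) (hBR : Rst A ⊆ B)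
    (hK : b ≤ K) (hp : (Rst A).card ≤ p) (ht : (b + 1 + w) * p ≤ t)
    (hlow : ∀ i, -(K:ℤ) ≤ Pot w b (A i) ∅) :
    ∃ X, Til G (j + 1) 0 w X ∧ (univ \ X).card ≤ b * (j * K) + b := by
  have hb0 : 0 < b := by rw [hb]; positivity
  have hBR' : B ∩ Rst A = Rst A := inter_eq_right.2 hBR
  have hpt : (b + 1 + w) * (B ∩ Rst A).card ≤ (b + 1 + w) * p := by rw [hBR']; gcongr
  obtain ⟨U, ⟨hU, hUp⟩, hSp, hUc⟩ := sched (w := w) (b := b) (t := t) (F := F)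
    (fun U => Til G (j + 1) 0 w U ∧ ∀ i, -(K:ℤ) ≤ Pot w b (A i) U) (B ∩ Rst A) h.f1 h.f2 h.f3
    (by omega) ⟨Til.empty, hlow⟩ (by
      rintro x hx U Fb ⟨hU, hUp⟩ hUF hFb hxF hFF
      have hl : ∃ l, 0 < Pot w b (A l) U := by
        by_contra hno
        push Not at hno
        have h1 := sum_pot (w := w) (b := b) h.disj U
        have h2 : ∑ i, Pot w b (A i) U ≤ 0 := sum_nonpos fun i _ => hno i
        have h3 : 0 < (Rst A \ U).card := card_pos.2 ⟨x, mem_sdiff.2 ⟨(mem_inter.1 hx).2, fun h => hxF (hUF h)⟩⟩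
        have h4 : (b:ℤ) = j * w := by exact_mod_cast hb
        have h5 : (0:ℤ) < b * (Rst A \ U).card := by positivity
        rw [h1, ← h4] at h2
        linarith
      obtain ⟨l, hl⟩ := hl
      obtain ⟨X, h1, h2, h3, h4, h5⟩ := h.step0 hw hb (mem_inter.1 hx).1 (mem_inter.1 hx).2 hFb hxF hFF l
      have hXc : X.card = b := by rw [h1.card, hb]; ring
      have hd : Disjoint X U := disjoint_of_subset_right hUF h3
      refine ⟨X, hXc, h2, h3, Til.add U X hU h1 hd.symm, fun i => ?_⟩
      rw [pot_union hd hXc]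
      by_cases hi : i = l
      · rw [hi]
        have : (w:ℤ) = (X ∩ A l).card + 1 := by exact_mod_cast h4.symm
        rw [this]
        have hKz : (b:ℤ) ≤ K := by exact_mod_cast hK
        linarith
      · rw [h5 i hi]
        linarith [hUp i])
  rw [hBR'] at hSp
  have hbp : b * (B ∩ Rst A).card ≤ (b + 1 + w) * (B ∩ Rst A).card := by gcongr; omega
  have hT : (univ \ U).card < b * ((univ \ U).card / b) + b := Nat.lt_mul_div_succ _ hb0
  have := h.final (s := 0) (m' := 0) (T := (univ \ U).card / b + 1) (by rw [hb]; ring) hw hb0 hdD hbig (by simpa using hU) (by rw [hBR']; exact hSp)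
    (by omega) (fun _ => ∅) (fun _ => bottle_one rfl) (fun _ => empty_subset _) (fun _ _ _ => disjoint_empty_left _)
    (C := j * K) (by
      intro i
      have h1 := sum_pot (w := w) (b := b) h.disj U
      have h4 : (b:ℤ) = j * w := by exact_mod_cast hb
      rw [← h4, sdiff_eq_empty_iff_subset.2 hSp, card_empty] at h1
      have h2 : ∑ l ∈ univ.erase i, -(K:ℤ) ≤ ∑ l ∈ univ.erase i, Pot w b (A l) U := sum_le_sum fun l _ => hUp l
      rw [← add_sum_erase _ _ (mem_univ i)] at h1
      rw [sum_const, card_erase_of_mem (mem_univ i), card_univ, Fintype.card_fin, nsmul_eq_mul, Nat.cast_sub (by omega)] at h2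
      push_cast at h1 h2 ⊢
      have hK0 : (0:ℤ) ≤ K := by positivity
      linarith [show ((j:ℤ) - 1) * -(K:ℤ) = K - j * K by ring]) (by rw [mul_add]; omega)
  simpa using this

end
end ModE6
end OreT

namespace OreT
section ModE7
open Finset
open scoped Classical BigOperators

variable {V : Type} {G : SimpleGraph V}

structure ExtR [Fintype V] (G : SimpleGraph V) (j w : ℕ) (θ β ρ : ℝ) (z : Prop) (P A : Fin j → Finset V) (B : Finset V)
    (F : V → Finset V) : Prop where
  disj : ∀ i l, i ≠ l → Disjoint (A i) (A l)
  good : ∀ i, ∀ v, v ∉ B → v ∉ A i → (nn G (A i) v : ℝ) ≤ ρ * Fintype.card V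
  miss : ∀ i, ∀ v ∈ A i, (nn G (univ \ A i) v : ℝ) ≤ 6 * β * Fintype.card V
  Bc : (B.card : ℝ) ≤ 4 * j * ρ * Fintype.card V
  lo : ∀ i, (θ - ρ) * Fintype.card V - 1 ≤ (A i).card
  hi : ∀ i, ((A i).card : ℝ) ≤ θ * Fintype.card V + 2 * w
  sp : ∀ x ∈ B, x ∈ Rst A → (F x = ∅ ∧ ∀ l, β / 4 * Fintype.card V ≤ (ad G (A l) x : ℝ)) ∨
    ∃ i, F x ⊆ A i ∧ (F x).card = w ∧ (∀ u ∈ F x, G.Adj x u) ∧ ∀ l, l ≠ i → (nn G (A l) x : ℝ) ≤ 5 * β * Fintype.card V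
  fdisj : ∀ x ∈ B, x ∈ Rst A → ∀ y ∈ B, y ∈ Rst A → x ≠ y → Disjoint (F x) (F y)
  PA : ∀ i, ((P i \ A i).card : ℝ) ≤ 3 * ρ * Fintype.card V
  cov : z → Rst A ⊆ B
  BL : ¬ z → ∀ v ∈ B, (nn G univ v : ℝ) ≤ (θ + 2 * β) * Fintype.card V

set_option maxHeartbeats 2000000 in
lemma build [Fintype V] {j w : ℕ} {θ β ρ e : ℝ} {P : Fin j → Finset V} (z : Prop) (hz : z → j * θ = 1)
    (hO : Ore G θ) (hw : 0 < w) (he : 0 < e) (hρ : 0 < ρ) (hρβ : 16 * ρ ≤ β) (hwβ : 20 * (w+1) * β ≤ θ)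
    (hθ : 0 < θ) (hθ1 : θ ≤ 1) (he1 : 20 * e ≤ ρ * θ) (he2 : 20 * e ≤ ρ * ρ) (hn : 2 ≤ ρ * Fintype.card V)
    (hPd : ∀ i l, i ≠ l → Disjoint (P i) (P l)) (hP : ∀ i, Near G θ (e*e) (P i)) :
    ∃ A B F, ExtR G j w θ β ρ z P A B F := by
  set n : ℝ := (Fintype.card V : ℝ) with hnd
  have hn0 : 0 < n := by
    by_contra h; push Not at h
    have : ρ * n ≤ 0 := mul_nonpos_of_nonneg_of_nonpos hρ.le h
    linarith
  have hβ : 0 < β := by linarith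
  have hw1 : (1:ℝ) ≤ w := by exact_mod_cast hw
  have hwβ1 : 40 * β ≤ θ := by nlinarith
  have hρn : 16 * (ρ * n) ≤ β * n := by linarith [mul_le_mul_of_nonneg_right hρβ hn0.le]
  have hβn : 40 * (β * n) ≤ θ * n := by linarith [mul_le_mul_of_nonneg_right hwβ1 hn0.le]
  have hC : ∀ i, C1 G θ β ρ ρ (P i) (Ath G (P i) β) := fun i =>
    clean1 hO he hρ (by linarith) (by linarith) hθ hθ1 he1 he2 (by rw [← hnd]; linarith) (hP i)
  set A0 : Fin j → Finset V := fun i => Ath G (P i) β with hA0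
  have hS : ∀ i, ∃ Cn F, Stars G w (A0 i) Cn F ∧ (Cn.card : ℝ) ≤ ρ * n + 1 ∧
      (θ - ρ) * n - 1 ≤ ((A0 i \ Cn).card : ℝ) ∧ ((A0 i \ Cn).card : ℝ) ≤ θ * n + 2 * w := fun i =>
    star_step hO hw hθ hβ hρ.le (by linarith) hwβ (by rw [← hnd]; linarith) (hC i).lo (hC i).hi (hC i).inner
  choose Cn Fn hSt hCc hlo hhi using hS
  have hd0 : ∀ i l, i ≠ l → Disjoint (A0 i) (A0 l) := by
    intro i l hil
    rw [Finset.disjoint_left]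
    intro v hv hv'
    have h1 := (hC i).nnlo v hv
    have h2 := (hC l).nnlo v hv'
    have h3 := (hC i).nnhi v hv
    have h4 : nn G (P i) v + nn G (P l) v ≤ nn G univ v := by
      rw [nn_split (subset_univ (P i)) v]
      gcongr
      refine nn_mono ?_ v
      intro u hu
      exact mem_sdiff.2 ⟨mem_univ _, Finset.disjoint_right.1 (hPd i l hil) hu⟩
    have h4' : (nn G (P i) v : ℝ) + nn G (P l) v ≤ nn G univ v := by exact_mod_cast h4
    rw [← hnd] at h1 h2 h3
    have : 0 < θ * n := by positivity
    nlinarith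
  set bad : Fin j → Finset V := fun i => univ.filter fun v => v ∉ A0 i ∧ ρ * n < nn G (A0 i) v with hbad
  set E : Finset V := if z then Rst A0 else ∅ with hE
  set A : Fin j → Finset V := fun i => A0 i \ Cn i with hA
  set B : Finset V := E ∪ (univ.biUnion bad ∪ univ.biUnion Cn) with hB
  set F : V → Finset V := fun x => univ.biUnion fun i => if x ∈ Cn i then Fn i x else ∅ with hF
  have hAA : ∀ i, A i ⊆ A0 i := fun i => sdiff_subset
  have hCA : ∀ i, Cn i ⊆ A0 i := fun i => (hSt i).sub
  have hFc : ∀ i, ∀ x ∈ Cn i, F x = Fn i x := by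
    intro i x hx
    ext u
    simp only [hF, mem_biUnion, mem_univ, true_and]
    constructor
    · rintro ⟨l, hl⟩
      by_cases hxl : x ∈ Cn l
      · have : l = i := by
          by_contra hne
          exact Finset.disjoint_left.1 (hd0 l i hne) (hCA l hxl) (hCA i hx)
        subst this
        rwa [if_pos hxl] at hl
      · rw [if_neg hxl] at hl; simp at hl
    · intro hu
      exact ⟨i, by rwa [if_pos hx]⟩
  have hF0 : ∀ x, (∀ i, x ∉ Cn i) → F x = ∅ := by
    intro x hx
    simp only [hF]
    ext u
    simp [hx]
  have hR : ∀ x, x ∈ Rst A → (∃ i, x ∈ Cn i) ∨ ∀ i, x ∉ A0 i := by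
    intro x hx
    rw [mem_Rst] at hx
    by_cases h : ∃ i, x ∈ Cn i
    · exact Or.inl h
    · push Not at h
      exact Or.inr fun i hi => hx i (mem_sdiff.2 ⟨hi, h i⟩)
  have hFA : ∀ i, ∀ x ∈ Cn i, F x ⊆ A i := fun i x hx => by
    rw [hFc i x hx]; exact (hSt i).leaf x hx
  refine ⟨A, B, F, ?_, ?_, ?_, ?_, ?_, ?_, ?_, ?_, ?_, ?_, ?_⟩
  · intro i l hil
    exact disjoint_of_subset_left (hAA i) (disjoint_of_subset_right (hAA l) (hd0 i l hil))
  · intro i v hvB hvA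
    have h1 : v ∉ A0 i := by
      intro h
      refine hvA (mem_sdiff.2 ⟨h, fun hc => hvB ?_⟩)
      exact mem_union_right _ (mem_union_right _ (mem_biUnion.2 ⟨i, mem_univ _, hc⟩))
    have h2 : ¬ ρ * n < nn G (A0 i) v := by
      intro h
      refine hvB (mem_union_right _ (mem_union_left _ (mem_biUnion.2 ⟨i, mem_univ _, ?_⟩)))
      exact mem_filter.2 ⟨mem_univ _, h1, h⟩
    push Not at h2
    refine le_trans ?_ h2
    exact_mod_cast nn_mono (hAA i) v
  · intro i v hv
    have h1 := (hC i).miss v (hAA i hv)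
    have h2 : nn G (univ \ A i) v ≤ nn G (univ \ A0 i) v + (Cn i).card := by
      refine (nn_mono ?_ v).trans (nn_union_le _ _ v)
      intro u hu
      simp only [hA, mem_sdiff, mem_union, mem_univ, true_and] at hu ⊢
      tauto
    have h2' : (nn G (univ \ A i) v : ℝ) ≤ nn G (univ \ A0 i) v + (Cn i).card := by exact_mod_cast h2
    have h3 := hCc i
    rw [← hnd] at h1 ⊢
    linarith
  · have h1 : (E.card : ℝ) ≤ j * ρ * n := by
      by_cases hzz : z
      · rw [hE, if_pos hzz]
        have h2 := part_card hd0 (∅ : Finset V)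
        simp only [sdiff_empty, card_univ] at h2
        have h2' : (n:ℝ) = (Rst A0).card + ∑ i, ((A0 i).card : ℝ) := by rw [hnd]; exact_mod_cast h2
        have h3 : ∑ i : Fin j, (θ - ρ) * n ≤ ∑ i, ((A0 i).card : ℝ) := sum_le_sum fun i _ => (hC i).lo
        rw [sum_const, card_univ, Fintype.card_fin, nsmul_eq_mul] at h3
        have h4 := hz hzz
        have : (j:ℝ) * ((θ - ρ) * n) = (j * θ) * n - j * ρ * n := by ring
        rw [h4] at this
        linarith
      · rw [hE, if_neg hzz]; simp; positivity
    have h2 : ((univ.biUnion bad).card : ℝ) ≤ j * ρ * n := by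
      have : ((univ.biUnion bad).card : ℝ) ≤ ∑ i, ((bad i).card : ℝ) := by exact_mod_cast card_biUnion_le
      refine this.trans ((sum_le_sum (g := fun _ => ρ * n) fun i _ => ?_).trans ?_)
      · exact (hC i).bad
      · rw [sum_const, card_univ, Fintype.card_fin, nsmul_eq_mul]; linarith
    have h3 : ((univ.biUnion Cn).card : ℝ) ≤ j * ρ * n + j * ρ * n := by
      have : ((univ.biUnion Cn).card : ℝ) ≤ ∑ i, ((Cn i).card : ℝ) := by exact_mod_cast card_biUnion_le
      refine this.trans ((sum_le_sum (g := fun _ => ρ * n + ρ * n) fun i _ => ?_).trans ?_)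
      · have := hCc i; linarith
      · rw [sum_const, card_univ, Fintype.card_fin, nsmul_eq_mul]; linarith
    have h4 : (B.card : ℝ) ≤ E.card + ((univ.biUnion bad).card + (univ.biUnion Cn).card) := by
      have h5 := card_union_le E (univ.biUnion bad ∪ univ.biUnion Cn)
      have h6 := card_union_le (univ.biUnion bad) (univ.biUnion Cn)
      exact_mod_cast h5.trans (by omega)
    linarith
  · exact hlo
  · exact hhi
  · intro x hxB hxR
    rcases hR x hxR with ⟨i, hi⟩ | hno
    · refine Or.inr ⟨i, hFA i x hi, ?_, ?_, ?_⟩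
      · rw [hFc i x hi]; exact (hSt i).card x hi
      · rw [hFc i x hi]; exact (hSt i).adj x hi
      · intro l hl
        refine le_trans ?_ ((hC i).miss x (hCA i hi))
        have : nn G (A l) x ≤ nn G (univ \ A0 i) x := by
          refine nn_mono ?_ x
          intro u hu
          exact mem_sdiff.2 ⟨mem_univ _, Finset.disjoint_left.1 (hd0 l i hl) (hAA l hu)⟩
        exact_mod_cast this
    · refine Or.inl ⟨hF0 x fun i hi => hno i (hCA i hi), fun l => ?_⟩
      have h1 := (hC l).rich x (hno l)
      have h2 : ad G (A0 l) x ≤ ad G (A l) x + (Cn l).card := by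
        refine (ad_mono ?_ x).trans (ad_union_le _ _ x)
        intro u hu
        simp only [hA, mem_sdiff, mem_union]
        tauto
      have h2' : (ad G (A0 l) x : ℝ) ≤ ad G (A l) x + (Cn l).card := by exact_mod_cast h2
      have h3 := hCc l
      rw [← hnd] at h1
      linarith
  · intro x hxB hxR y hyB hyR hxy
    by_cases hx : ∃ i, x ∈ Cn i
    swap
    · push Not at hx; rw [hF0 x hx]; exact disjoint_empty_left _
    by_cases hy : ∃ i, y ∈ Cn i
    swap
    · push Not at hy; rw [hF0 y hy]; exact disjoint_empty_right _
    obtain ⟨i, hi⟩ := hx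
    obtain ⟨l, hl⟩ := hy
    by_cases hil : i = l
    · subst hil
      rw [hFc i x hi, hFc i y hl]
      exact (hSt i).disj x hi y hl hxy
    · exact disjoint_of_subset_left ((hFA i x hi).trans (hAA i)) (disjoint_of_subset_right ((hFA l y hl).trans (hAA l)) (hd0 i l hil))
  · intro i
    have h1 := (hC i).PA
    have h2 : (P i \ A i).card ≤ (P i \ A0 i).card + (Cn i).card := by
      refine (card_le_card ?_).trans (card_union_le _ _)
      intro u hu
      simp only [hA, mem_sdiff, mem_union] at hu ⊢
      tauto
    have h2' : ((P i \ A i).card : ℝ) ≤ (P i \ A0 i).card + (Cn i).card := by exact_mod_cast h2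
    have h3 := hCc i
    rw [← hnd] at h1 ⊢
    linarith
  · intro hzz x hx
    rcases hR x hx with ⟨i, hi⟩ | hno
    · exact mem_union_right _ (mem_union_right _ (mem_biUnion.2 ⟨i, mem_univ _, hi⟩))
    · refine mem_union_left _ ?_
      rw [hE, if_pos hzz, mem_Rst]
      exact hno
  · intro hzz v hv
    rw [hB, hE, if_neg hzz, empty_union] at hv
    rcases mem_union.1 hv with hv | hv
    · obtain ⟨i, -, hi⟩ := mem_biUnion.1 hv
      obtain ⟨-, hvA, hvn⟩ := mem_filter.1 hi
      by_contra hlt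
      push Not at hlt
      have h0 : nn G (A0 i) v = 0 := by
        unfold nn
        rw [card_eq_zero, filter_eq_empty_iff]
        intro y hy hadj
        have hyv : v ≠ y := fun h => hvA (h ▸ hy)
        have h1 := hO v y hyv hadj
        have h2 := (hC i).nnlo y hy
        have h3 : (nn G (P i) y : ℝ) ≤ nn G univ y := by exact_mod_cast nn_mono (subset_univ _) y
        rw [← hnd] at h1 h2
        linarith
      rw [h0] at hvn
      have : 0 < ρ * n := by positivity
      norm_num at hvn
      linarith
    · obtain ⟨i, -, hi⟩ := mem_biUnion.1 hv
      exact (hC i).nnhi v (hCA i hi)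

end ModE7
end OreT

namespace OreT
section ModE8
open Finset
open scoped Classical BigOperators

variable {V : Type} {G : SimpleGraph V}

def K1 (j w b : ℕ) : ℕ := 2 * w + j * w + b + 2 * ((b + 1 + w) * (4 * j) + b * (j * (2 * b)))

structure ExtN [Fintype V] (G : SimpleGraph V) (j w b : ℕ) (β : ℝ) (A : Fin j → Finset V) (B : Finset V)
    (F : V → Finset V) (d D t Q Z p P0 : ℕ) : Prop where
  ext : Ext G j w b d D t Q A B F
  hZ : 2 * t + w * D ≤ Z
  hdD : d ≤ D
  hbig : ∀ i, w * D + b * D + t ≤ (A i).card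
  hp : B.card ≤ p
  ht : (b + 1 + w) * p + b * (j * P0) ≤ t
  hlow : ∀ i, -((2 * w * b : ℕ):ℤ) ≤ Pot w b (A i) ∅
  hhigh : ∀ i, Pot w b (A i) ∅ ≤ P0
  hZn : (Z:ℝ) ≤ 7 * w * β * Fintype.card V

set_option maxHeartbeats 2000000 in
lemma ExtR.toExt [Fintype V] {j w b : ℕ} {θ β ρ : ℝ} {z : Prop} {P A : Fin j → Finset V} {B : Finset V}
    {F : V → Finset V} (h : ExtR G j w θ β ρ z P A B F) (hw : 0 < w) (hb : 0 < b) (hθ : θ = w / b)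
    (hρ : 0 < ρ) (hK : 8 * (K1 j w b : ℝ) * ρ ≤ β) (hβ : 100 * ((w:ℝ) + 1 + b) * β ≤ θ)
    (hn : 2 ≤ ρ * Fintype.card V) :
    ∃ d D t Q Z p P0, ExtN G j w b β A B F d D t Q Z p P0 := by
  set n : ℝ := (Fintype.card V : ℝ) with hnd
  have hn0 : 0 < n := by
    by_contra h; push Not at h
    have : ρ * n ≤ 0 := mul_nonpos_of_nonneg_of_nonpos hρ.le h
    linarith
  have hw1 : (1:ℝ) ≤ w := by exact_mod_cast hw
  have hb1 : (1:ℝ) ≤ b := by exact_mod_cast hb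
  have hK3 : (3:ℝ) ≤ K1 j w b := by
    have : 3 ≤ K1 j w b := by unfold K1; omega
    exact_mod_cast this
  set T : ℝ := ρ * n with hT
  set M : ℝ := β * n with hM
  have hKM : 8 * (K1 j w b : ℝ) * T ≤ M := by
    have := mul_le_mul_of_nonneg_right hK hn0.le
    rw [hT, hM]; linarith
  have hM24 : 24 * T ≤ M := by
    have : 3 * T ≤ K1 j w b * T := by gcongr
    linarith
  have hM0 : 0 ≤ M := by linarith
  have hθn : 100 * ((w:ℝ) + 1 + b) * M ≤ θ * n := by
    have := mul_le_mul_of_nonneg_right hβ hn0.le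
    rw [hM]; linarith
  have hθn' : 100 * (w * M) + 100 * M + 100 * (b * M) ≤ θ * n := by linarith
  have hbθ : (b:ℝ) * (θ * n) = w * n := by
    rw [hθ]; field_simp
  have hwM : M ≤ w * M := le_mul_of_one_le_left hM0 hw1
  have hbM : M ≤ b * M := le_mul_of_one_le_left hM0 hb1
  set d := ⌊T⌋₊ with hd
  set D := ⌊6 * M⌋₊ with hD
  set p := ⌊4 * j * T⌋₊ with hp
  set P0 := ⌊2 * b * T⌋₊ with hP0
  have hT0 : 0 ≤ T := by linarith
  have dle : (d:ℝ) ≤ T := Nat.floor_le hT0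
  have Dle : (D:ℝ) ≤ 6 * M := Nat.floor_le (by linarith)
  have ple : (p:ℝ) ≤ 4 * j * T := Nat.floor_le (by positivity)
  have P0le : (P0:ℝ) ≤ 2 * b * T := Nat.floor_le (by positivity)
  set t := (b + 1 + w) * p + b * (j * P0) with ht
  set Q := 2 * w + j * (w * d) + b * d + 2 * t with hQ
  have tle : (t:ℝ) ≤ ((b + 1 + w) * (4 * j) + b * (j * (2 * b))) * T := by
    rw [ht]; push_cast
    have h1 : ((b:ℝ) + 1 + w) * p ≤ (b + 1 + w) * (4 * j * T) := by gcongr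
    have h2 : (b:ℝ) * (j * P0) ≤ b * (j * (2 * b * T)) := by gcongr
    linarith
  have Qle : (Q:ℝ) ≤ K1 j w b * T := by
    rw [hQ]; unfold K1; push_cast
    have h1 : (j:ℝ) * (w * d) ≤ j * (w * T) := by gcongr
    have h2 : (b:ℝ) * d ≤ b * T := by gcongr
    have h3 : (w:ℝ) ≤ w * T := le_mul_of_one_le_right (by linarith) (by linarith)
    linarith
  have QM : (Q:ℝ) ≤ M / 8 := by linarith
  have tQ : 2 * t ≤ Q := by omega
  have tQ' : 2 * (t:ℝ) ≤ Q := by exact_mod_cast tQ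
  have wD : (w:ℝ) * D ≤ 6 * (w * M) := by
    have : (w:ℝ) * D ≤ w * (6 * M) := by gcongr
    linarith
  have bD : (b:ℝ) * D ≤ 6 * (b * M) := by
    have : (b:ℝ) * D ≤ b * (6 * M) := by gcongr
    linarith
  have hlo : ∀ i, θ * n - T - 1 ≤ ((A i).card : ℝ) := by
    intro i; have := h.lo i; rw [← hnd] at this; rw [hT]; linarith
  refine ⟨d, D, t, Q, 2 * t + w * D, p, P0, ⟨⟨h.disj, ?_, ?_, ?_, le_rfl, ?_, ?_, h.fdisj⟩, le_rfl, ?_, ?_, ?_, le_rfl, ?_, ?_, ?_⟩⟩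
  · intro i v h1 h2
    exact Nat.le_floor (h.good i v h1 h2)
  · intro i v h1
    refine Nat.le_floor ?_
    have := h.miss i v h1
    rw [← hnd] at this; rw [hM]; linarith
  · have h1 : B.card ≤ p := Nat.le_floor (by have := h.Bc; rw [← hnd] at this; rw [hT]; linarith)
    have h2 : p ≤ (b + 1 + w) * p := Nat.le_mul_of_pos_left p (by omega)
    omega
  · intro i
    have := hlo i
    have h2 : ((Q + w * D : ℕ):ℝ) ≤ (A i).card := by push_cast; linarith
    exact_mod_cast h2
  · intro x hx hxR
    rcases h.sp x hx hxR with ⟨h1, h2⟩ | ⟨i, h1, h2, h3, h4⟩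
    · left
      refine ⟨h1, fun l => ?_⟩
      have := h2 l
      rw [← hnd] at this
      have h5 : (Q:ℝ) ≤ ad G (A l) x := by linarith
      exact_mod_cast h5
    · right
      refine ⟨i, h1, h2, h3, fun l hl => ?_⟩
      have h5 := h4 l hl
      rw [← hnd] at h5
      have h6 := ad_nn (G := G) (A l) x
      have h7 := hlo l
      have h8 : ((Q + w * D : ℕ):ℝ) ≤ ad G (A l) x := by push_cast; linarith
      exact_mod_cast h8
  · exact Nat.floor_mono (by linarith)
  · intro i
    have := hlo i
    have h2 : ((w * D + b * D + t : ℕ):ℝ) ≤ (A i).card := by push_cast; linarith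
    exact_mod_cast h2
  · exact Nat.le_floor (by have := h.Bc; rw [← hnd] at this; rw [hT]; linarith)
  · intro i
    have h1 := h.hi i
    rw [← hnd] at h1
    have h2 : (b:ℝ) * (A i).card ≤ b * (θ * n + 2 * w) := by gcongr
    have h3 : ((-((2 * w * b : ℕ):ℤ) : ℤ) : ℝ) ≤ (((w:ℤ) * Fintype.card V - b * (A i).card : ℤ) : ℝ) := by
      push_cast; rw [← hnd]; linarith
    unfold Pot
    rw [sdiff_empty, sdiff_empty, card_univ]
    exact Int.cast_le.1 h3
  · intro i
    have h1 := hlo i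
    have h2 : (b:ℝ) * (θ * n - T - 1) ≤ b * (A i).card := by gcongr
    have h4 : (((w:ℤ) * Fintype.card V - b * (A i).card : ℤ) : ℝ) ≤ 2 * b * T := by
      push_cast
      rw [← hnd]
      have : (b:ℝ) * 1 ≤ b * T := by gcongr; linarith
      linarith
    unfold Pot
    rw [sdiff_empty, sdiff_empty, card_univ]
    have h5 := Int.le_floor.2 h4
    rw [hP0]
    rwa [Int.natCast_floor_eq_floor (by positivity)]
  · push_cast
    linarith

end ModE8
end OreT

namespace OreT
section ModE9
open Finset
open scoped Classical BigOperators

variable {V : Type} {G : SimpleGraph V}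

lemma ee_mono' {P Q : Finset V} (h : P ⊆ Q) : ee G P ≤ ee G Q := by
  unfold ee
  exact card_le_card (filter_subset_filter _ (product_subset_product h h))

lemma clique_L [Fintype V] {θ β : ℝ} (hO : Ore G θ) (hβ : 0 ≤ β) :
    ((univ.filter fun v => (θ + 2 * β) * (Fintype.card V : ℝ) < nn G univ v : Finset V) : Set V).Pairwise G.Adj := by
  intro x hx y hy hxy
  by_contra hno
  have h1 := hO x y hxy hno
  have hx' := (mem_filter.1 (mem_coe.1 hx)).2
  have hy' := (mem_filter.1 (mem_coe.1 hy)).2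
  have h2 : 0 ≤ β * (Fintype.card V : ℝ) := by positivity
  linarith

set_option maxHeartbeats 2000000 in
lemma hypS [Fintype V] {j w b b' Z : ℕ} {θ θ' β ρ Γ γ μ : ℝ} {z : Prop} {P A : Fin j → Finset V} {B S : Finset V}
    {F : V → Finset V} (h : ExtR G j w θ β ρ z P A B F) (hw : 0 < w) (hbb : b = b' + j * w) (hb' : 0 < b')
    (hO : Ore G θ) (hθ : θ = w / b) (hθ' : θ' = w / b') (hβ : 0 < β) (hρ : 0 < ρ) (hjn : 2 * j ≤ β * Fintype.card V)
    (hno : ∀ P' ⊆ univ \ univ.biUnion P, ¬ Near G θ Γ P') (hΓ : 0 < Γ) (hγ : γ ≤ Γ / 4) (hγ0 : 0 < γ) (hγθ : γ ≤ θ)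
    (hμ : 2 * β + 8 * w * β * (w + 1) ≤ μ / b) (hμ1 : μ ≤ 1)
    (hβΓ : 8 * w * w * β ≤ Γ / 4) (hβb : 8 * w * β ≤ 1 / (2 * b)) (hρΓ : 3 * j * ρ ≤ Γ / 4)
    (hZ : (Z:ℝ) ≤ 7 * w * β * Fintype.card V) (hSR : S ⊆ Rst A) (hSc : (Rst A).card ≤ S.card + Z) :
    (Fintype.card V : ℝ) ≤ 2 * b * S.card ∧
    Hyp G S (univ.filter fun v => (θ + 2 * β) * (Fintype.card V : ℝ) < nn G univ v) θ' μ γ Γ := by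
  set n : ℝ := (Fintype.card V : ℝ) with hnd
  have hn0 : 0 ≤ n := by positivity
  have hw1 : (1:ℝ) ≤ w := by exact_mod_cast hw
  have hb'1 : (1:ℝ) ≤ b' := by exact_mod_cast hb'
  have hbR : (b:ℝ) = b' + j * w := by rw [hbb]; push_cast; ring
  have hbp : (0:ℝ) < b := by rw [hbR]; positivity
  have hθp : 0 < θ := by rw [hθ]; positivity
  have hjθ : (j:ℝ) * θ = 1 - b' / b := by
    rw [hθ, eq_sub_iff_add_eq]; field_simp; rw [hbR]; ring
  set q : ℝ := b' / b with hq
  have hq1 : q ≤ 1 := by rw [hq, div_le_one hbp, hbR]; have : (0:ℝ) ≤ j * w := by positivity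
                         linarith
  have hqb : 1 / b ≤ q := by rw [hq]; gcongr
  have hθq : θ' * q = θ := by rw [hθ, hθ', hq]; field_simp
  have hθ'w : θ' ≤ w := by rw [hθ']; exact div_le_self (by linarith) hb'1
  have hθ'p : 0 < θ' := by rw [hθ']; positivity
  have hθθ' : θ ≤ θ' := by rw [← hθq]; exact mul_le_of_le_one_right hθ'p.le hq1
  have hμ0 : 0 < μ := by
    have : 0 < μ / b := lt_of_lt_of_le (by positivity) hμ
    by_contra hc; push Not at hc
    have := div_nonpos_of_nonpos_of_nonneg hc hbp.le
    linarith
  have hN : (q - 8 * w * β) * n ≤ S.card := by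
    have h1 := part_card h.disj ∅
    rw [sdiff_empty, card_univ, sdiff_empty] at h1
    have h1' : n = (Rst A).card + ∑ i, ((A i).card : ℝ) := by
      have h4 : Fintype.card V = (Rst A).card + ∑ i, (A i).card := by rw [h1]; simp
      rw [hnd]; exact_mod_cast h4
    have h2 : ∑ i, ((A i).card : ℝ) ≤ j * (θ * n + 2 * w) := by
      calc ∑ i, ((A i).card : ℝ) ≤ ∑ i : Fin j, (θ * n + 2 * w) := sum_le_sum fun i _ => h.hi i
        _ = _ := by rw [sum_const, card_univ, Fintype.card_fin, nsmul_eq_mul]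
    have h3 : ((Rst A).card : ℝ) ≤ S.card + Z := by exact_mod_cast hSc
    have h5 : (j:ℝ) * (θ * n + 2 * w) = (j * θ) * n + w * (2 * j) := by ring
    rw [hjθ] at h5
    have h6 : (w:ℝ) * (2 * j) ≤ w * (β * n) := by gcongr
    linarith
  have hSn : (S.card : ℝ) ≤ n := by rw [hnd]; exact_mod_cast card_le_univ S
  refine ⟨?_, clique_L hO hβ.le, ?_, ?_⟩
  · have h1 : (1 / (2 * b)) * n ≤ (q - 8 * w * β) * n := by
      gcongr
      have : 1 / (b:ℝ) = 1 / (2 * b) + 1 / (2 * b) := by field_simp; norm_num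
      linarith
    have h2 : (1 / (2 * b)) * n ≤ S.card := h1.trans hN
    have h3 : 2 * b * ((1 / (2 * b)) * n) ≤ 2 * b * (S.card : ℝ) := by gcongr
    have h4 : 2 * (b:ℝ) * ((1 / (2 * b)) * n) = n := by field_simp
    linarith
  · intro v _ hv
    have h1 : (nn G univ v : ℝ) ≤ (θ + 2 * β) * n := by
      by_contra hc; push Not at hc
      exact hv (mem_filter.2 ⟨mem_univ _, hc⟩)
    have h2 : (nn G S v : ℝ) ≤ nn G univ v := by exact_mod_cast nn_mono (subset_univ S) v
    have h3 : (θ' + μ) * ((q - 8 * w * β) * n) ≤ (θ' + μ) * S.card := by gcongr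
    have h4 : (θ + 2 * β) * n ≤ ((θ' + μ) * (q - 8 * w * β)) * n := by
      gcongr
      have h5 : μ / b ≤ μ * q := by rw [div_eq_mul_one_div]; gcongr
      have h6 : 8 * w * β * (θ' + μ) ≤ 8 * w * β * (w + 1) := by gcongr
      have h7 : (θ' + μ) * (q - 8 * w * β) = θ' * q + μ * q - 8 * w * β * (θ' + μ) := by ring
      rw [h7, hθq]; linarith
    have h8 : (θ' + μ) * ((q - 8 * w * β) * n) = ((θ' + μ) * (q - 8 * w * β)) * n := by ring
    linarith
  · intro P0 hP0 hP0c
    set P' := P0 \ univ.biUnion P with hP'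
    have h1 : (P0.card : ℝ) ≤ P'.card + 3 * j * ρ * n := by
      have h2 : P0 ⊆ P' ∪ univ.biUnion fun i => P i \ A i := by
        intro u hu
        rw [mem_union, hP', mem_sdiff, mem_biUnion, mem_biUnion]
        by_cases hc : ∃ a ∈ univ, u ∈ P a
        · right
          obtain ⟨i, hi, hu2⟩ := hc
          exact ⟨i, hi, mem_sdiff.2 ⟨hu2, mem_Rst.1 (hSR (hP0 hu)) i⟩⟩
        · left; exact ⟨hu, hc⟩
      have h3 := (card_le_card h2).trans ((card_union_le _ _).trans (Nat.add_le_add_left card_biUnion_le _))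
      have h4 : (P0.card : ℝ) ≤ P'.card + ∑ i, ((P i \ A i).card : ℝ) := by exact_mod_cast h3
      have h5 : ∑ i, ((P i \ A i).card : ℝ) ≤ j * (3 * ρ * n) := by
        calc ∑ i, ((P i \ A i).card : ℝ) ≤ ∑ i : Fin j, (3 * ρ * n) := sum_le_sum fun i _ => h.PA i
          _ = _ := by rw [sum_const, card_univ, Fintype.card_fin, nsmul_eq_mul]
      linarith
    have h2 : (θ' - γ) * ((q - 8 * w * β) * n) ≤ (θ' - γ) * S.card := by
      have : 0 ≤ θ' - γ := by linarith
      gcongr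
    have h3 : (θ - Γ / 2) * n ≤ ((θ' - γ) * (q - 8 * w * β)) * n := by
      gcongr
      have h5 : (θ' - γ) * (q - 8 * w * β) = θ' * q - γ * q - 8 * w * β * (θ' - γ) := by ring
      have h6 : γ * q ≤ γ := mul_le_of_le_one_right hγ0.le hq1
      have h7 : 8 * w * β * (θ' - γ) ≤ 8 * w * β * w := by gcongr; linarith
      rw [h5, hθq]; linarith
    have h4 : 3 * j * ρ * n ≤ Γ / 4 * n := by gcongr
    have h8 : (θ' - γ) * ((q - 8 * w * β) * n) = ((θ' - γ) * (q - 8 * w * β)) * n := by ring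
    have h9 : 0 ≤ Γ * n := by positivity
    have h10 := hno P' (sdiff_subset_sdiff (subset_univ _) subset_rfl)
    by_contra hc
    push Not at hc
    refine h10 ⟨?_, ?_⟩
    · rw [← hnd]; linarith
    · rw [← hnd]
      have h11 : (ee G P' : ℝ) ≤ ee G P0 := by exact_mod_cast ee_mono' sdiff_subset
      have h12 : Γ * (S.card : ℝ)^2 ≤ Γ * n^2 := by gcongr
      linarith

end ModE9
end OreT

namespace OreT
section ModF1
open Finset
open scoped Classical BigOperators

variable {V : Type} {G : SimpleGraph V}

lemma small4 {a1 a2 a3 a4 c1 c2 c3 c4 : ℝ} (h1 : 0 < a1) (h2 : 0 < a2) (h3 : 0 < a3) (h4 : 0 < a4)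
    (k1 : 0 < c1) (k2 : 0 < c2) (k3 : 0 < c3) (k4 : 0 < c4) :
    ∃ β > 0, a1 * β ≤ c1 ∧ a2 * β ≤ c2 ∧ a3 * β ≤ c3 ∧ a4 * β ≤ c4 := by
  refine ⟨min (min (c1 / a1) (c2 / a2)) (min (c3 / a3) (c4 / a4)), by positivity, ?_, ?_, ?_, ?_⟩
  · rw [← le_div_iff₀' h1]; exact (min_le_left _ _).trans (min_le_left _ _)
  · rw [← le_div_iff₀' h2]; exact (min_le_left _ _).trans (min_le_right _ _)
  · rw [← le_div_iff₀' h3]; exact (min_le_right _ _).trans (min_le_left _ _)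
  · rw [← le_div_iff₀' h4]; exact (min_le_right _ _).trans (min_le_right _ _)

lemma K1_ge {j w b : ℕ} (hw : 0 < w) (hb : 0 < b) : (3:ℝ) ≤ K1 j w b ∧ (j:ℝ) ≤ K1 j w b := by
  have h1 : 3 ≤ K1 j w b := by unfold K1; omega
  have h2 : j ≤ K1 j w b := by
    have : j ≤ j * w := Nat.le_mul_of_pos_right j hw
    unfold K1; omega
  exact ⟨by exact_mod_cast h1, by exact_mod_cast h2⟩

/-- choose `ρ` and `e` from `β` -/
lemma chooseρ {j w b : ℕ} {θ β Γ : ℝ} (hw : 0 < w) (hb : 0 < b) (hβ : 0 < β) (hΓ : 0 < Γ) (hθ : 0 < θ) (hθ1 : θ ≤ 1)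
    (hβθ : 100 * ((w:ℝ) + 1 + b) * β ≤ θ) :
    ∃ ρ > 0, ∃ e > 0, 16 * ρ ≤ β ∧ 8 * (K1 j w b : ℝ) * ρ ≤ β ∧ 3 * j * ρ ≤ Γ / 4 ∧ 20 * e ≤ ρ * θ ∧ 20 * e ≤ ρ * ρ
      ∧ 20 * (w+1) * β ≤ θ ∧ β ≤ 1 := by
  have hw1 : (1:ℝ) ≤ w := by exact_mod_cast hw
  have hb1 : (1:ℝ) ≤ b := by exact_mod_cast hb
  obtain ⟨hK3, hKj⟩ := K1_ge (j := j) hw hb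
  obtain ⟨ρ, hρ, h1, h2, h3, -⟩ := small4 (a1 := 16) (a2 := 8 * (K1 j w b : ℝ)) (a3 := 3 * j + 1) (a4 := 1)
    (c1 := β) (c2 := β) (c3 := Γ / 4) (c4 := 1) (by norm_num) (by linarith) (by positivity) one_pos hβ hβ (by positivity) one_pos
  have h4 : 0 ≤ w * β := by positivity
  have h5 : 0 ≤ b * β := by positivity
  have hβ1 : 100 * β ≤ 1 := by nlinarith
  refine ⟨ρ, hρ, ρ * ρ * θ / 20, by positivity, h1, h2, by linarith, ?_, ?_, by nlinarith, by linarith⟩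
  · have : ρ * (ρ * θ) ≤ 1 * (ρ * θ) := by gcongr; linarith
    linarith
  · have : ρ * ρ * θ ≤ ρ * ρ * 1 := by gcongr
    linarith

set_option maxHeartbeats 2000000 in
lemma stepE (m' j s w b : ℕ) (hb : b = s + (m' + j) * w) (hsw : s < w) (hcase : 0 < s ∨ 1 ≤ m') (hm : 1 ≤ m' + j)
    (Γ : ℝ) (hΓ : 0 < Γ) : ∃ γ' > 0, ∃ C n0 : ℕ, ∀ (V : Type) [Fintype V] (G : SimpleGraph V), n0 ≤ Fintype.card V →
      Ore G ((w:ℝ)/b) → ∀ P : Fin j → Finset V, (∀ i l, i ≠ l → Disjoint (P i) (P l)) →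
      (∀ i, Near G ((w:ℝ)/b) γ' (P i)) → (∀ P' ⊆ univ \ univ.biUnion P, ¬ Near G ((w:ℝ)/b) Γ P') →
      ∃ X, Til G (m' + j + 1) s w X ∧ (univ \ X).card ≤ C := by
  have hw : 0 < w := by omega
  have hbw : w ≤ b := by
    have : 1 * w ≤ (m' + j) * w := Nat.mul_le_mul_right w hm
    omega
  have hb0 : 0 < b := by omega
  have hw1 : (1:ℝ) ≤ w := by exact_mod_cast hw
  have hb1 : (1:ℝ) ≤ b := by exact_mod_cast hb0
  obtain ⟨θ, hθ⟩ : ∃ θ : ℝ, θ = (w:ℝ) / b := ⟨_, rfl⟩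
  rw [← hθ]
  have hθp : 0 < θ := by rw [hθ]; positivity
  have hθ1 : θ ≤ 1 := by rw [hθ, div_le_one (by linarith)]; exact_mod_cast hbw
  obtain ⟨b', hb'⟩ : ∃ b' : ℕ, b' = s + m' * w := ⟨_, rfl⟩
  have hbb : b = b' + j * w := by rw [hb, hb']; ring
  have hb'0 : 0 < b' := by
    rcases hcase with h | h
    · omega
    · have : 1 * w ≤ m' * w := Nat.mul_le_mul_right w h
      omega
  obtain ⟨γ, hγ0, hγ, hγθ⟩ : ∃ γ : ℝ, 0 < γ ∧ γ ≤ Γ / 4 ∧ γ ≤ θ :=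
    ⟨min (Γ/4) θ, by positivity, min_le_left _ _, min_le_right _ _⟩
  obtain ⟨μ0, hμ0, hres⟩ := res m' s w b' hsw hb' hcase γ hγ0
  obtain ⟨C, n1, hres⟩ := hres Γ hΓ
  obtain ⟨μ, hμp, hμμ, hμ1⟩ : ∃ μ : ℝ, 0 < μ ∧ μ ≤ μ0 ∧ μ ≤ 1 := ⟨min μ0 1, by positivity, min_le_left _ _, min_le_right _ _⟩
  obtain ⟨β, hβ, q1, q2, q3, q4⟩ := small4 (a1 := 2 + 8 * w * (w + 1)) (a2 := 8 * w * w) (a3 := 8 * w)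
    (a4 := 100 * ((w:ℝ) + 1 + b)) (c1 := μ / b) (c2 := Γ / 4) (c3 := 1 / (2 * b)) (c4 := θ) (by positivity) (by positivity)
    (by positivity) (by positivity) (by positivity) (by positivity) (by positivity) hθp
  obtain ⟨ρ, hρ, e, he, r1, r2, r3, r4, r5, r6, r7⟩ := chooseρ (j := j) hw hb0 hβ hΓ hθp hθ1 q4
  refine ⟨e * e, by positivity, b * (b * C + j * (2 * w * b)) + b, ⌈2 / ρ⌉₊ + 2 * b * n1, ?_⟩
  intro V _ G hn hO P hPd hP hno
  have hnρ : 2 ≤ ρ * (Fintype.card V : ℝ) := by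
    have h1 : ⌈2 / ρ⌉₊ ≤ Fintype.card V := by omega
    have h2 := Nat.ceil_le.1 h1
    rwa [div_le_iff₀' hρ] at h2
  have hjn : 2 * (j:ℝ) ≤ β * (Fintype.card V : ℝ) := by
    obtain ⟨-, hKj⟩ := K1_ge (j := j) hw hb0
    have h1 : 8 * (K1 j w b : ℝ) * ρ * (Fintype.card V : ℝ) ≤ β * (Fintype.card V : ℝ) := by gcongr
    have h2 : 8 * (j:ℝ) * 2 ≤ 8 * (K1 j w b : ℝ) * (ρ * (Fintype.card V : ℝ)) := by gcongr
    have h3 : (0:ℝ) ≤ j := by positivity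
    linarith
  obtain ⟨A, B, F, hE⟩ := build False (fun h => h.elim) hO hw he hρ r1 r6 hθp hθ1 r4 r5 hnρ hPd hP
  obtain ⟨d, D, t, Q, Z, p, P0, hN⟩ := hE.toExt hw hb0 hθ hρ r2 q4 hnρ
  have hq : 2 * β + 8 * w * β * (w + 1) ≤ μ / b := by linarith
  refine hN.ext.conclude (m' := m') (C := C) (Z := Z) (p := p) (K := 2 * w * b) (P0 := P0)
    (L := univ.filter fun v => (θ + 2 * β) * (Fintype.card V : ℝ) < nn G univ v) hb hsw (by omega) ?_ ?_ hN.hZ hN.hdD hN.hbig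
    ?_ ((card_le_card inter_subset_left).trans hN.hp) hN.ht hN.hlow hN.hhigh
  · rw [Finset.disjoint_left]
    intro v hv hv2
    have h1 := hE.BL not_false v hv
    have h2 := (mem_filter.1 hv2).2
    linarith
  · intro S hSR hSc
    obtain ⟨h1, h2⟩ := hypS hE hw hbb hb'0 hO hθ rfl hβ hρ hjn hno hΓ hγ hγ0 hγθ hq hμ1 q2 q3 r3 hN.hZn hSR hSc
    refine hres V G S _ μ hμp.le hμμ ?_ h2
    have h3 : Fintype.card V ≤ 2 * b * S.card := by exact_mod_cast h1
    have h4 : 2 * b * n1 ≤ 2 * b * S.card := by omega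
    exact Nat.le_of_mul_le_mul_left h4 (by omega)
  · have : b * w = w * b := mul_comm _ _
    rw [mul_assoc]; omega

set_option maxHeartbeats 2000000 in
lemma stepE0 (m w b : ℕ) (hb : b = m * w) (hw : 0 < w) (hm : 1 ≤ m) :
    ∃ γ' > 0, ∃ C n0 : ℕ, ∀ (V : Type) [Fintype V] (G : SimpleGraph V), n0 ≤ Fintype.card V →
      Ore G ((w:ℝ)/b) → ∀ P : Fin m → Finset V, (∀ i l, i ≠ l → Disjoint (P i) (P l)) →
      (∀ i, Near G ((w:ℝ)/b) γ' (P i)) → 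
      ∃ X, Til G (m + 1) 0 w X ∧ (univ \ X).card ≤ C := by
  have hbw : w ≤ b := by rw [hb]; exact Nat.le_mul_of_pos_left w hm
  have hb0 : 0 < b := by omega
  have hw1 : (1:ℝ) ≤ w := by exact_mod_cast hw
  have hb1 : (1:ℝ) ≤ b := by exact_mod_cast hb0
  obtain ⟨θ, hθ⟩ : ∃ θ : ℝ, θ = (w:ℝ) / b := ⟨_, rfl⟩
  rw [← hθ]
  have hθp : 0 < θ := by rw [hθ]; positivity
  have hθ1 : θ ≤ 1 := by rw [hθ, div_le_one (by linarith)]; exact_mod_cast hbw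
  have hmθ : (m:ℝ) * θ = 1 := by
    have hmp : (0:ℝ) < m := by exact_mod_cast hm
    rw [hθ, hb]; push_cast; field_simp
  obtain ⟨β, hβ, q4, -⟩ := small4 (a1 := 100 * ((w:ℝ) + 1 + b)) (a2 := 1) (a3 := 1)
    (a4 := 1) (c1 := θ) (c2 := 1) (c3 := 1) (c4 := 1) (by positivity) (by positivity)
    (by positivity) (by positivity) hθp one_pos one_pos one_pos
  obtain ⟨ρ, hρ, e, he, r1, r2, r3, r4, r5, r6, r7⟩ := chooseρ (j := m) hw hb0 hβ one_pos hθp hθ1 q4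
  refine ⟨e * e, by positivity, b * (m * (2 * w * b)) + b, ⌈2 / ρ⌉₊, ?_⟩
  intro V _ G hn hO P hPd hP
  have hnρ : 2 ≤ ρ * (Fintype.card V : ℝ) := by
    have h2 := Nat.ceil_le.1 hn
    rwa [div_le_iff₀' hρ] at h2
  obtain ⟨A, B, F, hE⟩ := build True (fun _ => hmθ) hO hw he hρ r1 r6 hθp hθ1 r4 r5 hnρ hPd hP
  obtain ⟨d, D, t, Q, Z, p, P0, hN⟩ := hE.toExt hw hb0 hθ hρ r2 q4 hnρ
  refine hN.ext.conclude0 (p := p) (K := 2 * w * b) hw hm hb hN.hdD hN.hbig (hE.cov trivial) ?_ 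
    ((card_le_card (hE.cov trivial)).trans hN.hp) (by have := hN.ht; omega) hN.hlow
  exact Nat.le_mul_of_pos_left b (by omega)

lemma Near.mono [Fintype V] {θ Γ Γ' : ℝ} {P : Finset V} (h : Near G θ Γ P) (hΓ : Γ ≤ Γ') : Near G θ Γ' P :=
  ⟨le_trans (by gcongr) h.size, h.ee.trans (by gcongr)⟩

def Qs (s w b m j : ℕ) : Prop :=
  ∃ Γ > 0, ∃ C n0 : ℕ, ∀ (V : Type) [Fintype V] (G : SimpleGraph V), n0 ≤ Fintype.card V →
      Ore G ((w:ℝ)/b) → ∀ P : Fin j → Finset V, (∀ i l, i ≠ l → Disjoint (P i) (P l)) →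
      (∀ i, Near G ((w:ℝ)/b) Γ (P i)) → ∃ X, Til G (m + 1) s w X ∧ (univ \ X).card ≤ C

lemma Qs.step {s w b m j : ℕ} (hb : b = s + m * w) (hsw : s < w) (hm : 1 ≤ m) (hj : j ≤ m) (hcase : 0 < s ∨ j < m)
    (h : Qs s w b m (j+1)) : Qs s w b m j := by
  obtain ⟨m', rfl⟩ : ∃ m', m = m' + j := ⟨m - j, by omega⟩
  obtain ⟨Γ, hΓ, C1, n1, h1⟩ := h
  obtain ⟨γ', hγ', C2, n2, h2⟩ := stepE m' j s w b hb hsw (by omega) hm Γ hΓ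
  refine ⟨min Γ γ', by positivity, C1 + C2, n1 + n2, ?_⟩
  intro V _ G hn hO P hPd hP
  by_cases hc : ∀ P' ⊆ univ \ univ.biUnion P, ¬ Near G ((w:ℝ)/b) Γ P'
  · obtain ⟨X, hX, hX2⟩ := h2 V G (by omega) hO P hPd (fun i => (hP i).mono (min_le_right _ _)) hc
    exact ⟨X, hX, by omega⟩
  · push Not at hc
    obtain ⟨P', hP', hP'N⟩ := hc
    have hdj : ∀ i, Disjoint (P i) P' := by
      intro i
      rw [Finset.disjoint_left]
      intro u hu hu2
      exact (mem_sdiff.1 (hP' hu2)).2 (mem_biUnion.2 ⟨i, mem_univ _, hu⟩)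
    obtain ⟨X, hX, hX2⟩ := h1 V G (by omega) hO (Fin.snoc (α := fun _ => Finset V) P P') (by
      intro i l
      refine Fin.lastCases ?_ (fun i => ?_) i <;> refine Fin.lastCases ?_ (fun l => ?_) l
      · intro h; exact absurd rfl h
      · intro _; rw [Fin.snoc_last, Fin.snoc_castSucc]; exact (hdj l).symm
      · intro _; rw [Fin.snoc_last, Fin.snoc_castSucc]; exact hdj i
      · intro h; rw [Fin.snoc_castSucc, Fin.snoc_castSucc]
        exact hPd i l (fun h' => h (by rw [h']))) (by
      intro i
      refine Fin.lastCases ?_ (fun i => ?_) i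
      · rw [Fin.snoc_last]; exact hP'N
      · rw [Fin.snoc_castSucc]; exact (hP i).mono (min_le_left _ _))
    exact ⟨X, hX, by omega⟩

lemma Qs.vac {s w b m : ℕ} (hb : b = s + m * w) (hsw : s < w) (hs : 0 < s) : Qs s w b m (m+1) := by
  have hw : 0 < w := by omega
  have hbp : (0:ℝ) < b := by have : 0 < b := by omega
                             exact_mod_cast this
  have hm2 : (0:ℝ) < 2 * ((m:ℝ) + 1) * b := by positivity
  refine ⟨1 / (2 * ((m:ℝ) + 1) * b), by positivity, 0, 1, ?_⟩
  intro V _ G hn hO P hPd hP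
  exfalso
  have hn1 : (1:ℝ) ≤ Fintype.card V := by exact_mod_cast hn
  have h1 : ∑ i, ((P i).card : ℝ) ≤ Fintype.card V := by
    have : ∑ i, (P i).card ≤ Fintype.card V := by
      rw [← card_biUnion (fun i _ l _ h => hPd i l h)]
      exact card_le_univ _
    exact_mod_cast this
  have h2 : ((m:ℝ) + 1) * (((w:ℝ)/b - 1 / (2 * ((m:ℝ) + 1) * b)) * Fintype.card V) ≤ ∑ i, ((P i).card : ℝ) := by
    calc ((m:ℝ) + 1) * (((w:ℝ)/b - 1 / (2 * ((m:ℝ) + 1) * b)) * Fintype.card V) 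
        = ∑ i : Fin (m+1), (((w:ℝ)/b - 1 / (2 * ((m:ℝ) + 1) * b)) * Fintype.card V) := by 
          rw [sum_const, card_univ, Fintype.card_fin, nsmul_eq_mul]; push_cast; ring
      _ ≤ _ := sum_le_sum fun i _ => (hP i).size
  have h3 : ((m:ℝ) + 1) * ((w:ℝ)/b - 1 / (2 * ((m:ℝ) + 1) * b)) = ((m + 1) * w - 1/2) / b := by
    field_simp
  have h4 : 1 < ((m:ℝ) + 1) * ((w:ℝ)/b - 1 / (2 * ((m:ℝ) + 1) * b)) := by
    rw [h3, lt_div_iff₀ hbp]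
    have h5 : (b:ℝ) + 1 ≤ (m + 1) * w := by
      have : b + 1 ≤ (m + 1) * w := by
        have : (m + 1) * w = m * w + w := by ring
        omega
      exact_mod_cast this
    linarith
  have h6 := mul_lt_mul_of_pos_right h4 (show (0:ℝ) < Fintype.card V by linarith)
  linarith

lemma Qs.all {s w b m : ℕ} (hb : b = s + m * w) (hsw : s < w) (hm : 1 ≤ m) : Qs s w b m 0 := by
  have key : ∀ J, Qs s w b m J → (0 < s ∧ J ≤ m + 1 ∨ J ≤ m) → Qs s w b m 0 := by
    intro J
    induction J with
    | zero => intro h _; exact h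
    | succ J ih =>
      intro h hc
      exact ih (h.step hb hsw hm (by omega) (by omega)) (by omega)
  rcases Nat.eq_zero_or_pos s with h | h
  · subst h
    refine key m ?_ (Or.inr le_rfl)
    obtain ⟨γ', hγ', C, n0, h1⟩ := stepE0 m w b (by omega) (by omega) hm
    exact ⟨γ', hγ', C, n0, h1⟩
  · exact key (m+1) (Qs.vac hb hsw h) (Or.inl ⟨h, le_rfl⟩)

theorem bottles (s w b m : ℕ) (hb : b = s + m * w) (hsw : s < w) (hm : 1 ≤ m) :
    ∃ C n0 : ℕ, ∀ (V : Type) [Fintype V] (G : SimpleGraph V), n0 ≤ Fintype.card V →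
      Ore G ((w:ℝ)/b) → ∃ X, Til G (m + 1) s w X ∧ (univ \ X).card ≤ C := by
  obtain ⟨Γ, hΓ, C, n0, h⟩ := Qs.all hb hsw hm
  exact ⟨C, n0, fun V _ G hn hO => h V G hn hO (fun i => i.elim0) (fun i => i.elim0) (fun i => i.elim0)⟩

end ModF1
end OreT

namespace OreT
section ModF2
open Finset
open scoped Classical BigOperators

variable {V : Type} {G : SimpleGraph V}

lemma ad_degree [Fintype V] [DecidableRel G.Adj] (x : V) : ad G univ x = G.degree x := by
  unfold ad
  rw [← SimpleGraph.card_neighborFinset_eq_degree]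
  congr 1
  ext u
  simp

lemma bottle_drop {k w : ℕ} {X : Finset V} (h : IsBottle G (k+2) 0 w X) : IsBottle G (k+1) w w X := by
  obtain ⟨D, i0, hD, h0, h1, rfl⟩ := h
  refine ⟨fun i => D (i0.succAbove i), 0, ?_, h1 _ (Fin.succAbove_ne _ _), fun i _ => h1 _ (Fin.succAbove_ne _ _), ?_⟩
  · intro i j hij
    exact hD _ _ (fun h => hij (Fin.succAbove_right_injective h))
  · ext u
    simp only [mem_biUnion, mem_univ, true_and]
    constructor
    · rintro ⟨i, hi⟩
      by_cases hc : i = i0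
      · subst hc
        rw [card_eq_zero.1 h0] at hi
        exact absurd hi (notMem_empty u)
      · obtain ⟨l, rfl⟩ := Fin.exists_succAbove_eq hc
        exact ⟨l, hi⟩
    · rintro ⟨i, hi⟩
      exact ⟨_, hi⟩

lemma HT.fin [Fintype V] {W : Type} {H : SimpleGraph W} {X : Finset V} {C : ℕ} (h : HT H G X)
    (hC : (univ \ X).card ≤ C) : ∃ 𝒯 : Finset (W → V), IsTiling H G 𝒯 ∧ (untiled 𝒯).ncard ≤ C := by
  obtain ⟨T, hT, hX⟩ := h
  refine ⟨T, hT, le_trans (le_of_eq ?_) hC⟩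
  rw [← Set.ncard_coe_finset]
  congr 1
  ext v
  rw [mem_coe, mem_sdiff, ← hX v]
  simp only [untiled, Set.mem_setOf_eq, mem_univ, true_and]
  push Not
  rfl

lemma exists_bottle_tiling (m0 s0 w0 : ℕ) (hm : 1 ≤ m0) (hw : 0 < w0) (hsw : s0 ≤ w0) :
    ∃ C n0 : ℕ, ∀ (V : Type) [Fintype V] (G : SimpleGraph V), n0 ≤ Fintype.card V →
      Ore G ((w0:ℝ)/(s0 + m0 * w0 : ℕ)) → ∀ (W : Type) (H : SimpleGraph W),
      (∀ Y : Finset V, IsBottle G (m0+1) s0 w0 Y → HT H G Y) →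
      ∃ X, HT H G X ∧ (univ \ X).card ≤ C := by
  rcases hsw.lt_or_eq with h | h
  · obtain ⟨C, n0, h1⟩ := bottles s0 w0 _ m0 rfl h hm
    refine ⟨C, n0, fun V _ G hn hO W H hH => ?_⟩
    obtain ⟨X, hX, hc⟩ := h1 V G hn hO
    exact ⟨X, hX.ht hH, hc⟩
  · obtain ⟨C, n0, h1⟩ := bottles 0 w0 (s0 + m0 * w0) (m0+1) (by rw [h]; ring) hw (by omega)
    refine ⟨C, n0, fun V _ G hn hO W H hH => ?_⟩
    obtain ⟨X, hX, hc⟩ := h1 V G hn hO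
    refine ⟨X, hX.ht fun Y hY => hH Y ?_, hc⟩
    rw [h]; exact bottle_drop hY

end ModF2
end OreT

/-- **Theorem (main).** For every graph `H` with at least one edge there are a constant `C`
and an integer `n₀` such that every graph `G` on `n ≥ n₀` vertices with
`d(x) + d(y) ≥ 2 (1 - 1/χ_cr(H)) n` for all distinct nonadjacent `x, y` has an
`H`-tiling covering all but at most `C` vertices.  Here `χ_cr(H) = (k-1)·h/(h-σ)`
with `k = χ(H)`, `h = |V(H)|`, `σ = σ(H)`. -/
theorem ore_htiling_constant_leftover
    {W : Type} [Fintype W] (H : SimpleGraph W) (hedge : ∃ a b : W, H.Adj a b)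
    (k σ : ℕ) (hk : H.chromaticNumber = (k : ℕ∞)) (hσ : IsMinColorClassSize H k σ) :
    ∃ (C n₀ : ℕ), ∀ (V : Type) [Fintype V] (G : SimpleGraph V) [DecidableRel G.Adj],
      n₀ ≤ Fintype.card V →
      (∀ x y : V, x ≠ y → ¬ G.Adj x y →
        2 * (1 - 1 / (((k : ℝ) - 1) * (Fintype.card W) / ((Fintype.card W : ℝ) - σ))) *
          (Fintype.card V) ≤ (G.degree x : ℝ) + (G.degree y : ℝ)) →
      ∃ 𝒯 : Finset (W → V), IsTiling H G 𝒯 ∧ (untiled 𝒯).ncard ≤ C := by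
  classical
  obtain ⟨a, a', haa⟩ := hedge
  obtain ⟨⟨c, i0, hc⟩, hmin⟩ := hσ
  haveI : Nonempty W := ⟨a⟩
  have hne : c a ≠ c a' := c.valid haa
  have hk2 : 2 ≤ k := by
    have h1 := (c a).isLt
    have h2 := (c a').isLt
    by_contra hcon
    exact hne (Fin.ext (by omega))
  obtain ⟨m, rfl⟩ : ∃ m, k = m + 1 := ⟨k - 1, by omega⟩
  have hm : 1 ≤ m := by omega
  have hh : 0 < Fintype.card W := Fintype.card_pos
  have hsum : (m + 1) * σ ≤ Fintype.card W := by
    have h1 : Fintype.card W = ∑ i : Fin (m+1), (Finset.univ.filter fun v => c v = i).card := by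
      rw [← Finset.card_univ]
      exact Finset.card_eq_sum_card_fiberwise fun x _ => Finset.mem_coe.2 (Finset.mem_univ _)
    rw [h1]
    calc (m + 1) * σ = ∑ i : Fin (m+1), σ := by simp
      _ ≤ _ := Finset.sum_le_sum fun i _ => by
        convert hmin c i
  have hsum' : m * σ + σ ≤ Fintype.card W := by rw [← Nat.succ_mul]; exact hsum
  have hmσ : σ ≤ m * σ := Nat.le_mul_of_pos_left σ hm
  obtain ⟨C, n0, hmain⟩ := OreT.exists_bottle_tiling m (m * σ) (Fintype.card W - σ) hm (by omega) (by omega)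
  refine ⟨C, n0, fun V _ G _ hn hdeg => ?_⟩
  have hOre : OreT.Ore G (((Fintype.card W - σ : ℕ):ℝ)/(m * σ + m * (Fintype.card W - σ) : ℕ)) := by
    intro x y hxy hadj
    have h1 := hdeg x y hxy hadj
    have hx := OreT.ad_nn (G := G) Finset.univ x
    have hy := OreT.ad_nn (G := G) Finset.univ y
    rw [OreT.ad_degree, Finset.card_univ] at hx hy
    have hb : m * σ + m * (Fintype.card W - σ) = m * Fintype.card W := by
      rw [← Nat.mul_add]; congr 1; omega
    rw [hb, Nat.cast_sub (by omega)]
    rw [one_div_div] at h1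
    push_cast at h1 ⊢
    rw [add_sub_cancel_right] at h1
    linarith
  obtain ⟨X, hX, hXC⟩ := hmain V G hn hOre W H fun Y hY => OreT.bottle_ht c hm i0 (by convert hc) hY
  exact hX.fin hXC
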